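/- For each integer n ≥ 3 there exist a metric space (X,d), a homeomorphism from X onto the Euclidean n-sphere Sⁿ, and a closed subset E ⊆ X homeomorphic to the Cantor space such that X is Ahlfors n-regular and linearly locally contractible, every point of X \ E has for every ε > 0 an open neighborhood that is (1+ε)-bilipschitz homeomorphic to an open subset of ℝⁿ, and there is no quasisymmetric homeomorphism from X onto Sⁿ, i.e. there is no homeomorphism f : X → Sⁿ together with a homeomorphism η : [0,∞) → [0,∞) satisfying d(f(x),f(y))/d(f(x),f(z)) ≤ η(d(x,y)/d(x,z)) for all triples of distinct points x,y,z ∈ X. -/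

import Mathlib

open Metric MeasureTheory
open scoped ENNReal NNReal

noncomputable section

/-- The Euclidean `n`-sphere: the unit sphere in `ℝ^(n+1)` with the induced metric. -/
abbrev EucSphere (n : ℕ) :=
  ↥(Metric.sphere (0 : EuclideanSpace ℝ (Fin (n + 1))) 1)

/-- The `d`-dimensional Hausdorff measure of a subset of a metric space
(with respect to the Borel σ-algebra of the metric). -/
noncomputable def hausdorffM (X : Type) [MetricSpace X] (d : ℝ) (s : Set X) : ℝ≥0∞ :=
  letI : MeasurableSpace X := borel X
  haveI : BorelSpace X := ⟨rfl⟩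
  MeasureTheory.Measure.hausdorffMeasure d s

/-- A metric space is Ahlfors `n`-regular if the Hausdorff `n`-measure of every ball
of radius `0 < r ≤ diam X` is comparable to `r^n`. -/
def AhlforsRegular (X : Type) [MetricSpace X] (n : ℕ) : Prop :=
  ∃ C : ℝ, 1 ≤ C ∧ ∀ (x : X) (r : ℝ), 0 < r → r ≤ Metric.diam (Set.univ : Set X) →
    ENNReal.ofReal (C⁻¹ * r ^ n) ≤ hausdorffM X n (Metric.ball x r) ∧
      hausdorffM X n (Metric.ball x r) ≤ ENNReal.ofReal (C * r ^ n)

/-- A metric space is linearly locally contractible if there is `C ≥ 1` such that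
every ball `B(x,r)` with `r < diam X / C` is contractible inside `B(x, C r)`. -/
def LinearlyLocallyContractible (X : Type) [MetricSpace X] : Prop :=
  ∃ C : ℝ, 1 ≤ C ∧ ∀ (x : X) (r : ℝ), 0 < r → r < Metric.diam (Set.univ : Set X) / C →
    ∃ (h : Metric.ball x r ⊆ Metric.ball x (C * r)) (y : Metric.ball x (C * r)),
      ContinuousMap.Homotopic
        ⟨Set.inclusion h, continuous_inclusion h⟩
        (ContinuousMap.const _ y)

/-- A homeomorphism-type map between metric spaces is quasiconformal if the metric
distortion ratio `H_f(x,r)` has `limsup_{r → 0⁺} H_f(x,r) ≤ H < ∞` at every point. -/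
def IsQuasiconformal {X Y : Type*} [MetricSpace X] [MetricSpace Y] (f : X → Y) : Prop :=
  ∃ H : ℝ≥0∞, H < ⊤ ∧ ∀ x : X,
    Filter.limsup
      (fun r : ℝ =>
        (⨆ y ∈ {y : X | dist x y ≤ r}, edist (f x) (f y)) /
          ⨅ y ∈ {y : X | r ≤ dist x y}, edist (f x) (f y))
      (nhdsWithin 0 (Set.Ioi (0 : ℝ))) ≤ H

/-- A map between metric spaces is quasisymmetric if there is a homeomorphism
`η : [0,∞) → [0,∞)` controlling all ratios of distances of triples of distinct points. -/
def IsQuasisymmetric {X Y : Type*} [MetricSpace X] [MetricSpace Y] (f : X → Y) : Prop :=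
  ∃ η : ℝ≥0 ≃ₜ ℝ≥0, ∀ x y z : X, x ≠ y → x ≠ z → y ≠ z →
    nndist (f x) (f y) / nndist (f x) (f z) ≤ η (nndist x y / nndist x z)

/-- `x` has, for every `ε > 0`, an open neighborhood admitting a `(1+ε)`-bilipschitz
homeomorphism onto an open subset of Euclidean `n`-space. -/
def AlmostSmoothAt (X : Type) [MetricSpace X] (n : ℕ) (x : X) : Prop :=
  ∀ ε : ℝ, 0 < ε → ∃ U : Set X, IsOpen U ∧ x ∈ U ∧
    ∃ V : Set (EuclideanSpace ℝ (Fin n)), IsOpen V ∧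
      ∃ g : U ≃ V, ∀ a b : U,
        (1 + ε)⁻¹ * dist a b ≤ dist (g a : EuclideanSpace ℝ (Fin n)) (g b) ∧
          dist (g a : EuclideanSpace ℝ (Fin n)) (g b) ≤ (1 + ε) * dist a b

/-- A metric is a length metric in the approximate-midpoint sense. -/
def IsApproxLengthMetric (X : Type) [MetricSpace X] : Prop :=
  ∀ (x y : X) (ε : ℝ), 0 < ε →
    ∃ z : X, dist x z ≤ dist x y / 2 + ε ∧ dist z y ≤ dist x y / 2 + ε

end

namespace BD

open Module

/-- Iterated commutator of a family indexed by words. -/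
def iterComm {G : Type*} [Group G] : ℕ → (List Bool → G) → G
  | 0, X => X []
  | k + 1, X =>
    iterComm k (fun w => X (true :: w)) * (iterComm k (fun w => X (false :: w)))⁻¹ *
      (iterComm k (fun w => X (true :: w)))⁻¹ * iterComm k (fun w => X (false :: w))

theorem map_iterComm {G H : Type*} [Group G] [Group H] (φ : G →* H) (k : ℕ)
    (X : List Bool → G) : φ (iterComm k X) = iterComm k (fun w => φ (X w)) := by
  induction k generalizing X with
  | zero => rfl
  | succ k ih => simp [iterComm, ih]

section
variable {V : Type} [AddCommGroup V] [Module ℚ V]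

def phiEnd (S x : End ℚ V) : End ℚ (V × V) :=
  LinearMap.prod (x ∘ₗ LinearMap.fst ℚ V V + (x - 1) ∘ₗ S ∘ₗ LinearMap.snd ℚ V V)
    (LinearMap.snd ℚ V V)

def psiEnd (S x : End ℚ V) : End ℚ (V × V) :=
  LinearMap.prod (LinearMap.fst ℚ V V)
    ((x - 1) ∘ₗ S ∘ₗ LinearMap.fst ℚ V V + x ∘ₗ LinearMap.snd ℚ V V)

def phiHom (S : End ℚ V) : End ℚ V →* End ℚ (V × V) where
  toFun x := phiEnd S x
  map_one' := by ext <;> simp [phiEnd]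
  map_mul' x y := by ext <;> simp [phiEnd]

def psiHom (S : End ℚ V) : End ℚ V →* End ℚ (V × V) where
  toFun x := psiEnd S x
  map_one' := by ext <;> simp [psiEnd]
  map_mul' x y := by ext <;> simp [psiEnd]

noncomputable def rk (x : (End ℚ V)ˣ) : ℕ := finrank ℚ (LinearMap.range ((x : End ℚ V) - 1))

theorem finrank_range_conj (u w : (End ℚ V)ˣ) (x : End ℚ V) :
    finrank ℚ (LinearMap.range ((u : End ℚ V) * x * (w : End ℚ V))) = finrank ℚ (LinearMap.range x) := by
  have hw : Function.Surjective ((w : End ℚ V)) := fun y => ⟨((w⁻¹ : (End ℚ V)ˣ) : End ℚ V) y, by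
    rw [← Module.End.mul_apply, Units.mul_inv]; rfl⟩
  have hu : Function.Injective ((u : End ℚ V)) := by
    intro a b h
    have := congrArg ((u⁻¹ : (End ℚ V)ˣ) : End ℚ V) h
    rw [← Module.End.mul_apply, ← Module.End.mul_apply, Units.inv_mul] at this
    exact this
  have h1 : LinearMap.range ((u : End ℚ V) * x * (w : End ℚ V)) =
      (LinearMap.range x).map (u : End ℚ V) := by
    rw [Module.End.mul_eq_comp, Module.End.mul_eq_comp,
      LinearMap.range_comp_of_range_eq_top _ (LinearMap.range_eq_top.2 hw), LinearMap.range_comp]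
  rw [h1]
  exact (Submodule.equivMapOfInjective _ hu _).finrank_eq.symm

theorem rk_eq_of_eq (a : (End ℚ V)ˣ) (x : End ℚ V) (h : (a : End ℚ V) - 1 = x) :
    rk a = finrank ℚ (LinearMap.range x) := by
  subst h; rfl

theorem rk_one : rk (1 : (End ℚ V)ˣ) = 0 := by
  rw [rk_eq_of_eq _ 0 (by simp), LinearMap.range_zero]
  simp

theorem rk_inv (a : (End ℚ V)ˣ) : rk a⁻¹ = rk a := by
  rw [rk_eq_of_eq a⁻¹ (((a⁻¹ : (End ℚ V)ˣ) : End ℚ V) * ((a : End ℚ V) - 1) *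
    ((-1 : (End ℚ V)ˣ) : End ℚ V)) (by simp [mul_sub]), finrank_range_conj]
  rfl

theorem rk_conj (a b : (End ℚ V)ˣ) : rk (b * a * b⁻¹) = rk a := by
  rw [rk_eq_of_eq (b * a * b⁻¹) ((b : End ℚ V) * ((a : End ℚ V) - 1) *
    ((b⁻¹ : (End ℚ V)ˣ) : End ℚ V)) (by simp [mul_sub, sub_mul]), finrank_range_conj]
  rfl

theorem rk_mul [FiniteDimensional ℚ V] (a b : (End ℚ V)ˣ) : rk (a * b) ≤ rk a + rk b := by
  have h : ((a * b : (End ℚ V)ˣ) : End ℚ V) - 1 = (a - 1 : End ℚ V) * (b : End ℚ V) + ((b : End ℚ V) - 1) := by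
    push_cast; noncomm_ring
  have h2 := finrank_range_conj 1 b (a - 1 : End ℚ V)
  have h3 : ((1 : (End ℚ V)ˣ) : End ℚ V) * (a - 1 : End ℚ V) * (b : End ℚ V) =
    (a - 1 : End ℚ V) * (b : End ℚ V) := by simp
  rw [h3] at h2
  unfold rk
  rw [h, ← h2]
  have hle : LinearMap.range ((a - 1 : End ℚ V) * (b : End ℚ V) + ((b : End ℚ V) - 1)) ≤
      LinearMap.range ((a - 1 : End ℚ V) * (b : End ℚ V)) ⊔ LinearMap.range ((b : End ℚ V) - 1) := by
    rintro _ ⟨v, rfl⟩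
    exact Submodule.add_mem_sup ⟨v, rfl⟩ ⟨v, rfl⟩
  refine (Submodule.finrank_mono hle).trans ?_
  simpa using Submodule.finrank_add_le_finrank_add_finrank
    (LinearMap.range ((a - 1 : End ℚ V) * (b : End ℚ V))) (LinearMap.range ((b : End ℚ V) - 1))

theorem rk_phi (S : End ℚ V) (x : (End ℚ V)ˣ) [FiniteDimensional ℚ V] :
    rk (Units.map (phiHom S) x) ≤ rk x := by
  unfold rk
  have hle : LinearMap.range (((Units.map (phiHom S) x : (End ℚ (V × V))ˣ) : End ℚ (V × V)) - 1) ≤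
      (LinearMap.range ((x : End ℚ V) - 1)).map (LinearMap.inl ℚ V V) := by
    rintro _ ⟨v, rfl⟩
    refine ⟨(x - 1 : End ℚ V) (v.1 + S v.2), ⟨_, rfl⟩, ?_⟩
    ext
    · simp [phiHom, phiEnd]; abel
    · simp [phiHom, phiEnd]
  exact (Submodule.finrank_mono hle).trans (Submodule.finrank_map_le _ _)

theorem rk_psi (S : End ℚ V) (x : (End ℚ V)ˣ) [FiniteDimensional ℚ V] :
    rk (Units.map (psiHom S) x) ≤ rk x := by
  unfold rk
  have hle : LinearMap.range (((Units.map (psiHom S) x : (End ℚ (V × V))ˣ) : End ℚ (V × V)) - 1) ≤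
      (LinearMap.range ((x : End ℚ V) - 1)).map (LinearMap.inr ℚ V V) := by
    rintro _ ⟨v, rfl⟩
    refine ⟨(x - 1 : End ℚ V) (S v.1 + v.2), ⟨_, rfl⟩, ?_⟩
    ext
    · simp [psiHom, psiEnd]
    · simp [psiHom, psiEnd]; abel
  exact (Submodule.finrank_mono hle).trans (Submodule.finrank_map_le _ _)

theorem exists_geninv (α : End ℚ V) : ∃ S : End ℚ V, ∀ v, α (S (α v)) = α v := by
  obtain ⟨g, hg⟩ := LinearMap.exists_rightInverse_of_surjective α.rangeRestrict
    (LinearMap.range_eq_top.2 α.surjective_rangeRestrict)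
  obtain ⟨S, hS⟩ := LinearMap.exists_extend g
  refine ⟨S, fun v => ?_⟩
  have h1 : S (α v) = g ⟨α v, ⟨v, rfl⟩⟩ := by
    rw [← hS]; rfl
  have h2 := congrArg Subtype.val (LinearMap.congr_fun hg ⟨α v, ⟨v, rfl⟩⟩)
  rw [h1]
  exact h2

theorem exists_good_scalar [FiniteDimensional ℚ V] (S : End ℚ V) :
    ∃ t : ℚ, t ≠ 0 ∧ Function.Surjective (1 - t • (S * S) : End ℚ V) := by
  have hfin := Module.End.finite_hasEigenvalue (S * S)
  have : ∃ s : ℚ, s ∉ ({s | Module.End.HasEigenvalue (S * S) s} ∪ {0} : Set ℚ) :=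
    (hfin.union (Set.finite_singleton 0)).infinite_compl.nonempty
  obtain ⟨s, hs⟩ := this
  simp only [Set.mem_union, Set.mem_ofPred_eq, Set.mem_singleton_iff, not_or] at hs
  refine ⟨s⁻¹, inv_ne_zero hs.2, ?_⟩
  rw [← LinearMap.injective_iff_surjective]
  rw [← LinearMap.ker_eq_bot, Submodule.eq_bot_iff]
  intro v hv
  by_contra hv0
  apply hs.1
  refine Module.End.hasEigenvalue_of_hasEigenvector (x := v) ⟨?_, hv0⟩
  rw [Module.End.mem_eigenspace_iff]
  have : v = s⁻¹ • (S * S) v := by simpa [sub_eq_zero] using hv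
  conv_rhs => rw [this]
  rw [smul_smul, mul_inv_cancel₀ hs.2, one_smul]

theorem rk_comm_ge [FiniteDimensional ℚ V] (x : (End ℚ V)ˣ) : ∃ S S' : End ℚ V,
    2 * rk x ≤ rk (Units.map (psiHom S') x * (Units.map (phiHom S) x)⁻¹ *
      (Units.map (psiHom S') x)⁻¹ * Units.map (phiHom S) x) := by
  set α : End ℚ V := x - 1 with hα
  obtain ⟨S, hS⟩ := exists_geninv α
  obtain ⟨t, ht, hsurj⟩ := exists_good_scalar S
  refine ⟨S, t • S, ?_⟩
  set a := Units.map (phiHom S) x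
  set b := Units.map (psiHom (t • S)) x
  have key : ((b * a⁻¹ * b⁻¹ * a : (End ℚ (V × V))ˣ) : End ℚ (V × V)) - 1 =
      ((a⁻¹ : (End ℚ (V × V))ˣ) : End ℚ (V × V)) * ((a : End ℚ (V × V)) * (b : End ℚ (V × V)) - (b : End ℚ (V × V)) * (a : End ℚ (V × V))) *
        ((a⁻¹ * b⁻¹ * a : (End ℚ (V × V))ˣ) : End ℚ (V × V)) := by
    have e1 : (a⁻¹ : (End ℚ (V × V))ˣ) * (a * b) * (a⁻¹ * b⁻¹ * a) = b * a⁻¹ * b⁻¹ * a := by group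
    have e2 : (a⁻¹ : (End ℚ (V × V))ˣ) * (b * a) * (a⁻¹ * b⁻¹ * a) = 1 := by group
    rw [mul_sub, sub_mul]
    rw [← Units.val_mul, ← Units.val_mul, ← Units.val_mul, ← Units.val_mul, e1,
      ← Units.val_mul, ← Units.val_mul, e2]
    simp
  have hr : rk (b * a⁻¹ * b⁻¹ * a) =
      finrank ℚ (LinearMap.range ((a : End ℚ (V × V)) * (b : End ℚ (V × V)) - (b : End ℚ (V × V)) * (a : End ℚ (V × V)))) := by
    unfold rk
    rw [key, finrank_range_conj]
  rw [hr]
  have hcomm : ∀ v : V × V, ((a : End ℚ (V × V)) * (b : End ℚ (V × V)) - (b : End ℚ (V × V)) * (a : End ℚ (V × V))) v =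
      (α (t • S v.1 + v.2), - (t • α (v.1 + S v.2))) := by
    intro v
    have ha : ∀ v : V × V, (a : End ℚ (V × V)) v = (v.1 + α (v.1 + S v.2), v.2) := by
      intro v
      ext
      · simp [a, phiHom, phiEnd, hα]; abel
      · simp [a, phiHom, phiEnd]
    have hb : ∀ v : V × V, (b : End ℚ (V × V)) v = (v.1, v.2 + α (t • S v.1 + v.2)) := by
      intro v
      ext
      · simp [b, psiHom, psiEnd]
      · simp [b, psiHom, psiEnd, hα, smul_sub]; abel
    rw [LinearMap.sub_apply, Module.End.mul_apply, Module.End.mul_apply, ha, hb, ha, hb]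
    ext
    · simp [hS]
    · simp [hS]
  have hle : (LinearMap.range α).prod (LinearMap.range α) ≤
      LinearMap.range ((a : End ℚ (V × V)) * (b : End ℚ (V × V)) - (b : End ℚ (V × V)) * (a : End ℚ (V × V))) := by
    rintro ⟨_, _⟩ ⟨⟨p, rfl⟩, ⟨q, rfl⟩⟩
    -- need v with t S v + v' = p, v + S v' = -t⁻¹ q
    obtain ⟨v, hv⟩ := hsurj (-(t⁻¹ • q) - S p)
    refine ⟨(v, p - t • S v), ?_⟩
    rw [hcomm]
    have hv' : v - t • S (S v) = -(t⁻¹ • q) - S p := by simpa using hv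
    have h2 : v + S (p - t • S v) = -(t⁻¹ • q) := by
      rw [map_sub, map_smul]
      have : v + (S p - t • S (S v)) = (v - t • S (S v)) + S p := by abel
      rw [this, hv']; abel
    simp only [h2]
    ext
    · simp
    · simp [smul_smul, ht]
  let j : (LinearMap.range α × LinearMap.range α) →ₗ[ℚ]
      LinearMap.range ((a : End ℚ (V × V)) * (b : End ℚ (V × V)) -
        (b : End ℚ (V × V)) * (a : End ℚ (V × V))) :=
    ((LinearMap.range α).subtype.prodMap (LinearMap.range α).subtype).codRestrict _
      (fun c => hle ⟨c.1.2, c.2.2⟩)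
  have hj : Function.Injective j := by
    intro c d h
    have := congrArg Subtype.val h
    have h1 := congrArg Prod.fst this
    have h2 := congrArg Prod.snd this
    exact Prod.ext (Subtype.ext h1) (Subtype.ext h2)
  have := LinearMap.finrank_le_finrank_of_injective hj
  rw [Module.finrank_prod] at this
  unfold rk
  rw [← hα]
  omega
end

theorem exists_cost_aux (k : ℕ) : ∃ (V : Type) (_ : AddCommGroup V) (_ : Module ℚ V)
    (_ : FiniteDimensional ℚ V) (X : List Bool → (End ℚ V)ˣ),
    (∀ w, rk (X w) ≤ 1) ∧ 2 ^ k ≤ rk (iterComm k X) := by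
  induction k with
  | zero =>
    refine ⟨ℚ, inferInstance, inferInstance, inferInstance,
      fun _ => Units.map (algebraMap ℚ (End ℚ ℚ)).toMonoidHom (Units.mk0 2 (by norm_num)), ?_, ?_⟩
    · intro w
      unfold rk
      exact (Submodule.finrank_le _).trans (by simp)
    · simp only [iterComm, rk, pow_zero]
      have : LinearMap.range ((((Units.map (algebraMap ℚ (End ℚ ℚ)).toMonoidHom
          (Units.mk0 2 (by norm_num)) : (End ℚ ℚ)ˣ)) : End ℚ ℚ) - 1) = ⊤ := by
        rw [LinearMap.range_eq_top]
        intro y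
        refine ⟨y, ?_⟩
        simp [Algebra.algebraMap_eq_smul_one]
        ring
      have h3 := congrArg (fun p : Submodule ℚ ℚ => finrank ℚ p) this
      simp only [finrank_top, finrank_self] at h3
      exact h3.ge
  | succ k ih =>
    obtain ⟨V, i1, i2, i3, X, hX, hk⟩ := ih
    obtain ⟨S, S', h⟩ := rk_comm_ge (iterComm k X)
    refine ⟨V × V, inferInstance, inferInstance, inferInstance, fun w => match w with
      | [] => 1
      | false :: w => Units.map (phiHom S) (X w)
      | true :: w => Units.map (psiHom S') (X w), ?_, ?_⟩
    · intro w
      match w with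
      | [] => simp [rk_one]
      | false :: w => exact (rk_phi _ _).trans (hX w)
      | true :: w => exact (rk_psi _ _).trans (hX w)
    · simp only [iterComm]
      rw [← map_iterComm, ← map_iterComm]
      refine le_trans ?_ h
      rw [pow_succ]; omega

theorem exists_cost (k : ℕ) : ∃ (G : Type) (_ : Group G) (cost : G → ℕ) (X : List Bool → G),
    cost 1 = 0 ∧ (∀ a b, cost (a * b) ≤ cost a + cost b) ∧ (∀ a, cost a⁻¹ = cost a) ∧
    (∀ a b, cost (b * a * b⁻¹) = cost a) ∧ (∀ w, cost (X w) ≤ 1) ∧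
    2 ^ k ≤ cost (iterComm k X) := by
  obtain ⟨V, i1, i2, i3, X, hX, hk⟩ := exists_cost_aux k
  exact ⟨_, inferInstance, rk, X, rk_one, rk_mul, rk_inv, rk_conj, hX, hk⟩

end BD

namespace BD
open Set Metric Filter Topology

section
variable {G : Type*} [Group G]

/-- local cocycle at a point -/
def LocCoc {α : Type*} [TopologicalSpace α] (c : α → α → G) (p : α) : Prop :=
  ∃ O ∈ 𝓝 p, ∀ a ∈ O, ∀ b ∈ O, ∀ d ∈ O, c a b * c b d = c a d

/-- potential on a set -/
def Pot {α : Type*} [PseudoMetricSpace α] (c : α → α → G) (S : Set α) (u : α → G) : Prop :=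
  ∃ δ > 0, ∀ x ∈ S, ∀ y ∈ S, dist x y < δ → u y = u x * c x y

theorem LocCoc.comp {α β : Type*} [TopologicalSpace α] [TopologicalSpace β] {c : β → β → G}
    {f : α → β} {p : α} (h : LocCoc c (f p)) (hf : ContinuousAt f p) :
    LocCoc (fun a b => c (f a) (f b)) p := by
  obtain ⟨O, hO, h⟩ := h
  exact ⟨f ⁻¹' O, hf hO, fun a ha b hb d hd => h _ ha _ hb _ hd⟩

theorem Pot.mono {α : Type*} [PseudoMetricSpace α] {c : α → α → G} {S T : Set α} {u : α → G}
    (h : Pot c S u) (hT : T ⊆ S) : Pot c T u := by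
  obtain ⟨δ, hδ, h⟩ := h
  exact ⟨δ, hδ, fun x hx y hy hxy => h x (hT hx) y (hT hy) hxy⟩

/-- pulling back a potential along a map uniformly continuous on the set -/
theorem Pot.comp {α β : Type*} [PseudoMetricSpace α] [PseudoMetricSpace β] {c : β → β → G}
    {S : Set α} {T : Set β} {u : β → G} {f : α → β} (h : Pot c T u) (hf : ContinuousOn f S)
    (hS : IsCompact S) (hST : MapsTo f S T) :
    Pot (fun a b => c (f a) (f b)) S (u ∘ f) := by
  obtain ⟨δ, hδ, h⟩ := h
  have := hS.uniformContinuousOn_of_continuous hf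
  rw [Metric.uniformContinuousOn_iff] at this
  obtain ⟨δ', hδ', h'⟩ := this δ hδ
  exact ⟨δ', hδ', fun x hx y hy hxy => h _ (hST hx) _ (hST hy) (h' x hx y hy hxy)⟩

theorem const_of_unif_locconst {α β : Type*} [PseudoMetricSpace α] {S : Set α}
    (hS : IsPreconnected S) (f : α → β)
    (h : ∃ δ > 0, ∀ x ∈ S, ∀ y ∈ S, dist x y < δ → f x = f y) :
    ∀ x ∈ S, ∀ y ∈ S, f x = f y := by
  intro x hx y hy
  obtain ⟨δ, hδ, h⟩ := h
  let _ : TopologicalSpace β := ⊥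
  have _ : DiscreteTopology β := ⟨rfl⟩
  have hc : ContinuousOn f S := by
    intro a ha
    have : (fun b => f b) =ᶠ[𝓝[S] a] fun _ => f a := by
      filter_upwards [self_mem_nhdsWithin, mem_nhdsWithin_of_mem_nhds (ball_mem_nhds a hδ)]
        with b hb hb'
      exact h b hb a ha hb'
    exact (continuousWithinAt_const (b := f a)).congr_of_eventuallyEq this rfl
  exact hS.constant hc hx hy

theorem Pot.unique {α : Type*} [PseudoMetricSpace α] {c : α → α → G} {S : Set α}
    (hS : IsPreconnected S) {u u' : α → G} (hu : Pot c S u) (hu' : Pot c S u')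
    {x y : α} (hx : x ∈ S) (hy : y ∈ S) : (u x)⁻¹ * u y = (u' x)⁻¹ * u' y := by
  obtain ⟨δ, hδ, h⟩ := hu
  obtain ⟨δ', hδ', h'⟩ := hu'
  have := const_of_unif_locconst hS (fun x => u' x * (u x)⁻¹) ⟨min δ δ', lt_min hδ hδ', by
    intro a ha b hb hab
    rw [h a ha b hb (hab.trans_le (min_le_left _ _)), h' a ha b hb (hab.trans_le (min_le_right _ _))]
    group⟩ x hx y hy
  have h2 : u' y = u' x * (u x)⁻¹ * u y := by rw [this]; group
  rw [h2]; group

/-- a potential of a trivial cocycle is constant -/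
theorem Pot.const {α : Type*} [PseudoMetricSpace α] {c : α → α → G} {S : Set α}
    (hS : IsPreconnected S) {u : α → G} (hu : Pot c S u) (h1 : ∀ x ∈ S, ∀ y ∈ S, c x y = 1)
    {x y : α} (hx : x ∈ S) (hy : y ∈ S) : u x = u y := by
  obtain ⟨δ, hδ, h⟩ := hu
  refine const_of_unif_locconst hS u ⟨δ, hδ, fun a ha b hb hab => ?_⟩ x hx y hy
  rw [h a ha b hb hab, h1 a ha b hb, mul_one]

/-- a potential of a full cocycle -/
theorem Pot.full {α : Type*} [PseudoMetricSpace α] {c : α → α → G} {S : Set α}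
    (hS : IsPreconnected S) {u : α → G} (hu : Pot c S u)
    (h1 : ∀ x ∈ S, ∀ y ∈ S, ∀ z ∈ S, c x y * c y z = c x z)
    {x y : α} (hx : x ∈ S) (hy : y ∈ S) : (u x)⁻¹ * u y = c x y := by
  have h2 : Pot c S (fun z => c x z) := ⟨1, one_pos, fun a ha b hb _ => (h1 x hx a ha b hb).symm⟩
  rw [hu.unique hS h2 hx hy]
  have h3 : c x x = 1 := by simpa using h1 x hx x hx x hx
  simp [h3]

theorem exists_pot {W : Type*} [NormedAddCommGroup W] [NormedSpace ℝ W] {c : W → W → G}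
    {S : Set W} (hS : IsCompact S) (hconv : Convex ℝ S) (hc : ∀ p ∈ S, LocCoc c p) :
    ∃ u, Pot c S u := by
  rcases S.eq_empty_or_nonempty with rfl | ⟨x0, hx0⟩
  · exact ⟨fun _ => 1, 1, one_pos, by simp⟩
  choose! O hO hcoc using hc
  obtain ⟨δ, hδ, hleb⟩ := lebesgue_number_lemma_of_metric
    (c := fun p : S => interior (O p)) hS
    (fun p => isOpen_interior) (fun p hp => mem_iUnion.2 ⟨⟨p, hp⟩, mem_interior_iff_mem_nhds.2 (hO p hp)⟩)
  have key : ∀ x ∈ S, ∀ a ∈ ball x δ, ∀ b ∈ ball x δ, ∀ d ∈ ball x δ, c a b * c b d = c a d := by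
    intro x hx a ha b hb d hd
    obtain ⟨y, hy⟩ := hleb x hx
    exact hcoc y y.2 a (interior_subset (hy ha)) b (interior_subset (hy hb)) d
      (interior_subset (hy hd))
  obtain ⟨D, hD⟩ := hS.isBounded.subset_closedBall x0
  obtain ⟨N, hN⟩ := exists_nat_gt (max 1 (D / (δ / 4)))
  have hN0 : (0 : ℝ) < N := lt_trans one_pos ((le_max_left _ _).trans_lt hN)
  have hND : D / N < δ / 4 := by
    have := (le_max_right _ _).trans_lt hN
    rw [div_lt_iff₀ (by positivity)] at this
    rw [div_lt_iff₀ hN0]; linarith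
  let p : ℕ → W → W := fun j x => x0 + ((j : ℝ) / N) • (x - x0)
  have hpS : ∀ j ≤ N, ∀ x ∈ S, p j x ∈ S := by
    intro j hj x hx
    have hj1 : (j : ℝ) / N ≤ 1 := by
      rw [div_le_one hN0]; exact_mod_cast hj
    exact hconv.add_smul_sub_mem hx0 hx ⟨by positivity, hj1⟩
  have hstep : ∀ j, ∀ x ∈ S, dist (p (j + 1) x) (p j x) < δ / 4 := by
    intro j x hx
    have hx' : ‖x - x0‖ ≤ D := by simpa [dist_eq_norm] using hD hx
    have : p (j + 1) x - p j x = (1 / (N : ℝ)) • (x - x0) := by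
      simp only [p, add_sub_add_left_eq_sub, ← sub_smul]
      congr 1; push_cast; field_simp; ring
    rw [dist_eq_norm, this, norm_smul, Real.norm_of_nonneg (by positivity)]
    calc 1 / (N : ℝ) * ‖x - x0‖ ≤ 1 / (N : ℝ) * D := by gcongr
      _ = D / N := by ring
      _ < δ / 4 := hND
  have hlat : ∀ j ≤ N, ∀ x y, dist (p j x) (p j y) ≤ dist x y := by
    intro j hj x y
    have hj1 : (j : ℝ) / N ≤ 1 := by
      rw [div_le_one hN0]; exact_mod_cast hj
    have : p j x - p j y = ((j : ℝ) / N) • (x - y) := by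
      simp only [p, add_sub_add_left_eq_sub, ← smul_sub]
      congr 1; abel
    rw [dist_eq_norm, this, norm_smul, Real.norm_of_nonneg (by positivity), dist_eq_norm]
    exact mul_le_of_le_one_left (norm_nonneg _) hj1
  let u : ℕ → W → G := fun j x => Nat.rec (motive := fun _ => G) 1 (fun i r => r * c (p i x) (p (i + 1) x)) j
  have hu0 : ∀ x, u 0 x = 1 := fun x => rfl
  have hus : ∀ j x, u (j + 1) x = u j x * c (p j x) (p (j + 1) x) := fun j x => rfl
  have hlad : ∀ j ≤ N, ∀ x ∈ S, ∀ y ∈ S, dist x y < δ / 4 → u j y = u j x * c (p j x) (p j y) := by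
    intro j
    induction j with
    | zero =>
      intro _ x hx y hy _
      have h0 : ∀ z, p 0 z = x0 := fun z => by simp [p]
      rw [hu0, hu0, h0, h0, one_mul]
      have := key x0 hx0 x0 (mem_ball_self hδ) x0 (mem_ball_self hδ) x0 (mem_ball_self hδ)
      exact (by simpa using this : c x0 x0 = 1).symm
    | succ j ih =>
      intro hj x hx y hy hxy
      have hj' : j ≤ N := by omega
      rw [hus, hus, ih hj' x hx y hy hxy]
      have hc := hpS j hj' x hx
      have m1 : p j x ∈ ball (p j x) δ := mem_ball_self hδ
      have d2 : dist (p j y) (p j x) < δ / 4 := by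
        rw [dist_comm]; exact (hlat j hj' x y).trans_lt hxy
      have d3 := hstep j x hx
      have d4 := hstep j y hy
      have m2 : p j y ∈ ball (p j x) δ := mem_ball.2 (by linarith)
      have m3 : p (j + 1) x ∈ ball (p j x) δ := mem_ball.2 (by linarith)
      have m4 : p (j + 1) y ∈ ball (p j x) δ :=
        mem_ball.2 ((dist_triangle _ (p j y) _).trans_lt (by linarith))
      rw [mul_assoc, mul_assoc, key _ hc _ m1 _ m2 _ m4, key _ hc _ m1 _ m3 _ m4]
  have hpN : ∀ x, p N x = x := fun x => by
    simp [p, div_self hN0.ne']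
  refine ⟨u N, δ / 4, by positivity, fun x hx y hy hxy => ?_⟩
  have := hlad N le_rfl x hx y hy hxy
  rwa [hpN, hpN] at this

open Classical in
/-- holonomy along a segment -/
noncomputable def hol {W : Type*} [NormedAddCommGroup W] [NormedSpace ℝ W] (c : W → W → G)
    (a b : W) : G :=
  if h : ∃ u, Pot c (segment ℝ a b) u then (h.choose a)⁻¹ * h.choose b else 1

theorem hol_eq {W : Type*} [NormedAddCommGroup W] [NormedSpace ℝ W] {c : W → W → G}
    {S : Set W} {u : W → G} (hu : Pot c S u) {a b : W} (hab : segment ℝ a b ⊆ S) :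
    hol c a b = (u a)⁻¹ * u b := by
  have h : ∃ u, Pot c (segment ℝ a b) u := ⟨u, hu.mono hab⟩
  rw [hol, dif_pos h]
  exact Pot.unique (convex_segment a b).isPreconnected h.choose_spec (hu.mono hab)
    (left_mem_segment ℝ a b) (right_mem_segment ℝ a b)

end
end BD

namespace BD
open Set Metric Filter Topology

noncomputable section

/-- pattern space -/
abbrev PP (m : ℕ) := ℝ × ℝ × (Fin m → ℝ)

def bet (t : ℝ) : ℝ := Real.smoothTransition ((5 - t) / 2)

theorem bet_one {t : ℝ} (h : t ≤ 3) : bet t = 1 := Real.smoothTransition.one_of_one_le (by linarith)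
theorem bet_zero {t : ℝ} (h : 5 ≤ t) : bet t = 0 :=
  Real.smoothTransition.zero_of_nonpos (by linarith)
theorem bet_contDiff {k : ℕ∞} : ContDiff ℝ k bet :=
  Real.smoothTransition.contDiff.comp ((contDiff_const.sub contDiff_id).div_const _)
theorem bet_nonneg (t : ℝ) : 0 ≤ bet t := Real.smoothTransition.nonneg _
theorem bet_le_one (t : ℝ) : bet t ≤ 1 := Real.smoothTransition.le_one _
theorem bet_anti {s t : ℝ} (h : s ≤ t) : bet t ≤ bet s :=
  Real.smoothTransition.monotone (by linarith)

variable {m : ℕ}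

/-- angle -/
def ang (p : PP m) : ℝ := 2 * Real.pi * bet (p.1 ^ 2 + p.2.1 ^ 2)

def tau (p : PP m) : PP m :=
  (p.1 * Real.cos (ang p) - p.2.1 * Real.sin (ang p),
    p.1 * Real.sin (ang p) + p.2.1 * Real.cos (ang p), p.2.2)

def tauI (p : PP m) : PP m :=
  (p.1 * Real.cos (ang p) + p.2.1 * Real.sin (ang p),
    - p.1 * Real.sin (ang p) + p.2.1 * Real.cos (ang p), p.2.2)

theorem tau_r (p : PP m) : (tau p).1 ^ 2 + (tau p).2.1 ^ 2 = p.1 ^ 2 + p.2.1 ^ 2 := by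
  simp only [tau]
  linear_combination (p.1 ^ 2 + p.2.1 ^ 2) * Real.sin_sq_add_cos_sq (ang p)

theorem tauI_r (p : PP m) : (tauI p).1 ^ 2 + (tauI p).2.1 ^ 2 = p.1 ^ 2 + p.2.1 ^ 2 := by
  simp only [tauI]
  linear_combination (p.1 ^ 2 + p.2.1 ^ 2) * Real.sin_sq_add_cos_sq (ang p)

theorem ang_tau (p : PP m) : ang (tau p) = ang p := by
  rw [ang, tau_r]; rfl
theorem ang_tauI (p : PP m) : ang (tauI p) = ang p := by
  rw [ang, tauI_r]; rfl

theorem tau_tauI (p : PP m) : tau (tauI p) = p := by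
  have h := Real.sin_sq_add_cos_sq (ang p)
  refine Prod.ext ?_ (Prod.ext ?_ rfl)
  · change (tauI p).1 * Real.cos (ang (tauI p)) - (tauI p).2.1 * Real.sin (ang (tauI p)) = _
    rw [ang_tauI]; simp only [tauI]; linear_combination p.1 * h
  · change (tauI p).1 * Real.sin (ang (tauI p)) + (tauI p).2.1 * Real.cos (ang (tauI p)) = _
    rw [ang_tauI]; simp only [tauI]; linear_combination p.2.1 * h

theorem tauI_tau (p : PP m) : tauI (tau p) = p := by
  have h := Real.sin_sq_add_cos_sq (ang p)
  refine Prod.ext ?_ (Prod.ext ?_ rfl)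
  · change (tau p).1 * Real.cos (ang (tau p)) + (tau p).2.1 * Real.sin (ang (tau p)) = _
    rw [ang_tau]; simp only [tau]; linear_combination p.1 * h
  · change -(tau p).1 * Real.sin (ang (tau p)) + (tau p).2.1 * Real.cos (ang (tau p)) = _
    rw [ang_tau]; simp only [tau]; linear_combination p.2.1 * h

theorem tauI_triv {p : PP m} (h : p.1 ^ 2 + p.2.1 ^ 2 ≤ 3 ∨ 5 ≤ p.1 ^ 2 + p.2.1 ^ 2) :
    tauI p = p := by
  rcases h with h | h
  · simp [tauI, ang, bet_one h]
  · simp [tauI, ang, bet_zero h]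

theorem tau_triv {p : PP m} (h : p.1 ^ 2 + p.2.1 ^ 2 ≤ 3 ∨ 5 ≤ p.1 ^ 2 + p.2.1 ^ 2) :
    tau p = p := by
  rcases h with h | h
  · simp [tau, ang, bet_one h]
  · simp [tau, ang, bet_zero h]

def mu (e : ℝ) (p : PP m) : PP m :=
  (p.1 / 10, 2 * e + 3 / 10 * p.2.1, fun j => Real.arsinh (4 * p.2.2 j))

def muI (e : ℝ) (p : PP m) : PP m :=
  (10 * p.1, (p.2.1 - 2 * e) * (10 / 3), fun j => Real.sinh (p.2.2 j) / 4)

theorem mu_muI (e : ℝ) (p : PP m) : mu e (muI e p) = p := by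
  refine Prod.ext ?_ (Prod.ext ?_ ?_)
  · simp [mu, muI]
  · simp [mu, muI]; ring
  · funext j; simp only [mu, muI]
    rw [mul_div_cancel₀ _ (by norm_num : (4 : ℝ) ≠ 0), Real.arsinh_sinh]

theorem muI_mu (e : ℝ) (p : PP m) : muI e (mu e p) = p := by
  refine Prod.ext ?_ (Prod.ext ?_ ?_)
  · simp [mu, muI]; ring
  · simp [mu, muI]; ring
  · funext j; simp [mu, muI]

/-- sign associated with index 1 , 2 -/
def sg (i : Fin 3) : ℝ := if i = 1 then 1 else -1

def hm (i : Fin 3) (p : PP m) : PP m :=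
  if i = 0 then (5 / 2 + p.1 / 100, 5 / 2 + p.2.1 / 100, fun j => p.2.2 j / 100)
  else tauI (mu (sg i) p)

def hI (i : Fin 3) (p : PP m) : PP m :=
  if i = 0 then (100 * (p.1 - 5 / 2), 100 * (p.2.1 - 5 / 2), fun j => 100 * p.2.2 j)
  else muI (sg i) (tau p)

theorem hm_hI (i : Fin 3) (p : PP m) : hm i (hI i p) = p := by
  unfold hm hI
  split_ifs
  · refine Prod.ext ?_ (Prod.ext ?_ ?_)
    · simp
    · simp
    · funext j; simp
  · rw [mu_muI, tauI_tau]

theorem hI_hm (i : Fin 3) (p : PP m) : hI i (hm i p) = p := by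
  unfold hm hI
  split_ifs
  · refine Prod.ext ?_ (Prod.ext ?_ ?_)
    · simp; ring
    · simp; ring
    · funext j; simp; ring
  · rw [tau_tauI, muI_mu]

theorem ang_contDiff {k : ℕ∞} : ContDiff ℝ k (ang : PP m → ℝ) :=
  contDiff_const.mul (bet_contDiff.comp
    ((contDiff_fst.pow 2).add ((contDiff_fst.comp contDiff_snd).pow 2)))

theorem hm_contDiff (i : Fin 3) {k : ℕ∞} : ContDiff ℝ k (hm i : PP m → PP m) := by
  unfold hm
  split_ifs
  · fun_prop
  · have h1 : ContDiff ℝ k (tauI : PP m → PP m) := by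
      have := ang_contDiff (m := m) (k := k)
      unfold tauI
      fun_prop
    have h2 : ContDiff ℝ k (mu (sg i) : PP m → PP m) := by
      unfold mu
      fun_prop
    exact h1.comp h2

theorem hI_contDiff (i : Fin 3) {k : ℕ∞} : ContDiff ℝ k (hI i : PP m → PP m) := by
  unfold hI
  split_ifs
  · fun_prop
  · have h1 : ContDiff ℝ k (tau : PP m → PP m) := by
      have := ang_contDiff (m := m) (k := k)
      unfold tau
      fun_prop
    have h2 : ContDiff ℝ k (muI (sg i) : PP m → PP m) := by
      unfold muI
      fun_prop
    exact h2.comp h1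

theorem hm_cont (i : Fin 3) : Continuous (hm i : PP m → PP m) := (hm_contDiff i (k := 1)).continuous
theorem hI_cont (i : Fin 3) : Continuous (hI i : PP m → PP m) := (hI_contDiff i (k := 1)).continuous

/-- the basic region -/
def UU (m : ℕ) : Set (PP m) := {p | |p.1| < 3 ∧ |p.2.1| < 3 ∧ ‖p.2.2‖ < 4 ∧
  (1 < |p.2.1| ∨ 1 < ‖p.2.2‖)}

def UB (m : ℕ) : Set (PP m) := {p | |p.1| ≤ 3 ∧ |p.2.1| ≤ 3 ∧ ‖p.2.2‖ ≤ 4 ∧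
  (1 ≤ |p.2.1| ∨ 1 ≤ ‖p.2.2‖)}

def Con (m : ℕ) (e : ℝ) : Set (PP m) := {p | |p.1| < 3 ∧ |p.2.1| < 3 ∧ ‖p.2.2‖ < 4 ∧
  (1 < e * p.2.1 ∨ 1 < ‖p.2.2‖)}

theorem isOpen_UU : IsOpen (UU m) := by
  have e : UU m = {p | |p.1| < 3} ∩ ({p | |p.2.1| < 3} ∩ ({p | ‖p.2.2‖ < 4} ∩
    ({p | 1 < |p.2.1|} ∪ {p | 1 < ‖p.2.2‖}))) := rfl
  rw [e]
  refine (isOpen_lt (by fun_prop) (by fun_prop)).inter ((isOpen_lt (by fun_prop) (by fun_prop)).inter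
    ((isOpen_lt (by fun_prop) (by fun_prop)).inter
      ((isOpen_lt (by fun_prop) (by fun_prop)).union (isOpen_lt (by fun_prop) (by fun_prop)))))

theorem isClosed_UB : IsClosed (UB m) := by
  have e : UB m = {p | |p.1| ≤ 3} ∩ ({p | |p.2.1| ≤ 3} ∩ ({p | ‖p.2.2‖ ≤ 4} ∩
    ({p | 1 ≤ |p.2.1|} ∪ {p | 1 ≤ ‖p.2.2‖}))) := rfl
  rw [e]
  refine (isClosed_le (by fun_prop) (by fun_prop)).inter ((isClosed_le (by fun_prop) (by fun_prop)).inter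
    ((isClosed_le (by fun_prop) (by fun_prop)).inter
      ((isClosed_le (by fun_prop) (by fun_prop)).union (isClosed_le (by fun_prop) (by fun_prop)))))

theorem UU_sub_UB : UU m ⊆ UB m := fun _ h =>
  ⟨h.1.le, h.2.1.le, h.2.2.1.le, h.2.2.2.imp le_of_lt le_of_lt⟩

theorem isCompact_UB : IsCompact (UB m) := by
  refine (isCompact_closedBall (0 : PP m) 4).of_isClosed_subset isClosed_UB ?_
  intro p hp
  rw [mem_closedBall_zero_iff, Prod.norm_def, Prod.norm_def]
  exact max_le (by simpa using hp.1.trans (by norm_num))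
    (max_le (by simpa using hp.2.1.trans (by norm_num)) hp.2.2.1)

theorem Con_sub_UU {e : ℝ} (he : |e| = 1) : Con m e ⊆ UU m := fun p h =>
  ⟨h.1, h.2.1, h.2.2.1, h.2.2.2.imp (fun h' => by
    calc 1 < e * p.2.1 := h'
      _ ≤ |e * p.2.1| := le_abs_self _
      _ = |p.2.1| := by rw [abs_mul, he, one_mul]) id⟩

theorem exp_four_bound : (32.1 : ℝ) < Real.exp 3.9 := by
  have h1 : (2.7 : ℝ) < Real.exp 1 := by linarith [Real.exp_one_gt_d9]
  have h2 : Real.exp 3.9 = Real.exp 1 ^ 3 * Real.exp 0.9 := by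
    rw [← Real.exp_nat_mul, ← Real.exp_add]; norm_num
  have h3 : (1.9 : ℝ) ≤ Real.exp 0.9 := by linarith [Real.add_one_le_exp (0.9 : ℝ)]
  rw [h2]
  have h4 : (19.6 : ℝ) < Real.exp 1 ^ 3 := by
    calc (19.6 : ℝ) < 2.7 ^ 3 := by norm_num
      _ ≤ Real.exp 1 ^ 3 := by gcongr
  nlinarith

theorem sinh_bound : (16 : ℝ) < Real.sinh 3.9 := by
  rw [Real.sinh_eq]
  have h1 := exp_four_bound
  have h2 : Real.exp (-3.9) < 0.1 := by
    rw [Real.exp_neg, inv_lt_comm₀ (Real.exp_pos _) (by norm_num)]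
    linarith
  linarith

theorem sinh_one_lt : Real.sinh 1 < 4 := by
  rw [Real.sinh_eq]
  linarith [Real.exp_one_lt_d9, Real.exp_pos (-1)]

theorem abs_arsinh (x : ℝ) : |Real.arsinh x| = Real.arsinh |x| := by
  rcases le_total 0 x with h | h
  · rw [abs_of_nonneg h, abs_of_nonneg (Real.arsinh_nonneg_iff.2 h)]
  · rw [abs_of_nonpos h, abs_of_nonpos (Real.arsinh_nonpos_iff.2 h), Real.arsinh_neg]

theorem norm_ars_lt (v : Fin m → ℝ) (h : ‖v‖ ≤ 4) : ‖fun j => Real.arsinh (4 * v j)‖ < 3.9 := by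
  rw [pi_norm_lt_iff (by norm_num)]
  intro j
  have hj : |v j| ≤ 4 := (norm_le_pi_norm v j).trans h
  rw [Real.norm_eq_abs, abs_arsinh, abs_mul, ← Real.arsinh_sinh 3.9]
  refine Real.arsinh_lt_arsinh.2 (lt_of_le_of_lt ?_ sinh_bound)
  rw [abs_of_nonneg (by norm_num : (0 : ℝ) ≤ 4)]; linarith

theorem one_lt_norm_ars (v : Fin m → ℝ) (h : 1 ≤ ‖v‖) : 1 < ‖fun j => Real.arsinh (4 * v j)‖ := by
  by_contra hcon
  push Not at hcon
  rw [pi_norm_le_iff_of_nonneg (by norm_num)] at hcon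
  have : ‖v‖ < 1 := by
    rw [pi_norm_lt_iff one_pos]
    intro j
    have hj := hcon j
    rw [Real.norm_eq_abs, abs_arsinh, abs_mul, ← Real.arsinh_sinh 1, Real.arsinh_le_arsinh,
      abs_of_nonneg (by norm_num : (0 : ℝ) ≤ 4)] at hj
    rw [Real.norm_eq_abs]
    linarith [sinh_one_lt]
  linarith

theorem sg_cases (i : Fin 3) : sg i = 1 ∨ sg i = -1 := by
  unfold sg; split_ifs <;> simp

theorem sg_abs (i : Fin 3) : |sg i| = 1 := by
  rcases sg_cases i with h | h <;> simp [h]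

/-- images of the closed region for i = 1, 2 -/
theorem hm_maps_Con {i : Fin 3} (hi : i ≠ 0) {p : PP m} (hp : p ∈ UB m) : hm i p ∈ Con m (sg i) := by
  obtain ⟨hx, hy, hv, hor⟩ := hp
  rw [hm, if_neg hi]
  set q := mu (sg i) p with hq
  have hqx : |q.1| ≤ 3 / 10 := by
    simp only [hq, mu, abs_div]; rw [abs_of_nonneg (by norm_num : (0 : ℝ) ≤ 10)]; linarith
  have hqy : sg i * q.2.1 = 2 + 3 / 10 * (sg i * p.2.1) := by
    simp only [hq, mu]
    rcases sg_cases i with h | h <;> rw [h] <;> ring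
  have hsy : |sg i * p.2.1| = |p.2.1| := by rw [abs_mul, sg_abs, one_mul]
  have hsq : q.2.1 ^ 2 = (sg i * q.2.1) ^ 2 := by
    rcases sg_cases i with h | h <;> rw [h] <;> ring
  have hx2 : q.1 ^ 2 ≤ 9 / 100 := by
    rw [← sq_abs]; nlinarith [abs_nonneg q.1]
  rw [← hsy] at hy hor
  set y := sg i * p.2.1
  obtain ⟨hy1, hy2⟩ := abs_le.1 hy
  have hr : q.1 ^ 2 + q.2.1 ^ 2 < 9 := by rw [hsq, hqy]; nlinarith
  have hr' := tauI_r q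
  have a1 : |(tauI q).1| < 3 := abs_lt_of_sq_lt_sq (by nlinarith [sq_nonneg (tauI q).2.1]) (by norm_num)
  have a2 : |(tauI q).2.1| < 3 := abs_lt_of_sq_lt_sq (by nlinarith [sq_nonneg (tauI q).1]) (by norm_num)
  have a3 : ‖(tauI q).2.2‖ < 4 := (norm_ars_lt p.2.2 hv).trans (by norm_num)
  refine ⟨a1, a2, a3, ?_⟩
  rcases hor with h | h
  · left
    have ht : tauI q = q := by
      apply tauI_triv
      rw [hsq, hqy]
      rcases le_abs'.1 h with h | h
      · left; nlinarith
      · right; nlinarith [sq_nonneg q.1]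
    rw [ht, hqy]; linarith
  · right
    exact one_lt_norm_ars _ h

theorem hm_zero_box {p : PP m} (hp : ‖p‖ ≤ 8) : (|(hm 0 p).1 - 5 / 2| ≤ 8 / 100) ∧
    (|(hm 0 p).2.1 - 5 / 2| ≤ 8 / 100) ∧ ‖(hm 0 p).2.2‖ ≤ 8 / 100 := by
  rw [Prod.norm_def, Prod.norm_def, max_le_iff, max_le_iff] at hp
  obtain ⟨h1, h2, h3⟩ := hp
  simp only [hm, if_true, Real.norm_eq_abs] at *
  refine ⟨?_, ?_, ?_⟩
  · rw [add_sub_cancel_left, abs_div]; norm_num; linarith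
  · rw [add_sub_cancel_left, abs_div]; norm_num; linarith
  · rw [pi_norm_le_iff_of_nonneg (by norm_num)] at h3 ⊢
    intro j
    have := h3 j
    rw [norm_div]; norm_num at *; linarith

theorem UB_norm {p : PP m} (hp : p ∈ UB m) : ‖p‖ ≤ 4 := by
  rw [Prod.norm_def, Prod.norm_def]
  exact max_le (by simpa using hp.1.trans (by norm_num))
    (max_le (by simpa using hp.2.1.trans (by norm_num)) hp.2.2.1)

theorem hm_zero_UU {p : PP m} (hp : ‖p‖ ≤ 8) : hm 0 p ∈ UU m := by
  obtain ⟨h1, h2, h3⟩ := hm_zero_box hp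
  rw [abs_le] at h1 h2
  refine ⟨abs_lt.2 ⟨by linarith, by linarith⟩, abs_lt.2 ⟨by linarith, by linarith⟩, by linarith,
    Or.inl (lt_abs.2 (Or.inl (by linarith)))⟩

theorem hm_maps (i : Fin 3) {p : PP m} (hp : p ∈ UB m) : hm i p ∈ UU m := by
  by_cases hi : i = 0
  · subst hi; exact hm_zero_UU ((UB_norm hp).trans (by norm_num))
  · exact Con_sub_UU (sg_abs i) (hm_maps_Con hi hp)

theorem mu_y_bound (i : Fin 3) {p : PP m} (hp : |p.2.1| ≤ 3) : 1 ≤ sg i * (mu (sg i) p).2.1 := by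
  have hqy : sg i * (mu (sg i) p).2.1 = 2 + 3 / 10 * (sg i * p.2.1) := by
    simp only [mu]
    rcases sg_cases i with h | h <;> rw [h] <;> ring
  have hsy : |sg i * p.2.1| = |p.2.1| := by rw [abs_mul, sg_abs, one_mul]
  rw [hqy]
  rw [← hsy] at hp
  linarith [(abs_le.1 hp).1]

theorem hm_ne_zero_r {i : Fin 3} (hi : i ≠ 0) {p : PP m} (hx : |p.1| ≤ 3) (hy : |p.2.1| ≤ 3) :
    (hm i p).1 ^ 2 + (hm i p).2.1 ^ 2 < 9 := by
  rw [hm, if_neg hi, tauI_r]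
  have hsy : |sg i * p.2.1| = |p.2.1| := by rw [abs_mul, sg_abs, one_mul]
  rw [← hsy] at hy
  have h2 : (mu (sg i) p).2.1 ^ 2 = (2 + 3 / 10 * (sg i * p.2.1)) ^ 2 := by
    simp only [mu]
    rcases sg_cases i with h | h <;> rw [h] <;> ring
  have h1 : (mu (sg i) p).1 ^ 2 ≤ 9 / 100 := by
    simp only [mu]; have := sq_abs p.1; nlinarith [abs_nonneg p.1]
  obtain ⟨a, b⟩ := abs_le.1 hy
  rw [h2]; nlinarith

theorem hm_zero_r {p : PP m} (hp : ‖p‖ ≤ 8) : 9 < (hm 0 p).1 ^ 2 + (hm 0 p).2.1 ^ 2 := by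
  obtain ⟨h1, h2, h3⟩ := hm_zero_box hp
  rw [abs_le] at h1 h2
  nlinarith

theorem hm_disj12 {i j : Fin 3} (hi : i ≠ 0) (hj : j ≠ 0) (hij : i ≠ j) {p q : PP m}
    (hp : |p.2.1| ≤ 3) (hq : |q.2.1| ≤ 3) : hm i p ≠ hm j q := by
  intro h
  rw [hm, hm, if_neg hi, if_neg hj] at h
  have h' := congrArg tau h
  rw [tau_tauI, tau_tauI] at h'
  have e : (mu (sg i) p).2.1 = (mu (sg j) q).2.1 := by rw [h']
  have a := mu_y_bound i hp
  have b := mu_y_bound j hq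
  have hs : sg i = - sg j := by
    fin_cases i <;> fin_cases j <;> simp_all [sg]
  rw [e, hs] at a
  rcases sg_cases j with h | h <;> rw [h] at a b <;> linarith

theorem hm_disj {i j : Fin 3} (hij : i ≠ j) {p q : PP m} (hp : p ∈ UB m) (hq : q ∈ UB m) :
    hm i p ≠ hm j q := by
  intro h
  by_cases hi : i = 0
  · subst hi
    have a := hm_zero_r ((UB_norm hp).trans (by norm_num))
    have b := hm_ne_zero_r (Ne.symm hij) hq.1 hq.2.1
    rw [h] at a; linarith
  · by_cases hj : j = 0
    · subst hj
      have a := hm_zero_r ((UB_norm hq).trans (by norm_num))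
      have b := hm_ne_zero_r hi hp.1 hp.2.1
      rw [h] at b; linarith
    · exact hm_disj12 hi hj hij hp.2.1 hq.2.1 h

end
end BD

namespace BD
open Set Metric Filter Topology

noncomputable section

variable {m : ℕ} {G : Type*} [Group G]

def GB (m : ℕ) : Set (PP m) := {p | |p.1| ≤ 2.95 ∧ |p.2.1| ≤ 2.95 ∧ ‖p.2.2‖ ≤ 3.9}

def gAm (m : ℕ) : Set (PP m) := {p | -1 ≤ p.1 ∧ p.1 < 0 ∧ |p.2.1| < 2 ∧ ‖p.2.2‖ < 2}
def gAp (m : ℕ) : Set (PP m) := {p | 0 ≤ p.1 ∧ p.1 ≤ 1 ∧ |p.2.1| < 2 ∧ ‖p.2.2‖ < 2}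

/-- the rim -/
def KR (m : ℕ) : Set (PP m) := {p | p.1 = 0 ∧ max |p.2.1| ‖p.2.2‖ = 2}

open Classical in
def gate0 (X : G) (a b : PP m) : G :=
  if a ∈ gAm m ∧ b ∈ gAp m then X else if a ∈ gAp m ∧ b ∈ gAm m then X⁻¹ else 1

def gt : ℕ → (List Bool → G) → PP m → PP m → G
  | 0, X, a, b => gate0 (X []) a b
  | k + 1, X, a, b => gt k (fun w => X (false :: w)) (hI 1 a) (hI 1 b) *
      gt k (fun w => X (true :: w)) (hI 2 a) (hI 2 b)

def bi (b : Bool) : Fin 3 := if b then 2 else 1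

def hw : List (Fin 3) → PP m → PP m
  | [], p => p
  | i :: w, p => hm i (hw w p)

def hwI : List (Fin 3) → PP m → PP m
  | [], p => p
  | i :: w, p => hwI w (hI i p)

theorem hw_hwI (w : List (Fin 3)) (p : PP m) : hw w (hwI w p) = p := by
  induction w generalizing p with
  | nil => rfl
  | cons i w ih => rw [hwI, hw, ih, hm_hI]

theorem hwI_hw (w : List (Fin 3)) (p : PP m) : hwI w (hw w p) = p := by
  induction w generalizing p with
  | nil => rfl
  | cons i w ih => rw [hwI, hw, hI_hm, ih]

theorem hw_append (v w : List (Fin 3)) (p : PP m) : hw (v ++ w) p = hw v (hw w p) := by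
  induction v with
  | nil => rfl
  | cons i v ih => simp [hw, ih]

theorem hwI_append (v w : List (Fin 3)) (p : PP m) : hwI (v ++ w) p = hwI w (hwI v p) := by
  induction v generalizing p with
  | nil => rfl
  | cons i v ih => simp [hwI, ih]

theorem hw_cont (w : List (Fin 3)) : Continuous (hw w : PP m → PP m) := by
  induction w with
  | nil => exact continuous_id
  | cons i w ih => exact (hm_cont i).comp ih

theorem hwI_cont (w : List (Fin 3)) : Continuous (hwI w : PP m → PP m) := by
  induction w with
  | nil => exact continuous_id
  | cons i w ih => exact ih.comp (hI_cont i)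

theorem GB_sub_box {p : PP m} (h : p ∈ GB m) : |p.1| ≤ 3 ∧ |p.2.1| ≤ 3 ∧ ‖p.2.2‖ ≤ 4 :=
  ⟨h.1.trans (by norm_num), h.2.1.trans (by norm_num), h.2.2.trans (by norm_num)⟩

theorem hm_GB {i : Fin 3} (hi : i ≠ 0) {p : PP m} (hp : p ∈ GB m) : hm i p ∈ GB m := by
  obtain ⟨hx, hy, hv⟩ := hp
  have hr : (hm i p).1 ^ 2 + (hm i p).2.1 ^ 2 ≤ 2.95 ^ 2 := by
    rw [hm, if_neg hi, tauI_r]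
    have hsy : |sg i * p.2.1| = |p.2.1| := by rw [abs_mul, sg_abs, one_mul]
    rw [← hsy] at hy
    have h2 : (mu (sg i) p).2.1 ^ 2 = (2 + 3 / 10 * (sg i * p.2.1)) ^ 2 := by
      simp only [mu]
      rcases sg_cases i with h | h <;> rw [h] <;> ring
    have h1 : (mu (sg i) p).1 ^ 2 ≤ 9 / 100 := by
      simp only [mu]; have := sq_abs p.1; nlinarith [abs_nonneg p.1]
    obtain ⟨a, b⟩ := abs_le.1 hy
    rw [h2]; nlinarith
  refine ⟨abs_le_of_sq_le_sq (by nlinarith [sq_nonneg (hm i p).2.1]) (by norm_num),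
    abs_le_of_sq_le_sq (by nlinarith [sq_nonneg (hm i p).1]) (by norm_num), ?_⟩
  rw [hm, if_neg hi]
  exact (norm_ars_lt p.2.2 (hv.trans (by norm_num))).le

theorem GB_of_hI {i : Fin 3} (hi : i ≠ 0) {p : PP m} (hp : hI i p ∈ GB m) : p ∈ GB m := by
  have := hm_GB hi hp
  rwa [hm_hI] at this

theorem gate0_ne {X : G} {a b : PP m} (h : gate0 X a b ≠ 1) : a ∈ GB m ∧ b ∈ GB m := by
  have h1 : ∀ p ∈ gAm m, p ∈ GB m := fun p hp =>
    ⟨abs_le.2 ⟨by linarith [hp.1], by linarith [hp.2.1]⟩, by linarith [hp.2.2.1], by linarith [hp.2.2.2]⟩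
  have h2 : ∀ p ∈ gAp m, p ∈ GB m := fun p hp =>
    ⟨abs_le.2 ⟨by linarith [hp.1], by linarith [hp.2.1]⟩, by linarith [hp.2.2.1], by linarith [hp.2.2.2]⟩
  unfold gate0 at h
  split_ifs at h with h3 h4
  · exact ⟨h1 _ h3.1, h2 _ h3.2⟩
  · exact ⟨h2 _ h4.1, h1 _ h4.2⟩
  · exact absurd rfl h

theorem gt_ne {k : ℕ} {X : List Bool → G} {a b : PP m} (h : gt k X a b ≠ 1) :
    a ∈ GB m ∧ b ∈ GB m := by
  induction k generalizing X a b with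
  | zero => exact gate0_ne h
  | succ k ih =>
    rw [gt] at h
    by_cases h1 : gt k (fun w => X (false :: w)) (hI 1 a) (hI 1 b) = 1
    · rw [h1, one_mul] at h
      exact ⟨GB_of_hI (by decide) (ih h).1, GB_of_hI (by decide) (ih h).2⟩
    · exact ⟨GB_of_hI (by decide) (ih h1).1, GB_of_hI (by decide) (ih h1).2⟩

theorem gt_eq_one_left {k : ℕ} {X : List Bool → G} {a b : PP m} (h : a ∉ GB m) :
    gt k X a b = 1 := by
  by_contra hc; exact h (gt_ne hc).1
theorem gt_eq_one_right {k : ℕ} {X : List Bool → G} {a b : PP m} (h : b ∉ GB m) :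
    gt k X a b = 1 := by
  by_contra hc; exact h (gt_ne hc).2

theorem bi_ne_zero (b : Bool) : bi b ≠ 0 := by cases b <;> decide

theorem hw_bi_GB (w : List Bool) {p : PP m} (hp : p ∈ GB m) : hw (w.map bi) p ∈ GB m := by
  induction w with
  | nil => exact hp
  | cons b w ih => exact hm_GB (bi_ne_zero b) ih

theorem hI_hm_notGB {i j : Fin 3} (hi : i ≠ 0) (hj : j ≠ 0) (hij : i ≠ j) {p : PP m}
    (hp : p ∈ GB m) : hI j (hm i p) ∉ GB m := by
  intro h
  refine hm_disj12 hi hj hij (GB_sub_box hp).2.1 (GB_sub_box h).2.1 ?_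
  rw [hm_hI]

theorem gt_word (w : List Bool) (X : List Bool → G) {a b : PP m} (ha : a ∈ GB m) :
    gt w.length X (hw (w.map bi) a) (hw (w.map bi) b) = gate0 (X w) a b := by
  induction w generalizing X with
  | nil => rfl
  | cons c w ih =>
    have h := hw_bi_GB w ha
    cases c
    · simp only [List.length_cons, gt, List.map_cons, hw]
      change gt w.length _ (hI 1 (hm 1 _)) (hI 1 (hm 1 _)) *
        gt w.length _ (hI 2 (hm 1 _)) (hI 2 (hm 1 _)) = _
      rw [hI_hm, hI_hm, ih, gt_eq_one_left (hI_hm_notGB (by decide) (by decide) (by decide) h), mul_one]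
    · simp only [List.length_cons, gt, List.map_cons, hw]
      change gt w.length _ (hI 1 (hm 2 _)) (hI 1 (hm 2 _)) *
        gt w.length _ (hI 2 (hm 2 _)) (hI 2 (hm 2 _)) = _
      rw [hI_hm, hI_hm, ih, gt_eq_one_left (hI_hm_notGB (by decide) (by decide) (by decide) h), one_mul]

/-- rims of level k -/
def KK (m k : ℕ) : Set (PP m) := {p | ∃ w : List Bool, w.length = k ∧ hwI (w.map bi) p ∈ KR m}

theorem KR_sub : KR m ⊆ UU m := by
  intro p hp
  have h1 : |p.2.1| ≤ 2 := hp.2 ▸ le_max_left _ _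
  have h2 : ‖p.2.2‖ ≤ 2 := hp.2 ▸ le_max_right _ _
  refine ⟨by rw [hp.1]; norm_num, by linarith, by linarith, ?_⟩
  rcases max_choice |p.2.1| ‖p.2.2‖ with h | h
  · left; rw [← h, hp.2]; norm_num
  · right; rw [← h, hp.2]; norm_num

theorem hw_maps (w : List (Fin 3)) {p : PP m} (hp : p ∈ UU m) : hw w p ∈ UU m := by
  induction w with
  | nil => exact hp
  | cons i w ih => exact hm_maps i (UU_sub_UB ih)

theorem KK_sub (k : ℕ) : KK m k ⊆ UU m := by
  rintro p ⟨w, _, hp⟩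
  have := hw_maps (w.map bi) (KR_sub hp)
  rwa [hw_hwI] at this

theorem gate0_coc_of {X : G} {O : Set (PP m)}
    (h : (∀ a ∈ O, a ∉ gAm m) ∨ (∀ a ∈ O, a ∉ gAp m) ∨ (∀ a ∈ O, a ∈ gAm m ∨ a ∈ gAp m)) :
    ∀ a ∈ O, ∀ b ∈ O, ∀ d ∈ O, gate0 X a b * gate0 X b d = gate0 X a d := by
  intro a ha b hb d hd
  have hdis : ∀ p, p ∈ gAm m → p ∉ gAp m := fun p hp hp' => by linarith [hp.2.1, hp'.1]
  rcases h with h | h | h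
  · simp [gate0, h a ha, h b hb, h d hd]
  · simp [gate0, h a ha, h b hb, h d hd]
  · rcases h a ha with h1 | h1 <;> rcases h b hb with h2 | h2 <;> rcases h d hd with h3 | h3 <;>
    · have n1 := hdis a
      have n2 := hdis b
      have n3 := hdis d
      have n1' : a ∈ gAp m → a ∉ gAm m := fun h h' => n1 h' h
      have n2' : b ∈ gAp m → b ∉ gAm m := fun h h' => n2 h' h
      have n3' : d ∈ gAp m → d ∉ gAm m := fun h h' => n3 h' h
      simp_all [gate0]

theorem gate0_locCoc (X : G) {p : PP m} (hp : p ∉ KR m) : LocCoc (gate0 X) p := by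
  rcases lt_trichotomy p.1 0 with h | h | h
  · refine ⟨{q | q.1 < 0}, (isOpen_lt (by fun_prop) (by fun_prop)).mem_nhds h,
      gate0_coc_of (Or.inr (Or.inl fun a ha h' => ?_))⟩
    have ha : a.1 < 0 := ha
    linarith [h'.1]
  · rcases lt_trichotomy (max |p.2.1| ‖p.2.2‖) 2 with h2 | h2 | h2
    · refine ⟨{q | |q.1| < 1} ∩ {q | max |q.2.1| ‖q.2.2‖ < 2}, inter_mem
        ((isOpen_lt (by fun_prop) (by fun_prop)).mem_nhds (by simp [h]))
        ((isOpen_lt (by fun_prop) (by fun_prop)).mem_nhds h2),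
        gate0_coc_of (Or.inr (Or.inr fun a ha => ?_))⟩
      have h3 : |a.1| < 1 := ha.1
      have h4 : max |a.2.1| ‖a.2.2‖ < 2 := ha.2
      rw [max_lt_iff] at h4
      rw [abs_lt] at h3
      rcases lt_or_ge a.1 0 with h5 | h5
      · left; exact ⟨h3.1.le, h5, h4.1, h4.2⟩
      · right; exact ⟨h5, h3.2.le, h4.1, h4.2⟩
    · exact absurd ⟨h, h2⟩ hp
    · refine ⟨{q | 2 < max |q.2.1| ‖q.2.2‖}, (isOpen_lt (by fun_prop) (by fun_prop)).mem_nhds h2,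
        gate0_coc_of (Or.inl fun a ha h' => ?_)⟩
      have ha : 2 < max |a.2.1| ‖a.2.2‖ := ha
      exact absurd (max_lt h'.2.2.1 h'.2.2.2) ha.le.not_gt
  · refine ⟨{q | 0 < q.1}, (isOpen_lt (by fun_prop) (by fun_prop)).mem_nhds h,
      gate0_coc_of (Or.inl fun a ha h' => ?_)⟩
    have ha : 0 < a.1 := ha
    linarith [h'.2.1]

theorem isClosed_GB : IsClosed (GB m) := by
  have e : GB m = {p | |p.1| ≤ 2.95} ∩ ({p | |p.2.1| ≤ 2.95} ∩ {p | ‖p.2.2‖ ≤ 3.9}) := rfl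
  rw [e]
  exact (isClosed_le (by fun_prop) (by fun_prop)).inter ((isClosed_le (by fun_prop) (by fun_prop)).inter
    (isClosed_le (by fun_prop) (by fun_prop)))

theorem gt_locCoc {k : ℕ} (X : List Bool → G) {p : PP m} (hp : p ∉ KK m k) : LocCoc (gt k X) p := by
  induction k generalizing X p with
  | zero =>
    refine gate0_locCoc (X []) (fun h => hp ⟨[], rfl, h⟩)
  | succ k ih =>
    have h1 : hI 1 p ∉ KK m k := fun ⟨w, hw, h⟩ => hp ⟨false :: w, by simp [hw], h⟩
    have h2 : hI 2 p ∉ KK m k := fun ⟨w, hw, h⟩ => hp ⟨true :: w, by simp [hw], h⟩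
    have l1 := (ih (fun w => X (false :: w)) h1).comp (hI_cont 1).continuousAt
    have l2 := (ih (fun w => X (true :: w)) h2).comp (hI_cont 2).continuousAt
    by_cases hg : hI 1 p ∈ GB m
    · have hn : hI 2 p ∉ GB m := by
        have := hI_hm_notGB (i := 1) (j := 2) (by decide) (by decide) (by decide) hg
        rwa [hm_hI] at this
      obtain ⟨O, hO, h⟩ := l1
      refine ⟨O ∩ hI 2 ⁻¹' (GB m)ᶜ, inter_mem hO ((hI_cont 2).continuousAt
        (isClosed_GB.isOpen_compl.mem_nhds hn)), fun a ha b hb d hd => ?_⟩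
      simp only [gt]
      rw [gt_eq_one_left (a := hI 2 a) ha.2, gt_eq_one_left (a := hI 2 a) ha.2,
        gt_eq_one_left (a := hI 2 b) hb.2, mul_one, mul_one, mul_one]
      exact h a ha.1 b hb.1 d hd.1
    · obtain ⟨O, hO, h⟩ := l2
      refine ⟨O ∩ hI 1 ⁻¹' (GB m)ᶜ, inter_mem hO ((hI_cont 1).continuousAt
        (isClosed_GB.isOpen_compl.mem_nhds hg)), fun a ha b hb d hd => ?_⟩
      simp only [gt]
      rw [gt_eq_one_left (a := hI 1 a) ha.2, gt_eq_one_left (a := hI 1 a) ha.2,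
        gt_eq_one_left (a := hI 1 b) hb.2, one_mul, one_mul, one_mul]
      exact h a ha.1 b hb.1 d hd.1

/-- axis statement of level `k` -/
def AxisHol (G : Type*) [Group G] (m k : ℕ) : Prop := ∀ (X : List Bool → G) (u : ℝ → G),
  Pot (fun s t : ℝ => gt k X ((s, 0, 0) : PP m) ((t, 0, 0) : PP m)) (Icc (-3) 3) u →
    (u (-3))⁻¹ * u 3 = iterComm k X

theorem axisHol_zero : AxisHol G m 0 := by
  intro X u hu
  have h2 : Pot (fun s t : ℝ => gt 0 X ((s, 0, 0) : PP m) ((t, 0, 0) : PP m)) (Icc (-3) 3)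
      (fun t => if t < 0 then 1 else X []) := by
    refine ⟨1, one_pos, fun x _ y _ hxy => ?_⟩
    rw [Real.dist_eq, abs_lt] at hxy
    simp only [gt, gate0, gAm, gAp, mem_ofPred_eq]
    by_cases hx : x < 0 <;> by_cases hy : y < 0
    · simp [hx, hy, not_le.2 hx, not_le.2 hy]
    · push Not at hy
      have : -1 ≤ x := by linarith
      have : y ≤ 1 := by linarith
      simp [*, not_lt.2 hy]
    · push Not at hx
      have : -1 ≤ y := by linarith
      have : x ≤ 1 := by linarith
      simp [*, not_lt.2 hx]
    · push Not at hx hy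
      simp [*, not_lt.2 hx, not_lt.2 hy]
  rw [hu.unique isPreconnected_Icc h2 (by norm_num) (by norm_num)]
  norm_num [iterComm]

def chan (m : ℕ) : Set (PP m) := Icc (-3) 3 ×ˢ Icc (-1) 1 ×ˢ {0}

theorem chan_notU {p : PP m} (h : p ∈ chan m) : p ∉ UU m := by
  rintro ⟨_, _, _, h'⟩
  have h1 : |p.2.1| ≤ 1 := abs_le.2 h.2.1
  have h2 : p.2.2 = 0 := h.2.2
  rw [h2] at h'
  rcases h' with h' | h'
  · linarith
  · norm_num at h'

theorem piece {k : ℕ} (ih : AxisHol G m k) (X : List Bool → G) (q : ℝ → ℝ × ℝ) {s₁ s₂ : ℝ}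
    (hs : s₁ ≤ s₂) (hq : ContinuousOn q (Icc s₁ s₂))
    (hch : ∀ t ∈ Icc s₁ s₂, |(q t).1| ≤ 2.95 → |(q t).2| ≤ 1) (u : ℝ → G)
    (hu : Pot (fun s t : ℝ => gt k X (((q s).1, (q s).2, 0) : PP m) (((q t).1, (q t).2, 0) : PP m))
      (Icc s₁ s₂) u) :
    ((q s₁).1 ≤ -3 → 3 ≤ (q s₂).1 → (u s₁)⁻¹ * u s₂ = iterComm k X) ∧
    (3 ≤ (q s₁).1 → (q s₂).1 ≤ -3 → (u s₁)⁻¹ * u s₂ = (iterComm k X)⁻¹) := by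
  have hcc : IsCompact (chan m) := isCompact_Icc.prod (isCompact_Icc.prod isCompact_singleton)
  have hcv : Convex ℝ (chan m) := (convex_Icc _ _).prod ((convex_Icc _ _).prod (convex_singleton _))
  obtain ⟨V, hV⟩ := exists_pot (c := gt k X) hcc hcv
    (fun p hp => gt_locCoc X (fun h => chan_notU hp (KK_sub k h)))
  let κ : ℝ → PP m := fun t => (max (-3) (min 3 (q t).1), max (-1) (min 1 (q t).2), 0)
  have hκc : ContinuousOn κ (Icc s₁ s₂) := by
    have h1 := hq.fst
    have h2 := hq.snd
    exact ContinuousOn.prodMk (continuousOn_const.sup (continuousOn_const.inf h1))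
      (ContinuousOn.prodMk (continuousOn_const.sup (continuousOn_const.inf h2)) continuousOn_const)
  have hκm : MapsTo κ (Icc s₁ s₂) (chan m) := fun t _ =>
    ⟨⟨le_max_left _ _, max_le (by norm_num) (min_le_left _ _)⟩,
      ⟨le_max_left _ _, max_le (by norm_num) (min_le_left _ _)⟩, rfl⟩
  have hp := hV.comp hκc isCompact_Icc hκm
  have hfix : ∀ t ∈ Icc s₁ s₂, |(q t).1| ≤ 2.95 → κ t = ((q t).1, (q t).2, 0) := by
    intro t ht h
    have h2 := abs_le.1 (hch t ht h)
    have h1 := abs_le.1 h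
    simp only [κ]
    rw [min_eq_right (by linarith), max_eq_right (by linarith), min_eq_right (by linarith),
      max_eq_right (by linarith)]
  have hnot : ∀ t ∈ Icc s₁ s₂, ¬ |(q t).1| ≤ 2.95 → κ t ∉ GB m ∧
      (((q t).1, (q t).2, 0) : PP m) ∉ GB m := by
    intro t ht h
    refine ⟨fun hh => h ?_, fun hh => h hh.1⟩
    have h1 : |max (-3) (min 3 (q t).1)| ≤ 2.95 := hh.1
    rw [abs_le] at h1 ⊢
    rcases le_total (q t).1 3 with a | a
    · rw [min_eq_right a] at h1
      rcases le_total (-3) (q t).1 with b | b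
      · rwa [max_eq_right b] at h1
      · rw [max_eq_left b] at h1; norm_num at h1
    · rw [min_eq_left a] at h1; norm_num at h1
  have hpu : Pot (fun s t : ℝ => gt k X (((q s).1, (q s).2, 0) : PP m)
      (((q t).1, (q t).2, 0) : PP m)) (Icc s₁ s₂) (V ∘ κ) := by
    obtain ⟨δ, hδ, h⟩ := hp
    refine ⟨δ, hδ, fun x hx y hy hxy => ?_⟩
    rw [h x hx y hy hxy]
    congr 1
    dsimp only
    by_cases h1 : |(q x).1| ≤ 2.95
    · by_cases h2 : |(q y).1| ≤ 2.95
      · rw [hfix x hx h1, hfix y hy h2]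
      · rw [gt_eq_one_right (hnot y hy h2).1, gt_eq_one_right (hnot y hy h2).2]
    · rw [gt_eq_one_left (hnot x hx h1).1, gt_eq_one_left (hnot x hx h1).2]
  have hun := hu.unique isPreconnected_Icc hpu (left_mem_Icc.2 hs) (right_mem_Icc.2 hs)
  have hend : ∀ x ∈ ({-3, 3} : Set ℝ), ∀ y ∈ Icc (-1 : ℝ) 1, V (x, y, 0) = V (x, 0, 0) := by
    intro x hx y hy
    have hx' : x ∈ Icc (-3 : ℝ) 3 := by rcases hx with rfl | rfl <;> norm_num
    have hx2 : ¬ |x| ≤ 2.95 := by rcases hx with rfl | rfl <;> norm_num [abs_of_nonneg]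
    let T : Set (PP m) := {x} ×ˢ Icc (-1) 1 ×ˢ {0}
    have hT : T ⊆ chan m := by
      rintro p ⟨h1, h2, h3⟩
      have h1 : p.1 = x := h1
      exact ⟨h1 ▸ hx', h2, h3⟩
    have hTp : IsPreconnected T :=
      (((convex_singleton x).prod ((convex_Icc _ _).prod (convex_singleton _))) :
        Convex ℝ T).isPreconnected
    refine (hV.mono hT).const hTp ?_ ⟨rfl, hy, rfl⟩ ⟨rfl, by norm_num, rfl⟩
    intro a ha b hb
    refine gt_eq_one_left fun h => hx2 ?_
    have h1 : a.1 = x := ha.1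
    rw [← h1]; exact h.1
  have hax := ih X (fun t => V (t, 0, 0))
    (hV.comp (f := fun t : ℝ => ((t, 0, 0) : PP m)) (S := Icc (-3) 3) (by fun_prop) isCompact_Icc
      (fun t ht => ⟨ht, by norm_num, rfl⟩))
  have hkm : ∀ t, max (-1) (min 1 (q t).2) ∈ Icc (-1 : ℝ) 1 := fun t =>
    ⟨le_max_left _ _, max_le (by norm_num) (min_le_left _ _)⟩
  have hlow : ∀ t, (q t).1 ≤ -3 → V (κ t) = V (-3, 0, 0) := by
    intro t ht
    have : κ t = (-3, max (-1) (min 1 (q t).2), 0) := by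
      simp only [κ]; rw [min_eq_right (by linarith), max_eq_left ht]
    rw [this]; exact hend _ (by simp) _ (hkm t)
  have hhigh : ∀ t, 3 ≤ (q t).1 → V (κ t) = V (3, 0, 0) := by
    intro t ht
    have : κ t = (3, max (-1) (min 1 (q t).2), 0) := by
      simp only [κ]; rw [min_eq_left ht, max_eq_right (by norm_num)]
    rw [this]; exact hend _ (by simp) _ (hkm t)
  refine ⟨fun h1 h2 => ?_, fun h1 h2 => ?_⟩
  · rw [hun, Function.comp, Function.comp, hlow _ h1, hhigh _ h2]; exact hax
  · rw [hun, Function.comp, Function.comp, hlow _ h2, hhigh _ h1, ← hax]; group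

end
end BD

namespace BD
open Set Metric Filter Topology

noncomputable section

variable {m : ℕ} {G : Type*} [Group G]

def aphi (t : ℝ) : ℝ := 2 * Real.pi * bet (t ^ 2)

/-- preimage of axis point -/
def aq (e t : ℝ) : ℝ × ℝ := (10 * (t * Real.cos (aphi t)), (t * Real.sin (aphi t) - 2 * e) * (10 / 3))

theorem hI_axis {i : Fin 3} (hi : i ≠ 0) (t : ℝ) :
    hI i ((t, 0, 0) : PP m) = ((aq (sg i) t).1, (aq (sg i) t).2, 0) := by
  rw [hI, if_neg hi]
  have h : ang ((t, 0, 0) : PP m) = aphi t := by simp [ang, aphi]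
  refine Prod.ext ?_ (Prod.ext ?_ ?_)
  · simp [muI, tau, h, aq]
  · simp [muI, tau, h, aq]
  · funext j; simp [muI, tau]

theorem aphi_cont : Continuous aphi :=
  continuous_const.mul ((bet_contDiff (k := 1)).continuous.comp (continuous_pow 2))

theorem aq_cont (e : ℝ) : Continuous (aq e) := by
  have := aphi_cont
  unfold aq
  fun_prop

theorem aq_triv {i : Fin 3} {t : ℝ} (h : sg i * (t * Real.sin (aphi t)) ≤ 0) :
    (((aq (sg i) t).1, (aq (sg i) t).2, 0) : PP m) ∉ GB m := by
  intro h'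
  have h2 : |(aq (sg i) t).2| ≤ 2.95 := h'.2.1
  simp only [aq] at h2
  rw [abs_le] at h2
  rcases sg_cases i with e | e <;> rw [e] at h h2 <;> linarith

theorem aq_chan {i : Fin 3} {t : ℝ} (h : 0 ≤ sg i * (t * Real.sin (aphi t))) (ht : 3 ≤ t ^ 2)
    (hx : |(aq (sg i) t).1| ≤ 2.95) : |(aq (sg i) t).2| ≤ 1 := by
  simp only [aq] at hx ⊢
  have hid : (t * Real.cos (aphi t)) ^ 2 + (t * Real.sin (aphi t)) ^ 2 = t ^ 2 := by
    linear_combination t ^ 2 * Real.sin_sq_add_cos_sq (aphi t)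
  have h5 : t ^ 2 ≤ 5 := by
    by_contra hc
    push Not at hc
    have h0 : aphi t = 0 := by simp [aphi, bet_zero hc.le]
    rw [h0, Real.cos_zero, mul_one, abs_le] at hx
    nlinarith
  have h6 : (t * Real.cos (aphi t)) ^ 2 ≤ 0.09 := by
    rw [abs_le] at hx; nlinarith
  have hsq : (sg i * (t * Real.sin (aphi t))) ^ 2 = (t * Real.sin (aphi t)) ^ 2 := by
    rcases sg_cases i with e | e <;> rw [e] <;> ring
  set y := sg i * (t * Real.sin (aphi t)) with hy
  have h7 : 1.7 ≤ y := by nlinarith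
  have h8 : y ≤ 2.3 := by nlinarith [sq_nonneg (t * Real.cos (aphi t))]
  rw [abs_le]
  rcases sg_cases i with e | e <;> rw [e] at hy ⊢ <;> constructor <;> linarith

theorem sin_aphi_nonneg {t : ℝ} (h : bet (t ^ 2) ≤ 1 / 2) : 0 ≤ Real.sin (aphi t) :=
  Real.sin_nonneg_of_nonneg_of_le_pi (mul_nonneg (by positivity) (bet_nonneg _))
    (by unfold aphi; nlinarith [Real.pi_pos])

theorem sin_aphi_nonpos {t : ℝ} (h : 1 / 2 ≤ bet (t ^ 2)) : Real.sin (aphi t) ≤ 0 := by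
  have h1 : Real.sin (aphi t) = - Real.sin (aphi t - Real.pi) := by rw [Real.sin_sub_pi]; ring
  have h2 : 0 ≤ Real.sin (aphi t - Real.pi) :=
    Real.sin_nonneg_of_nonneg_of_le_pi (by unfold aphi; nlinarith [Real.pi_pos])
      (by unfold aphi; nlinarith [Real.pi_pos, bet_le_one (t ^ 2)])
  linarith

theorem sub_piece {k : ℕ} (X : List Bool → G) (u : ℝ → G) {s₁ s₂ : ℝ}
    (h₁ : -3 ≤ s₁) (h₂ : s₂ ≤ 3)
    (hu : Pot (fun s t : ℝ => gt (k + 1) X ((s, 0, 0) : PP m) ((t, 0, 0) : PP m)) (Icc (-3) 3) u)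
    (i : Bool) (htriv : ∀ t ∈ Icc s₁ s₂, sg (bi (!i)) * (t * Real.sin (aphi t)) ≤ 0) :
    Pot (fun s t : ℝ => gt k (fun w => X (i :: w))
      (((aq (sg (bi i)) s).1, (aq (sg (bi i)) s).2, 0) : PP m)
      (((aq (sg (bi i)) t).1, (aq (sg (bi i)) t).2, 0) : PP m)) (Icc s₁ s₂) u := by
  obtain ⟨δ, hδ, h⟩ := hu
  refine ⟨δ, hδ, fun x hx y hy hxy => ?_⟩
  rw [h x ⟨by linarith [hx.1], by linarith [hx.2]⟩ y ⟨by linarith [hy.1], by linarith [hy.2]⟩ hxy]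
  congr 1
  simp only [gt]
  rw [hI_axis (by decide), hI_axis (by decide), hI_axis (by decide), hI_axis (by decide)]
  have ht := aq_triv (m := m) (htriv x hx)
  cases i
  · change _ * gt k _ (((aq (sg (bi (!false))) x).1, (aq (sg (bi (!false))) x).2, 0)) _ = _
    rw [gt_eq_one_left ht, mul_one]; rfl
  · change gt k _ (((aq (sg (bi (!true))) x).1, (aq (sg (bi (!true))) x).2, 0)) _ * _ = _
    rw [gt_eq_one_left ht, one_mul]; rfl

theorem axisHol_succ {k : ℕ} (ih : AxisHol G m k) : AxisHol G m (k + 1) := by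
  intro X u hu
  have s2 : (0 : ℝ) < √3 := by positivity
  have s3 : √3 * √3 = 3 := Real.mul_self_sqrt (by norm_num)
  have s1 : √3 < 3 := by nlinarith
  have s5 : 1 < √3 := by nlinarith
  obtain ⟨t0, ht0, hb⟩ : ∃ t0 ∈ Icc (√3) 3, bet (t0 ^ 2) = 1 / 2 := by
    have hc : ContinuousOn (fun t : ℝ => bet (t ^ 2)) (Icc (√3) 3) :=
      ((bet_contDiff (k := 1)).continuous.comp (continuous_pow 2)).continuousOn
    have := intermediate_value_Icc' s1.le hc
    exact this ⟨by rw [bet_zero (by norm_num)]; norm_num,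
      by rw [bet_one (by nlinarith)]; norm_num⟩
  obtain ⟨ta, tb⟩ := ht0
  have hph : aphi t0 = Real.pi := by rw [aphi, hb]; ring
  have hphn : aphi (-t0) = Real.pi := by rw [aphi, neg_sq, hb]; ring
  have hp3 : aphi 3 = 0 := by rw [aphi, bet_zero (by norm_num)]; ring
  have hpn3 : aphi (-3) = 0 := by rw [aphi, bet_zero (by norm_num)]; ring
  have hps : aphi (√3) = 2 * Real.pi := by rw [aphi, bet_one (by nlinarith)]; ring
  have hpns : aphi (-√3) = 2 * Real.pi := by rw [aphi, bet_one (by nlinarith)]; ring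
  have hlo : ∀ t : ℝ, t0 ^ 2 ≤ t ^ 2 → 0 ≤ Real.sin (aphi t) := fun t ht =>
    sin_aphi_nonneg ((bet_anti ht).trans hb.le)
  have hhi : ∀ t : ℝ, t ^ 2 ≤ t0 ^ 2 → Real.sin (aphi t) ≤ 0 := fun t ht =>
    sin_aphi_nonpos (hb.ge.trans (bet_anti ht))
  have sg1 : sg (bi false) = 1 := by simp [sg, bi]
  have sg2 : sg (bi true) = -1 := by simp [sg, bi]
  set a := iterComm k (fun w => X (false :: w)) with ha
  set b := iterComm k (fun w => X (true :: w)) with hb'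
  -- piece 1
  have p1 : (u (-3))⁻¹ * u (-t0) = b := by
    have hsub := sub_piece X u (s₁ := -3) (s₂ := -t0) le_rfl (by linarith) hu true (by
      intro t ht
      have := hlo t (by nlinarith [ht.2])
      rw [Bool.not_true, sg1]; nlinarith [ht.2])
    refine (piece ih _ _ (by linarith) (aq_cont _).continuousOn (fun t ht => aq_chan ?_ ?_) u hsub).1 ?_ ?_
    · have := hlo t (by nlinarith [ht.2])
      rw [sg2]; nlinarith [ht.2]
    · nlinarith [ht.2]
    · simp only [aq, hpn3, Real.cos_zero]; norm_num
    · simp only [aq, hphn, Real.cos_pi]; linarith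
  have p2 : (u (-t0))⁻¹ * u (-√3) = a⁻¹ := by
    have hsub := sub_piece X u (s₁ := -t0) (s₂ := -√3) (by linarith) (by linarith) hu false (by
      intro t ht
      have := hhi t (by nlinarith [ht.1, ht.2])
      rw [Bool.not_false, sg2]; nlinarith [ht.2])
    refine (piece ih _ _ (by linarith) (aq_cont _).continuousOn (fun t ht => aq_chan ?_ ?_) u hsub).2 ?_ ?_
    · have := hhi t (by nlinarith [ht.1, ht.2])
      rw [sg1]; nlinarith [ht.2]
    · nlinarith [ht.2]
    · simp only [aq, hphn, Real.cos_pi]; linarith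
    · simp only [aq, hpns, Real.cos_two_pi]; linarith
  have p3 : u (-√3) = u (√3) := by
    have hsin : ∀ t ∈ Icc (-√3) √3, t * Real.sin (aphi t) = 0 := by
      intro t ht
      have : aphi t = 2 * Real.pi := by
        rw [aphi, bet_one (by nlinarith [ht.1, ht.2]), mul_one]
      rw [this, Real.sin_two_pi, mul_zero]
    have hsub := sub_piece X u (s₁ := -√3) (s₂ := √3) (by linarith) (by linarith) hu false (by
      intro t ht; rw [hsin t ht]; simp)
    refine hsub.const isPreconnected_Icc ?_ (left_mem_Icc.2 (by linarith)) (right_mem_Icc.2 (by linarith))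
    intro x hx y hy
    refine gt_eq_one_left (aq_triv ?_)
    rw [hsin x hx]; simp
  have p4 : (u (√3))⁻¹ * u t0 = b⁻¹ := by
    have hsub := sub_piece X u (s₁ := √3) (s₂ := t0) (by linarith) (by linarith) hu true (by
      intro t ht
      have := hhi t (by nlinarith [ht.1, ht.2])
      rw [Bool.not_true, sg1]; nlinarith [ht.1])
    refine (piece ih _ _ (by linarith) (aq_cont _).continuousOn (fun t ht => aq_chan ?_ ?_) u hsub).2 ?_ ?_
    · have := hhi t (by nlinarith [ht.1, ht.2])
      rw [sg2]; nlinarith [ht.1]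
    · nlinarith [ht.1]
    · simp only [aq, hps, Real.cos_two_pi]; linarith
    · simp only [aq, hph, Real.cos_pi]; linarith
  have p5 : (u t0)⁻¹ * u 3 = a := by
    have hsub := sub_piece X u (s₁ := t0) (s₂ := 3) (by linarith) le_rfl hu false (by
      intro t ht
      have := hlo t (by nlinarith [ht.1])
      rw [Bool.not_false, sg2]; nlinarith [ht.1])
    refine (piece ih _ _ (by linarith) (aq_cont _).continuousOn (fun t ht => aq_chan ?_ ?_) u hsub).1 ?_ ?_
    · have := hlo t (by nlinarith [ht.1])
      rw [sg1]; nlinarith [ht.1]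
    · nlinarith [ht.1]
    · simp only [aq, hph, Real.cos_pi]; linarith
    · simp only [aq, hp3, Real.cos_zero]; norm_num
  rw [iterComm, ← ha, ← hb', ← p2, ← p4, ← p5, ← p1, p3]
  group

theorem axisHol (k : ℕ) : AxisHol G m k := by
  induction k with
  | zero => exact axisHol_zero
  | succ k ih => exact axisHol_succ ih

end
end BD

namespace BD
open Set Metric Filter Topology MeasureTheory
open scoped ENNReal NNReal

noncomputable section

/-! ### Hausdorff measure wrappers -/
section HM
variable {X Y : Type} [MetricSpace X] [MetricSpace Y]

theorem hM_mono {d : ℝ} {s t : Set X} (h : s ⊆ t) : hausdorffM X d s ≤ hausdorffM X d t := by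
  unfold hausdorffM
  exact measure_mono h

theorem hM_image_le {d : ℝ} (hd : 0 ≤ d) {K : ℝ≥0} {f : X → Y} {s : Set X} (h : LipschitzOnWith K f s) :
    hausdorffM Y d (f '' s) ≤ (K : ℝ≥0∞) ^ d * hausdorffM X d s := by
  unfold hausdorffM
  let _ : MeasurableSpace X := borel X
  have _ : BorelSpace X := ⟨rfl⟩
  let _ : MeasurableSpace Y := borel Y
  have _ : BorelSpace Y := ⟨rfl⟩
  exact h.hausdorffMeasure_image_le hd

theorem hM_iUnion_le {d : ℝ} {ι : Type*} [Countable ι] (s : ι → Set X) :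
    hausdorffM X d (⋃ i, s i) ≤ ∑' i, hausdorffM X d (s i) := by
  unfold hausdorffM
  exact measure_iUnion_le s

theorem hM_union_le {d : ℝ} (s t : Set X) :
    hausdorffM X d (s ∪ t) ≤ hausdorffM X d s + hausdorffM X d t := by
  unfold hausdorffM
  exact measure_union_le s t

theorem hM_singleton {d : ℝ} (hd : 0 < d) (x : X) : hausdorffM X d {x} = 0 := by
  unfold hausdorffM
  let _ : MeasurableSpace X := borel X
  have _ : BorelSpace X := ⟨rfl⟩
  have := Measure.nullSingletonClass_hausdorff X hd
  exact measure_singleton x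

theorem hM_eq [i : MeasurableSpace X] [hB : BorelSpace X] (d : ℝ) (s : Set X) :
    hausdorffM X d s = Measure.hausdorffMeasure d s := by
  obtain ⟨h⟩ := hB
  subst h
  rfl

end HM

abbrev En (n : ℕ) := EuclideanSpace ℝ (Fin n)

theorem hM_pi (n : ℕ) (ρ : ℝ≥0) :
    hausdorffM (Fin n → ℝ) n (closedBall 0 ρ) = ENNReal.ofReal ((2 * ρ) ^ n) := by
  have := Real.volume_pi_closedBall (0 : Fin n → ℝ) (NNReal.coe_nonneg ρ)
  rw [← hausdorffMeasure_pi_real] at this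
  simp only [Fintype.card_fin] at this
  rw [← this, hM_eq]

theorem hE_upper (n : ℕ) : ∃ C : ℝ≥0, ∀ ρ : ℝ≥0,
    hausdorffM (En n) (n : ℝ) (closedBall 0 ρ) ≤ C * (ρ : ℝ≥0∞) ^ n := by
  set K : ℝ≥0 := ((Fintype.card (Fin n) : ℝ≥0) ^ (1 / (2 : ℝ≥0∞)).toReal)
  refine ⟨K ^ n * 2 ^ n, fun ρ => ?_⟩
  have h1 : LipschitzWith K (@WithLp.toLp 2 (Fin n → ℝ)) := PiLp.lipschitzWith_toLp 2 (fun _ : Fin n => ℝ)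
  have h2 : closedBall (0 : En n) ρ ⊆ WithLp.toLp 2 '' closedBall (0 : Fin n → ℝ) ρ := by
    intro x hx
    refine ⟨x.ofLp, ?_, rfl⟩
    have := (PiLp.lipschitzWith_ofLp 2 (fun _ : Fin n => ℝ)).dist_le_mul x 0
    simp only [mem_closedBall] at hx ⊢
    simp at this
    simpa using this.trans (by simpa using hx)
  refine (hM_mono h2).trans ((hM_image_le (by positivity) h1.lipschitzOnWith).trans ?_)
  have h3 := hM_pi n ρ
  rw [h3]
  rw [ENNReal.ofReal_pow (by positivity), ENNReal.ofReal_mul (by norm_num)]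
  simp only [ENNReal.ofReal_coe_nnreal, ENNReal.rpow_natCast, ENNReal.ofReal_ofNat]
  push_cast
  rw [mul_pow, mul_assoc]

theorem hE_lower (n : ℕ) : ∃ c : ℝ≥0, 0 < c ∧ ∀ ρ : ℝ≥0,
    c * (ρ : ℝ≥0∞) ^ n ≤ hausdorffM (En n) (n : ℝ) (closedBall 0 ρ) := by
  set K : ℝ≥0 := ((Fintype.card (Fin n) : ℝ≥0) ^ (1 / (2 : ℝ≥0∞)).toReal) + 1
  have hK : 0 < K := by positivity
  refine ⟨(2 / K) ^ n, by positivity, fun ρ => ?_⟩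
  have h1 : LipschitzWith 1 (@WithLp.ofLp 2 (Fin n → ℝ)) := PiLp.lipschitzWith_ofLp 2 (fun _ : Fin n => ℝ)
  have h2 : closedBall (0 : Fin n → ℝ) (ρ / K : ℝ≥0) ⊆ WithLp.ofLp '' closedBall (0 : En n) ρ := by
    intro x hx
    refine ⟨WithLp.toLp 2 x, ?_, rfl⟩
    have := (PiLp.lipschitzWith_toLp 2 (fun _ : Fin n => ℝ)).dist_le_mul x 0
    simp only [mem_closedBall] at hx ⊢
    rw [WithLp.toLp_zero] at this
    refine this.trans ?_
    calc _ ≤ (K : ℝ) * (ρ / K : ℝ≥0) := by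
          gcongr
          exact le_self_add
      _ = ρ := by
          push_cast
          have : (0 : ℝ) < K := hK
          field_simp
  have h3 := (hM_mono h2).trans (hM_image_le (d := n) (by positivity) h1.lipschitzOnWith)
  rw [hM_pi] at h3
  simp only [ENNReal.coe_one, ENNReal.one_rpow, one_mul] at h3
  refine le_trans (le_of_eq ?_) h3
  rw [← ENNReal.coe_pow, ← ENNReal.coe_mul, ← ENNReal.ofReal_coe_nnreal]
  congr 1
  push_cast
  rw [← mul_pow]
  ring

/-! ### The sphere -/
variable {n : ℕ}

instance factN (n : ℕ) : Fact (Module.finrank ℝ (En (n + 1)) = n + 1) := ⟨by simp⟩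

/-- inverse stereographic projection from v -/
def ster (v : EucSphere n) (a : En n) : EucSphere n := (stereographic' n v).symm a

theorem ster_inner (v : EucSphere n) (a b : En n) :
    inner ℝ (ster v a : En (n + 1)) (ster v b) * ((‖a‖ ^ 2 + 4) * (‖b‖ ^ 2 + 4)) =
      16 * inner ℝ a b + (‖a‖ ^ 2 - 4) * (‖b‖ ^ 2 - 4) := by
  have hv : inner ℝ (v : En (n + 1)) v = 1 := by
    rw [real_inner_self_eq_norm_sq, norm_eq_of_mem_sphere]; norm_num
  set U := (OrthonormalBasis.fromOrthogonalSpanSingleton (𝕜 := ℝ) n (ne_zero_of_mem_unit_sphere v)).repr with hU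
  have ha := stereographic'_symm_apply v a
  have hb := stereographic'_symm_apply v b
  simp only [← hU] at ha hb
  have e0 : ∀ x : En n, ‖((U.symm x : (ℝ ∙ (v : En (n + 1)))ᗮ) : En (n + 1))‖ = ‖x‖ := fun x => by
    rw [← Submodule.coe_norm, LinearIsometryEquiv.norm_map]
  have e1 : inner ℝ ((U.symm a : (ℝ ∙ (v : En (n + 1)))ᗮ) : En (n + 1)) (U.symm b : (ℝ ∙ (v : En (n + 1)))ᗮ) = inner ℝ a b := by
    rw [← Submodule.coe_inner, LinearIsometryEquiv.inner_map_map]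
  have e2 : ∀ x : En n, inner ℝ ((U.symm x : (ℝ ∙ (v : En (n + 1)))ᗮ) : En (n + 1)) (v : En (n + 1)) = 0 := fun x => by
    exact Submodule.inner_left_of_mem_orthogonal (Submodule.mem_span_singleton_self _) (U.symm x).2
  have e3 : ∀ x : En n, inner ℝ (v : En (n + 1)) ((U.symm x : (ℝ ∙ (v : En (n + 1)))ᗮ) : En (n + 1)) = 0 := fun x => by
    rw [real_inner_comm]; exact e2 x
  unfold ster
  rw [ha, hb]
  simp only [inner_add_left, inner_add_right, real_inner_smul_left, real_inner_smul_right, e0, e1, e2, e3, hv]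
  have p1 : (0 : ℝ) < ‖a‖ ^ 2 + 4 := by positivity
  have p2 : (0 : ℝ) < ‖b‖ ^ 2 + 4 := by positivity
  field_simp
  ring

theorem ster_dist (v : EucSphere n) (a b : En n) :
    dist (ster v a) (ster v b) ^ 2 * ((‖a‖ ^ 2 + 4) * (‖b‖ ^ 2 + 4)) = 16 * dist a b ^ 2 := by
  rw [Subtype.dist_eq, dist_eq_norm, dist_eq_norm, norm_sub_sq_real, norm_sub_sq_real,
    norm_eq_of_mem_sphere, norm_eq_of_mem_sphere]
  have := ster_inner v a b
  linear_combination (-2) * this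

theorem ster_lip (v : EucSphere n) (a b : En n) : dist (ster v a) (ster v b) ≤ dist a b := by
  have h := ster_dist v a b
  have h1 : 16 * dist (ster v a) (ster v b) ^ 2 ≤ 16 * dist a b ^ 2 := by
    rw [← h]
    have : (16 : ℝ) ≤ (‖a‖ ^ 2 + 4) * (‖b‖ ^ 2 + 4) := by nlinarith [sq_nonneg ‖a‖, sq_nonneg ‖b‖, mul_nonneg (sq_nonneg ‖a‖) (sq_nonneg ‖b‖)]
    nlinarith [sq_nonneg (dist (ster v a) (ster v b))]
  exact abs_le_of_sq_le_sq' (by linarith) dist_nonneg |>.2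

theorem ster_antilip (v : EucSphere n) {a b : En n} {R : ℝ} (ha : ‖a‖ ≤ R) (hb : ‖b‖ ≤ R) :
    dist a b ≤ (R ^ 2 + 4) / 4 * dist (ster v a) (ster v b) := by
  have h := ster_dist v a b
  have h1 : (‖a‖ ^ 2 + 4) * (‖b‖ ^ 2 + 4) ≤ (R ^ 2 + 4) ^ 2 := by
    rw [sq (R ^ 2 + 4)]
    gcongr
  refine (abs_le_of_sq_le_sq' ?_ (by positivity)).2
  rw [mul_pow, div_pow]
  nlinarith [sq_nonneg (dist (ster v a) (ster v b))]

theorem ster_ne (v : EucSphere n) (a : En n) : ster v a ≠ v := by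
  have := (stereographic' n v).map_target (x := a) (by simp)
  rw [stereographic'_source] at this
  exact this

theorem ster_right (v : EucSphere n) {p : EucSphere n} (h : p ≠ v) : ster v (stereographic' n v p) = p :=
  (stereographic' n v).left_inv (by simpa using h)

theorem ster_left (v : EucSphere n) (a : En n) : stereographic' n v (ster v a) = a :=
  (stereographic' n v).right_inv (by simp)

theorem ster_neg_zero (q : EucSphere n) : ster (-q) 0 = q := by
  set U := (OrthonormalBasis.fromOrthogonalSpanSingleton (𝕜 := ℝ) n (ne_zero_of_mem_unit_sphere (-q))).repr with hU
  have ha := stereographic'_symm_apply (-q) (0 : En n)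
  have h0 : U.symm 0 = 0 := map_zero _
  simp only [← hU, h0] at ha
  ext1
  unfold ster
  rw [ha]
  simp [smul_smul]

theorem ster_contDiff (v : EucSphere n) : ContDiff ℝ 1 (fun a => (ster v a : En (n + 1))) := by
  set U := (OrthonormalBasis.fromOrthogonalSpanSingleton (𝕜 := ℝ) n (ne_zero_of_mem_unit_sphere v)).repr with hU
  have : (fun a => (ster v a : En (n + 1))) = fun a => stereoInvFunAux (v : En (n + 1))
      ((ℝ ∙ (v : En (n + 1)))ᗮ.subtypeL (U.symm.toContinuousLinearEquiv.toContinuousLinearMap a)) := by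
    funext a
    unfold ster
    rw [stereographic'_symm_apply]
    simp only [← hU, stereoInvFunAux_apply, smul_add]
    rfl
  rw [this]
  exact contDiff_stereoInvFunAux.comp ((ContinuousLinearMap.contDiff _).comp (ContinuousLinearMap.contDiff _))

theorem dist_le_two (p q : EucSphere n) : dist p q ≤ 2 := by
  rw [Subtype.dist_eq, dist_eq_norm]
  refine (norm_sub_le _ _).trans ?_
  rw [norm_eq_of_mem_sphere, norm_eq_of_mem_sphere]; norm_num

theorem ster_cap (q : EucSphere n) (ρ : ℝ≥0) (hρ : ρ ≤ 1) :
    closedBall q ρ ⊆ ster (-q) '' closedBall 0 (2 * ρ : ℝ≥0) := by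
  intro p hp
  have hp' : dist p q ≤ ρ := hp
  have hr : (ρ : ℝ) ≤ 1 := hρ
  have h0 : p ≠ -q := by
    rintro rfl
    rw [Subtype.dist_eq, dist_eq_norm] at hp'
    have : ((-q : EucSphere n) : En (n + 1)) - q = (-2 : ℝ) • (q : En (n + 1)) := by
      rw [coe_neg_sphere]; module
    rw [this, norm_smul, norm_eq_of_mem_sphere] at hp'
    norm_num at hp'; linarith
  refine ⟨_, ?_, ster_right (-q) h0⟩
  set a := stereographic' n (-q) p
  have h := ster_dist (-q) a 0
  rw [ster_right _ h0, ster_neg_zero, dist_zero_right, norm_zero] at h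
  rw [mem_closedBall, dist_zero_right]
  push_cast
  refine (abs_le_of_sq_le_sq' ?_ (by positivity)).2
  have h5 : dist p q ^ 2 ≤ (ρ : ℝ) ^ 2 := by gcongr
  have h6 : (ρ : ℝ) ^ 2 ≤ 1 := by nlinarith [ρ.2]
  nlinarith [sq_nonneg ‖a‖, mul_le_mul_of_nonneg_right h5 (sq_nonneg ‖a‖), mul_le_mul_of_nonneg_right h6 (sq_nonneg ‖a‖)]

theorem hS_upper (n : ℕ) : ∃ C : ℝ≥0, ∀ (q : EucSphere n) (ρ : ℝ≥0),
    hausdorffM (EucSphere n) (n : ℝ) (closedBall q ρ) ≤ C * (ρ : ℝ≥0∞) ^ n := by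
  obtain ⟨C, hC⟩ := hE_upper n
  have hs : ∀ (q : EucSphere n) (ρ : ℝ≥0), ρ ≤ 1 →
      hausdorffM (EucSphere n) (n : ℝ) (closedBall q ρ) ≤ (C * 2 ^ n : ℝ≥0) * (ρ : ℝ≥0∞) ^ n := by
    intro q ρ hρ
    refine (hM_mono (ster_cap q ρ hρ)).trans ?_
    refine (hM_image_le (K := 1) (by positivity) (f := ster (-q)) (LipschitzWith.lipschitzOnWith (LipschitzWith.of_dist_le_mul
      (fun a b => by simpa using ster_lip (-q) a b)))).trans ?_
    refine le_trans (by simpa using hC (2 * ρ)) ?_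
    push_cast
    rw [mul_pow, mul_assoc]
  obtain ⟨t, -, ht⟩ := (isCompact_univ : IsCompact (univ : Set (EucSphere n))).elim_finite_subcover_image (b := univ)
      (c := fun q : EucSphere n => ball q 1) (fun _ _ => isOpen_ball) (by
        intro x _; exact mem_biUnion (mem_univ x) (mem_ball_self one_pos))
  obtain ⟨htf, htc⟩ := ht
  set N := htf.toFinset.card
  refine ⟨(N + 1) * (C * 2 ^ n), fun q ρ => ?_⟩
  rcases le_total ρ 1 with h | h
  · refine (hs q ρ h).trans ?_
    have h7 : (C * 2 ^ n : ℝ≥0) ≤ (N + 1) * (C * 2 ^ n) := by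
      rw [add_mul, one_mul]; exact le_add_self
    exact mul_le_mul_left (ENNReal.coe_le_coe.2 h7) _
  · have h1 : hausdorffM (EucSphere n) (n : ℝ) (closedBall q ρ) ≤
        ∑ p ∈ htf.toFinset, hausdorffM (EucSphere n) (n : ℝ) (closedBall p (1 : ℝ≥0)) := by
      unfold hausdorffM
      refine le_trans (measure_mono ?_) (measure_biUnion_finset_le _ _)
      intro x _
      have := htc (mem_univ x)
      simp only [mem_iUnion] at this ⊢
      obtain ⟨p, hp, hx⟩ := this
      exact ⟨p, by simpa using hp, ball_subset_closedBall (by simpa using hx)⟩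
    refine h1.trans ((Finset.sum_le_card_nsmul _ _ ((C * 2 ^ n : ℝ≥0) : ℝ≥0∞) ?_).trans ?_)
    · intro p _
      simpa using hs p 1 le_rfl
    · have h2 : (1 : ℝ≥0∞) ≤ (ρ : ℝ≥0∞) ^ n := one_le_pow₀ (by exact_mod_cast h)
      calc _ = ((N * (C * 2 ^ n) : ℝ≥0) : ℝ≥0∞) * 1 := by simp [N]
        _ ≤ _ := by
          gcongr
          exact le_self_add

theorem hS_lower (n : ℕ) : ∃ c : ℝ≥0, 0 < c ∧ ∀ (q : EucSphere n) (ρ : ℝ≥0), ρ ≤ 2 →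
    c * (ρ : ℝ≥0∞) ^ n ≤ hausdorffM (EucSphere n) (n : ℝ) (closedBall q ρ) := by
  obtain ⟨c, hc0, hc⟩ := hE_lower n
  refine ⟨c / 2 ^ n, by positivity, fun q ρ hρ => ?_⟩
  have h1 : ster (-q) '' closedBall 0 ρ ⊆ closedBall q ρ := by
    rintro _ ⟨a, ha, rfl⟩
    have := ster_lip (-q) a 0
    rw [ster_neg_zero] at this
    exact this.trans ha
  have h2 : LipschitzOnWith 2 (stereographic' n (-q)) (ster (-q) '' closedBall 0 ρ) := by
    refine LipschitzOnWith.of_dist_le_mul ?_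
    rintro _ ⟨a, ha, rfl⟩ _ ⟨b, hb, rfl⟩
    rw [ster_left, ster_left]
    have hr : (ρ : ℝ) ≤ 2 := hρ
    have := ster_antilip (-q) (a := a) (b := b) (R := 2) (by simpa using le_trans (by simpa using ha) hr)
      (by simpa using le_trans (by simpa using hb) hr)
    norm_num at this
    simpa using this
  have h3 := hM_image_le (d := n) (by positivity) h2
  have h4 : stereographic' n (-q) '' (ster (-q) '' closedBall 0 ρ) = closedBall 0 ρ := by
    rw [← image_comp]
    convert image_id _
    ext1 a
    exact ster_left _ _
  rw [h4] at h3
  have h5 := (hc ρ).trans (h3.trans (mul_le_mul_right (hM_mono h1) _))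
  rw [ENNReal.rpow_natCast] at h5
  rw [ENNReal.coe_div (by positivity), ENNReal.div_eq_inv_mul, mul_assoc]
  refine (mul_le_mul_right h5 _).trans (le_of_eq ?_)
  rw [← mul_assoc, ENNReal.coe_pow, ENNReal.inv_mul_cancel (by simp) (by simp), one_mul]

end
end BD

namespace BD
open Set Metric Filter Topology MeasureTheory
open scoped ENNReal NNReal

noncomputable section

variable {m : ℕ}

abbrev SS (m : ℕ) := EucSphere (m + 2)

def Np (m : ℕ) : SS m := ⟨EuclideanSpace.single 0 1, by simp⟩

def Lc (m : ℕ) : En (m + 2) ≃L[ℝ] PP m := ContinuousLinearEquiv.ofFinrankEq (by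
  simp [PP]; omega)

def io (b : PP m) : SS m := ster (Np m) ((Lc m).symm b)
def jo (p : SS m) : PP m := Lc m (stereographic' (m + 2) (Np m) p)

theorem io_ne (b : PP m) : io b ≠ Np m := ster_ne _ _
theorem jo_io (b : PP m) : jo (io b) = b := by
  unfold jo io; rw [ster_left]; simp
theorem io_jo {p : SS m} (h : p ≠ Np m) : io (jo p) = p := by
  unfold jo io; simp [ster_right _ h]
theorem io_inj {a b : PP m} (h : io a = io b) : a = b := by rw [← jo_io a, h, jo_io]

theorem io_contDiff : ContDiff ℝ 1 (fun b : PP m => (io b : En (m + 2 + 1))) :=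
  (ster_contDiff (Np m)).comp (Lc m).symm.contDiff

theorem io_cont : Continuous (io : PP m → SS m) :=
  Continuous.subtype_mk (io_contDiff.continuous) _

theorem jo_contAt {p : SS m} (h : p ≠ Np m) : ContinuousAt jo p :=
  (Lc m).continuous.continuousAt.comp ((stereographic' (m + 2) (Np m)).continuousAt (by simpa using h))

theorem io_lip (m : ℕ) : ∃ K : ℝ≥0, LipschitzWith K (io : PP m → SS m) := by
  refine ⟨_, (LipschitzWith.of_dist_le_mul (K := 1) (fun a b => ?_)).comp (Lc m).symm.lipschitz⟩
  simpa using ster_lip (Np m) a b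

theorem jo_locLip {p : SS m} (h : p ≠ Np m) : ∃ K : ℝ≥0, ∃ t ∈ 𝓝 p, LipschitzOnWith K jo t := by
  set st := stereographic' (m + 2) (Np m) with hst
  have hc : ContinuousAt st p := st.continuousAt (by simpa [hst] using h)
  set R : ℝ := ‖st p‖ + 1
  have h1 : ∀ᶠ x in 𝓝 p, ‖st x‖ < R := hc.norm.eventually_lt_const (by simp [R])
  have h2 : ∀ᶠ x in 𝓝 p, x ≠ Np m := isOpen_ne.mem_nhds h
  have hl : LipschitzOnWith (Real.toNNReal ((R ^ 2 + 4) / 4)) st {x | ‖st x‖ < R ∧ x ≠ Np m} := by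
    refine LipschitzOnWith.of_dist_le_mul fun x hx y hy => ?_
    have := ster_antilip (Np m) (a := st x) (b := st y) hx.1.le hy.1.le
    rw [ster_right _ hx.2, ster_right _ hy.2] at this
    rw [Real.coe_toNNReal _ (by positivity)]
    exact this
  exact ⟨_, _, h1.and h2, (Lc m).lipschitz.comp_lipschitzOnWith hl⟩

/-- extension by zero to the sphere -/
def liftS {W : Type*} [Zero W] (g : PP m → W) (p : SS m) : W := open Classical in if p = Np m then 0 else g (jo p)

theorem liftS_io {W : Type*} [Zero W] (g : PP m → W) (b : PP m) : liftS g (io b) = g b := by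
  rw [liftS, if_neg (io_ne b), jo_io]

theorem locLip_comp_jo {W : Type*} [NormedAddCommGroup W] [NormedSpace ℝ W] {g : PP m → W} (hg : ContDiff ℝ 1 g)
    {p : SS m} (h : p ≠ Np m) : ∃ K : ℝ≥0, ∃ t ∈ 𝓝 p, LipschitzOnWith K (fun x => g (jo x)) t := by
  obtain ⟨K1, t1, ht1, h1⟩ := jo_locLip h
  obtain ⟨K2, t2, ht2, h2⟩ := hg.locallyLipschitz (jo p)
  refine ⟨K2 * K1, t1 ∩ jo ⁻¹' t2, inter_mem ht1 ((jo_contAt h).preimage_mem_nhds ht2), ?_⟩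
  exact h2.comp (h1.mono inter_subset_left) (fun x hx => hx.2)

theorem liftS_lip {W : Type*} [NormedAddCommGroup W] [NormedSpace ℝ W] {g : PP m → W} (hg : ContDiff ℝ 1 g)
    (hs : HasCompactSupport g) : ∃ K : ℝ≥0, LipschitzWith K (liftS g) := by
  have h : LocallyLipschitz (liftS g) := by
    intro p
    by_cases hp : p = Np m
    · refine ⟨0, (io '' tsupport g)ᶜ, ?_, ?_⟩
      · refine (hs.isCompact.image io_cont).isClosed.isOpen_compl.mem_nhds ?_
        rintro ⟨b, -, hb⟩
        exact io_ne b (hb.trans hp)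
      · have hz : ∀ x ∈ (io '' tsupport g)ᶜ, liftS g x = 0 := by
          intro x hx
          unfold liftS
          split_ifs with h
          · rfl
          · by_contra h0
            exact hx ⟨jo x, subset_tsupport _ h0, io_jo h⟩
        intro x hx y hy
        rw [hz x hx, hz y hy]; simp
    · obtain ⟨K, t, ht, h⟩ := locLip_comp_jo hg hp
      refine ⟨K, t ∩ {Np m}ᶜ, inter_mem ht (isOpen_ne.mem_nhds hp), ?_⟩
      intro x hx y hy
      have := h hx.1 hy.1
      have hx2 : x ≠ Np m := hx.2
      have hy2 : y ≠ Np m := hy.2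
      rwa [liftS, liftS, if_neg hx2, if_neg hy2]
  obtain ⟨K, hK⟩ := LocallyLipschitzOn.exists_lipschitzOnWith_of_compact (s := univ) isCompact_univ h.locallyLipschitzOn
  exact ⟨K, lipschitzOnWith_univ.1 hK⟩

/-! ### cutoff -/

def NK (m : ℕ) : Set (PP m) := {p | |p.1| ≤ 1 / 2 ∧ 3 / 2 ≤ max |p.2.1| ‖p.2.2‖ ∧ max |p.2.1| ‖p.2.2‖ ≤ 5 / 2}

theorem NK_sub : NK m ⊆ UU m := by
  rintro p ⟨h1, h2, h3⟩
  obtain ⟨h4, h5⟩ := max_le_iff.1 h3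
  refine ⟨by linarith, by linarith, by linarith, ?_⟩
  rcases le_max_iff.1 h2 with h | h
  · left; linarith
  · right; linarith

theorem isClosed_NK : IsClosed (NK m) := by
  have h1 : Continuous fun p : PP m => |p.1| := by fun_prop
  have h2 : Continuous fun p : PP m => max |p.2.1| ‖p.2.2‖ := by fun_prop
  exact (isClosed_le h1 continuous_const).inter ((isClosed_le continuous_const h2).inter (isClosed_le h2 continuous_const))

def UP (m : ℕ) : Set (PP m) := ((⋃ i : Fin 3, hm i '' UB m) ∪ NK m) ∪ hm 0 '' closedBall 0 8

theorem isClosed_UP : IsClosed (UP m) := by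
  refine IsClosed.union (IsClosed.union ?_ isClosed_NK) ?_
  · exact isClosed_iUnion_of_finite fun i => (isCompact_UB.image (hm_cont i)).isClosed
  · exact ((isCompact_closedBall 0 8).image (hm_cont 0)).isClosed

theorem UP_sub : UP m ⊆ UU m := by
  rintro p ((h | h) | ⟨q, hq, rfl⟩)
  · obtain ⟨i, q, hq, rfl⟩ := mem_iUnion.1 h
    exact hm_maps i hq
  · exact NK_sub h
  · exact hm_zero_UU (by simpa using hq)

theorem exists_omg (m : ℕ) : ∃ f : PP m → ℝ, ContDiff ℝ 1 f ∧ (∀ x, 0 ≤ f x) ∧ (∀ x, f x ≤ 1) ∧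
    (∀ x, f x ≠ 0 ↔ x ∈ UU m) ∧ (∀ x ∈ UP m, f x = 1) := by
  obtain ⟨f, h1, h2, h3, h4⟩ := exists_contMDiff_zero_iff_one_iff_of_isClosed (n := 1) (modelWithCornersSelf ℝ (PP m)) (M := PP m)
    (s := (UU m)ᶜ) (t := UP m) isOpen_UU.isClosed_compl isClosed_UP
    (disjoint_left.2 fun x hx hx' => hx (UP_sub hx'))
  refine ⟨f, by simpa using h1.contDiff, fun x => (h2 (mem_range_self x)).1, fun x => (h2 (mem_range_self x)).2, fun x => ?_,
    fun x hx => (h4 x).1 hx⟩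
  rw [Ne, ← h3 x]; simp

def omg (m : ℕ) : PP m → ℝ := Classical.choose (exists_omg m)
theorem omg_contDiff : ContDiff ℝ 1 (omg m) := (Classical.choose_spec (exists_omg m)).1
theorem omg_nonneg (x : PP m) : 0 ≤ omg m x := (Classical.choose_spec (exists_omg m)).2.1 x
theorem omg_le_one (x : PP m) : omg m x ≤ 1 := (Classical.choose_spec (exists_omg m)).2.2.1 x
theorem omg_ne {x : PP m} : omg m x ≠ 0 ↔ x ∈ UU m := (Classical.choose_spec (exists_omg m)).2.2.2.1 x
theorem omg_one {x : PP m} (h : x ∈ UP m) : omg m x = 1 := (Classical.choose_spec (exists_omg m)).2.2.2.2 x h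
theorem omg_supp : HasCompactSupport (omg m) := by
  refine HasCompactSupport.of_support_subset_isCompact isCompact_UB fun x hx => UU_sub_UB (omg_ne.1 hx)

theorem omg_half (m : ℕ) : ∃ b : PP m, omg m b = 1 / 2 := by
  have h1 : ∃ b : PP m, omg m b = 1 := ⟨hm 0 0, omg_one (Or.inr ⟨0, by simp, rfl⟩)⟩
  have h0 : ∃ b : PP m, omg m b = 0 := ⟨0, by
    by_contra h
    have := omg_ne.1 h
    rcases this.2.2.2 with h | h <;> norm_num at h⟩
  obtain ⟨b1, h1⟩ := h1
  obtain ⟨b0, h0⟩ := h0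
  exact mem_range_of_exists_le_of_exists_ge omg_contDiff.continuous ⟨b0, by rw [h0]; norm_num⟩ ⟨b1, by rw [h1]; norm_num⟩

/-! ### tree -/

abbrev Wd := List (Fin 3)

def Inn (w : Wd) : Prop := ∃ (j : ℕ) (v : Wd), w = List.replicate j 0 ++ v ∧ (∀ i ∈ v, i ≠ 0) ∧ (v.length < j ∨ v = [])

def Prs (w : Wd) : Prop := ∀ v i, w = v ++ [i] → Inn v

theorem Inn.prs {w : Wd} (h : Inn w) : Prs w := by
  rintro v i rfl
  obtain ⟨j, u, h1, h2, h3⟩ := h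
  rcases List.eq_nil_or_concat u with rfl | ⟨u', k, rfl⟩
  · rw [List.append_nil] at h1
    rcases j with _ | j
    · simp at h1
    · rw [List.replicate_succ'] at h1
      obtain ⟨rfl, -⟩ := List.append_inj' h1 rfl
      exact ⟨j, [], by simp, by simp, Or.inr rfl⟩
  · rw [List.concat_eq_append, ← List.append_assoc] at h1
    obtain ⟨rfl, -⟩ := List.append_inj' h1 rfl
    refine ⟨j, u', rfl, fun i hi => h2 i (by simp [hi]), ?_⟩
    rcases h3 with h3 | h3
    · left; simp at h3; omega
    · simp at h3

theorem prs_child {w : Wd} {i : Fin 3} : Prs (w ++ [i]) ↔ Inn w := by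
  constructor
  · intro h; exact h w i rfl
  · intro h v j hv
    obtain ⟨rfl, -⟩ := List.append_inj' hv rfl
    exact h

open Classical in
def aw (w : Wd) (p : SS m) : ℝ :=
  if w = [] then 1 else if Prs w ∧ p ≠ Np m then omg m (hwI w (jo p)) else 0

theorem aw_nil (p : SS m) : aw [] p = 1 := by simp [aw]

theorem aw_nonneg (w : Wd) (p : SS m) : 0 ≤ aw w p := by
  unfold aw; split_ifs
  · norm_num
  · exact omg_nonneg _
  · exact le_rfl

theorem aw_le_one (w : Wd) (p : SS m) : aw w p ≤ 1 := by
  unfold aw; split_ifs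
  · norm_num
  · exact omg_le_one _
  · norm_num

theorem aw_ne {w : Wd} (hw : w ≠ []) {p : SS m} :
    aw w p ≠ 0 ↔ Prs w ∧ p ≠ Np m ∧ hwI w (jo p) ∈ UU m := by
  unfold aw; rw [if_neg hw]
  split_ifs with h
  · rw [omg_ne]; tauto
  · simp only [ne_eq, not_true_eq_false, false_iff]; tauto

theorem aw_eq {w : Wd} (hw : w ≠ []) (hp : Prs w) {p : SS m} (h : p ≠ Np m) :
    aw w p = omg m (hwI w (jo p)) := by
  unfold aw; rw [if_neg hw, if_pos ⟨hp, h⟩]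

theorem aw_absent {w : Wd} (hw : w ≠ []) (hp : ¬ Prs w) (p : SS m) : aw w p = 0 := by
  unfold aw; rw [if_neg hw, if_neg (by tauto)]

theorem hwI_snoc (w : Wd) (i : Fin 3) (b : PP m) : hwI (w ++ [i]) b = hI i (hwI w b) := by
  rw [hwI_append]; rfl
theorem hw_snoc (w : Wd) (i : Fin 3) (b : PP m) : hw (w ++ [i]) b = hw w (hm i b) := by
  rw [hw_append]; rfl

theorem snoc_ne (w : Wd) (i : Fin 3) : w ++ [i] ≠ [] := by simp

theorem aw_parent {w : Wd} {i : Fin 3} {p : SS m} (h : aw (w ++ [i]) p ≠ 0) : aw w p = 1 := by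
  by_cases hw : w = []
  · subst hw; exact aw_nil p
  · obtain ⟨h1, h2, h3⟩ := (aw_ne (snoc_ne w i)).1 h
    rw [aw_eq hw (prs_child.1 h1).prs h2]
    apply omg_one
    refine Or.inl (Or.inl (mem_iUnion.2 ⟨i, hI i (hwI w (jo p)), UU_sub_UB ?_, hm_hI _ _⟩))
    rwa [hwI_snoc] at h3

theorem aw_sib {w : Wd} {i j : Fin 3} (hij : i ≠ j) {p : SS m} (h : aw (w ++ [i]) p ≠ 0) : aw (w ++ [j]) p = 0 := by
  by_contra h'
  obtain ⟨h1, h2, h3⟩ := (aw_ne (snoc_ne w i)).1 h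
  obtain ⟨-, -, h4⟩ := (aw_ne (snoc_ne w j)).1 h'
  rw [hwI_snoc] at h3 h4
  exact hm_disj hij (UU_sub_UB h3) (UU_sub_UB h4) (by rw [hm_hI, hm_hI])

theorem aw_app_one {w v : Wd} (hv : v ≠ []) {p : SS m} (h : aw (w ++ v) p ≠ 0) : aw w p = 1 := by
  induction v using List.reverseRecOn with
  | nil => exact absurd rfl hv
  | append_singleton v i ih =>
    rw [← List.append_assoc] at h
    have := aw_parent h
    by_cases h0 : v = []
    · subst h0; simpa using this
    · exact ih h0 (by rw [this]; norm_num)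

theorem aw_unique {w w' : Wd} (hl : w.length = w'.length) {p : SS m} (h : aw w p ≠ 0) (h' : aw w' p ≠ 0) : w = w' := by
  induction w using List.reverseRecOn generalizing w' with
  | nil => simpa using (List.length_eq_zero_iff.1 hl.symm).symm
  | append_singleton v i ih =>
    rcases List.eq_nil_or_concat w' with rfl | ⟨v', j, rfl⟩
    · simp at hl
    · rw [List.concat_eq_append] at *
      have := ih (w' := v') (by simpa using hl) (by rw [aw_parent h]; norm_num) (by rw [aw_parent h']; norm_num)
      subst this
      by_cases hij : i = j
      · rw [hij]
      · exact absurd (aw_sib hij h) h'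

theorem aw_chain {w w' : Wd} (hl : w.length ≤ w'.length) {p : SS m} (h : aw w p ≠ 0) (h' : aw w' p ≠ 0) : w <+: w' := by
  have h1 : w' = w'.take w.length ++ w'.drop w.length := (List.take_append_drop _ _).symm
  have h2 : aw (w'.take w.length) p ≠ 0 := by
    by_cases h0 : w'.drop w.length = []
    · rw [h0, List.append_nil] at h1; rwa [← h1]
    · rw [h1] at h'
      rw [aw_app_one h0 h']; norm_num
  have := aw_unique (by simp [hl]) h h2
  exact ⟨w'.drop w.length, by conv_rhs => rw [h1, ← this]⟩

def th (w : Wd) (p : SS m) : ℝ := aw w p * (1 - ∑ i, aw (w ++ [i]) p)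

theorem sum_child {w : Wd} {p : SS m} {i : Fin 3} (h : aw (w ++ [i]) p ≠ 0) : ∑ j, aw (w ++ [j]) p = aw (w ++ [i]) p :=
  Finset.sum_eq_single i (fun j _ hj => aw_sib (Ne.symm hj) h) (by simp)

theorem sum_child_le {w : Wd} {p : SS m} {c : ℝ} (hc : 0 ≤ c) (h : ∀ i, aw (w ++ [i]) p ≤ c) : ∑ j, aw (w ++ [j]) p ≤ c := by
  by_cases h0 : ∃ i, aw (w ++ [i]) p ≠ 0
  · obtain ⟨i, hi⟩ := h0
    rw [sum_child hi]; exact h i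
  · push Not at h0
    simp [h0, hc]

theorem th_nonneg (w : Wd) (p : SS m) : 0 ≤ th w p :=
  mul_nonneg (aw_nonneg _ _) (by linarith [sum_child_le (m := m) zero_le_one (fun i => aw_le_one (w ++ [i]) p)])

theorem sum_child_nonneg (w : Wd) (p : SS m) : 0 ≤ ∑ j, aw (w ++ [j]) p := Finset.sum_nonneg fun _ _ => aw_nonneg _ _

theorem th_le (w : Wd) (p : SS m) : th w p ≤ aw w p := by
  have := aw_nonneg w p
  have := sum_child_nonneg w p
  unfold th; nlinarith

theorem th_zero {w : Wd} {p : SS m} (h : aw w p = 0) : th w p = 0 := by simp [th, h]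
theorem th_full {w : Wd} {i : Fin 3} {p : SS m} (h : aw (w ++ [i]) p ≠ 0) : th w p = 1 - aw (w ++ [i]) p := by
  rw [th, sum_child h, aw_parent h, one_mul]
theorem th_leaf {w : Wd} {p : SS m} (h : ∀ i, aw (w ++ [i]) p = 0) : th w p = aw w p := by simp [th, h]

/-- (E5) -/
theorem home_or_full (p : SS m) (L : ℕ) : (∃ w : Wd, w.length = L ∧ aw w p = 1) ∨
    ∃ v : Wd, v.length ≤ L ∧ 1 / 2 ≤ th v p := by
  induction L with
  | zero => exact Or.inl ⟨[], rfl, aw_nil p⟩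
  | succ L ih =>
    rcases ih with ⟨w, hw, h1⟩ | ⟨v, hv, h⟩
    · by_cases h2 : ∃ i, aw (w ++ [i]) p = 1
      · obtain ⟨i, hi⟩ := h2
        exact Or.inl ⟨w ++ [i], by simp [hw], hi⟩
      · right
        push Not at h2
        by_cases h3 : ∃ i, 1 / 2 ≤ aw (w ++ [i]) p
        · obtain ⟨i, hi⟩ := h3
          refine ⟨w ++ [i], by simp [hw], ?_⟩
          rw [th_leaf]
          · exact hi
          · intro j
            by_contra hj
            exact h2 i (aw_parent hj)
        · push Not at h3
          refine ⟨w, by omega, ?_⟩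
          rw [th, h1]
          have := sum_child_le (p := p) (w := w) (c := 1 / 2) (by norm_num) (fun i => (h3 i).le)
          linarith
    · exact Or.inr ⟨v, by omega, h⟩

end
end BD

namespace BD
open Set Metric Filter Topology MeasureTheory
open scoped ENNReal NNReal

noncomputable section

variable {m : ℕ}

def sc (w : Wd) : ℝ := (1 / 2) ^ w.length
theorem sc_pos (w : Wd) : 0 < sc w := by unfold sc; positivity
theorem sc_snoc (w : Wd) (i : Fin 3) : sc (w ++ [i]) = sc w / 2 := by
  simp [sc, pow_succ]; ring

open Classical in
/-- inverse of the model map on the sphere -/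
def hS (w : Wd) (p : SS m) : SS m := if p = Np m then Np m else io (hwI w (jo p))

theorem hS_of {w : Wd} {p : SS m} (h : p ≠ Np m) : hS w p = io (hwI w (jo p)) := by rw [hS, if_neg h]
theorem hS_nil (p : SS m) : hS [] p = p := by
  unfold hS; split_ifs with h
  · exact h.symm
  · exact io_jo h
theorem hS_io (w : Wd) (b : PP m) : hS w (io (hw w b)) = io b := by
  rw [hS_of (io_ne _), jo_io, hwI_hw]
theorem hS_ne {w : Wd} {p : SS m} (h : p ≠ Np m) : hS w p ≠ Np m := by
  rw [hS_of h]; exact io_ne _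
theorem jo_hS {w : Wd} {p : SS m} (h : p ≠ Np m) : jo (hS w p) = hwI w (jo p) := by
  rw [hS_of h, jo_io]
theorem hS_inj {w : Wd} {p p' : SS m} (h : hS w p = hS w p') : p = p' := by
  by_cases h1 : p = Np m
  · by_cases h2 : p' = Np m
    · rw [h1, h2]
    · rw [h1] at h
      have : hS w (Np m) = Np m := by simp [hS]
      rw [this] at h
      exact absurd h.symm (hS_ne h2)
  · by_cases h2 : p' = Np m
    · rw [h2] at h
      have : hS w (Np m) = Np m := by simp [hS]
      rw [this] at h
      exact absurd h (hS_ne h1)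
    · rw [hS_of h1, hS_of h2] at h
      have h3 := congrArg (hw w) (io_inj h)
      rw [hw_hwI, hw_hwI] at h3
      rw [← io_jo h1, ← io_jo h2, h3]

abbrev Vv (m : ℕ) := En (m + 2 + 1)

def sl (i : Bool × Wd) (p : SS m) : Vv m :=
  if i.1 then (2 * sc i.2 * aw i.2 p) • (Np m : Vv m) else (sc i.2 * th i.2 p) • (hS i.2 p : Vv m)

theorem sl_true (w : Wd) (p : SS m) : sl (true, w) p = (2 * sc w * aw w p) • (Np m : Vv m) := by simp [sl]
theorem sl_false (w : Wd) (p : SS m) : sl (false, w) p = (sc w * th w p) • (hS w p : Vv m) := by simp [sl]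

theorem norm_SS (p : SS m) : ‖(p : Vv m)‖ = 1 := norm_eq_of_mem_sphere p

theorem th_le_one (w : Wd) (p : SS m) : th w p ≤ 1 := (th_le w p).trans (aw_le_one w p)

theorem sl_norm_le (i : Bool × Wd) (p : SS m) : ‖sl i p‖ ≤ 2 * sc i.2 := by
  obtain ⟨b, w⟩ := i
  have h0 := sc_pos w
  have h1 := aw_nonneg w p
  have h2 := aw_le_one w p
  have h3 := th_nonneg w p
  have h4 := th_le_one w p
  cases b
  · rw [sl_false, norm_smul, norm_SS, Real.norm_of_nonneg (by positivity)]
    simp only; nlinarith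
  · rw [sl_true, norm_smul, norm_SS, Real.norm_of_nonneg (by positivity)]
    simp only; nlinarith

theorem sl_zero {i : Bool × Wd} {p : SS m} (h : aw i.2 p = 0) : sl i p = 0 := by
  obtain ⟨b, w⟩ := i
  cases b
  · rw [sl_false, th_zero h]; simp
  · rw [sl_true]; simp only at h; rw [h]; simp

theorem geo_le (N : ℕ) : ∑ j ∈ Finset.range N, (1 / 4 : ℝ) ^ j ≤ 4 / 3 := by
  have : ∑ j ∈ Finset.range N, (1 / 4 : ℝ) ^ j = 4 / 3 * (1 - (1 / 4) ^ N) := by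
    induction N with
    | zero => simp
    | succ N ih => rw [Finset.sum_range_succ, ih, pow_succ]; ring
  rw [this]
  have : (0 : ℝ) < (1 / 4) ^ N := by positivity
  linarith

theorem sl_tail (p : SS m) (l : ℕ) (s : Finset (Bool × Wd)) (hs : ∀ i ∈ s, l ≤ i.2.length) :
    ∑ i ∈ s, ‖sl i p‖ ^ 2 ≤ 16 * (1 / 4) ^ l := by
  classical
  set s' := s.filter (fun i => aw i.2 p ≠ 0) with hs'
  have h1 : ∑ i ∈ s, ‖sl i p‖ ^ 2 = ∑ i ∈ s', ‖sl i p‖ ^ 2 := by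
    symm
    apply Finset.sum_subset (Finset.filter_subset _ _)
    intro i hi hi'
    have : aw i.2 p = 0 := by
      by_contra h; exact hi' (Finset.mem_filter.2 ⟨hi, h⟩)
    rw [sl_zero this]; simp
  have hmem : ∀ i ∈ s', l ≤ i.2.length ∧ aw i.2 p ≠ 0 := fun i hi =>
    ⟨hs i (Finset.mem_filter.1 hi).1, (Finset.mem_filter.1 hi).2⟩
  let f : Bool × Wd → Bool × ℕ := fun i => (i.1, i.2.length - l)
  let g : Bool × ℕ → ℝ := fun i => 4 * (1 / 4) ^ l * (1 / 4) ^ i.2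
  have hinj : Set.InjOn f s' := by
    rintro ⟨b, w⟩ hi ⟨b', w'⟩ hj h
    simp only [f, Prod.mk.injEq] at h
    have a1 := hmem _ hi
    have a2 := hmem _ hj
    simp only at a1 a2
    have := aw_unique (w := w) (w' := w') (by omega) a1.2 a2.2
    rw [h.1, this]
  have h2 : ∑ i ∈ s', ‖sl i p‖ ^ 2 ≤ ∑ i ∈ s', g (f i) := by
    apply Finset.sum_le_sum
    intro i hi
    have hl := (hmem i hi).1
    calc _ ≤ (2 * sc i.2) ^ 2 := by gcongr; exact sl_norm_le i p
      _ = g (f i) := by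
        simp only [g, f, sc]
        rw [mul_assoc, ← pow_add, Nat.add_sub_cancel' hl, mul_pow, ← pow_mul, mul_comm _ 2, pow_mul]
        norm_num
  have h3 : ∑ i ∈ s', g (f i) = ∑ j ∈ s'.image f, g j := (Finset.sum_image hinj).symm
  set N := (s'.image f).sup (fun i => i.2) + 1
  have h4 : s'.image f ⊆ (Finset.univ : Finset Bool) ×ˢ Finset.range N := by
    intro j hj
    simp only [Finset.mem_product, Finset.mem_univ, Finset.mem_range, true_and]
    exact Nat.lt_succ_of_le (Finset.le_sup (f := fun i : Bool × ℕ => i.2) hj)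
  have h5 : ∑ j ∈ s'.image f, g j ≤ ∑ j ∈ (Finset.univ : Finset Bool) ×ˢ Finset.range N, g j :=
    Finset.sum_le_sum_of_subset_of_nonneg h4 (fun _ _ _ => by positivity)
  have h6 : ∑ j ∈ (Finset.univ : Finset Bool) ×ˢ Finset.range N, g j =
      2 * (4 * (1 / 4) ^ l * ∑ j ∈ Finset.range N, (1 / 4 : ℝ) ^ j) := by
    rw [Finset.sum_product]
    simp [g, Finset.mul_sum]
  have h7 := geo_le N
  have h8 : (0 : ℝ) < (1 / 4) ^ l := by positivity
  rw [h1]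
  calc _ ≤ 2 * (4 * (1 / 4) ^ l * ∑ j ∈ Finset.range N, (1 / 4 : ℝ) ^ j) := by rw [← h6]; linarith
    _ ≤ 2 * (4 * (1 / 4) ^ l * (4 / 3)) := by gcongr
    _ ≤ _ := by linarith

theorem sl_mem (p : SS m) : Memℓp (fun i => sl i p) 2 := by
  refine memℓp_gen' (C := 16) (fun s => ?_)
  have := sl_tail p 0 s (by simp)
  simpa using this

abbrev LL (m : ℕ) := lp (fun _ : Bool × Wd => Vv m) 2

def FF (p : SS m) : LL m := ⟨fun i => sl i p, sl_mem p⟩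

theorem FF_apply (p : SS m) (i : Bool × Wd) : FF p i = sl i p := rfl

def dF (p p' : SS m) : ℝ := ‖FF p - FF p'‖

theorem sl_le_dF (i : Bool × Wd) (p p' : SS m) : ‖sl i p - sl i p'‖ ≤ dF p p' :=
  lp.norm_apply_le_norm (by norm_num) (FF p - FF p') i

theorem lp_norm_le {f : LL m} {C : ℝ} (hC : 0 ≤ C) (h : ∀ s : Finset (Bool × Wd), ∑ i ∈ s, ‖f i‖ ^ 2 ≤ C ^ 2) : ‖f‖ ≤ C := by
  refine lp.norm_le_of_forall_sum_le (by norm_num) hC (fun s => ?_)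
  have := h s
  simpa using this

theorem lp_norm_le_card {f : LL m} (s : Finset (Bool × Wd)) {B : ℝ} (hB : 0 ≤ B) (h0 : ∀ i, i ∉ s → f i = 0)
    (h : ∀ i, ‖f i‖ ≤ B) : ‖f‖ ≤ s.card * B := by
  classical
  refine lp_norm_le (by positivity) (fun t => ?_)
  calc ∑ i ∈ t, ‖f i‖ ^ 2 = ∑ i ∈ t ∩ s, ‖f i‖ ^ 2 := by
        symm
        apply Finset.sum_subset Finset.inter_subset_left
        intro i hi hi'
        rw [h0 i (fun h => hi' (Finset.mem_inter.2 ⟨hi, h⟩))]; simp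
    _ ≤ ∑ i ∈ s, ‖f i‖ ^ 2 := Finset.sum_le_sum_of_subset_of_nonneg Finset.inter_subset_right (fun _ _ _ => by positivity)
    _ ≤ ∑ i ∈ s, B ^ 2 := by gcongr; exact h _
    _ = s.card * B ^ 2 := by simp
    _ ≤ (s.card * B) ^ 2 := by
      rw [mul_pow]
      gcongr
      have : (s.card : ℝ) ≤ (s.card : ℝ) ^ 2 := by exact_mod_cast Nat.le_self_pow (by norm_num) _
      exact this

/-- (E1) -/
theorem E1 {w : Wd} {p p' : SS m} {c : ℝ} (hc : 0 < c) (h : c ≤ th w p) :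
    dist (hS w p) (hS w p') ≤ 2 / c * (dF p p' / sc w) := by
  have h1 := sl_le_dF (false, w) p p'
  have hs := sc_pos w
  rw [sl_false, sl_false, mul_smul, mul_smul, ← smul_sub, norm_smul, Real.norm_of_nonneg hs.le] at h1
  set t := th w p
  set t' := th w p'
  have ht' : 0 ≤ t' := th_nonneg _ _
  set q := (hS w p : Vv m)
  set q' := (hS w p' : Vv m)
  have e1 : |t - t'| ≤ ‖t • q - t' • q'‖ := by
    have := abs_norm_sub_norm_le (t • q) (t' • q')
    rwa [norm_smul, norm_smul, norm_SS, norm_SS, mul_one, mul_one, Real.norm_of_nonneg (by linarith : 0 ≤ t),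
      Real.norm_of_nonneg ht'] at this
  have e2 : t * ‖q - q'‖ ≤ 2 * ‖t • q - t' • q'‖ := by
    calc t * ‖q - q'‖ = ‖(t • q - t' • q') - (t - t') • q'‖ := by
          rw [← Real.norm_of_nonneg (by linarith : 0 ≤ t), ← norm_smul]
          rw [Real.norm_of_nonneg (by linarith : 0 ≤ t)]
          congr 1; module
      _ ≤ ‖t • q - t' • q'‖ + ‖(t - t') • q'‖ := norm_sub_le _ _
      _ ≤ _ := by
        rw [norm_smul, norm_SS, Real.norm_eq_abs]; linarith
  rw [Subtype.dist_eq, dist_eq_norm]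
  have e3 : ‖t • q - t' • q'‖ ≤ dF p p' / sc w := by rw [le_div_iff₀ hs]; linarith
  rw [div_mul_eq_mul_div, le_div_iff₀ hc]
  nlinarith [norm_nonneg (q - q')]

theorem E4' (w : Wd) (p p' : SS m) : 2 * sc w * |aw w p - aw w p'| ≤ dF p p' := by
  have h1 := sl_le_dF (true, w) p p'
  have hs := sc_pos w
  rw [sl_true, sl_true, ← sub_smul, ← mul_sub, norm_smul, norm_SS, mul_one, Real.norm_eq_abs, abs_mul,
    abs_of_pos (by positivity)] at h1
  exact h1

theorem E4 {w : Wd} {p p' : SS m} (h : aw w p = 1) (hd : dF p p' < 2 * sc w) : aw w p' ≠ 0 := by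
  intro h'
  have := E4' w p p'
  rw [h, h'] at this
  norm_num at this
  linarith

theorem pre_or_zero {w u : Wd} {p : SS m} (hw : aw w p ≠ 0) (hl : u.length ≤ w.length) : u <+: w ∨ aw u p = 0 := by
  by_cases h : aw u p = 0
  · exact Or.inr h
  · exact Or.inl (aw_chain hl h hw)

/-- slots of strict ancestors of the parent -/
theorem sl_below {w u : Wd} {p p' : SS m} (hp : aw w p ≠ 0) (hp' : aw w p' ≠ 0) (hl : u.length + 1 < w.length) (b : Bool) :
    sl (b, u) p = sl (b, u) p' := by
  by_cases hu : u <+: w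
  · obtain ⟨v, rfl⟩ := hu
    rcases v with _ | ⟨i, v⟩
    · simp at hl
    · have hv : v ≠ [] := by rintro rfl; simp at hl
      have key : ∀ x : SS m, aw (u ++ i :: v) x ≠ 0 → aw u x = 1 ∧ th u x = 0 := by
        intro x hx
        refine ⟨aw_app_one (by simp) hx, ?_⟩
        have : aw (u ++ [i]) x = 1 := aw_app_one (v := v) hv (by simpa using hx)
        rw [th_full (i := i) (by rw [this]; norm_num), this]; norm_num
      obtain ⟨a1, a2⟩ := key p hp
      obtain ⟨b1, b2⟩ := key p' hp'
      cases b
      · rw [sl_false, sl_false, a2, b2]; simp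
      · rw [sl_true, sl_true, a1, b1]
  · have h1 := (pre_or_zero hp (by omega : u.length ≤ w.length)).resolve_left hu
    have h2 := (pre_or_zero hp' (by omega : u.length ≤ w.length)).resolve_left hu
    rw [sl_zero (i := (b, u)) h1, sl_zero (i := (b, u)) h2]

/-- (E3) -/
theorem E3 {w : Wd} {p p' : SS m} (hp : aw w p ≠ 0) (hp' : aw w p' ≠ 0) : dF p p' ≤ 16 * sc w := by
  classical
  have hs := sc_pos w
  refine lp_norm_le (by positivity) (fun s => ?_)
  set l := w.length - 1
  set s' := s.filter (fun i => l ≤ i.2.length)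
  have h1 : ∑ i ∈ s, ‖(FF p - FF p') i‖ ^ 2 = ∑ i ∈ s', ‖sl i p - sl i p'‖ ^ 2 := by
    symm
    apply Finset.sum_subset (Finset.filter_subset _ _)
    intro i hi hi'
    have : ¬ l ≤ i.2.length := fun h => hi' (Finset.mem_filter.2 ⟨hi, h⟩)
    rw [sl_below hp hp' (u := i.2) (by omega) i.1]; simp
  have hm : ∀ i ∈ s', l ≤ i.2.length := fun i hi => (Finset.mem_filter.1 hi).2
  have t1 := sl_tail p l s' hm
  have t2 := sl_tail p' l s' hm
  have h2 : ∑ i ∈ s', ‖sl i p - sl i p'‖ ^ 2 ≤ ∑ i ∈ s', (2 * ‖sl i p‖ ^ 2 + 2 * ‖sl i p'‖ ^ 2) := by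
    apply Finset.sum_le_sum
    intro i _
    have := norm_sub_le (sl i p) (sl i p')
    nlinarith [norm_nonneg (sl i p - sl i p'), sq_nonneg (‖sl i p‖ - ‖sl i p'‖)]
  rw [Finset.sum_add_distrib, ← Finset.mul_sum, ← Finset.mul_sum] at h2
  have h3 : (1 / 4 : ℝ) ^ l ≤ 4 * sc w ^ 2 := by
    have : sc w ^ 2 = (1 / 4) ^ w.length := by
      rw [sc, ← pow_mul, mul_comm, pow_mul]; norm_num
    rw [this]
    by_cases h0 : w.length = 0
    · simp [l, h0]
    · have : w.length = l + 1 := by omega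
      rw [this, pow_succ]; linarith
  rw [h1, mul_pow]
  nlinarith

end
end BD

namespace BD
open Set Metric Filter Topology MeasureTheory
open scoped ENNReal NNReal

noncomputable section

variable {m : ℕ}

def gch (i : Fin 3) (b : PP m) : Vv m := omg m (hI i b) • (io (hI i b) : Vv m)

theorem supp_comp_hI {W : Type*} [NormedAddCommGroup W] (i : Fin 3) {g : PP m → W} (hg : ∀ b, omg m (hI i b) = 0 → g b = 0) :
    HasCompactSupport g := by
  refine HasCompactSupport.of_support_subset_isCompact (isCompact_UB.image (hm_cont i)) fun x hx => ?_
  have : omg m (hI i x) ≠ 0 := fun h => hx (hg x h)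
  exact ⟨hI i x, UU_sub_UB (omg_ne.1 this), hm_hI i x⟩

theorem exists_K (m : ℕ) : ∃ K : ℝ, 1 ≤ K ∧ ∀ q q' : SS m,
    |liftS (omg m) q - liftS (omg m) q'| ≤ K * dist q q' ∧
    (∀ i, |liftS (fun b => omg m (hI i b)) q - liftS (fun b => omg m (hI i b)) q'| ≤ K * dist q q') ∧
    (∀ i, ‖liftS (gch (m := m) i) q - liftS (gch i) q'‖ ≤ K * dist q q') ∧
    (∀ i, q ∈ io '' UB m → q' ∈ io '' UB m → dist (io (hm i (jo q))) (io (hm i (jo q'))) ≤ K * dist q q') := by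
  obtain ⟨K1, h1⟩ := liftS_lip (m := m) omg_contDiff omg_supp
  have h2 : ∀ i, ∃ K : ℝ≥0, LipschitzWith K (liftS (fun b : PP m => omg m (hI i b))) := fun i =>
    liftS_lip (omg_contDiff.comp (hI_contDiff i)) (supp_comp_hI i fun b hb => hb)
  have h3 : ∀ i, ∃ K : ℝ≥0, LipschitzWith K (liftS (gch (m := m) i)) := fun i =>
    liftS_lip ((omg_contDiff.comp (hI_contDiff i)).smul (io_contDiff.comp (hI_contDiff i)))
      (supp_comp_hI i fun b hb => by simp [gch, hb])
  have h4 : ∀ i : Fin 3, ∃ K : ℝ≥0, LipschitzOnWith K (fun q : SS m => io (hm i (jo q))) (io '' UB m) := by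
    intro i
    refine LocallyLipschitzOn.exists_lipschitzOnWith_of_compact (isCompact_UB.image io_cont) ?_
    rintro p ⟨b, hb, rfl⟩
    obtain ⟨K, t, ht, h⟩ := locLip_comp_jo (m := m) (g := fun b => (io (hm i b) : Vv m)) (io_contDiff.comp (hm_contDiff i)) (io_ne b)
    exact ⟨K, t, mem_nhdsWithin_of_mem_nhds ht, h⟩
  choose K2 h2 using h2
  choose K3 h3 using h3
  choose K4 h4 using h4
  let K : ℝ := 1 + K1 + ∑ i, (K2 i : ℝ) + ∑ i, (K3 i : ℝ) + ∑ i, (K4 i : ℝ)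
  have s2 : ∀ i, (K2 i : ℝ) ≤ ∑ i, (K2 i : ℝ) := fun i => Finset.single_le_sum (f := fun i => (K2 i : ℝ)) (fun _ _ => NNReal.coe_nonneg _) (Finset.mem_univ i)
  have s3 : ∀ i, (K3 i : ℝ) ≤ ∑ i, (K3 i : ℝ) := fun i => Finset.single_le_sum (f := fun i => (K3 i : ℝ)) (fun _ _ => NNReal.coe_nonneg _) (Finset.mem_univ i)
  have s4 : ∀ i, (K4 i : ℝ) ≤ ∑ i, (K4 i : ℝ) := fun i => Finset.single_le_sum (f := fun i => (K4 i : ℝ)) (fun _ _ => NNReal.coe_nonneg _) (Finset.mem_univ i)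
  have n1 := K1.coe_nonneg
  have n2 : 0 ≤ ∑ i, (K2 i : ℝ) := Finset.sum_nonneg fun _ _ => NNReal.coe_nonneg _
  have n3 : 0 ≤ ∑ i, (K3 i : ℝ) := Finset.sum_nonneg fun _ _ => NNReal.coe_nonneg _
  have n4 : 0 ≤ ∑ i, (K4 i : ℝ) := Finset.sum_nonneg fun _ _ => NNReal.coe_nonneg _
  refine ⟨K, by simp only [K]; linarith, fun q q' => ⟨?_, fun i => ?_, fun i => ?_, fun i hq hq' => ?_⟩⟩
  · have := h1.dist_le_mul q q'
    rw [Real.dist_eq] at this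
    exact this.trans (mul_le_mul_of_nonneg_right (by simp only [K]; linarith) dist_nonneg)
  · have := (h2 i).dist_le_mul q q'
    rw [Real.dist_eq] at this
    exact this.trans (mul_le_mul_of_nonneg_right (by simp only [K]; linarith [s2 i]) dist_nonneg)
  · have := (h3 i).dist_le_mul q q'
    rw [dist_eq_norm] at this
    exact this.trans (mul_le_mul_of_nonneg_right (by simp only [K]; linarith [s3 i]) dist_nonneg)
  · have := (h4 i).dist_le_mul q hq q' hq'
    exact this.trans (mul_le_mul_of_nonneg_right (by simp only [K]; linarith [s4 i]) dist_nonneg)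

def CK (m : ℕ) : ℝ := Classical.choose (exists_K m)
theorem CK_one : 1 ≤ CK m := (Classical.choose_spec (exists_K m)).1
theorem CK_spec (q q' : SS m) :
    |liftS (omg m) q - liftS (omg m) q'| ≤ CK m * dist q q' ∧
    (∀ i, |liftS (fun b => omg m (hI i b)) q - liftS (fun b => omg m (hI i b)) q'| ≤ CK m * dist q q') ∧
    (∀ i, ‖liftS (gch (m := m) i) q - liftS (gch i) q'‖ ≤ CK m * dist q q') ∧
    (∀ i, q ∈ io '' UB m → q' ∈ io '' UB m → dist (io (hm i (jo q))) (io (hm i (jo q'))) ≤ CK m * dist q q') := (Classical.choose_spec (exists_K m)).2 q q'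

/-- value of `aw w` via the model coordinate -/
theorem aw_lift {w : Wd} (hw : w ≠ []) (hp : Prs w) (p : SS m) : aw w p = liftS (omg m) (hS w p) := by
  by_cases h : p = Np m
  · subst h; simp [aw, hw, liftS, hS]
  · rw [aw_eq hw hp h, hS_of h, liftS_io]

theorem aw_child_lift {w : Wd} (hp : Inn w) (i : Fin 3) (p : SS m) :
    aw (w ++ [i]) p = liftS (fun b => omg m (hI i b)) (hS w p) := by
  by_cases h : p = Np m
  · subst h; simp [aw, liftS, hS]
  · rw [aw_eq (snoc_ne w i) (prs_child.2 hp) h, hS_of h, liftS_io, hwI_snoc]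

theorem aw_Lip (w : Wd) {p p' : SS m} (hp : aw w p ≠ 0) : |aw w p - aw w p'| ≤ CK m * dist (hS w p) (hS w p') := by
  by_cases hw : w = []
  · subst hw; rw [aw_nil, aw_nil]; simp only [sub_self, abs_zero]
    exact mul_nonneg (by linarith [CK_one (m := m)]) dist_nonneg
  · obtain ⟨h1, -, -⟩ := (aw_ne hw).1 hp
    rw [aw_lift hw h1, aw_lift hw h1]
    exact (CK_spec _ _).1

theorem aw_child_Lip (w : Wd) (i : Fin 3) (p p' : SS m) :
    |aw (w ++ [i]) p - aw (w ++ [i]) p'| ≤ CK m * dist (hS w p) (hS w p') := by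
  by_cases hI : Inn w
  · rw [aw_child_lift hI, aw_child_lift hI]; exact (CK_spec _ _).2.1 i
  · rw [aw_absent (snoc_ne w i) (fun h => hI (prs_child.1 h)), aw_absent (snoc_ne w i) (fun h => hI (prs_child.1 h))]
    simp only [sub_self, abs_zero]
    exact mul_nonneg (by linarith [CK_one (m := m)]) dist_nonneg

def RR (w : Wd) : Set (SS m) := {p | aw w p ≠ 0 ∧ ∀ i, aw (w ++ [i]) p < 1}

theorem RR_deep {w : Wd} {p : SS m} (h : p ∈ RR w) (i j : Fin 3) : aw (w ++ [i] ++ [j]) p = 0 := by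
  by_contra h'
  have := aw_parent h'
  linarith [h.2 i]

theorem RR_deep' {w u : Wd} {p : SS m} (h : p ∈ RR w) (hu : w.length + 2 ≤ u.length) : aw u p = 0 := by
  by_contra h'
  have hpre := aw_chain (by omega : w.length ≤ u.length) h.1 h'
  obtain ⟨v, rfl⟩ := hpre
  rcases v with _ | ⟨i, _ | ⟨j, v⟩⟩
  · simp at hu
  · simp at hu
  · have := aw_app_one (w := w ++ [i]) (v := j :: v) (by simp) (p := p) (by simpa using h')
    linarith [h.2 i]

theorem smul_sub_le {a a' : ℝ} {x x' : Vv m} (ha' : |a'| ≤ 1) (hx : ‖x‖ ≤ 1) : ‖a • x - a' • x'‖ ≤ |a - a'| + ‖x - x'‖ := by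
  have : a • x - a' • x' = (a - a') • x + a' • (x - x') := by module
  rw [this]
  refine (norm_add_le _ _).trans ?_
  rw [norm_smul, norm_smul, Real.norm_eq_abs, Real.norm_eq_abs]
  have := mul_le_mul_of_nonneg_left hx (abs_nonneg (a - a'))
  have := mul_le_mul_of_nonneg_right ha' (norm_nonneg (x - x'))
  linarith

theorem th_Lip (w : Wd) {p p' : SS m} (hp : aw w p ≠ 0) : |th w p - th w p'| ≤ 4 * CK m * dist (hS w p) (hS w p') := by
  have h1 := aw_Lip w (p' := p') hp
  have h2 : |∑ i, aw (w ++ [i]) p - ∑ i, aw (w ++ [i]) p'| ≤ 3 * (CK m * dist (hS w p) (hS w p')) := by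
    rw [← Finset.sum_sub_distrib]
    refine (Finset.abs_sum_le_sum_abs _ _).trans ?_
    refine (Finset.sum_le_sum fun i _ => aw_child_Lip w i p p').trans ?_
    simp
  have a1 := aw_nonneg w p
  have a2 := aw_le_one w p
  have b0 := sum_child_nonneg w p'
  have b1 := sum_child_le (m := m) zero_le_one (fun i => aw_le_one (w ++ [i]) p')
  unfold th
  set S := ∑ i, aw (w ++ [i]) p
  set S' := ∑ i, aw (w ++ [i]) p'
  have e : aw w p * (1 - S) - aw w p' * (1 - S') = (aw w p - aw w p') * (1 - S') - aw w p * (S - S') := by ring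
  rw [e]
  refine (abs_sub _ _).trans ?_
  rw [abs_mul, abs_mul, abs_of_nonneg a1, abs_of_nonneg (by linarith : 0 ≤ 1 - S')]
  have := mul_le_mul_of_nonneg_left (by linarith : 1 - S' ≤ 1) (abs_nonneg (aw w p - aw w p'))
  have := mul_le_mul_of_nonneg_right a2 (abs_nonneg (S - S'))
  linarith

theorem sl_parent {u : Wd} {i : Fin 3} {p p' : SS m} (hp : aw (u ++ [i]) p ≠ 0) (hp' : aw (u ++ [i]) p' ≠ 0) :
    ‖sl (false, u) p - sl (false, u) p'‖ ≤ 4 * CK m * sc (u ++ [i]) * dist (hS (u ++ [i]) p) (hS (u ++ [i]) p') := by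
  obtain ⟨-, a1, a2⟩ := (aw_ne (snoc_ne u i)).1 hp
  obtain ⟨-, b1, b2⟩ := (aw_ne (snoc_ne u i)).1 hp'
  have key : ∀ x : SS m, x ≠ Np m → hS u x = io (hm i (jo (hS (u ++ [i]) x))) := by
    intro x hx
    rw [jo_hS hx, hwI_snoc, hm_hI, hS_of hx]
  rw [sl_false, sl_false, mul_smul, mul_smul, ← smul_sub, norm_smul, Real.norm_of_nonneg (sc_pos u).le, th_full hp, th_full hp']
  have h1 := smul_sub_le (m := m) (a := 1 - aw (u ++ [i]) p) (a' := 1 - aw (u ++ [i]) p') (x := hS u p) (x' := hS u p')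
    (by rw [abs_of_nonneg (by linarith [aw_le_one (u ++ [i]) p'])]; linarith [aw_nonneg (u ++ [i]) p']) (norm_SS _).le
  have h2 := aw_Lip (u ++ [i]) (p' := p') hp
  have h3 : ‖(hS u p : Vv m) - hS u p'‖ ≤ CK m * dist (hS (u ++ [i]) p) (hS (u ++ [i]) p') := by
    rw [← dist_eq_norm, ← Subtype.dist_eq, key p a1, key p' b1]
    refine (CK_spec _ _).2.2.2 i ⟨_, UU_sub_UB a2, ?_⟩ ⟨_, UU_sub_UB b2, ?_⟩
    · rw [hS_of a1]
    · rw [hS_of b1]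
  have e : 1 - aw (u ++ [i]) p - (1 - aw (u ++ [i]) p') = -(aw (u ++ [i]) p - aw (u ++ [i]) p') := by ring
  rw [e, abs_neg] at h1
  rw [sc_snoc]
  have := mul_le_mul_of_nonneg_left (h1.trans (add_le_add h2 h3)) (sc_pos u).le
  linarith

theorem sl_child {w : Wd} {p p' : SS m} (hp : p ∈ RR w) (hp' : p' ∈ RR w) (i : Fin 3) :
    ‖sl (false, w ++ [i]) p - sl (false, w ++ [i]) p'‖ ≤ CK m * sc w * dist (hS w p) (hS w p') := by
  have hK := CK_one (m := m)
  by_cases hI : Inn w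
  · have key : ∀ x : SS m, x ∈ RR w → sl (false, w ++ [i]) x = sc (w ++ [i]) • liftS (gch i) (hS w x) := by
      intro x hx
      rw [sl_false, th_leaf (RR_deep hx i), mul_smul]
      congr 1
      rw [aw_child_lift hI]
      by_cases h : x = Np m
      · subst h; simp [liftS, hS]
      · rw [hS_of h, hS_of h, liftS_io, liftS_io, hwI_snoc]; rfl
    rw [key p hp, key p' hp', ← smul_sub, norm_smul, Real.norm_of_nonneg (sc_pos _).le, sc_snoc]
    have := mul_le_mul_of_nonneg_left ((CK_spec (hS w p) (hS w p')).2.2.1 i) (sc_pos w).le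
    have h0 := mul_nonneg (sc_pos w).le (norm_nonneg (liftS (gch i) (hS w p) - liftS (gch i) (hS w p')))
    linarith
  · have : ∀ x : SS m, sl (false, w ++ [i]) x = 0 := fun x =>
      sl_zero (aw_absent (snoc_ne w i) (fun h => hI (prs_child.1 h)) x)
    rw [this, this]; simp only [sub_self, norm_zero]
    have := sc_pos w
    positivity

theorem sl_self {w : Wd} {p p' : SS m} (hp : aw w p ≠ 0) :
    ‖sl (false, w) p - sl (false, w) p'‖ ≤ 5 * CK m * sc w * dist (hS w p) (hS w p') := by
  rw [sl_false, sl_false, mul_smul, mul_smul, ← smul_sub, norm_smul, Real.norm_of_nonneg (sc_pos w).le]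
  have h1 := smul_sub_le (m := m) (a := th w p) (a' := th w p') (x := hS w p) (x' := hS w p')
    (by rw [abs_of_nonneg (th_nonneg _ _)]; exact th_le_one _ _) (norm_SS _).le
  have h2 := th_Lip w (p' := p') hp
  rw [← dist_eq_norm (hS w p : Vv m), ← Subtype.dist_eq] at h1
  have h3 : dist (hS w p) (hS w p') ≤ CK m * dist (hS w p) (hS w p') := le_mul_of_one_le_left dist_nonneg CK_one
  have := mul_le_mul_of_nonneg_left (by linarith : ‖th w p • (hS w p : Vv m) - th w p' • (hS w p' : Vv m)‖ ≤
    5 * (CK m * dist (hS w p) (hS w p'))) (sc_pos w).le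
  linarith

theorem slots_eq {w u : Wd} {p p' : SS m} (hp : p ∈ RR w) (hp' : p' ∈ RR w) (b : Bool)
    (h1 : u ≠ w) (h2 : ∀ i, u ++ [i] ≠ w) (h3 : ∀ i, u ≠ w ++ [i]) : sl (b, u) p = sl (b, u) p' := by
  have z : ∀ x : SS m, x ∈ RR w → w.length ≤ u.length + 1 → aw u x = 0 := by
    intro x hx hl
    by_contra h
    rcases le_or_gt u.length w.length with hl' | hl'
    · obtain ⟨v, hv⟩ := aw_chain hl' h hx.1
      rcases v with _ | ⟨i, _ | ⟨j, v⟩⟩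
      · exact h1 (by simpa using hv)
      · exact h2 i hv
      · have := congrArg List.length hv; simp at this; omega
    · rcases Nat.lt_or_ge u.length (w.length + 2) with hl2 | hl2
      · obtain ⟨v, hv⟩ := aw_chain hl'.le hx.1 h
        rcases v with _ | ⟨i, _ | ⟨j, v⟩⟩
        · exact h1 (by simpa using hv.symm)
        · exact h3 i hv.symm
        · have := congrArg List.length hv; simp at this; omega
      · exact h (RR_deep' hx hl2)
  rcases Nat.lt_or_ge (u.length + 1) w.length with hl | hl
  · exact sl_below hp.1 hp'.1 hl b
  · rw [sl_zero (i := (b, u)) (z p hp hl), sl_zero (i := (b, u)) (z p' hp' hl)]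

theorem sl_true_sub (w : Wd) (p p' : SS m) : ‖sl (true, w) p - sl (true, w) p'‖ = 2 * sc w * |aw w p - aw w p'| := by
  have hs := sc_pos w
  rw [sl_true, sl_true, ← sub_smul, ← mul_sub, norm_smul, norm_SS, mul_one, Real.norm_eq_abs, abs_mul,
    abs_of_pos (by positivity)]

def slotSet (w : Wd) : Finset (Bool × Wd) :=
  Finset.univ ×ˢ ({w, w.dropLast, w ++ [0], w ++ [1], w ++ [2]} : Finset Wd)

theorem slotSet_card (w : Wd) : (slotSet w).card ≤ 10 := by
  rw [slotSet, Finset.card_product]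
  have := Finset.card_le_five (a := w) (b := w.dropLast) (c := w ++ [0]) (d := w ++ [1]) (e := w ++ [2])
  simp only [Finset.card_univ, Fintype.card_bool]
  omega

theorem slotSet_not {w : Wd} {b : Bool} {u : Wd} (h : (b, u) ∉ slotSet w) : u ≠ w ∧ (∀ i, u ++ [i] ≠ w) ∧ ∀ i, u ≠ w ++ [i] := by
  simp only [slotSet, Finset.mem_product, Finset.mem_univ, true_and, Finset.mem_insert, Finset.mem_singleton, not_or] at h
  refine ⟨h.1, ?_, ?_⟩
  · rintro i rfl; exact h.2.1 (by simp)
  · intro i; fin_cases i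
    · exact h.2.2.1
    · exact h.2.2.2.1
    · exact h.2.2.2.2

theorem E2 {w : Wd} {p p' : SS m} (hp : p ∈ RR w) (hp' : p' ∈ RR w) :
    dF p p' ≤ 50 * CK m * sc w * dist (hS w p) (hS w p') := by
  have hK := CK_one (m := m)
  have hs := sc_pos w
  have hD : 0 ≤ dist (hS w p) (hS w p') := dist_nonneg
  set D := dist (hS w p) (hS w p')
  set B := CK m * sc w * D with hB
  have hB0 : 0 ≤ B := by positivity
  have key : ∀ i : Bool × Wd, ‖(FF p - FF p') i‖ ≤ 5 * B := by
    rintro ⟨b, u⟩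
    change ‖sl (b, u) p - sl (b, u) p'‖ ≤ _
    by_cases h1 : u = w
    · subst h1
      cases b
      · exact (sl_self hp.1).trans (by rw [hB]; linarith)
      · rw [sl_true_sub]
        have := mul_le_mul_of_nonneg_left (aw_Lip u (p' := p') hp.1) hs.le
        linarith
    by_cases h2 : ∃ i, u ++ [i] = w
    · obtain ⟨i, rfl⟩ := h2
      cases b
      · exact (sl_parent hp.1 hp'.1).trans (by linarith)
      · rw [sl_true_sub, aw_parent hp.1, aw_parent hp'.1]; simp; positivity
    by_cases h3 : ∃ i, u = w ++ [i]
    · obtain ⟨i, rfl⟩ := h3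
      cases b
      · exact (sl_child hp hp' i).trans (by linarith)
      · rw [sl_true_sub, sc_snoc]
        have := mul_le_mul_of_nonneg_left (aw_child_Lip w i p p') hs.le
        linarith
    · push Not at h2 h3
      rw [slots_eq hp hp' b h1 h2 h3]; simp; positivity
  have := lp_norm_le_card (f := FF p - FF p') (slotSet w) (by positivity : 0 ≤ 5 * B) (by
    rintro ⟨b, u⟩ hu
    obtain ⟨h1, h2, h3⟩ := slotSet_not hu
    change sl (b, u) p - sl (b, u) p' = 0
    rw [slots_eq hp hp' b h1 h2 h3, sub_self]) key
  refine this.trans ?_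
  have hc : ((slotSet w).card : ℝ) ≤ 10 := by exact_mod_cast slotSet_card w
  have := mul_le_mul_of_nonneg_right hc (by positivity : 0 ≤ 5 * B)
  rw [hB] at this ⊢
  linarith

end
end BD

namespace BD
open Set Metric Filter Topology MeasureTheory
open scoped ENNReal NNReal

noncomputable section

variable {m : ℕ}

theorem hwI_contDiff (w : Wd) : ContDiff ℝ 1 (hwI w : PP m → PP m) := by
  induction w with
  | nil => exact contDiff_id
  | cons i w ih => exact ih.comp (hI_contDiff i)

theorem hw_contDiff (w : Wd) : ContDiff ℝ 1 (hw w : PP m → PP m) := by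
  induction w with
  | nil => exact contDiff_id
  | cons i w ih => exact (hm_contDiff i).comp ih

theorem aw_lipS (w : Wd) : ∃ K : ℝ≥0, LipschitzWith K (aw w : SS m → ℝ) := by
  by_cases hw0 : w = []
  · subst hw0
    refine ⟨0, ?_⟩
    have : (aw [] : SS m → ℝ) = fun _ => 1 := funext aw_nil
    rw [this]; exact LipschitzWith.const 1
  by_cases hp : Prs w
  · obtain ⟨K, h⟩ := liftS_lip (m := m) (g := fun b => omg m (hwI w b)) (omg_contDiff.comp (hwI_contDiff w)) (by
      refine HasCompactSupport.of_support_subset_isCompact (isCompact_UB.image (hw_cont w)) fun x hx => ?_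
      exact ⟨hwI w x, UU_sub_UB (omg_ne.1 hx), hw_hwI w x⟩)
    refine ⟨K, ?_⟩
    convert h using 1
    funext p
    by_cases h : p = Np m
    · subst h; simp [aw, hw0, liftS]
    · rw [aw_eq hw0 hp h, liftS, if_neg h]
  · refine ⟨0, ?_⟩
    have : (aw w : SS m → ℝ) = fun _ => 0 := funext (aw_absent hw0 hp)
    rw [this]; exact LipschitzWith.const 0

theorem aw_cont (w : Wd) : Continuous (aw w : SS m → ℝ) := (aw_lipS w).choose_spec.continuous

theorem aw_ne_Np {w : Wd} {p : SS m} (h : aw w p ≠ 0) : w = [] ∨ p ≠ Np m := by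
  by_cases hw : w = []
  · exact Or.inl hw
  · exact Or.inr ((aw_ne hw).1 h).2.1

theorem hS_contAt {w : Wd} {p : SS m} (h : w = [] ∨ p ≠ Np m) : ContinuousAt (hS w) p := by
  rcases h with rfl | h
  · have : (hS [] : SS m → SS m) = id := funext hS_nil
    rw [this]; exact continuousAt_id
  · have h1 : ContinuousAt (fun x : SS m => io (hwI w (jo x))) p :=
      (io_cont.comp (hwI_cont w)).continuousAt.comp (jo_contAt h)
    refine h1.congr ?_
    filter_upwards [isOpen_ne.mem_nhds h] with x hx
    rw [hS_of hx]

theorem isOpen_RR (w : Wd) : IsOpen (RR w : Set (SS m)) := by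
  have e : (RR w : Set (SS m)) = {p | aw w p ≠ 0} ∩ ⋂ i, {p | aw (w ++ [i]) p < 1} := by
    ext p; simp [RR]
  rw [e]
  exact (isOpen_ne_fun (aw_cont w) continuous_const).inter
    (isOpen_iInter_of_finite fun i => isOpen_lt (aw_cont _) continuous_const)

theorem home_child {w : Wd} {p : SS m} {c : ℝ} (hc : 0 < c) (h : c ≤ th w p) (i : Fin 3) : aw (w ++ [i]) p ≤ 1 - c := by
  have h0 := sum_child_nonneg w p
  have h1 := aw_le_one w p
  have h2 := aw_nonneg w p
  have h3 : aw (w ++ [i]) p ≤ ∑ j, aw (w ++ [j]) p :=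
    Finset.single_le_sum (f := fun j => aw (w ++ [j]) p) (fun _ _ => aw_nonneg _ _) (Finset.mem_univ i)
  have h4 := sum_child_le (m := m) zero_le_one (fun i => aw_le_one (w ++ [i]) p)
  unfold th at h
  nlinarith

theorem home_RR {w : Wd} {p : SS m} {c : ℝ} (hc : 0 < c) (h : c ≤ th w p) : p ∈ RR w := by
  refine ⟨fun h0 => ?_, fun i => ?_⟩
  · rw [th_zero h0] at h; linarith
  · linarith [home_child hc h i]

/-! the limit point -/
def x0P (m : ℕ) : PP m := (250 / 99, 250 / 99, 0)
def X0 (m : ℕ) : SS m := io (x0P m)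

theorem hm_x0P : hm 0 (x0P m) = x0P m := by
  unfold hm x0P; simp only [if_true]
  refine Prod.ext ?_ (Prod.ext ?_ ?_)
  · norm_num
  · norm_num
  · funext j; simp

theorem hI_x0P : hI 0 (x0P m) = x0P m := by
  conv_lhs => rw [← hm_x0P, hI_hm]

theorem hwI_x0P (j : ℕ) : hwI (List.replicate j 0) (x0P m) = x0P m := by
  induction j with
  | zero => rfl
  | succ j ih => rw [List.replicate_succ]; change hwI _ (hI 0 _) = _; rw [hI_x0P, ih]

theorem x0P_norm : ‖x0P m‖ ≤ 3 := by
  rw [Prod.norm_def, Prod.norm_def]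
  simp only [x0P]; norm_num [abs_of_nonneg]

theorem x0P_UP : x0P m ∈ UP m := by
  rw [← hm_x0P]
  exact Or.inr ⟨_, by simpa using x0P_norm.trans (by norm_num), rfl⟩

theorem replicate_inn (j : ℕ) : Inn (List.replicate j 0) := ⟨j, [], by simp, by simp, Or.inr rfl⟩

theorem aw_X0 (j : ℕ) : aw (List.replicate j 0) (X0 m) = 1 := by
  rcases j with _ | j
  · exact aw_nil _
  · rw [X0, aw_eq (by simp) (replicate_inn _).prs (io_ne _), jo_io, hwI_x0P]
    exact omg_one x0P_UP

theorem hwI_zero_sub (j : ℕ) (b : PP m) : hwI (List.replicate j 0) b - x0P m = (100 : ℝ) ^ j • (b - x0P m) := by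
  induction j generalizing b with
  | zero => simp [hwI]
  | succ j ih =>
    rw [List.replicate_succ]; change hwI _ (hI 0 _) - _ = _
    rw [ih, pow_succ, mul_smul]
    congr 1
    unfold hI x0P; simp only [if_true]
    refine Prod.ext ?_ (Prod.ext ?_ ?_)
    · simp; ring
    · simp; ring
    · funext j; simp

theorem aw_zero_close {j : ℕ} {p : SS m} (h : aw (List.replicate (j + 1) 0) p ≠ 0) :
    p ≠ Np m ∧ ‖jo p - x0P m‖ ≤ 7 / 100 ^ (j + 1) := by
  obtain ⟨-, h1, h2⟩ := (aw_ne (by simp)).1 h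
  refine ⟨h1, ?_⟩
  have h3 := hwI_zero_sub (j + 1) (jo p)
  have h4 := congrArg norm h3
  rw [norm_smul, norm_pow, Real.norm_of_nonneg (by norm_num : (0 : ℝ) ≤ 100)] at h4
  have h5 := norm_sub_le (hwI (List.replicate (j + 1) 0) (jo p)) (x0P m)
  have h6 := UB_norm (UU_sub_UB h2)
  have h7 := x0P_norm (m := m)
  rw [le_div_iff₀ (by positivity)]
  linarith

theorem eq_X0 {p : SS m} (h : ∀ j, aw (List.replicate j 0) p ≠ 0) : p = X0 m := by
  have h1 := (aw_zero_close (h 1)).1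
  have h2 : ‖jo p - x0P m‖ ≤ 0 := by
    have ht : Tendsto (fun j : ℕ => (7 : ℝ) / 100 ^ (j + 1)) atTop (𝓝 0) := by
      have := (tendsto_pow_atTop_nhds_zero_of_lt_one (r := (1 / 100 : ℝ)) (by norm_num) (by norm_num)).const_mul (7 / 100)
      rw [mul_zero] at this
      refine this.congr fun j => ?_
      rw [pow_succ, one_div, inv_pow]; field_simp
    exact ge_of_tendsto' ht fun j => (aw_zero_close (h (j + 1))).2
  have h3 : jo p = x0P m := sub_eq_zero.1 (norm_le_zero_iff.1 h2)
  rw [X0, ← h3, io_jo h1]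

theorem zero_pre {w : Wd} (hw : Prs w) {k : ℕ} (hl : 2 * k + 2 ≤ w.length) : List.replicate k 0 <+: w := by
  rcases List.eq_nil_or_concat w with rfl | ⟨u, i, rfl⟩
  · simp at hl
  · rw [List.concat_eq_append] at *
    obtain ⟨j, v, rfl, -, h⟩ := hw u i rfl
    have hj : k ≤ j := by
      simp at hl
      rcases h with h | h
      · omega
      · subst h; simp at hl; omega
    obtain ⟨l, rfl⟩ := Nat.exists_eq_add_of_le hj
    rw [List.replicate_add, List.append_assoc, List.append_assoc]
    exact List.prefix_append _ _

theorem deep_zero {w : Wd} {p : SS m} (h : aw w p ≠ 0) {k : ℕ} (hl : 2 * k + 2 ≤ w.length) :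
    aw (List.replicate k 0) p ≠ 0 := by
  have h0 : w ≠ [] := by rintro rfl; simp at hl
  obtain ⟨v, rfl⟩ := zero_pre ((aw_ne h0).1 h).1 hl
  by_cases hv : v = []
  · subst hv; simpa using h
  · rw [aw_app_one hv h]; norm_num

theorem home_or_X0 (p : SS m) : (∃ v : Wd, 1 / 2 ≤ th v p) ∨ p = X0 m := by
  by_cases h : ∃ v : Wd, 1 / 2 ≤ th v p
  · exact Or.inl h
  · right
    refine eq_X0 fun j => ?_
    rcases home_or_full p (2 * j + 2) with ⟨w, hw, h1⟩ | ⟨v, -, hv⟩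
    · exact deep_zero (w := w) (by rw [h1]; norm_num) hw.ge
    · exact absurd ⟨v, hv⟩ h

theorem dF_nonneg (p p' : SS m) : 0 ≤ dF p p' := norm_nonneg _
theorem dF_comm (p p' : SS m) : dF p p' = dF p' p := norm_sub_rev _ _

theorem FF_inj : Function.Injective (FF : SS m → LL m) := by
  have key : ∀ p p' : SS m, FF p = FF p' → (∃ v : Wd, 1 / 2 ≤ th v p) → p = p' := by
    rintro p p' h ⟨v, hv⟩
    have h1 := E1 (p' := p') (by norm_num) hv
    have h2 : dF p p' = 0 := by rw [dF, h, sub_self, norm_zero]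
    rw [h2] at h1
    simp only [zero_div, mul_zero] at h1
    exact hS_inj (dist_le_zero.1 h1)
  intro p p' h
  rcases home_or_X0 p with h1 | h1
  · exact key p p' h h1
  · rcases home_or_X0 p' with h2 | h2
    · exact (key p' p h.symm h2).symm
    · rw [h1, h2]

theorem sc_replicate (j : ℕ) : sc (List.replicate j 0) = (1 / 2) ^ j := by simp [sc]

theorem FF_cont : Continuous (FF : SS m → LL m) := by
  rw [continuous_iff_continuousAt]
  intro p
  rw [ContinuousAt, tendsto_iff_norm_sub_tendsto_zero]
  rcases home_or_X0 p with ⟨v, hv⟩ | rfl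
  · have hR := home_RR (by norm_num) hv
    have hc : Tendsto (fun x => 50 * CK m * sc v * dist (hS v x) (hS v p)) (𝓝 p) (𝓝 0) := by
      have h1 := ((hS_contAt (aw_ne_Np hR.1)).tendsto.dist (tendsto_const_nhds (x := hS v p))).const_mul (50 * CK m * sc v)
      rwa [dist_self, mul_zero] at h1
    refine squeeze_zero' (Eventually.of_forall fun _ => norm_nonneg _) ?_ hc
    filter_upwards [(isOpen_RR v).mem_nhds hR] with x hx
    exact E2 hx hR
  · rw [Metric.tendsto_nhds]
    intro ε hε
    obtain ⟨j, hj⟩ := exists_pow_lt_of_lt_one (by positivity : 0 < ε / 16) (by norm_num : (1 / 2 : ℝ) < 1)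
    have h1 : ∀ᶠ x in 𝓝 (X0 m), aw (List.replicate j 0) x ≠ 0 :=
      (isOpen_ne_fun (aw_cont _) continuous_const).mem_nhds (by
        change aw _ (X0 m) ≠ 0; rw [aw_X0]; norm_num)
    filter_upwards [h1] with x hx
    have h2 := E3 hx (by rw [aw_X0]; norm_num : aw (List.replicate j 0) (X0 m) ≠ 0)
    rw [sc_replicate] at h2
    rw [Real.dist_eq, sub_zero, abs_of_nonneg (norm_nonneg _)]
    change dF x (X0 m) < ε
    linarith

def XX (m : ℕ) : Type := SS m

instance : MetricSpace (XX m) := MetricSpace.induced (FF : SS m → LL m) FF_inj inferInstance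

def toX (p : SS m) : XX m := p
def toS (x : XX m) : SS m := x

theorem dist_X (x y : XX m) : dist x y = dF (toS x) (toS y) := dist_eq_norm (FF (toS x)) (FF (toS y))
theorem toX_cont : Continuous (toX : SS m → XX m) := continuous_induced_rng.2 FF_cont

def XH (m : ℕ) : SS m ≃ₜ XX m :=
  Continuous.homeoOfEquivCompactToT2 (f := (⟨toX, toS, fun _ => rfl, fun _ => rfl⟩ : SS m ≃ XX m)) toX_cont

theorem XH_apply (p : SS m) : XH m p = toX p := rfl
theorem toS_cont : Continuous (toS : XX m → SS m) := (XH m).symm.continuous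
instance : CompactSpace (XX m) := (XH m).compactSpace

end
end BD

namespace BD
open Set Metric Filter Topology MeasureTheory
open scoped ENNReal NNReal

noncomputable section

variable {m : ℕ}

theorem hM_img {X Y : Type} [MetricSpace X] [MetricSpace Y] (n : ℕ) {K : ℝ} (hK : 0 ≤ K) {f : X → Y} {s : Set X}
    (h : ∀ x ∈ s, ∀ y ∈ s, dist (f x) (f y) ≤ K * dist x y) :
    hausdorffM Y n (f '' s) ≤ ENNReal.ofReal (K ^ n) * hausdorffM X n s := by
  have h1 : LipschitzOnWith K.toNNReal f s := LipschitzOnWith.of_dist_le_mul fun x hx y hy => by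
    rw [Real.coe_toNNReal _ hK]; exact h x hx y hy
  refine (hM_image_le (Nat.cast_nonneg n) h1).trans_eq ?_
  rw [ENNReal.rpow_natCast, ENNReal.ofReal_pow hK]; rfl

theorem hSu (n : ℕ) : ∃ C : ℝ, 0 < C ∧ ∀ (q : EucSphere n) (ρ : ℝ), 0 ≤ ρ →
    hausdorffM (EucSphere n) n (closedBall q ρ) ≤ ENNReal.ofReal (C * ρ ^ n) := by
  obtain ⟨C, h⟩ := hS_upper n
  refine ⟨C + 1, by positivity, fun q ρ hρ => ?_⟩
  have := h q ρ.toNNReal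
  rw [Real.coe_toNNReal _ hρ] at this
  refine this.trans ?_
  have e : (C : ℝ≥0∞) * (ρ.toNNReal : ℝ≥0∞) ^ n = ENNReal.ofReal (C * ρ ^ n) := by
    rw [ENNReal.ofReal_mul C.coe_nonneg, ENNReal.ofReal_pow hρ, ENNReal.ofReal_coe_nnreal]; rfl
  rw [e]
  apply ENNReal.ofReal_le_ofReal
  have : 0 ≤ ρ ^ n := by positivity
  linarith

theorem hSl (n : ℕ) : ∃ c : ℝ, 0 < c ∧ ∀ (q : EucSphere n) (ρ : ℝ), 0 ≤ ρ → ρ ≤ 2 →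
    ENNReal.ofReal (c * ρ ^ n) ≤ hausdorffM (EucSphere n) n (closedBall q ρ) := by
  obtain ⟨c, hc, h⟩ := hS_lower n
  refine ⟨c, hc, fun q ρ hρ hρ2 => ?_⟩
  have := h q ρ.toNNReal (by rw [Real.toNNReal_le_iff_le_coe]; exact hρ2)
  rw [Real.coe_toNNReal _ hρ] at this
  refine le_trans (le_of_eq ?_) this
  rw [ENNReal.ofReal_mul c.coe_nonneg, ENNReal.ofReal_pow hρ, ENNReal.ofReal_coe_nnreal]; rfl

instance : Nonempty (SS m) := ⟨Np m⟩

theorem hS_injective (w : Wd) : Function.Injective (hS w : SS m → SS m) := fun _ _ h => hS_inj h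

theorem hS_surj (w : Wd) : Function.Surjective (hS w : SS m → SS m) := by
  intro q
  by_cases h : q = Np m
  · exact ⟨Np m, by simp [hS, h]⟩
  · exact ⟨io (hw w (jo q)), by rw [hS_io, io_jo h]⟩

theorem piece_le {w : Wd} {A : Set (SS m)} (hA : A ⊆ RR w) :
    hausdorffM (XX m) (m + 2 : ℕ) (toS ⁻¹' A) ≤ ENNReal.ofReal ((50 * CK m * sc w) ^ (m + 2)) *
      hausdorffM (SS m) (m + 2 : ℕ) (hS w '' A) := by
  have hK := CK_one (m := m)
  have e : toS ⁻¹' A = (fun q => toX (Function.invFun (hS w) q)) '' (hS w '' A) := by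
    rw [← image_comp]
    have : ∀ x : SS m, ((fun q => toX (Function.invFun (hS w) q)) ∘ hS w) x = toX x := fun x => by
      simp [Function.leftInverse_invFun (hS_injective w) x]
    rw [image_congr (fun x _ => this x)]
    ext x; constructor
    · intro h; exact ⟨_, h, rfl⟩
    · rintro ⟨y, hy, rfl⟩; exact hy
  rw [e]
  apply hM_img
  · have := sc_pos w; positivity
  · rintro _ ⟨p, hp, rfl⟩ _ ⟨p', hp', rfl⟩
    rw [Function.leftInverse_invFun (hS_injective w) p, Function.leftInverse_invFun (hS_injective w) p', dist_X]
    exact E2 (hA hp) (hA hp')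

/-- every point other than the limit point of a cell is in some piece -/
theorem cell_cover (w : Wd) {p : SS m} (h : aw w p ≠ 0) (h0 : p ≠ X0 m) : ∃ v : Wd, p ∈ RR (w ++ v) := by
  have h1 : ∃ j, aw (List.replicate j 0) p = 0 := by
    by_contra h1; push Not at h1; exact h0 (eq_X0 h1)
  obtain ⟨j, hj⟩ := h1
  have hb : ∀ v : Wd, aw (w ++ v) p ≠ 0 → v.length < 2 * j + 2 := by
    intro v hv
    by_contra hl
    refine deep_zero hv (k := j) ?_ hj
    simp; omega
  classical
  let P : ℕ → Prop := fun l => ∃ v : Wd, v.length = l ∧ aw (w ++ v) p ≠ 0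
  have hP0 : P 0 := ⟨[], rfl, by simpa using h⟩
  obtain ⟨v, hv1, hv2⟩ := Nat.findGreatest_spec (P := P) (Nat.zero_le (2 * j + 2)) hP0
  refine ⟨v, hv2, fun i => ?_⟩
  by_contra hi
  have h3 : aw (w ++ (v ++ [i])) p ≠ 0 := by
    rw [← List.append_assoc]; intro h; rw [h] at hi; norm_num at hi
  have h4 := Nat.le_findGreatest (P := P) (hb _ h3).le ⟨_, rfl, h3⟩
  simp only [List.length_append, List.length_singleton] at h4
  omega

theorem cell_measure (m : ℕ) (hm : 1 ≤ m) : ∃ C : ℝ, 0 < C ∧ ∀ w : Wd,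
    hausdorffM (XX m) (m + 2 : ℕ) (toS ⁻¹' {p : SS m | aw w p ≠ 0}) ≤ ENNReal.ofReal (C * sc w ^ (m + 2)) := by
  obtain ⟨C1, hC1, hu⟩ := hSu (m + 2)
  have hK := CK_one (m := m)
  set A : ℝ := (50 * CK m) ^ (m + 2) * (C1 * 2 ^ (m + 2)) with hA
  have hA0 : 0 < A := by positivity
  refine ⟨A * 2, by positivity, fun w => ?_⟩
  have hs := sc_pos w
  have huniv : ∀ B : Set (SS m), hausdorffM (SS m) (m + 2 : ℕ) B ≤ ENNReal.ofReal (C1 * 2 ^ (m + 2)) := fun B =>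
    (hM_mono (t := closedBall (Np m) 2) (fun q _ => by simpa using dist_le_two q (Np m))).trans (hu (Np m) 2 (by norm_num))
  have hpc : ∀ v : Wd, hausdorffM (XX m) (m + 2 : ℕ) (toS ⁻¹' (RR (w ++ v) : Set (SS m))) ≤
      ENNReal.ofReal (A * sc w ^ (m + 2)) * ENNReal.ofReal ((1 / 8) ^ v.length) := by
    intro v
    refine (piece_le subset_rfl).trans ((mul_le_mul_right (huniv _) _).trans ?_)
    rw [← ENNReal.ofReal_mul (by have := sc_pos (w ++ v); positivity), ← ENNReal.ofReal_mul (by positivity)]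
    apply ENNReal.ofReal_le_ofReal
    have e : sc (w ++ v) = sc w * (1 / 2) ^ v.length := by simp [sc, pow_add]
    have h8 : ((1 / 2 : ℝ) ^ v.length) ^ (m + 2) ≤ (1 / 8) ^ v.length := by
      rw [← pow_mul, mul_comm, pow_mul]
      gcongr
      calc (1 / 2 : ℝ) ^ (m + 2) ≤ (1 / 2) ^ 3 := pow_le_pow_of_le_one (by norm_num) (by norm_num) (by omega)
        _ = 1 / 8 := by norm_num
    calc _ = A * sc w ^ (m + 2) * ((1 / 2 : ℝ) ^ v.length) ^ (m + 2) := by rw [e, hA]; ring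
      _ ≤ _ := by gcongr
  have hsub : toS ⁻¹' {p : SS m | aw w p ≠ 0} ⊆ {toX (X0 m)} ∪ ⋃ j : ℕ, ⋃ f : Fin j → Fin 3,
      toS ⁻¹' (RR (w ++ List.ofFn f) : Set (SS m)) := by
    intro x hx
    by_cases h0 : toS x = X0 m
    · left; exact h0
    · right
      obtain ⟨v, hv⟩ := cell_cover w hx h0
      refine mem_iUnion.2 ⟨v.length, mem_iUnion.2 ⟨v.get, ?_⟩⟩
      rw [mem_preimage, List.ofFn_get]; exact hv
  refine (hM_mono hsub).trans ((hM_union_le _ _).trans ?_)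
  rw [hM_singleton (by positivity), zero_add]
  refine (hM_iUnion_le _).trans ?_
  have h1 : ∀ j : ℕ, hausdorffM (XX m) (m + 2 : ℕ) (⋃ f : Fin j → Fin 3, toS ⁻¹' (RR (w ++ List.ofFn f) : Set (SS m))) ≤
      ENNReal.ofReal (A * sc w ^ (m + 2)) * ENNReal.ofReal ((3 / 8) ^ j) := by
    intro j
    refine (hM_iUnion_le _).trans ?_
    rw [tsum_fintype]
    refine (Finset.sum_le_sum fun f _ => hpc (List.ofFn f)).trans_eq ?_
    simp only [List.length_ofFn, Finset.sum_const, Finset.card_univ, Fintype.card_fun, Fintype.card_fin, nsmul_eq_mul]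
    rw [mul_left_comm]
    congr 1
    rw [← ENNReal.ofReal_natCast, ← ENNReal.ofReal_mul (by positivity)]
    congr 1
    push_cast
    rw [← mul_pow]; norm_num
  refine (ENNReal.tsum_le_tsum h1).trans ?_
  rw [ENNReal.tsum_mul_left, ← ENNReal.ofReal_tsum_of_nonneg (fun _ => by positivity)
    (summable_geometric_of_lt_one (by norm_num) (by norm_num)), tsum_geometric_of_lt_one (by norm_num) (by norm_num),
    ← ENNReal.ofReal_mul (by positivity)]
  apply ENNReal.ofReal_le_ofReal
  have : 0 ≤ A * sc w ^ (m + 2) := by positivity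
  nlinarith

theorem FH (p : SS m) {r : ℝ} (hr : 0 < r) :
    (∃ u : Wd, aw u p = 1 ∧ (r ≤ 2 * sc u ∨ u = []) ∧ sc u ≤ 128 * CK m * r) ∨
    ∃ v : Wd, 1 / 2 ≤ th v p ∧ r ≤ sc v / (64 * CK m) := by
  have hK := CK_one (m := m)
  have hKr : r ≤ CK m * r := le_mul_of_one_le_left hr.le hK
  rcases lt_or_ge 1 r with h1 | h1
  · left
    exact ⟨[], aw_nil p, Or.inr rfl, by simp [sc]; linarith⟩
  · obtain ⟨L, hL1, hL2⟩ := exists_nat_pow_near_of_lt_one hr h1 (by norm_num : (0 : ℝ) < 1 / 2) (by norm_num)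
    rw [pow_succ] at hL1
    rcases home_or_full p L with ⟨w, hw, h⟩ | ⟨v, hv, h⟩
    · left
      have e : sc w = (1 / 2) ^ L := by rw [sc, hw]
      exact ⟨w, h, Or.inl (by rw [e]; linarith), by rw [e]; linarith⟩
    · have e : (1 / 2 : ℝ) ^ L ≤ sc v := pow_le_pow_of_le_one (by norm_num) (by norm_num) hv
      by_cases h2 : r ≤ sc v / (64 * CK m)
      · exact Or.inr ⟨v, h, h2⟩
      · left
        push Not at h2
        rw [div_lt_iff₀ (by positivity)] at h2
        rcases List.eq_nil_or_concat v with rfl | ⟨u, i, rfl⟩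
        · exact ⟨[], aw_nil p, Or.inr rfl, by linarith⟩
        · rw [List.concat_eq_append] at *
          have h3 : aw (u ++ [i]) p ≠ 0 := (home_RR (by norm_num) h).1
          rw [sc_snoc] at e h2
          exact ⟨u, aw_parent h3, Or.inl (by linarith), by linarith⟩

theorem F_ball {p p' : SS m} {u : Wd} {r : ℝ} (h : aw u p = 1) (h1 : r ≤ 2 * sc u ∨ u = []) (hd : dF p p' < r) : aw u p' ≠ 0 := by
  rcases h1 with h1 | rfl
  · exact E4 h (by linarith)
  · rw [aw_nil]; norm_num

theorem cap_th {v : Wd} {p p' : SS m} (h : 1 / 2 ≤ th v p) (hd : dist (hS v p) (hS v p') ≤ 1 / (16 * CK m)) : 1 / 4 ≤ th v p' := by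
  have hK := CK_one (m := m)
  have h1 := th_Lip v (p' := p') (home_RR (by norm_num) h).1
  rw [le_div_iff₀ (by positivity)] at hd
  have := (abs_le.1 h1).2
  linarith

theorem H_ball {v : Wd} {p p' : SS m} {r : ℝ} (h : 1 / 2 ≤ th v p) (hd : dF p p' < r) : dist (hS v p) (hS v p') ≤ 4 * (r / sc v) := by
  have h1 := E1 (p' := p') (by norm_num) h
  have h2 : dF p p' / sc v ≤ r / sc v := by
    have := sc_pos v; gcongr
  norm_num at h1
  linarith

theorem H_small {v : Wd} {r : ℝ} (h2 : r ≤ sc v / (64 * CK m)) : 4 * (r / sc v) ≤ 1 / (16 * CK m) := by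
  have hK := CK_one (m := m)
  have hs := sc_pos v
  rw [le_div_iff₀ (by positivity)] at h2 ⊢
  have e : 4 * (r / sc v) * (16 * CK m) = (r * (64 * CK m)) / sc v := by ring
  rw [e, div_le_one hs]; exact h2

theorem H_lower (m : ℕ) : ∃ c : ℝ, 0 < c ∧ ∀ (p : SS m) (v : Wd) (r : ℝ), 0 < r → 1 / 2 ≤ th v p → r ≤ sc v / (64 * CK m) →
    ENNReal.ofReal (c * r ^ (m + 2)) ≤ hausdorffM (XX m) (m + 2 : ℕ) (ball (toX p) r) := by
  obtain ⟨c, hc, hl⟩ := hSl (m + 2)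
  have hK := CK_one (m := m)
  refine ⟨c / (800 * CK m) ^ (m + 2), by positivity, fun p v r hr h h2 => ?_⟩
  have hs := sc_pos v
  set ρ := r / (100 * CK m * sc v) with hρ
  have hρ0 : 0 < ρ := by positivity
  have hρ1 : ρ ≤ 1 / (16 * CK m) := by
    refine le_trans ?_ (H_small h2)
    rw [hρ, ← mul_div_assoc, div_le_div_iff₀ (by positivity) hs]
    nlinarith [mul_pos hr hs]
  have hρ2 : ρ ≤ 2 := hρ1.trans (by rw [div_le_iff₀ (by positivity)]; linarith)
  set A : Set (SS m) := {p' | dist (hS v p') (hS v p) ≤ ρ} with hA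
  have hth : ∀ p' ∈ A, 1 / 4 ≤ th v p' := fun p' hp' => cap_th h (by rw [dist_comm]; exact le_trans hp' hρ1)
  have hsub : toS ⁻¹' A ⊆ ball (toX p) r := by
    intro x hx
    rw [mem_ball, dist_comm, dist_X]
    have h3 := E2 (home_RR (by norm_num) h) (home_RR (by norm_num) (hth (toS x) hx))
    have h4 : 50 * CK m * sc v * dist (hS v p) (hS v (toS x)) ≤ 50 * CK m * sc v * ρ := by
      rw [dist_comm]; gcongr; exact hx
    have h5 : 50 * CK m * sc v * ρ = r / 2 := by rw [hρ]; field_simp; norm_num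
    change dF p (toS x) < r
    linarith
  have himg : closedBall (hS v p) ρ ⊆ (fun x => hS v (toS x)) '' (toS ⁻¹' A) := by
    intro q hq
    obtain ⟨p', rfl⟩ := hS_surj v q
    exact ⟨toX p', hq, rfl⟩
  have h6 := hM_img (m + 2) (f := fun x : XX m => hS v (toS x)) (s := toS ⁻¹' A) (K := 8 / sc v) (by positivity) (by
    intro x hx y hy
    have := E1 (p' := toS y) (by norm_num) (hth (toS x) hx)
    rw [dist_X]
    refine this.trans_eq ?_
    field_simp; ring)
  have h7 := (hl (hS v p) ρ hρ0.le hρ2).trans ((hM_mono himg).trans (h6.trans (mul_le_mul_right (hM_mono hsub) _)))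
  have h8 : ENNReal.ofReal ((8 / sc v) ^ (m + 2)) ≠ 0 := by
    rw [Ne, ENNReal.ofReal_eq_zero, not_le]; positivity
  rw [← ENNReal.mul_le_mul_iff_right h8 ENNReal.ofReal_ne_top]
  refine le_trans (le_of_eq ?_) h7
  rw [← ENNReal.ofReal_mul (by positivity)]
  congr 1
  have e : 8 / sc v * (r / (800 * CK m)) = ρ := by rw [hρ]; field_simp; norm_num
  rw [← e]
  rw [mul_pow (8 / sc v), div_pow r (800 * CK m)]; ring

theorem exists_home {u : Wd} (hu : Prs u) : ∃ y : SS m, 1 / 2 ≤ th u y := by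
  by_cases h0 : u = []
  · subst h0
    refine ⟨Np m, ?_⟩
    rw [th_leaf, aw_nil]
    · norm_num
    · intro i; simp [aw]
  · obtain ⟨b, hb⟩ := omg_half m
    have h1 : aw u (io (hw u b)) = 1 / 2 := by rw [aw_eq h0 hu (io_ne _), jo_io, hwI_hw, hb]
    refine ⟨io (hw u b), ?_⟩
    rw [th_leaf, h1]
    intro i
    by_contra hi
    have := aw_parent hi
    linarith

theorem aw_prs {u : Wd} {p : SS m} (h : aw u p ≠ 0) : Prs u := by
  by_cases h0 : u = []
  · subst h0; intro v i h; simp at h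
  · exact ((aw_ne h0).1 h).1

theorem diam_X_le : diam (univ : Set (XX m)) ≤ 16 := by
  refine diam_le_of_forall_dist_le (by norm_num) fun x _ y _ => ?_
  rw [dist_X]
  have := E3 (w := []) (p := toS x) (p' := toS y) (by rw [aw_nil]; norm_num) (by rw [aw_nil]; norm_num)
  simpa [sc] using this

theorem ball_upper (m : ℕ) (hm : 1 ≤ m) : ∃ C : ℝ, 0 < C ∧ ∀ (x : XX m) (r : ℝ), 0 < r →
    hausdorffM (XX m) (m + 2 : ℕ) (ball x r) ≤ ENNReal.ofReal (C * r ^ (m + 2)) := by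
  obtain ⟨C1, hC1, h1⟩ := cell_measure m hm
  obtain ⟨C2, hC2, h2⟩ := hSu (m + 2)
  have hK := CK_one (m := m)
  refine ⟨C1 * (128 * CK m) ^ (m + 2) + (50 * CK m) ^ (m + 2) * (C2 * 4 ^ (m + 2)), by positivity, fun x r hr => ?_⟩
  rcases FH (toS x) hr with ⟨u, ha, hb, hc⟩ | ⟨v, ha, hb⟩
  · have hsub : ball x r ⊆ toS ⁻¹' {p : SS m | aw u p ≠ 0} := by
      intro y hy
      rw [mem_ball, dist_comm, dist_X] at hy
      exact F_ball ha hb hy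
    refine (hM_mono hsub).trans ((h1 u).trans (ENNReal.ofReal_le_ofReal ?_))
    have := sc_pos u
    calc C1 * sc u ^ (m + 2) ≤ C1 * (128 * CK m * r) ^ (m + 2) := by gcongr
      _ = C1 * (128 * CK m) ^ (m + 2) * r ^ (m + 2) := by rw [mul_pow _ r]; ring
      _ ≤ _ := by
        apply mul_le_mul_of_nonneg_right _ (by positivity)
        have : 0 ≤ (50 * CK m) ^ (m + 2) * (C2 * 4 ^ (m + 2)) := by positivity
        linarith
  · have hs := sc_pos v
    set A : Set (SS m) := {p' | dist (hS v (toS x)) (hS v p') ≤ 4 * (r / sc v)} with hA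
    have hsub : ball x r ⊆ toS ⁻¹' A := by
      intro y hy
      rw [mem_ball, dist_comm, dist_X] at hy
      exact H_ball ha hy
    have hAR : A ⊆ RR v := fun p' hp' => home_RR (by norm_num) (cap_th ha (le_trans hp' (H_small hb)))
    have hi : hS v '' A ⊆ closedBall (hS v (toS x)) (4 * (r / sc v)) := by
      rintro _ ⟨p', hp', rfl⟩
      rw [mem_closedBall, dist_comm]; exact hp'
    refine (hM_mono hsub).trans ((piece_le hAR).trans ((mul_le_mul_right ((hM_mono hi).trans (h2 _ _ (by positivity))) _).trans ?_))
    rw [← ENNReal.ofReal_mul (by positivity)]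
    apply ENNReal.ofReal_le_ofReal
    have e : sc v * (r / sc v) = r := by field_simp
    calc (50 * CK m * sc v) ^ (m + 2) * (C2 * (4 * (r / sc v)) ^ (m + 2))
        = (50 * CK m) ^ (m + 2) * (C2 * 4 ^ (m + 2)) * (sc v * (r / sc v)) ^ (m + 2) := by
          simp only [mul_pow]; ring
      _ = (50 * CK m) ^ (m + 2) * (C2 * 4 ^ (m + 2)) * r ^ (m + 2) := by rw [e]
      _ ≤ _ := by
        apply mul_le_mul_of_nonneg_right _ (by positivity)
        have : 0 ≤ C1 * (128 * CK m) ^ (m + 2) := by positivity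
        linarith

theorem ball_lower (m : ℕ) : ∃ c : ℝ, 0 < c ∧ ∀ (x : XX m) (r : ℝ), 0 < r → r ≤ 16 →
    ENNReal.ofReal (c * r ^ (m + 2)) ≤ hausdorffM (XX m) (m + 2 : ℕ) (ball x r) := by
  obtain ⟨c, hc, hl⟩ := H_lower m
  have hK := CK_one (m := m)
  refine ⟨c * (1 / (4096 * CK m * (256 * CK m))) ^ (m + 2), by positivity, fun x r hr hr16 => ?_⟩
  set r' := r / (4096 * CK m) with hr'
  have hr'0 : 0 < r' := by positivity
  have e : r' * (4096 * CK m) = r := by rw [hr']; field_simp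
  have hr'r : r' ≤ r := by nlinarith
  have e2 : c * (1 / (4096 * CK m * (256 * CK m))) ^ (m + 2) * r ^ (m + 2) = c * (r' / (256 * CK m)) ^ (m + 2) := by
    rw [mul_assoc, ← mul_pow]; congr 2; rw [hr']; field_simp
  rw [e2]
  have h256 : r' / (256 * CK m) ≤ r' := div_le_self hr'0.le (by linarith)
  rcases FH (toS x) hr'0 with ⟨u, ha, hb, hd⟩ | ⟨v, ha, hb⟩
  · have hs := sc_pos u
    have hu1 : r' ≤ 2 * sc u := by
      rcases hb with h | rfl
      · exact h
      · simp [sc]; rw [hr', div_le_iff₀ (by positivity)]; nlinarith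
    obtain ⟨y, hy⟩ := exists_home (m := m) (aw_prs (p := toS x) (by rw [ha]; norm_num))
    have hle : r' / (256 * CK m) ≤ sc u / (64 * CK m) := by
      rw [div_le_div_iff₀ (by positivity) (by positivity)]; nlinarith
    have h1 := hl y u (r' / (256 * CK m)) (by positivity) hy hle
    refine h1.trans (hM_mono ?_)
    intro z hz
    rw [mem_ball, dist_comm, dist_X] at hz
    have h2 := H_ball hy hz
    have h3 := home_RR (by norm_num) (cap_th hy (h2.trans (H_small hle)))
    rw [mem_ball, dist_comm, dist_X]
    have h4 := E3 (p := toS x) (p' := toS z) (by rw [ha]; norm_num) h3.1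
    have h5 : 16 * sc u ≤ r / 2 := by nlinarith
    linarith
  · have hs := sc_pos v
    have h1 := hl (toS x) v (r' / (256 * CK m)) (by positivity) ha (h256.trans hb)
    exact h1.trans (hM_mono (ball_subset_ball (h256.trans hr'r)))

theorem XX_AR (m : ℕ) (hm : 1 ≤ m) : AhlforsRegular (XX m) (m + 2) := by
  obtain ⟨C, hC, hu⟩ := ball_upper m hm
  obtain ⟨c, hc, hl⟩ := ball_lower m
  refine ⟨max 1 (max C c⁻¹), le_max_left _ _, fun x r hr hrd => ⟨?_, ?_⟩⟩
  · refine le_trans (ENNReal.ofReal_le_ofReal ?_) (hl x r hr (hrd.trans diam_X_le))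
    gcongr
    rw [inv_le_comm₀ (by positivity) hc]
    exact (le_max_right _ _).trans (le_max_right _ _)
  · refine (hu x r hr).trans (ENNReal.ofReal_le_ofReal ?_)
    gcongr
    exact (le_max_left _ _).trans (le_max_right _ _)

end
end BD

namespace BD
open Set Metric Filter Topology MeasureTheory
open scoped ENNReal NNReal

noncomputable section

variable {m : ℕ}

theorem homotopic_of {X : Type} [MetricSpace X] {x : X} {r R : ℝ} (hr : 0 < r) (h : ball x r ⊆ ball x R) (H : ℝ → X → X) (c : X)
    (hc : ContinuousOn (Function.uncurry H) (Icc 0 1 ×ˢ ball x r)) (hmem : ∀ t ∈ Icc (0 : ℝ) 1, ∀ y ∈ ball x r, H t y ∈ ball x R)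
    (h0 : ∀ y ∈ ball x r, H 0 y = y) (h1 : ∀ y ∈ ball x r, H 1 y = c) :
    ∃ (h : ball x r ⊆ ball x R) (y : ball x R), ContinuousMap.Homotopic ⟨Set.inclusion h, continuous_inclusion h⟩
        (ContinuousMap.const _ y) := by
  have hcm : c ∈ ball x R := by
    have := hmem 1 (by norm_num) x (mem_ball_self hr)
    rwa [h1 x (mem_ball_self hr)] at this
  refine ⟨h, ⟨c, hcm⟩, ⟨{ toFun := fun z => ⟨H z.1 z.2, hmem z.1 z.1.2 z.2 z.2.2⟩, continuous_toFun := ?_, map_zero_left := ?_, map_one_left := ?_ }⟩⟩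
  · refine Continuous.subtype_mk ?_ _
    have : Continuous (fun z : unitInterval × ball x r => ((z.1 : ℝ), (z.2 : X))) := by fun_prop
    exact hc.comp_continuous this fun z => ⟨z.1.2, z.2.2⟩
  · intro y; exact Subtype.ext (h0 y y.2)
  · intro y; exact Subtype.ext (h1 y y.2)

/-- contraction of a child cell in its parent, in model coordinates -/
def Hc (i : Fin 3) (t : ℝ) (b : PP m) : PP m :=
  if i = 0 then ((1 - t) * b.1 + t * (5 / 2), (1 - t) * b.2.1 + t * (5 / 2), (1 - t) • b.2.2)
  else ((1 - max (2 * t - 1) 0) * b.1, (1 - min (2 * t) 1) * b.2.1 + min (2 * t) 1 * (29 / 10 * sg i), (1 - max (2 * t - 1) 0) • b.2.2)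

theorem Hc_cont (i : Fin 3) : Continuous (Function.uncurry (Hc (m := m) i)) := by
  unfold Function.uncurry Hc
  split_ifs
  · fun_prop
  · fun_prop

theorem Hc_zero (i : Fin 3) (b : PP m) : Hc i 0 b = b := by
  unfold Hc; split_ifs
  · simp
  · simp

theorem Hc_one (i : Fin 3) (b b' : PP m) : Hc i 1 b = Hc i 1 b' := by
  unfold Hc; split_ifs
  · simp
  · norm_num

theorem Hc_maps (i : Fin 3) {t : ℝ} (ht : t ∈ Icc (0 : ℝ) 1) {b : PP m} (hb : b ∈ UB m) : Hc i t (hm i b) ∈ UU m := by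
  obtain ⟨t0, t1⟩ := ht
  by_cases hi : i = 0
  · subst hi
    obtain ⟨h1, h2, h3⟩ := hm_zero_box ((UB_norm hb).trans (by norm_num))
    set c := hm 0 b
    unfold Hc; rw [if_pos rfl]
    rw [abs_le] at h1 h2
    have a1 : |(1 - t) * c.1 + t * (5 / 2)| < 3 := by rw [abs_lt]; constructor <;> nlinarith
    have a2 : 2 < (1 - t) * c.2.1 + t * (5 / 2) := by nlinarith
    have a3 : (1 - t) * c.2.1 + t * (5 / 2) < 3 := by nlinarith
    refine ⟨a1, abs_lt.2 ⟨by simp only; linarith, by simpa using a3⟩, ?_, Or.inl (lt_abs.2 (Or.inl (by simp only; linarith)))⟩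
    simp only [norm_smul, Real.norm_eq_abs]
    rw [abs_of_nonneg (by linarith)]
    nlinarith [norm_nonneg c.2.2]
  · have hC := hm_maps_Con hi hb
    obtain ⟨h1, h2, h3, h4⟩ := hC
    set c := hm i b
    apply Con_sub_UU (sg_abs i)
    unfold Hc; rw [if_neg hi]
    set s := max (2 * t - 1) 0 with hs
    set s1 := min (2 * t) 1 with hs1
    have s0 : 0 ≤ s := le_max_right _ _
    have s01 : s ≤ 1 := max_le (by linarith) (by norm_num)
    have s10 : 0 ≤ s1 := le_min (by linarith) (by norm_num)
    have s11 : s1 ≤ 1 := min_le_right _ _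
    have hor : s = 0 ∨ s1 = 1 := by
      rcases le_total (2 * t) 1 with h | h
      · left; exact max_eq_right (by linarith)
      · right; exact min_eq_right h
    have hsg : sg i * sg i = 1 := by rcases sg_cases i with h | h <;> rw [h] <;> norm_num
    have hb2 : |sg i| = 1 := sg_abs i
    refine ⟨?_, ?_, ?_, ?_⟩
    · simp only; rw [abs_mul, abs_of_nonneg (by linarith)]; nlinarith [abs_nonneg c.1]
    · simp only
      rcases eq_or_lt_of_le s11 with h | h
      · rw [h]; rw [sub_self, zero_mul, zero_add, one_mul, abs_mul, hb2]; norm_num [abs_of_nonneg]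
      · refine (abs_add_le _ _).trans_lt ?_
        rw [abs_mul, abs_mul, abs_mul, hb2, abs_of_nonneg (by linarith : 0 ≤ 1 - s1), abs_of_nonneg s10,
          abs_of_nonneg (by norm_num : (0 : ℝ) ≤ 29 / 10)]
        nlinarith
    · simp only [norm_smul, Real.norm_eq_abs]
      rw [abs_of_nonneg (by linarith)]
      nlinarith [norm_nonneg c.2.2]
    · simp only
      rcases hor with h | h
      · rw [h, sub_zero, one_smul]
        rcases h4 with h4 | h4
        · left
          have e : sg i * ((1 - s1) * c.2.1 + s1 * (29 / 10 * sg i)) = (1 - s1) * (sg i * c.2.1) + s1 * (29 / 10) := by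
            linear_combination s1 * (29 / 10) * hsg
          rw [e]
          generalize sg i * c.2.1 = y at h4 ⊢
          nlinarith [mul_nonneg (sub_nonneg.2 s11) (sub_nonneg.2 h4.le), mul_nonneg s10 (sub_nonneg.2 h4.le)]
        · right; exact h4
      · left
        rw [h]
        have e : sg i * ((1 - 1) * c.2.1 + 1 * (29 / 10 * sg i)) = 29 / 10 := by linear_combination (29 / 10) * hsg
        rw [e]; norm_num

/-- normalized segment between points of the sphere -/
theorem norm_seg {q q' : SS m} {ρ t : ℝ} (hρ : ρ ≤ 1 / 16) (h : dist q q' ≤ ρ) (ht : t ∈ Icc (0 : ℝ) 1) :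
    ‖((1 - t) • (q' : Vv m) + t • (q : Vv m)) - q‖ ≤ ρ ∧ 15 / 16 ≤ ‖((1 - t) • (q' : Vv m) + t • (q : Vv m))‖ := by
  obtain ⟨t0, t1⟩ := ht
  rw [Subtype.dist_eq, dist_comm, dist_eq_norm] at h
  have h1 : ‖((1 - t) • (q' : Vv m) + t • (q : Vv m)) - q‖ ≤ ρ := by
    have e : ((1 - t) • (q' : Vv m) + t • (q : Vv m)) - q = (1 - t) • ((q' : Vv m) - q) := by module
    rw [e, norm_smul, Real.norm_of_nonneg (by linarith)]
    nlinarith [norm_nonneg ((q' : Vv m) - q)]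
  refine ⟨h1, ?_⟩
  have h2 := norm_sub_norm_le (q : Vv m) ((1 - t) • (q' : Vv m) + t • (q : Vv m))
  rw [norm_sub_rev, norm_SS] at h2
  linarith

open Classical in
def nz (z : Vv m) : SS m := if h : z = 0 then Np m else ⟨‖z‖⁻¹ • z, by
  rw [mem_sphere_zero_iff_norm, norm_smul, norm_inv, norm_norm, inv_mul_cancel₀ (norm_ne_zero_iff.2 h)]⟩

theorem nz_coe {z : Vv m} (h : z ≠ 0) : (nz z : Vv m) = ‖z‖⁻¹ • z := by rw [nz, dif_neg h]

theorem nz_self (q : SS m) : nz (q : Vv m) = q := by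
  apply Subtype.ext
  rw [nz_coe (by rw [← norm_ne_zero_iff, norm_SS]; norm_num), norm_SS]; simp

theorem nz_cont : ContinuousOn (nz : Vv m → SS m) {0}ᶜ := by
  rw [continuousOn_iff_continuous_restrict]
  refine Continuous.congr (f := fun z : ({0}ᶜ : Set (Vv m)) => (⟨‖(z : Vv m)‖⁻¹ • (z : Vv m), by
    rw [mem_sphere_zero_iff_norm, norm_smul, norm_inv, norm_norm, inv_mul_cancel₀ (norm_ne_zero_iff.2 z.2)]⟩ : SS m)) ?_ ?_
  · refine Continuous.subtype_mk ?_ _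
    refine Continuous.smul (Continuous.inv₀ (by fun_prop) fun z => norm_ne_zero_iff.2 z.2) (by fun_prop)
  · intro z; apply Subtype.ext; simp only [restrict_apply]; rw [nz_coe z.2]

theorem nz_dist {z : Vv m} (h : z ≠ 0) (q : SS m) : dist (nz z) q ≤ 2 * ‖z - q‖ := by
  rw [Subtype.dist_eq, nz_coe h, dist_eq_norm]
  have h1 : ‖‖z‖⁻¹ • z - z‖ ≤ ‖z - q‖ := by
    have e : ‖z‖⁻¹ • z - z = (‖z‖⁻¹ * (1 - ‖z‖)) • z := by
      have : ‖z‖⁻¹ * (1 - ‖z‖) = ‖z‖⁻¹ - 1 := by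
        have := norm_ne_zero_iff.2 h; field_simp
      rw [this]; module
    rw [e, norm_smul, norm_mul, norm_inv, norm_norm, mul_assoc, mul_comm ‖1 - ‖z‖‖, ← mul_assoc,
      inv_mul_cancel₀ (norm_ne_zero_iff.2 h), one_mul, Real.norm_eq_abs]
    have h2 := abs_norm_sub_norm_le (q : Vv m) z
    rw [norm_SS, norm_sub_rev] at h2
    exact h2
  have : ‖z‖⁻¹ • z - q = (‖z‖⁻¹ • z - z) + (z - q) := by abel
  rw [this]
  exact (norm_add_le _ _).trans (by linarith)

def gI (v : Wd) (q : SS m) : XX m := toX (Function.invFun (hS v) q)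
theorem gI_hS (v : Wd) (p : SS m) : gI v (hS v p) = toX p := by
  rw [gI, Function.leftInverse_invFun (hS_injective v)]
theorem gI_contOn (v : Wd) : ContinuousOn (gI v : SS m → XX m) (hS v '' RR v) := by
  have : LipschitzOnWith (50 * CK m * sc v).toNNReal (gI v : SS m → XX m) (hS v '' RR v) := by
    refine LipschitzOnWith.of_dist_le_mul ?_
    rintro _ ⟨p, hp, rfl⟩ _ ⟨p', hp', rfl⟩
    have hK := CK_one (m := m)
    have hs := sc_pos v
    rw [gI_hS, gI_hS, dist_X, Real.coe_toNNReal _ (by positivity)]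
    exact E2 hp hp'
  exact this.continuousOn

def Zt (v : Wd) (q : SS m) (t : ℝ) (y : XX m) : Vv m := (1 - t) • (hS v (toS y) : Vv m) + t • (q : Vv m)

theorem Zt_contOn {v : Wd} {q : SS m} {S : Set (XX m)} (h : ∀ y ∈ S, toS y ∈ RR v) :
    ContinuousOn (fun z : ℝ × XX m => Zt v q z.1 z.2) (Icc 0 1 ×ˢ S) := by
  have h1 : ContinuousOn (fun z : ℝ × XX m => (hS v (toS z.2))) (Icc 0 1 ×ˢ S) := by
    intro z hz
    have h2 : toS z.2 ∈ RR v := h _ hz.2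
    have : ContinuousAt (fun z : ℝ × XX m => hS v (toS z.2)) z :=
      ContinuousAt.comp (f := fun z : ℝ × XX m => toS z.2) (g := hS v) (hS_contAt (aw_ne_Np h2.1)) (toS_cont.comp continuous_snd).continuousAt
    exact this.continuousWithinAt
  have h3 : ContinuousOn (fun z : ℝ × XX m => (hS v (toS z.2) : Vv m)) (Icc 0 1 ×ˢ S) :=
    continuous_subtype_val.comp_continuousOn h1
  have h4 : ContinuousOn (fun z : ℝ × XX m => 1 - z.1) (Icc 0 1 ×ˢ S) := continuousOn_const.sub continuousOn_fst
  exact ContinuousOn.add (h4.smul h3) (ContinuousOn.smul continuousOn_fst continuousOn_const)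

theorem LLC_H {x : XX m} {r : ℝ} {v : Wd} (hr : 0 < r) (ha : 1 / 2 ≤ th v (toS x)) (hb : 2 * r ≤ sc v / (64 * CK m))
    (hball : ball x r ⊆ ball x (10000 * CK m * r)) :
    ∃ (h : ball x r ⊆ ball x (10000 * CK m * r)) (y : ball x (10000 * CK m * r)),
      ContinuousMap.Homotopic ⟨Set.inclusion h, continuous_inclusion h⟩ (ContinuousMap.const _ y) := by
  have hK := CK_one (m := m)
  have hKr : 0 < CK m * r := by positivity
  have hs := sc_pos v
  obtain ⟨ρ, hρ⟩ : ∃ ρ, ρ = 4 * (r / sc v) := ⟨_, rfl⟩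
  have hρ0 : 0 ≤ ρ := by rw [hρ]; positivity
  have hρ2 : 2 * ρ ≤ 1 / (16 * CK m) := by
    have := H_small hb
    rw [hρ]; refine le_trans (le_of_eq ?_) this; ring
  have hρ16 : ρ ≤ 1 / 16 := by
    have : 1 / (16 * CK m) ≤ 1 / 16 := by
      rw [div_le_div_iff₀ (by positivity) (by norm_num)]; linarith
    linarith
  have hcap : ∀ p' : SS m, dist (hS v (toS x)) (hS v p') ≤ 2 * ρ → p' ∈ RR v := fun p' h =>
    home_RR (by norm_num) (cap_th ha (h.trans hρ2))
  have hy : ∀ y ∈ ball x r, dist (hS v (toS x)) (hS v (toS y)) ≤ ρ := by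
    intro y hy
    rw [mem_ball, dist_comm, dist_X] at hy
    rw [hρ]
    exact H_ball ha hy
  obtain ⟨q, hq⟩ : ∃ q, q = hS v (toS x) := ⟨_, rfl⟩
  rw [← hq] at hcap hy
  have hZ0 : ∀ t ∈ Icc (0 : ℝ) 1, ∀ y ∈ ball x r, Zt v q t y ≠ 0 := by
    intro t ht y h h0
    have := (norm_seg hρ16 (hy y h) ht).2
    unfold Zt at h0
    rw [h0, norm_zero] at this; norm_num at this
  have hZd : ∀ t ∈ Icc (0 : ℝ) 1, ∀ y ∈ ball x r, dist (nz (Zt v q t y)) q ≤ 2 * ρ := by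
    intro t ht y h
    have h1 : ‖Zt v q t y - q‖ ≤ ρ := (norm_seg hρ16 (hy y h) ht).1
    have h2 := nz_dist (hZ0 t ht y h) q
    linarith
  have hZm : ∀ t ∈ Icc (0 : ℝ) 1, ∀ y ∈ ball x r, ∃ p' ∈ RR v, nz (Zt v q t y) = hS v p' := by
    intro t ht y h
    obtain ⟨p', hp'⟩ := hS_surj v (nz (Zt v q t y))
    refine ⟨p', hcap p' ?_, hp'.symm⟩
    rw [hp', dist_comm]; exact hZd t ht y h
  have h2 := Zt_contOn (v := v) (q := q) (S := ball x r) fun y h => hcap _ ((hy y h).trans (by linarith))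
  refine homotopic_of hr hball (fun t y => gI v (nz (Zt v q t y))) x ?_ ?_ ?_ ?_
  · have h3 : ContinuousOn (fun z : ℝ × XX m => nz (Zt v q z.1 z.2)) (Icc 0 1 ×ˢ ball x r) :=
      nz_cont.comp h2 fun z hz => hZ0 z.1 hz.1 z.2 hz.2
    refine (gI_contOn v).comp h3 fun z hz => ?_
    obtain ⟨p', hp', h⟩ := hZm z.1 hz.1 z.2 hz.2
    exact ⟨p', hp', h.symm⟩
  · intro t ht y h
    obtain ⟨p', hp', h'⟩ := hZm t ht y h
    rw [h', gI_hS, mem_ball, dist_X]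
    have h1 := E2 hp' (home_RR (by norm_num) ha)
    have h2 := hZd t ht y h
    rw [h'] at h2
    rw [← hq] at h1
    have h3 : 50 * CK m * sc v * dist (hS v p') q ≤ 50 * CK m * sc v * (2 * ρ) := by gcongr
    have h4 : 50 * CK m * sc v * (2 * ρ) = 400 * (CK m * r) := by rw [hρ]; field_simp; ring
    change dF p' (toS x) < _
    linarith
  · intro y h
    rw [Zt, sub_zero, one_smul, zero_smul, add_zero, nz_self, gI_hS]; rfl
  · intro y h
    rw [Zt, sub_self, one_smul, zero_smul, zero_add, nz_self, hq, gI_hS]; rfl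

theorem XX_LLC (m : ℕ) : LinearlyLocallyContractible (XX m) := by
  have hK := CK_one (m := m)
  refine ⟨10000 * CK m, by linarith, fun x r hr hrd => ?_⟩
  have hr16 : r * (10000 * CK m) < 16 := by
    rw [lt_div_iff₀ (by positivity)] at hrd
    exact hrd.trans_le diam_X_le
  have hCr : r ≤ 10000 * CK m * r := le_mul_of_one_le_left hr.le (by linarith)
  have hKr : 0 < CK m * r := by positivity
  have hball : ball x r ⊆ ball x (10000 * CK m * r) := ball_subset_ball hCr
  rcases FH (toS x) (by linarith : 0 < 2 * r) with ⟨u, ha, hb, hc⟩ | ⟨v, ha, hb⟩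
  · have hu : u ≠ [] := by
      rintro rfl
      have : sc [] = 1 := by simp [sc]
      rw [this] at hc
      linarith
    obtain ⟨w, i, rfl⟩ : ∃ w i, u = w ++ [i] := by
      rcases List.eq_nil_or_concat u with h | ⟨w, i, h⟩
      · exact absurd h hu
      · exact ⟨w, i, by rw [h, List.concat_eq_append]⟩
    rw [sc_snoc] at hc
    have hy : ∀ y ∈ ball x r, aw (w ++ [i]) (toS y) ≠ 0 := by
      intro y hy
      rw [mem_ball, dist_comm, dist_X] at hy
      exact F_ball ha hb (by linarith)
    have hy2 : ∀ y ∈ ball x r, toS y ≠ Np m ∧ ∃ b ∈ UB m, hwI w (jo (toS y)) = hm i b := by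
      intro y h
      obtain ⟨-, h1, h2⟩ := (aw_ne (snoc_ne w i)).1 (hy y h)
      refine ⟨h1, _, UU_sub_UB h2, ?_⟩
      rw [hwI_snoc, hm_hI]
    have hpw : Prs w := (prs_child.1 (aw_prs (hy x (mem_ball_self hr)))).prs
    refine homotopic_of hr hball (fun t y => toX (io (hw w (Hc i t (hwI w (jo (toS y)))))))
      (toX (io (hw w (Hc i 1 0)))) ?_ ?_ ?_ ?_
    · refine (toX_cont.comp (io_cont.comp (hw_cont w))).comp_continuousOn ?_
      have h1 : ContinuousOn (fun z : ℝ × XX m => (z.1, hwI w (jo (toS z.2)))) (Icc 0 1 ×ˢ ball x r) := by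
        refine ContinuousOn.prodMk continuousOn_fst ?_
        refine (hwI_cont w).comp_continuousOn ?_
        intro z hz
        have : ContinuousAt (fun z : ℝ × XX m => jo (toS z.2)) z :=
          ContinuousAt.comp (f := fun z : ℝ × XX m => toS z.2) (g := jo) (jo_contAt (hy2 z.2 hz.2).1) (toS_cont.comp continuous_snd).continuousAt
        exact this.continuousWithinAt
      exact (Hc_cont i).comp_continuousOn h1
    · intro t ht y h
      obtain ⟨h1, b, hb, hb'⟩ := hy2 y h
      have h3 : aw w (io (hw w (Hc i t (hwI w (jo (toS y)))))) ≠ 0 := by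
        by_cases hw0 : w = []
        · subst hw0; rw [aw_nil]; norm_num
        · rw [aw_ne hw0]
          refine ⟨hpw, io_ne _, ?_⟩
          rw [jo_io, hwI_hw, hb']
          exact Hc_maps i ht hb
      have h4 : aw w (toS x) ≠ 0 := by rw [aw_parent (hy x (mem_ball_self hr))]; norm_num
      have h5 := E3 h4 h3
      rw [mem_ball, dist_comm, dist_X]
      change dF (toS x) (io _) < _
      linarith
    · intro y h
      obtain ⟨h1, -⟩ := hy2 y h
      rw [Hc_zero, hw_hwI, io_jo h1]; rfl
    · intro y h
      rw [Hc_one i _ 0]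
  · exact LLC_H hr ha hb hball

end
end BD

namespace BD
open Set Metric Filter Topology MeasureTheory
open scoped ENNReal NNReal

noncomputable section

variable {m : ℕ}

theorem bilip_of {H : Type} [NormedAddCommGroup H] [InnerProductSpace ℝ H] {G : PP m → H} (hG : ContDiff ℝ 1 G) (b0 : PP m)
    {c : ℝ} (hc : 0 < c) (hl : ∀ᶠ b in 𝓝 b0, c * ‖b - b0‖ ≤ ‖G b - G b0‖) {ε : ℝ} (hε : 0 < ε) :
    ∃ A : PP m ≃L[ℝ] En (m + 2), ∃ δ > 0, ∀ b ∈ ball b0 δ, ∀ b' ∈ ball b0 δ,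
      (1 + ε)⁻¹ * ‖G b - G b'‖ ≤ ‖A b - A b'‖ ∧ ‖A b - A b'‖ ≤ (1 + ε) * ‖G b - G b'‖ := by
  have hs : HasStrictFDerivAt G (fderiv ℝ G b0) b0 := hG.contDiffAt.hasStrictFDerivAt (by norm_num)
  set D := fderiv ℝ G b0
  have hinj : Function.Injective D := by
    rw [injective_iff_map_eq_zero]
    intro u hu
    by_contra hu0
    have h1 := hs.hasFDerivAt.isLittleO.def (half_pos hc)
    have ht : Tendsto (fun t : ℝ => b0 + t • u) (𝓝[≠] 0) (𝓝 b0) := by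
      have : Continuous (fun t : ℝ => b0 + t • u) := by fun_prop
      have h := this.tendsto 0
      rw [zero_smul, add_zero] at h
      exact h.mono_left nhdsWithin_le_nhds
    obtain ⟨t, ⟨h2, h3⟩, h4⟩ := ((ht.eventually (h1.and hl)).and self_mem_nhdsWithin).exists
    rw [add_sub_cancel_left, map_smul, hu, smul_zero, sub_zero] at h2
    rw [add_sub_cancel_left] at h3
    have : 0 < ‖t • u‖ := norm_pos_iff.2 (smul_ne_zero h4 hu0)
    nlinarith
  let W := LinearMap.range (D : PP m →ₗ[ℝ] H)
  let e1 : PP m ≃ₗ[ℝ] W := LinearEquiv.ofInjective (D : PP m →ₗ[ℝ] H) hinj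
  have _ : FiniteDimensional ℝ W := e1.finiteDimensional
  have hfr : Module.finrank ℝ W = m + 2 := by
    rw [← e1.finrank_eq]; simp [PP]; omega
  let e2 := ((stdOrthonormalBasis ℝ W).reindex (finCongr hfr)).repr
  let A : PP m ≃L[ℝ] En (m + 2) := (e1.trans e2.toLinearEquiv).toContinuousLinearEquiv
  have hA : ∀ u, ‖A u‖ = ‖D u‖ := by
    intro u
    change ‖e2 (e1 u)‖ = _
    rw [e2.norm_map]; rfl
  obtain ⟨K, hK⟩ : ∃ K : ℝ, 0 < K ∧ ∀ u, ‖u‖ ≤ K * ‖A u‖ := by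
    refine ⟨‖(A.symm : En (m + 2) →L[ℝ] PP m)‖ + 1, by positivity, fun u => ?_⟩
    have := (A.symm : En (m + 2) →L[ℝ] PP m).le_opNorm (A u)
    simp only [ContinuousLinearEquiv.coe_coe, ContinuousLinearEquiv.symm_apply_apply] at this
    nlinarith [norm_nonneg (A u)]
  have h1 := hs.isLittleO.def (c := ε / (1 + ε) / K) (by have := hK.1; positivity)
  obtain ⟨δ, hδ, h2⟩ := Metric.eventually_nhds_iff.1 h1
  refine ⟨A, δ, hδ, fun b hb b' hb' => ?_⟩
  have h3 := h2 (y := (b, b')) (by rw [Prod.dist_eq]; exact max_lt hb hb')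
  simp only at h3
  have h4 : ε / (1 + ε) / K * ‖b - b'‖ ≤ ε / (1 + ε) * ‖A b - A b'‖ := by
    rw [← map_sub, div_mul_eq_mul_div, div_le_iff₀ hK.1, mul_assoc, mul_comm _ K]
    gcongr
    exact hK.2 _
  have h5 : ‖A b - A b'‖ = ‖D (b - b')‖ := by rw [← map_sub, hA]
  have h6 := abs_norm_sub_norm_le (G b - G b') (D (b - b'))
  rw [abs_le, ← h5] at h6
  set x := ‖G b - G b'‖
  set y := ‖A b - A b'‖
  have hx : 0 ≤ x := norm_nonneg _
  have hy : 0 ≤ y := norm_nonneg _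
  have h7 : ε / (1 + ε) = 1 - (1 + ε)⁻¹ := by field_simp; ring
  have h8 : ε / (1 + ε) ≤ ε := div_le_self hε.le (by linarith)
  have h9 : ε / (1 + ε) * y ≤ ε * y := by gcongr
  constructor
  · rw [inv_mul_le_iff₀ (by linarith)]; linarith [h6.2]
  · have : (1 + ε)⁻¹ * y ≤ x := by
      have h10 : ε / (1 + ε) * y = (1 - (1 + ε)⁻¹) * y := by rw [h7]
      linarith [h6.1]
    rwa [inv_mul_le_iff₀ (by linarith)] at this

theorem aw_io_contDiff (w v : Wd) : ContDiff ℝ 1 (fun b : PP m => aw w (io (hw v b))) := by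
  by_cases hw0 : w = []
  · subst hw0; simp only [aw_nil]; exact contDiff_const
  · by_cases hp : Prs w
    · have : (fun b : PP m => aw w (io (hw v b))) = fun b => omg m (hwI w (hw v b)) := by
        funext b; rw [aw_eq hw0 hp (io_ne _), jo_io]
      rw [this]
      exact omg_contDiff.comp ((hwI_contDiff w).comp (hw_contDiff v))
    · have : (fun b : PP m => aw w (io (hw v b))) = fun b => 0 := by
        funext b; exact aw_absent hw0 hp _
      rw [this]; exact contDiff_const

theorem sl_io_contDiff (i : Bool × Wd) (v : Wd) : ContDiff ℝ 1 (fun b : PP m => sl i (io (hw v b))) := by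
  obtain ⟨b, w⟩ := i
  cases b
  · simp only [sl_false]
    have h1 : ContDiff ℝ 1 (fun b : PP m => sc w * th w (io (hw v b))) := by
      refine contDiff_const.mul ?_
      unfold th
      exact (aw_io_contDiff w v).mul (contDiff_const.sub (ContDiff.sum fun i _ => aw_io_contDiff _ v))
    have h2 : ContDiff ℝ 1 (fun b : PP m => (hS w (io (hw v b)) : Vv m)) := by
      have : (fun b : PP m => (hS w (io (hw v b)) : Vv m)) = fun b => (io (hwI w (hw v b)) : Vv m) := by
        funext b; rw [hS_of (io_ne _), jo_io]
      rw [this]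
      exact io_contDiff.comp ((hwI_contDiff w).comp (hw_contDiff v))
    exact h1.smul h2
  · simp only [sl_true]
    exact (contDiff_const.mul (aw_io_contDiff w v)).smul contDiff_const

abbrev HT (m : ℕ) (v : Wd) : Type := PiLp 2 (fun _ : slotSet v => Vv m)

def Tv (v : Wd) (b : PP m) : HT m v := WithLp.toLp 2 fun i => sl i (io (hw v b))

theorem Tv_contDiff (v : Wd) : ContDiff ℝ 1 (Tv v : PP m → HT m v) := by
  unfold Tv
  refine (PiLp.contDiff_toLp).comp ?_
  exact contDiff_pi.2 fun i => sl_io_contDiff i v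

theorem Tv_norm {v : Wd} {b b' : PP m} (h : io (hw v b) ∈ RR v) (h' : io (hw v b') ∈ RR v) :
    ‖Tv v b - Tv v b'‖ = dF (io (hw v b)) (io (hw v b')) := by
  have e1 : dF (io (hw v b)) (io (hw v b')) ^ 2 = ∑ i ∈ slotSet v, ‖sl i (io (hw v b)) - sl i (io (hw v b'))‖ ^ 2 := by
    have := lp.norm_rpow_eq_tsum (p := 2) (by norm_num) (FF (io (hw v b)) - FF (io (hw v b')))
    simp only [ENNReal.toReal_ofNat] at this
    unfold dF
    rw [← Real.rpow_natCast]
    push_cast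
    rw [this, tsum_eq_sum (s := slotSet v)]
    · refine Finset.sum_congr rfl fun i _ => ?_
      rw [← Real.rpow_natCast]; rfl
    · rintro ⟨b1, u⟩ hu
      obtain ⟨h1, h2, h3⟩ := slotSet_not hu
      change ‖sl (b1, u) _ - sl (b1, u) _‖ ^ (2 : ℝ) = 0
      rw [slots_eq h h' b1 h1 h2 h3, sub_self]; simp
  have e2 : ‖Tv v b - Tv v b'‖ ^ 2 = ∑ i ∈ slotSet v, ‖sl i (io (hw v b)) - sl i (io (hw v b'))‖ ^ 2 := by
    rw [PiLp.norm_sq_eq_of_L2]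
    exact Finset.sum_coe_sort (slotSet v) (fun i => ‖sl i (io (hw v b)) - sl i (io (hw v b'))‖ ^ 2)
  rw [← abs_of_nonneg (norm_nonneg (Tv v b - Tv v b')), ← abs_of_nonneg (dF_nonneg (io (hw v b)) (io (hw v b'))), ← sq_eq_sq_iff_abs_eq_abs, e1, e2]

theorem XX_AS {x : XX m} (h1 : toS x ≠ Np m) (h2 : toS x ≠ X0 m) : AlmostSmoothAt (XX m) (m + 2) x := by
  intro ε hε
  obtain ⟨v, hv⟩ := (home_or_X0 (toS x)).resolve_right h2
  obtain ⟨b0, hb0⟩ : ∃ b0, b0 = hwI v (jo (toS x)) := ⟨_, rfl⟩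
  have hx : io (hw v b0) = toS x := by rw [hb0, hw_hwI, io_jo h1]
  have hcont : Continuous (fun b : PP m => io (hw v b)) := io_cont.comp (hw_cont v)
  have hRR : ∀ᶠ b in 𝓝 b0, io (hw v b) ∈ RR v :=
    hcont.continuousAt.eventually ((isOpen_RR v).mem_nhds (by simp only [hx]; exact home_RR (by norm_num) hv))
  obtain ⟨K, t, ht, hK⟩ := jo_locLip (io_ne b0)
  have hs := sc_pos v
  have hlow : ∀ᶠ b in 𝓝 b0, (sc v / (4 * (K + 1))) * ‖b - b0‖ ≤ ‖Tv v b - Tv v b0‖ := by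
    filter_upwards [hRR, io_cont.continuousAt.eventually ht] with b hb hbt
    have a1 := hK.dist_le_mul _ hbt _ (mem_of_mem_nhds ht)
    rw [jo_io, jo_io, dist_eq_norm] at a1
    have a2 := E1 (p' := io (hw v b)) (by norm_num : (0 : ℝ) < 1 / 2) hv
    rw [← hx, hS_io, hS_io] at a2
    rw [norm_sub_rev, norm_sub_rev (Tv v b), Tv_norm hRR.self_of_nhds hb]
    have hK0 : (0 : ℝ) ≤ K := K.2
    rw [div_mul_eq_mul_div, div_le_iff₀ (by positivity)]
    have a3 : dist (io b0) (io b) * sc v ≤ 4 * dF (io (hw v b0)) (io (hw v b)) := by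
      rw [← le_div_iff₀ hs]; refine a2.trans (le_of_eq ?_); ring
    rw [norm_sub_rev, dist_comm] at a1
    have := dF_nonneg (io (hw v b0)) (io (hw v b))
    calc sc v * ‖b0 - b‖ ≤ sc v * (K * dist (io b0) (io b)) := by gcongr
      _ = K * (dist (io b0) (io b) * sc v) := by ring
      _ ≤ K * (4 * dF (io (hw v b0)) (io (hw v b))) := by gcongr
      _ ≤ _ := by nlinarith
  obtain ⟨A, δ, hδ, hA⟩ := bilip_of (Tv_contDiff v) b0 (by positivity) hlow hε
  obtain ⟨δ', hδ', hR'⟩ := Metric.eventually_nhds_iff_ball.1 hRR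
  set N := ball b0 (min δ δ') with hN
  have hN1 : ∀ b ∈ N, b ∈ ball b0 δ := fun b hb => ball_subset_ball (min_le_left _ _) hb
  have hN2 : ∀ b ∈ N, io (hw v b) ∈ RR v := fun b hb => hR' b (ball_subset_ball (min_le_right _ _) hb)
  obtain ⟨φ, hφ⟩ : ∃ φ : XX m → PP m, φ = fun y => hwI v (jo (toS y)) := ⟨_, rfl⟩
  have hφι : ∀ b, φ (toX (io (hw v b))) = b := by
    intro b; rw [hφ]; change hwI v (jo (io (hw v b))) = b; rw [jo_io, hwI_hw]
  have hιφ : ∀ y : XX m, toS y ≠ Np m → toX (io (hw v (φ y))) = y := by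
    intro y hy; rw [hφ]; simp only; rw [hw_hwI, io_jo hy]; rfl
  have hUo : IsOpen {y : XX m | toS y ≠ Np m ∧ φ y ∈ N} := by
    rw [isOpen_iff_mem_nhds]
    rintro y ⟨hy1, hy2⟩
    have hc1 : ContinuousAt φ y := by
     rw [hφ]
     exact (hwI_cont v).continuousAt.comp
      (ContinuousAt.comp (f := toS) (g := jo) (jo_contAt hy1) toS_cont.continuousAt)
    exact (toS_cont.continuousAt.eventually (isOpen_ne.mem_nhds hy1)).and (hc1.eventually (isOpen_ball.mem_nhds hy2))
  refine ⟨_, hUo, ⟨h1, ?_⟩, A '' N, A.toHomeomorph.isOpenMap _ isOpen_ball, ?_⟩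
  · rw [hφ]; change hwI v (jo (toS x)) ∈ N
    rw [← hb0]; exact mem_ball_self (lt_min hδ hδ')
  · refine ⟨⟨fun y => ⟨A (φ y), φ y, y.2.2, rfl⟩, fun z => ⟨toX (io (hw v (A.symm z))), ?_⟩, ?_, ?_⟩, ?_⟩
    · obtain ⟨z, b, hb, rfl⟩ := z
      refine ⟨io_ne _, ?_⟩
      rw [hφι]; simpa using hb
    · intro y
      apply Subtype.ext
      simp only [ContinuousLinearEquiv.symm_apply_apply]
      exact hιφ _ y.2.1
    · rintro ⟨z, b, hb, rfl⟩
      apply Subtype.ext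
      change A (φ (toX (io (hw v (A.symm (A b)))))) = A b
      rw [hφι, A.symm_apply_apply]
    · rintro ⟨a, ha1, ha2⟩ ⟨b, hb1, hb2⟩
      have hd : dist a b = ‖Tv v (φ a) - Tv v (φ b)‖ := by
        rw [Tv_norm (hN2 _ ha2) (hN2 _ hb2), dist_X]
        have e1 : io (hw v (φ a)) = toS a := hιφ a ha1
        have e2 : io (hw v (φ b)) = toS b := hιφ b hb1
        rw [e1, e2]
      have := hA _ (hN1 _ ha2) _ (hN1 _ hb2)
      rw [Subtype.dist_eq, hd]
      simp only [Equiv.coe_fn_mk]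
      rw [dist_eq_norm]
      exact this

/-! ### the Cantor set -/

theorem li_pair {x y : Vv m} (hx : ‖x‖ = 1) (hy : ‖y‖ = 1) (h1 : x ≠ y) (h2 : x ≠ -y) {s t : ℝ} (h : s • x + t • y = 0) : s = 0 ∧ t = 0 := by
  have h3 : s • x = -(t • y) := eq_neg_of_add_eq_zero_left h
  have h4 : |s| = |t| := by
    have := congrArg norm h3
    rwa [norm_neg, norm_smul, norm_smul, hx, hy, mul_one, mul_one] at this
  by_cases hs : s = 0
  · subst hs; rw [abs_zero] at h4; exact ⟨rfl, abs_eq_zero.1 h4.symm⟩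
  · exfalso
    rcases abs_eq_abs.1 h4 with h5 | h5
    · rw [← h5, ← smul_neg] at h3
      exact h2 (smul_right_injective _ hs h3)
    · have : t = -s := by linarith
      rw [this, neg_smul, neg_neg] at h3
      exact h1 (smul_right_injective _ hs h3)

theorem X0_ne_neg : ((X0 m : SS m) : Vv m) ≠ -(Np m : Vv m) := by
  intro h
  have h1 : (ster (Np m) 0 : Vv m) = -(Np m : Vv m) := by
    have := ster_neg_zero (-(Np m))
    rw [neg_neg] at this
    rw [this]; rfl
  have h2 : X0 m = io 0 := by
    apply Subtype.ext
    rw [h, ← h1, io, map_zero]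
  have h3 := congrArg Prod.fst (io_inj h2)
  norm_num [x0P] at h3

theorem cantor_E (m : ℕ) : ∃ E : Set (XX m), IsClosed E ∧ Nonempty (E ≃ₜ (ℕ → Bool)) ∧ toX (Np m) ∈ E ∧ toX (X0 m) ∈ E := by
  have hne : ((X0 m : SS m) : Vv m) ≠ (Np m : Vv m) := fun h => io_ne _ (Subtype.ext h)
  obtain ⟨γ, hγc, hγi, hγ0, hγ1⟩ : ∃ γ : ℝ → XX m, Continuous γ ∧ Function.Injective γ ∧ γ 0 = toX (Np m) ∧ γ (1 / 4) = toX (X0 m) := by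
    have key : ∀ s t : ℝ, s • (X0 m : Vv m) + t • (Np m : Vv m) = 0 → s = 0 ∧ t = 0 := fun s t h =>
      li_pair (norm_SS _) (norm_SS _) hne X0_ne_neg h
    let z : ℝ → Vv m := fun t => (4 * t) • (X0 m : Vv m) + (1 - 4 * t) • (Np m : Vv m)
    have hz : ∀ t, z t ≠ 0 := by
      intro t h
      obtain ⟨h1, h2⟩ := key _ _ h
      linarith
    refine ⟨fun t => toX (nz (z t)), ?_, ?_, ?_, ?_⟩
    · exact toX_cont.comp (nz_cont.comp_continuous (by fun_prop) hz)
    · intro t t' h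
      have h1 : nz (z t) = nz (z t') := h
      have h2 := congrArg (fun p : SS m => (p : Vv m)) h1
      rw [nz_coe (hz t), nz_coe (hz t')] at h2
      set a := ‖z t‖⁻¹
      set b := ‖z t'‖⁻¹
      have ha : a ≠ 0 := inv_ne_zero (norm_ne_zero_iff.2 (hz t))
      have h3 : (a * (4 * t) - b * (4 * t')) • (X0 m : Vv m) + (a * (1 - 4 * t) - b * (1 - 4 * t')) • (Np m : Vv m) = 0 := by
        have : (a * (4 * t) - b * (4 * t')) • (X0 m : Vv m) + (a * (1 - 4 * t) - b * (1 - 4 * t')) • (Np m : Vv m) = a • z t - b • z t' := by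
          simp only [z]; module
        rw [this, h2, sub_self]
      obtain ⟨h4, h5⟩ := key _ _ h3
      have h6 : a = b := by linarith
      rw [← h6] at h4
      have : a * (t - t') = 0 := by linarith
      rcases mul_eq_zero.1 this with h | h
      · exact absurd h ha
      · linarith
    · have : z 0 = Np m := by simp [z]
      simp only; rw [this, nz_self]
    · have : z (1 / 4) = X0 m := by simp [z]
      simp only; rw [this, nz_self]
  let e : cantorSet → XX m := fun t => γ t
  have he : Continuous e := hγc.comp continuous_subtype_val
  have hemb : IsClosedEmbedding e := by
    have : CompactSpace cantorSet := isCompact_iff_compactSpace.1 isCompact_cantorSet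
    exact he.isClosedEmbedding fun a b h => Subtype.ext (hγi h)
  refine ⟨range e, hemb.isClosed_range, ⟨(hemb.isEmbedding.toHomeomorph.symm).trans cantorSetHomeomorphNatToBool⟩,
    ⟨⟨0, zero_mem_cantorSet⟩, hγ0⟩, ⟨⟨1 / 4, quarter_mem_cantorSet⟩, hγ1⟩⟩

end
end BD

namespace BD
open Set Metric Filter Topology MeasureTheory
open scoped ENNReal NNReal
noncomputable section

/-- A conjugation-invariant length function. -/
structure IsCost {G : Type} [Group G] (cost : G → ℕ) : Prop where
  one : cost 1 = 0
  mul : ∀ a b, cost (a * b) ≤ cost a + cost b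
  inv : ∀ a, cost a⁻¹ = cost a
  conj : ∀ a b, cost (b * a * b⁻¹) = cost a

namespace LT
variable {G : Type} [Group G] {n : ℕ}

/-- last nonzero coordinate -/
def lst (x : Fin n → ℕ) (h : x ≠ 0) : Fin n :=
  (Finset.univ.filter (fun i => x i ≠ 0)).max' (by
    obtain ⟨i, hi⟩ := Function.ne_iff.1 h
    exact ⟨i, by simpa using hi⟩)

lemma lst_ne (x : Fin n → ℕ) (h : x ≠ 0) : x (lst x h) ≠ 0 := by
  have := Finset.max'_mem (Finset.univ.filter (fun i => x i ≠ 0)) (by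
    obtain ⟨i, hi⟩ := Function.ne_iff.1 h
    exact ⟨i, by simpa using hi⟩)
  simpa [lst] using (Finset.mem_filter.1 this).2

lemma le_lst (x : Fin n → ℕ) (h : x ≠ 0) (i : Fin n) (hi : x i ≠ 0) : i ≤ lst x h :=
  Finset.le_max' _ _ (by simpa using hi)

lemma lst_eq (x : Fin n → ℕ) (h : x ≠ 0) (i : Fin n) (hi : x i ≠ 0)
    (hm : ∀ j, x j ≠ 0 → j ≤ i) : lst x h = i :=
  le_antisymm (hm _ (lst_ne x h)) (le_lst x h i hi)

lemma sum_sub_lt (x : Fin n → ℕ) (i : Fin n) (h : x i ≠ 0) :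
    ∑ j, (x - Pi.single i 1 : Fin n → ℕ) j < ∑ j, x j := by
  apply Finset.sum_lt_sum
  · intro j _; simp
  · refine ⟨i, Finset.mem_univ _, ?_⟩
    simp; omega

/-- potential along the standard spanning tree -/
def PT (e : (Fin n → ℕ) → Fin n → G) (x : Fin n → ℕ) : G :=
  open Classical in
  if h : x = 0 then 1 else
    PT e (x - Pi.single (lst x h) 1) * e (x - Pi.single (lst x h) 1) (lst x h)
termination_by ∑ j, x j
decreasing_by exact sum_sub_lt x _ (lst_ne x _)

lemma PT_ne (e : (Fin n → ℕ) → Fin n → G) (x : Fin n → ℕ) (h : x ≠ 0) :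
    PT e x = PT e (x - Pi.single (lst x h) 1) * e (x - Pi.single (lst x h) 1) (lst x h) := by
  rw [PT]; simp [h]

lemma add_ne (x : Fin n → ℕ) (i : Fin n) : x + Pi.single i 1 ≠ 0 := by
  intro h
  have := congrFun h i
  simp at this

lemma PT_add (e : (Fin n → ℕ) → Fin n → G) (x : Fin n → ℕ) (i : Fin n)
    (hm : ∀ j, x j ≠ 0 → j ≤ i) : PT e (x + Pi.single i 1) = PT e x * e x i := by
  have h1 : lst (x + Pi.single i 1) (add_ne x i) = i := by
    apply lst_eq
    · simp
    · intro j hj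
      by_cases hji : j = i
      · exact hji.le
      · apply hm; simpa [hji] using hj
  rw [PT_ne e _ (add_ne x i), h1]
  simp

theorem PT_D {cost : G → ℕ} (hc : IsCost cost) (e : (Fin n → ℕ) → Fin n → G) (L B : ℕ)
    (hsq : ∀ y : Fin n → ℕ, (∀ κ, y κ ≤ L) → ∀ i j, i ≠ j →
      cost (e y j * e (y + Pi.single j 1) i * (e (y + Pi.single i 1) j)⁻¹ * (e y i)⁻¹) ≤ B)
    (N : ℕ) : ∀ x : Fin n → ℕ, ∑ κ, x κ ≤ N → (∀ κ, x κ ≤ L) → ∀ i,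
      cost (PT e x * e x i * (PT e (x + Pi.single i 1))⁻¹) ≤ N * B := by
  induction N with
  | zero =>
    intro x hx _ i
    have : x = 0 := by
      funext j
      have := Finset.sum_eq_zero_iff.1 (Nat.le_zero.1 hx) j (Finset.mem_univ _)
      simpa using this
    rw [PT_add e x i (by simp [this])]
    simp [hc.one]
  | succ N ih =>
    intro x hx hL i
    by_cases hm : ∀ j, x j ≠ 0 → j ≤ i
    · rw [PT_add e x i hm]; simp [hc.one]
    push Not at hm
    obtain ⟨j, hj, hij⟩ := hm
    have hx0 : x ≠ 0 := fun h => hj (by simp [h])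
    obtain ⟨k, hk⟩ : ∃ k, k = lst x hx0 := ⟨_, rfl⟩
    have hkx : x k ≠ 0 := hk ▸ lst_ne x hx0
    have hik : i < k := lt_of_lt_of_le hij (hk ▸ le_lst x hx0 j hj)
    obtain ⟨y, hy⟩ : ∃ y, y = x - Pi.single k 1 := ⟨_, rfl⟩
    have hxy : x = y + Pi.single k 1 := by
      rw [hy]; funext a
      by_cases ha : a = k
      · subst ha; simp; omega
      · simp [ha]
    have h1 : PT e x = PT e y * e y k := by
      rw [PT_ne e x hx0, ← hk, ← hy]
    have hle : ∀ a, x a ≠ 0 → a ≤ k := fun a ha => hk ▸ le_lst x hx0 a ha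
    have h2 : PT e (x + Pi.single i 1) = PT e (y + Pi.single i 1) * e (y + Pi.single i 1) k := by
      have : x + Pi.single i 1 = (y + Pi.single i 1) + Pi.single k 1 := by
        rw [hxy]; abel
      rw [this]
      apply PT_add
      intro a ha
      by_cases hai : a = i
      · rw [hai]; exact hik.le
      · apply hle
        rw [hxy]
        simp [hai] at ha
        simp; intro h; exact absurd h ha
    have hyx : ∀ a, y a ≤ x a := by intro a; rw [hy]; simp
    have h3 := ih y (by
      have := sum_sub_lt x k hkx
      rw [← hy] at this; omega) (fun a => (hyx a).trans (hL a)) i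
    have h4 := hsq y (fun a => (hyx a).trans (hL a)) i k hik.ne
    rw [← hxy] at h4
    have h5 : PT e x * e x i * (PT e (x + Pi.single i 1))⁻¹ =
      (PT e y * (e y k * e x i * (e (y + Pi.single i 1) k)⁻¹ * (e y i)⁻¹) * (PT e y)⁻¹) *
        (PT e y * e y i * (PT e (y + Pi.single i 1))⁻¹) := by
      rw [h1, h2]; group
    rw [h5]
    refine (hc.mul _ _).trans ?_
    rw [hc.conj]
    calc _ ≤ B + N * B := add_le_add h4 h3
      _ = (N + 1) * B := by ring

/-- comparing with a local potential on a box -/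
theorem PT_box {cost : G → ℕ} (hc : IsCost cost) (e : (Fin n → ℕ) → Fin n → G) (B : ℕ)
    (U : (Fin n → ℕ) → G) (a b : Fin n → ℕ) (hab : a ≤ b)
    (hD : ∀ x, a ≤ x → x ≤ b → ∀ i,
      cost (PT e x * e x i * (PT e (x + Pi.single i 1))⁻¹) ≤ B)
    (hU : ∀ x, a ≤ x → ∀ i, x + Pi.single i 1 ≤ b → e x i = (U x)⁻¹ * U (x + Pi.single i 1))
    : ∀ N : ℕ, ∀ x, a ≤ x → x ≤ b → ∑ κ, (b κ - x κ) ≤ N →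
      cost (PT e x * (U x)⁻¹ * (PT e b * (U b)⁻¹)⁻¹) ≤ N * B := by
  intro N
  induction N with
  | zero =>
    intro x hax hxb hN
    have : x = b := by
      funext j
      have h1 := Finset.sum_eq_zero_iff.1 (Nat.le_zero.1 hN) j (Finset.mem_univ _)
      have h2 : x j ≤ b j := hxb j
      omega
    rw [this, mul_inv_cancel, hc.one]; simp
  | succ N ih =>
    intro x hax hxb hN
    by_cases hx : x = b
    · rw [hx, mul_inv_cancel, hc.one]; simp
    obtain ⟨i, hi⟩ := Function.ne_iff.1 hx
    have hlt : x i < b i := lt_of_le_of_ne (hxb i) hi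
    have hxb' : x + Pi.single i 1 ≤ b := by
      intro j
      by_cases hj : j = i
      · subst hj; simp; omega
      · simpa [hj] using hxb j
    have hxx : x ≤ x + Pi.single i 1 := by intro j; simp
    have h1 := ih (x + Pi.single i 1) (hax.trans hxx) hxb' (by
      have : ∑ κ, (b κ - (x + Pi.single i 1 : Fin n → ℕ) κ) < ∑ κ, (b κ - x κ) := by
        apply Finset.sum_lt_sum
        · intro j _
          have h3 : x j ≤ (x + Pi.single i 1 : Fin n → ℕ) j := hxx j
          omega
        · refine ⟨i, Finset.mem_univ _, ?_⟩
          simp; omega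
      omega)
    have h2 := hD x hax hxb i
    rw [hU x hax i hxb'] at h2
    have h5 : PT e x * (U x)⁻¹ * (PT e b * (U b)⁻¹)⁻¹ =
      (PT e x * ((U x)⁻¹ * U (x + Pi.single i 1)) * (PT e (x + Pi.single i 1))⁻¹) *
      (PT e (x + Pi.single i 1) * (U (x + Pi.single i 1))⁻¹ * (PT e b * (U b)⁻¹)⁻¹) := by
      group
    rw [h5]
    refine (hc.mul _ _).trans ?_
    calc _ ≤ B + N * B := add_le_add h2 h1
      _ = (N + 1) * B := by ring

/-- two points, via the componentwise supremum -/
theorem PT_two {cost : G → ℕ} (hc : IsCost cost) (e : (Fin n → ℕ) → Fin n → G) (B N : ℕ)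
    (U : (Fin n → ℕ) → G) (x y : Fin n → ℕ)
    (hxy : ∀ κ, x κ ≤ y κ + N ∧ y κ ≤ x κ + N)
    (hD : ∀ z, x ⊓ y ≤ z → z ≤ x ⊔ y → ∀ i,
      cost (PT e z * e z i * (PT e (z + Pi.single i 1))⁻¹) ≤ B)
    (hU : ∀ z, x ⊓ y ≤ z → ∀ i, z + Pi.single i 1 ≤ x ⊔ y →
      e z i = (U z)⁻¹ * U (z + Pi.single i 1)) :
    cost (PT e x * ((U x)⁻¹ * U y) * (PT e y)⁻¹) ≤ 2 * (n * N) * B := by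
  have hs : ∀ z : Fin n → ℕ, (∀ κ, (x ⊔ y) κ ≤ z κ + N) →
      ∑ κ, ((x ⊔ y) κ - z κ) ≤ n * N := by
    intro z hz
    calc _ ≤ ∑ κ : Fin n, N := Finset.sum_le_sum (fun κ _ => by have := hz κ; omega)
      _ = n * N := by simp
  have h1 := PT_box hc e B U (x ⊓ y) (x ⊔ y) (inf_le_left.trans le_sup_left) hD hU (n * N) x
    inf_le_left le_sup_left (hs x (fun κ => by
      have := hxy κ; simp only [Pi.sup_apply]; exact max_le (by omega) (by omega)))
  have h2 := PT_box hc e B U (x ⊓ y) (x ⊔ y) (inf_le_left.trans le_sup_left) hD hU (n * N) y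
    inf_le_right le_sup_right (hs y (fun κ => by
      have := hxy κ; simp only [Pi.sup_apply]; exact max_le (by omega) (by omega)))
  rw [← hc.inv] at h2
  have h5 : PT e x * ((U x)⁻¹ * U y) * (PT e y)⁻¹ =
    (PT e x * (U x)⁻¹ * (PT e (x ⊔ y) * (U (x ⊔ y))⁻¹)⁻¹) *
    (PT e y * (U y)⁻¹ * (PT e (x ⊔ y) * (U (x ⊔ y))⁻¹)⁻¹)⁻¹ := by group
  rw [h5]
  refine (hc.mul _ _).trans ?_
  calc _ ≤ n * N * B + n * N * B := add_le_add h1 h2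
    _ = _ := by ring

/-- telescoping products -/
theorem telescope {cost : G → ℕ} (hc : IsCost cost) (v P κ : ℕ → G) (E : ℕ → G) (B : ℕ) (M : ℕ)
    (hv : ∀ j < M, (v j)⁻¹ * v (j+1) = κ j * E j * (κ (j+1))⁻¹)
    (hE : ∀ j < M, cost (P j * E j * (P (j+1))⁻¹) ≤ B) :
    cost (P 0 * (κ 0)⁻¹ * ((v 0)⁻¹ * v M) * κ M * (P M)⁻¹) ≤ M * B := by
  induction M with
  | zero =>
    have : P 0 * (κ 0)⁻¹ * ((v 0)⁻¹ * v 0) * κ 0 * (P 0)⁻¹ = 1 := by group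
    rw [this, hc.one]; simp
  | succ M ih =>
    have h1 := ih (fun j hj => hv j (by omega)) (fun j hj => hE j (by omega))
    have h2 := hE M (by omega)
    have h3 := hv M (by omega)
    have h5 : P 0 * (κ 0)⁻¹ * ((v 0)⁻¹ * v (M+1)) * κ (M+1) * (P (M+1))⁻¹ =
      (P 0 * (κ 0)⁻¹ * ((v 0)⁻¹ * v M) * κ M * (P M)⁻¹) * (P M * E M * (P (M+1))⁻¹) := by
      have h6 : v (M+1) = v M * (κ M * E M * (κ (M+1))⁻¹) := by rw [← h3]; group
      rw [h6]; group
    rw [h5]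
    refine (hc.mul _ _).trans ?_
    calc _ ≤ M * B + B := add_le_add h1 h2
      _ = _ := by ring

theorem telescope_closed {cost : G → ℕ} (hc : IsCost cost) (v P κ : ℕ → G) (E : ℕ → G)
    (B : ℕ) (M : ℕ)
    (hv : ∀ j < M, (v j)⁻¹ * v (j+1) = κ j * E j * (κ (j+1))⁻¹)
    (hE : ∀ j < M, cost (P j * E j * (P (j+1))⁻¹) ≤ B)
    (hP : P M = P 0) (hκ : κ M = κ 0) : cost ((v 0)⁻¹ * v M) ≤ M * B := by
  have := telescope hc v P κ E B M hv hE
  rw [hP, hκ] at this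
  have h : P 0 * (κ 0)⁻¹ * ((v 0)⁻¹ * v M) * κ 0 * (P 0)⁻¹ =
    (P 0 * (κ 0)⁻¹) * ((v 0)⁻¹ * v M) * (P 0 * (κ 0)⁻¹)⁻¹ := by group
  rw [h, hc.conj] at this
  exact this

end LT
end
end BD

namespace BD
open Set Metric Filter Topology MeasureTheory
open scoped ENNReal NNReal
noncomputable section
namespace QT
variable {G : Type} [Group G] {n : ℕ} {W : Type}

/-- adaptive edge holonomy -/
def hh (H : (Fin n → ℝ) → (Fin n → ℝ) → G) (K : W → Set (Fin n → ℝ)) (tw : W → ℝ) :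
    ℕ → (Fin n → ℝ) → Fin n → ℝ → G
  | 0, x, i, t => open Classical in
      if ∃ w, t ≤ tw w ∧ (Icc x (x + Pi.single i t) ∩ K w).Nonempty then 1
      else H x (x + Pi.single i t)
  | d+1, x, i, t => open Classical in
      if ∃ w, t ≤ tw w ∧ (Icc x (x + Pi.single i t) ∩ K w).Nonempty then 1
      else hh H K tw d x i (t/2) * hh H K tw d (x + Pi.single i (t/2)) i (t/2)

/-- the data for the quadtree estimate -/
structure Dat (cost : G → ℕ) (H : (Fin n → ℝ) → (Fin n → ℝ) → G) (K : W → Set (Fin n → ℝ))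
    (tw : W → ℝ) (Om : Set (Fin n → ℝ)) (y : W → Fin n → ℝ) (s : W → ℝ) : Prop where
  hc : IsCost cost
  tpos : ∀ w, 0 < tw w
  spos : ∀ w, 0 ≤ s w
  ball : ∀ w, K w ⊆ closedBall (y w) (s w)
  pot : ∀ S : Set (Fin n → ℝ), IsCompact S → Convex ℝ S → S ⊆ Om → (∀ w, Disjoint S (K w)) →
    ∃ u : (Fin n → ℝ) → G, ∀ a ∈ S, ∀ b ∈ S, H a b = (u a)⁻¹ * u b
  sep : ∀ w w' a b, a ∈ K w → b ∈ K w' → dist a b ≤ tw w → w' = w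
  side : ∀ (S : Set (Fin n → ℝ)) w z a b, IsCompact S → Convex ℝ S → S ⊆ Om →
    (∀ w, Disjoint S (K w)) → z ∈ K w → (∀ p ∈ S, dist z p ≤ tw w) → a ∈ S → b ∈ S →
    cost (H a b) ≤ 1

variable {cost : G → ℕ} {H : (Fin n → ℝ) → (Fin n → ℝ) → G} {K : W → Set (Fin n → ℝ)}
  {tw : W → ℝ} {Om : Set (Fin n → ℝ)} {y : W → Fin n → ℝ} {s : W → ℝ}

/-- holonomy around a square -/
def sq (H : (Fin n → ℝ) → (Fin n → ℝ) → G) (K : W → Set (Fin n → ℝ)) (tw : W → ℝ)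
    (d : ℕ) (x : Fin n → ℝ) (i j : Fin n) (t : ℝ) : G :=
  hh H K tw d x i t * hh H K tw d (x + Pi.single i t) j t *
    (hh H K tw d (x + Pi.single j t) i t)⁻¹ * (hh H K tw d x j t)⁻¹

lemma single_nn (i : Fin n) {t : ℝ} (ht : 0 ≤ t) : (0 : Fin n → ℝ) ≤ Pi.single i t := by
  intro j; by_cases h : j = i
  · subst h; simpa using ht
  · simp [h]

lemma single_mono (i : Fin n) {t t' : ℝ} (ht : t ≤ t') :
    (Pi.single i t : Fin n → ℝ) ≤ Pi.single i t' := by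
  intro j; by_cases h : j = i
  · subst h; simpa using ht
  · simp [h]

lemma half_add (i : Fin n) (t : ℝ) :
    (Pi.single i (t/2) : Fin n → ℝ) + Pi.single i (t/2) = Pi.single i t := by
  rw [← Pi.single_add]; congr 1; ring

lemma hh_untouched (h : Dat cost H K tw Om y s) (d : ℕ) : ∀ (x : Fin n → ℝ) (i : Fin n) (t : ℝ),
    0 ≤ t → Icc x (x + Pi.single i t) ⊆ Om → (∀ w, Disjoint (Icc x (x + Pi.single i t)) (K w)) →
    hh H K tw d x i t = H x (x + Pi.single i t) := by
  have key : ∀ (x : Fin n → ℝ) (i : Fin n) (t : ℝ),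
      (∀ w, Disjoint (Icc x (x + Pi.single i t)) (K w)) →
      ¬ ∃ w, t ≤ tw w ∧ (Icc x (x + Pi.single i t) ∩ K w).Nonempty := by
    rintro x i t hd ⟨w, _, z, hz1, hz2⟩
    exact Set.disjoint_left.1 (hd w) hz1 hz2
  induction d with
  | zero =>
    intro x i t ht hO hd
    rw [hh, if_neg (key x i t hd)]
  | succ d ih =>
    intro x i t ht hO hd
    rw [hh, if_neg (key x i t hd)]
    have h1 : Icc x (x + Pi.single i (t/2)) ⊆ Icc x (x + Pi.single i t) :=
      Icc_subset_Icc_right (by gcongr; linarith)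
    have e : x + Pi.single i (t/2) + Pi.single i (t/2) = x + Pi.single i t := by
      rw [add_assoc, half_add]
    have h2 : Icc (x + Pi.single i (t/2)) (x + Pi.single i (t/2) + Pi.single i (t/2)) ⊆
        Icc x (x + Pi.single i t) := by
      rw [e]
      exact Icc_subset_Icc_left (by simpa using single_nn i (by linarith))
    rw [ih x i (t/2) (by linarith) (h1.trans hO) (fun w => (hd w).mono_left h1),
      ih _ i (t/2) (by linarith) (h2.trans hO) (fun w => (hd w).mono_left h2), e]
    obtain ⟨u, hu⟩ := h.pot _ isCompact_Icc (convex_Icc x (x + Pi.single i t)) hO hd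
    have m1 : x ∈ Icc x (x + Pi.single i t) := ⟨le_rfl, by simpa using single_nn i ht⟩
    have m2 : x + Pi.single i t ∈ Icc x (x + Pi.single i t) := ⟨by simpa using single_nn i ht, le_rfl⟩
    have m3 : x + Pi.single i (t/2) ∈ Icc x (x + Pi.single i t) :=
      ⟨by simpa using single_nn i (by linarith : 0 ≤ t/2), by gcongr; linarith⟩
    rw [hu _ m1 _ m3, hu _ m3 _ m2, hu _ m1 _ m2]; group

/-- the square as an order interval -/
def Sq (x : Fin n → ℝ) (i j : Fin n) (t : ℝ) : Set (Fin n → ℝ) :=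
  Icc x (x + Pi.single i t + Pi.single j t)

lemma e1 (x : Fin n → ℝ) (i j : Fin n) {t : ℝ} (ht : 0 ≤ t) :
    Icc x (x + Pi.single i t) ⊆ Sq x i j t :=
  Icc_subset_Icc_right (by simpa using single_nn j ht)
lemma e2 (x : Fin n → ℝ) (i j : Fin n) {t : ℝ} (ht : 0 ≤ t) :
    Icc (x + Pi.single i t) (x + Pi.single i t + Pi.single j t) ⊆ Sq x i j t :=
  Icc_subset_Icc_left (by simpa using single_nn i ht)
lemma Sq_symm (x : Fin n → ℝ) (i j : Fin n) (t : ℝ) : Sq x i j t = Sq x j i t := by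
  unfold Sq; congr 1; abel
lemma e3 (x : Fin n → ℝ) (i j : Fin n) {t : ℝ} (ht : 0 ≤ t) :
    Icc (x + Pi.single j t) (x + Pi.single j t + Pi.single i t) ⊆ Sq x i j t := by
  rw [Sq_symm]; exact e2 x j i ht
lemma e4 (x : Fin n → ℝ) (i j : Fin n) {t : ℝ} (ht : 0 ≤ t) :
    Icc x (x + Pi.single j t) ⊆ Sq x i j t := by
  rw [Sq_symm]; exact e1 x j i ht

lemma Sq_dist {x : Fin n → ℝ} {i j : Fin n} {t : ℝ} (hij : i ≠ j) (ht : 0 ≤ t) {a b : Fin n → ℝ}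
    (ha : a ∈ Sq x i j t) (hb : b ∈ Sq x i j t) : dist a b ≤ t := by
  rw [dist_pi_le_iff ht]
  intro k
  have h1 := ha.1 k
  have h2 := ha.2 k
  have h3 := hb.1 k
  have h4 := hb.2 k
  have h5 : (x + Pi.single i t + Pi.single j t : Fin n → ℝ) k ≤ x k + t := by
    by_cases hk : k = i
    · subst hk; simp [hij]
    · by_cases hk' : k = j
      · subst hk'; simp [hk]
      · simp [hk, hk', ht]
  rw [Real.dist_eq, abs_le]
  constructor <;> linarith

lemma sq_untouched (h : Dat cost H K tw Om y s) (d : ℕ) (x : Fin n → ℝ) (i j : Fin n) (t : ℝ)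
    (ht : 0 ≤ t) (hO : Sq x i j t ⊆ Om) (hd : ∀ w, Disjoint (Sq x i j t) (K w)) :
    sq H K tw d x i j t = 1 := by
  obtain ⟨u, hu⟩ := h.pot (Sq x i j t) isCompact_Icc (convex_Icc _ _) hO hd
  unfold sq
  have f1 := e1 x i j ht
  have f2 := e2 x i j ht
  have f3 := e3 x i j ht
  have f4 := e4 x i j ht
  rw [hh_untouched h d x i t ht (f1.trans hO) (fun w => (hd w).mono_left f1),
    hh_untouched h d _ j t ht (f2.trans hO) (fun w => (hd w).mono_left f2),
    hh_untouched h d _ i t ht (f3.trans hO) (fun w => (hd w).mono_left f3),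
    hh_untouched h d x j t ht (f4.trans hO) (fun w => (hd w).mono_left f4)]
  have m1 : x ∈ Sq x i j t := f1 ⟨le_rfl, by simpa using single_nn i ht⟩
  have m2 : x + Pi.single i t ∈ Sq x i j t := f1 ⟨by simpa using single_nn i ht, le_rfl⟩
  have m3 : x + Pi.single j t ∈ Sq x i j t := f4 ⟨by simpa using single_nn j ht, le_rfl⟩
  have m4 : x + Pi.single i t + Pi.single j t ∈ Sq x i j t :=
    f2 ⟨by simpa using single_nn j ht, le_rfl⟩
  have e : x + Pi.single j t + Pi.single i t = x + Pi.single i t + Pi.single j t := by abel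
  rw [e, hu _ m1 _ m2, hu _ m2 _ m4, hu _ m3 _ m4, hu _ m1 _ m3]; group

lemma hh_cost1 (h : Dat cost H K tw Om y s) (d : ℕ) (x : Fin n → ℝ) (i : Fin n) (t : ℝ)
    (ht : 0 ≤ t) (w : W) (htw : t ≤ tw w) (z : Fin n → ℝ) (hz : z ∈ K w)
    (hdz : ∀ p ∈ Icc x (x + Pi.single i t), dist z p ≤ t)
    (hO : Icc x (x + Pi.single i t) ⊆ Om) : cost (hh H K tw d x i t) ≤ 1 := by
  by_cases hw : (Icc x (x + Pi.single i t) ∩ K w).Nonempty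
  · have : hh H K tw d x i t = 1 := by
      cases d <;> rw [hh, if_pos ⟨w, htw, hw⟩]
    rw [this, h.hc.one]; exact zero_le_one
  · have hd : ∀ w', Disjoint (Icc x (x + Pi.single i t)) (K w') := by
      intro w'
      rw [Set.disjoint_left]
      intro p hp hp'
      have := h.sep w w' z p hz hp' ((hdz p hp).trans htw)
      subst this
      exact hw ⟨p, hp, hp'⟩
    rw [hh_untouched h d x i t ht hO hd]
    exact h.side _ w z _ _ isCompact_Icc (convex_Icc _ _) hO hd hz
      (fun p hp => (hdz p hp).trans htw) ⟨le_rfl, by simpa using single_nn i ht⟩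
      ⟨by simpa using single_nn i ht, le_rfl⟩

lemma sq_small (h : Dat cost H K tw Om y s) (d : ℕ) (x : Fin n → ℝ) (i j : Fin n) (hij : i ≠ j)
    (t : ℝ) (ht : 0 ≤ t) (hO : Sq x i j t ⊆ Om) (w : W) (htw : t ≤ tw w)
    (hd : (Sq x i j t ∩ K w).Nonempty) :
    cost (sq H K tw d x i j t) ≤ 4 := by
  obtain ⟨z, hz1, hz2⟩ := hd
  have f1 := e1 x i j ht
  have f2 := e2 x i j ht
  have f3 := e3 x i j ht
  have f4 := e4 x i j ht
  have c1 := hh_cost1 h d x i t ht w htw z hz2 (fun p hp => Sq_dist hij ht hz1 (f1 hp)) (f1.trans hO)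
  have c2 := hh_cost1 h d _ j t ht w htw z hz2 (fun p hp => Sq_dist hij ht hz1 (f2 hp)) (f2.trans hO)
  have c3 := hh_cost1 h d _ i t ht w htw z hz2 (fun p hp => Sq_dist hij ht hz1 (f3 hp)) (f3.trans hO)
  have c4 := hh_cost1 h d x j t ht w htw z hz2 (fun p hp => Sq_dist hij ht hz1 (f4 hp)) (f4.trans hO)
  rw [← h.hc.inv] at c3 c4
  unfold sq
  have g1 := h.hc.mul (hh H K tw d x i t * hh H K tw d (x + Pi.single i t) j t *
    (hh H K tw d (x + Pi.single j t) i t)⁻¹) (hh H K tw d x j t)⁻¹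
  have g2 := h.hc.mul (hh H K tw d x i t * hh H K tw d (x + Pi.single i t) j t)
    (hh H K tw d (x + Pi.single j t) i t)⁻¹
  have g3 := h.hc.mul (hh H K tw d x i t) (hh H K tw d (x + Pi.single i t) j t)
  omega

/-- clamp -/
def cl (a R z : ℝ) : ℝ := max (a - R) (min (a + R) z)

lemma cl_mono (a R : ℝ) {z z' : ℝ} (h : z ≤ z') : cl a R z ≤ cl a R z' := by
  unfold cl; gcongr

lemma cl_id {a R z : ℝ} (h1 : a - R ≤ z) (h2 : z ≤ a + R) : cl a R z = z := by
  unfold cl; rw [min_eq_right h2, max_eq_right h1]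

lemma cl_bd {a R : ℝ} (hR : 0 ≤ R) (z z' : ℝ) : cl a R z' - cl a R z ≤ 2 * R := by
  have h1 : cl a R z' ≤ a + R := by
    unfold cl; exact max_le (by linarith) (min_le_left _ _)
  have h2 : a - R ≤ cl a R z := le_max_left _ _
  linarith

/-- clamped area of a square -/
def Ar (a : Fin n → ℝ) (R : ℝ) (x : Fin n → ℝ) (i j : Fin n) (t : ℝ) : ℝ :=
  (cl (a i) R (x i + t) - cl (a i) R (x i)) * (cl (a j) R (x j + t) - cl (a j) R (x j))

lemma Ar_nonneg (a : Fin n → ℝ) (R : ℝ) (x : Fin n → ℝ) (i j : Fin n) {t : ℝ} (ht : 0 ≤ t) :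
    0 ≤ Ar a R x i j t := by
  apply mul_nonneg <;> rw [sub_nonneg] <;> apply cl_mono <;> linarith

lemma Ar_le (a : Fin n → ℝ) {R : ℝ} (hR : 0 ≤ R) (x : Fin n → ℝ) (i j : Fin n) {t : ℝ} (ht : 0 ≤ t) :
    Ar a R x i j t ≤ (2 * R) ^ 2 := by
  rw [pow_two]
  apply mul_le_mul (cl_bd hR _ _) (cl_bd hR _ _) _ (by linarith)
  rw [sub_nonneg]; apply cl_mono; linarith

lemma Ar_add (a : Fin n → ℝ) (R : ℝ) (x : Fin n → ℝ) (i j : Fin n) (hij : i ≠ j) (t : ℝ) :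
    Ar a R x i j (t/2) + Ar a R (x + Pi.single i (t/2)) i j (t/2) +
    Ar a R (x + Pi.single j (t/2)) i j (t/2) +
    Ar a R (x + Pi.single i (t/2) + Pi.single j (t/2)) i j (t/2) = Ar a R x i j t := by
  unfold Ar
  simp only [Pi.add_apply, Pi.single_eq_same, Pi.single_eq_of_ne hij, Pi.single_eq_of_ne hij.symm,
    add_zero, add_assoc, add_halves]
  ring

open Classical in
/-- charge of a square at `w` -/
def Fw (K : W → Set (Fin n → ℝ)) (tw : W → ℝ) (y : W → Fin n → ℝ) (s : W → ℝ) (w : W)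
    (x : Fin n → ℝ) (i j : Fin n) (t : ℝ) : ℝ :=
  if (Sq x i j t ∩ K w).Nonempty then
    (if t ≤ tw w then 4 else 16 * Ar (y w) (s w + tw w) x i j t / (tw w)^2) else 0

lemma Fw_nonneg (h : Dat cost H K tw Om y s) (w : W) (x : Fin n → ℝ) (i j : Fin n) {t : ℝ}
    (ht : 0 ≤ t) : 0 ≤ Fw K tw y s w x i j t := by
  unfold Fw
  have := Ar_nonneg (y w) (s w + tw w) x i j ht
  split_ifs <;> positivity

lemma Fw_sub (h : Dat cost H K tw Om y s) (w : W) (x : Fin n → ℝ) (i j : Fin n) (hij : i ≠ j) {t : ℝ}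
    (ht : 0 ≤ t) (htw : tw w < 2 * t) :
    Fw K tw y s w x i j t ≤ 16 * Ar (y w) (s w + tw w) x i j t / (tw w)^2 := by
  have hA := Ar_nonneg (y w) (s w + tw w) x i j ht
  have h0 := h.tpos w
  unfold Fw
  split_ifs with h1 h2
  · obtain ⟨p, hp1, hp2⟩ := h1
    have hp := h.ball w hp2
    rw [mem_closedBall] at hp
    have hx : ∀ k, (k = i ∨ k = j) → y w k - (s w + tw w) ≤ x k ∧ x k + t ≤ y w k + (s w + tw w) := by
      intro k hk
      have a1 := (dist_le_pi_dist p (y w) k).trans hp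
      rw [Real.dist_eq, abs_le] at a1
      have a2 := hp1.1 k
      have a3 := hp1.2 k
      have a4 : (x + Pi.single i t + Pi.single j t : Fin n → ℝ) k = x k + t := by
        rcases hk with rfl | rfl
        · simp [hij]
        · simp [hij.symm]
      rw [a4] at a3
      constructor <;> linarith
    have hi := hx i (Or.inl rfl)
    have hj := hx j (Or.inr rfl)
    have : Ar (y w) (s w + tw w) x i j t = t * t := by
      unfold Ar
      rw [cl_id (z := x i + t) (by linarith) hi.2, cl_id (z := x i) hi.1 (by linarith),
        cl_id (z := x j + t) (by linarith) hj.2, cl_id (z := x j) hj.1 (by linarith)]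
      ring
    rw [this, le_div_iff₀ (by positivity)]
    nlinarith
  · exact le_rfl
  · positivity

lemma sq_split (d : ℕ) (x : Fin n → ℝ) (i j : Fin n) (t : ℝ)
    (hcst : IsCost cost)
    (h1 : ¬ ∃ w, t ≤ tw w ∧ (Icc x (x + Pi.single i t) ∩ K w).Nonempty)
    (h2 : ¬ ∃ w, t ≤ tw w ∧
      (Icc (x + Pi.single i t) (x + Pi.single i t + Pi.single j t) ∩ K w).Nonempty)
    (h3 : ¬ ∃ w, t ≤ tw w ∧
      (Icc (x + Pi.single j t) (x + Pi.single j t + Pi.single i t) ∩ K w).Nonempty)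
    (h4 : ¬ ∃ w, t ≤ tw w ∧ (Icc x (x + Pi.single j t) ∩ K w).Nonempty) :
    cost (sq H K tw (d+1) x i j t) ≤ cost (sq H K tw d x i j (t/2)) +
      cost (sq H K tw d (x + Pi.single i (t/2)) i j (t/2)) +
      cost (sq H K tw d (x + Pi.single j (t/2)) i j (t/2)) +
      cost (sq H K tw d (x + Pi.single i (t/2) + Pi.single j (t/2)) i j (t/2)) := by
  unfold sq
  rw [hh, if_neg h1, hh, if_neg h2, hh, if_neg h3, hh, if_neg h4]
  have q1 : x + Pi.single i (t/2) + Pi.single i (t/2) = x + Pi.single i t := by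
    rw [add_assoc, half_add]
  have q2 : x + Pi.single j (t/2) + Pi.single j (t/2) = x + Pi.single j t := by
    rw [add_assoc, half_add]
  have q3 : x + Pi.single i (t/2) + Pi.single j (t/2) + Pi.single i (t/2) =
      x + Pi.single i t + Pi.single j (t/2) := by rw [← q1]; abel
  have q4 : x + Pi.single i (t/2) + Pi.single j (t/2) + Pi.single j (t/2) =
      x + Pi.single j t + Pi.single i (t/2) := by rw [← q2]; abel
  have q5 : x + Pi.single j (t/2) + Pi.single i (t/2) = x + Pi.single i (t/2) + Pi.single j (t/2) := by
    abel
  rw [q1, q2, q3, q4, q5]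
  generalize hh H K tw d x i (t/2) = b1
  generalize hh H K tw d (x + Pi.single i (t/2)) i (t/2) = b2
  generalize hh H K tw d (x + Pi.single i t) j (t/2) = r1
  generalize hh H K tw d (x + Pi.single i t + Pi.single j (t/2)) j (t/2) = r2
  generalize hh H K tw d (x + Pi.single j t) i (t/2) = t1
  generalize hh H K tw d (x + Pi.single j t + Pi.single i (t/2)) i (t/2) = t2
  generalize hh H K tw d x j (t/2) = l1
  generalize hh H K tw d (x + Pi.single j (t/2)) j (t/2) = l2
  generalize hh H K tw d (x + Pi.single i (t/2)) j (t/2) = p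
  generalize hh H K tw d (x + Pi.single j (t/2)) i (t/2) = u
  generalize hh H K tw d (x + Pi.single i (t/2) + Pi.single j (t/2)) i (t/2) = v
  generalize hh H K tw d (x + Pi.single i (t/2) + Pi.single j (t/2)) j (t/2) = q
  have key : b1 * b2 * (r1 * r2) * (t1 * t2)⁻¹ * (l1 * l2)⁻¹ =
    (b1 * (b2 * r1 * v⁻¹ * p⁻¹) * b1⁻¹) *
    ((b1 * p) * (v * r2 * t2⁻¹ * q⁻¹) * (b1 * p)⁻¹) *
    (b1 * p * u⁻¹ * l1⁻¹) * (l1 * (u * q * t1⁻¹ * l2⁻¹) * l1⁻¹) := by group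
  rw [key]
  have g1 := hcst.conj (b2 * r1 * v⁻¹ * p⁻¹) b1
  have g2 := hcst.conj (v * r2 * t2⁻¹ * q⁻¹) (b1 * p)
  have g3 := hcst.conj (u * q * t1⁻¹ * l2⁻¹) l1
  have k1 := hcst.mul ((b1 * (b2 * r1 * v⁻¹ * p⁻¹) * b1⁻¹) *
    ((b1 * p) * (v * r2 * t2⁻¹ * q⁻¹) * (b1 * p)⁻¹) *
    (b1 * p * u⁻¹ * l1⁻¹)) (l1 * (u * q * t1⁻¹ * l2⁻¹) * l1⁻¹)
  have k2 := hcst.mul ((b1 * (b2 * r1 * v⁻¹ * p⁻¹) * b1⁻¹) *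
    ((b1 * p) * (v * r2 * t2⁻¹ * q⁻¹) * (b1 * p)⁻¹)) (b1 * p * u⁻¹ * l1⁻¹)
  have k3 := hcst.mul (b1 * (b2 * r1 * v⁻¹ * p⁻¹) * b1⁻¹)
    ((b1 * p) * (v * r2 * t2⁻¹ * q⁻¹) * (b1 * p)⁻¹)
  omega

lemma Sq_sub {x x' : Fin n → ℝ} {i j : Fin n} {t t' : ℝ} (h1 : x ≤ x')
    (h2 : x' + Pi.single i t' + Pi.single j t' ≤ x + Pi.single i t + Pi.single j t) :
    Sq x' i j t' ⊆ Sq x i j t := Icc_subset_Icc h1 h2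

theorem sq_bound [Fintype W] (h : Dat cost H K tw Om y s) (d : ℕ) :
    ∀ (x : Fin n → ℝ) (i j : Fin n) (t : ℝ),
    i ≠ j → 0 ≤ t → Sq x i j t ⊆ Om → (∀ w, t / 2^d ≤ tw w) →
    (cost (sq H K tw d x i j t) : ℝ) ≤ ∑ w, Fw K tw y s w x i j t := by
  have case12 : ∀ (d : ℕ) (x : Fin n → ℝ) (i j : Fin n) (t : ℝ),
      i ≠ j → 0 ≤ t → Sq x i j t ⊆ Om →
      ((∀ w, Disjoint (Sq x i j t) (K w)) ∨ ∃ w, t ≤ tw w ∧ (Sq x i j t ∩ K w).Nonempty) →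
      (cost (sq H K tw d x i j t) : ℝ) ≤ ∑ w, Fw K tw y s w x i j t := by
    intro d x i j t hij ht hO hh
    rcases hh with hh | ⟨w, hw1, hw2⟩
    · rw [sq_untouched h d x i j t ht hO hh, h.hc.one]
      push_cast
      exact Finset.sum_nonneg (fun w _ => Fw_nonneg h w x i j ht)
    · have h1 := sq_small h d x i j hij t ht hO w hw1 hw2
      have h2 : Fw K tw y s w x i j t = 4 := by
        unfold Fw; rw [if_pos hw2, if_pos hw1]
      calc (cost (sq H K tw d x i j t) : ℝ) ≤ 4 := by exact_mod_cast h1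
        _ = Fw K tw y s w x i j t := h2.symm
        _ ≤ _ := Finset.single_le_sum (f := fun w => Fw K tw y s w x i j t)
          (fun w _ => Fw_nonneg h w x i j ht) (Finset.mem_univ w)
  induction d with
  | zero =>
    intro x i j t hij ht hO htw
    apply case12 0 x i j t hij ht hO
    by_cases hh : ∀ w, Disjoint (Sq x i j t) (K w)
    · exact Or.inl hh
    · push Not at hh
      obtain ⟨w, hw⟩ := hh
      exact Or.inr ⟨w, by simpa using htw w, Set.not_disjoint_iff_nonempty_inter.1 hw⟩
  | succ d ih =>
    intro x i j t hij ht hO htw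
    by_cases hh : ∃ w, t ≤ tw w ∧ (Sq x i j t ∩ K w).Nonempty
    · exact case12 (d+1) x i j t hij ht hO (Or.inr hh)
    have hn : ∀ S, S ⊆ Sq x i j t → ¬ ∃ w, t ≤ tw w ∧ (S ∩ K w).Nonempty := by
      rintro S hS ⟨w, hw1, hw2⟩
      exact hh ⟨w, hw1, hw2.mono (inter_subset_inter_left _ hS)⟩
    have hs := sq_split (H := H) (K := K) (tw := tw) d x i j t h.hc (hn _ (e1 x i j ht))
      (hn _ (e2 x i j ht)) (hn _ (e3 x i j ht)) (hn _ (e4 x i j ht))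
    have ht2 : 0 ≤ t/2 := by linarith
    have nn1 := single_nn i ht2
    have nn2 := single_nn j ht2
    have hi := half_add i t
    have hj := half_add j t
    have htw' : ∀ w, t/2/2^d ≤ tw w := by
      intro w; have := htw w; rw [pow_succ] at this
      calc t/2/2^d = t/(2^d*2) := by field_simp
        _ ≤ _ := this
    have s1 : Sq x i j (t/2) ⊆ Sq x i j t := by
      apply Sq_sub le_rfl; rw [← hi, ← hj]; intro k
      have a := nn1 k; have b := nn2 k
      simp only [Pi.add_apply, Pi.zero_apply] at *; linarith
    have s2 : Sq (x + Pi.single i (t/2)) i j (t/2) ⊆ Sq x i j t := by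
      apply Sq_sub
      · simpa using nn1
      rw [← hi, ← hj]; intro k
      have a := nn1 k; have b := nn2 k
      simp only [Pi.add_apply, Pi.zero_apply] at *; linarith
    have s3 : Sq (x + Pi.single j (t/2)) i j (t/2) ⊆ Sq x i j t := by
      apply Sq_sub
      · simpa using nn2
      rw [← hi, ← hj]; intro k
      have a := nn1 k; have b := nn2 k
      simp only [Pi.add_apply, Pi.zero_apply] at *; linarith
    have s4 : Sq (x + Pi.single i (t/2) + Pi.single j (t/2)) i j (t/2) ⊆ Sq x i j t := by
      apply Sq_sub
      · intro k
        have a := nn1 k; have b := nn2 k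
        simp only [Pi.add_apply, Pi.zero_apply] at *; linarith
      rw [← hi, ← hj]; intro k
      have a := nn1 k; have b := nn2 k
      simp only [Pi.add_apply, Pi.zero_apply] at *; linarith
    have i1 := ih x i j (t/2) hij ht2 (s1.trans hO) htw'
    have i2 := ih _ i j (t/2) hij ht2 (s2.trans hO) htw'
    have i3 := ih _ i j (t/2) hij ht2 (s3.trans hO) htw'
    have i4 := ih _ i j (t/2) hij ht2 (s4.trans hO) htw'
    have hs' : (cost (sq H K tw (d+1) x i j t) : ℝ) ≤ cost (sq H K tw d x i j (t/2)) +
      cost (sq H K tw d (x + Pi.single i (t/2)) i j (t/2)) +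
      cost (sq H K tw d (x + Pi.single j (t/2)) i j (t/2)) +
      cost (sq H K tw d (x + Pi.single i (t/2) + Pi.single j (t/2)) i j (t/2)) := by
      exact_mod_cast hs
    refine (hs'.trans (add_le_add (add_le_add (add_le_add i1 i2) i3) i4)).trans ?_
    rw [← Finset.sum_add_distrib, ← Finset.sum_add_distrib, ← Finset.sum_add_distrib]
    apply Finset.sum_le_sum
    intro w _
    by_cases hw : (Sq x i j t ∩ K w).Nonempty
    · have hlt : tw w < t := by
        by_contra hc; exact hh ⟨w, not_lt.1 hc, hw⟩
      have h2 : Fw K tw y s w x i j t = 16 * Ar (y w) (s w + tw w) x i j t / (tw w)^2 := by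
        unfold Fw; rw [if_pos hw, if_neg (not_le.2 hlt)]
      have hlt' : tw w < 2 * (t/2) := by linarith
      have j1 := Fw_sub h w x i j hij ht2 hlt'
      have j2 := Fw_sub h w (x + Pi.single i (t/2)) i j hij ht2 hlt'
      have j3 := Fw_sub h w (x + Pi.single j (t/2)) i j hij ht2 hlt'
      have j4 := Fw_sub h w (x + Pi.single i (t/2) + Pi.single j (t/2)) i j hij ht2 hlt'
      refine (add_le_add (add_le_add (add_le_add j1 j2) j3) j4).trans ?_
      rw [h2, ← Ar_add _ _ x i j hij t]
      apply le_of_eq; ring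
    · have hz : ∀ x' t', Sq x' i j t' ⊆ Sq x i j t → Fw K tw y s w x' i j t' = 0 := by
        intro x' t' hs
        unfold Fw
        rw [if_neg (fun hc => hw (hc.mono (inter_subset_inter_left _ hs)))]
      rw [hz _ _ s1, hz _ _ s2, hz _ _ s3, hz _ _ s4, hz _ _ subset_rfl]; simp

open Classical in
/-- final form: cost bounded by a constant times the number of touched sets -/
theorem sq_count [Fintype W] (h : Dat cost H K tw Om y s) (d : ℕ) (C : ℝ) (hC : 0 ≤ C)
    (hst : ∀ w, s w ≤ C * tw w) (x : Fin n → ℝ) (i j : Fin n) (t : ℝ)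
    (hij : i ≠ j) (ht : 0 ≤ t) (hO : Sq x i j t ⊆ Om) (htw : ∀ w, t / 2^d ≤ tw w) :
    (cost (sq H K tw d x i j t) : ℝ) ≤ (64 * (C + 1)^2) *
      (Finset.univ.filter (fun w => (Sq x i j t ∩ K w).Nonempty)).card := by
  refine (sq_bound h d x i j t hij ht hO htw).trans ?_
  rw [mul_comm, ← nsmul_eq_mul, ← Finset.sum_const, Finset.sum_filter]
  apply Finset.sum_le_sum
  intro w _
  have h0 := h.tpos w
  unfold Fw
  split_ifs with h1 h2
  · nlinarith
  · rw [div_le_iff₀ (by positivity)]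
    have hR : 0 ≤ s w + tw w := by have := h.spos w; linarith
    have h3 := Ar_le (y w) hR x i j ht
    have h4 : (2 * (s w + tw w))^2 ≤ 4 * (C+1)^2 * (tw w)^2 := by
      have : s w + tw w ≤ (C+1) * tw w := by have := hst w; linarith
      calc (2 * (s w + tw w))^2 ≤ (2 * ((C+1) * tw w))^2 := by gcongr
        _ = _ := by ring
    linarith
  · exact le_rfl

end QT
end
end BD

namespace BD
open Set Metric Filter Topology MeasureTheory
open scoped ENNReal NNReal
noncomputable section
namespace AV
variable {m : ℕ} {W : Type}

/-- the slab of offsets -/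
def slab (l : ℝ) (a : Fin (m+2) → ℝ) (r : ℝ) (i j : Fin (m+2)) : Set (Fin (m+2) → ℝ) :=
  Set.pi univ (fun κ => if κ = i ∨ κ = j then Icc 0 l else Icc (a κ - r) (a κ + r))

lemma slab_meas (l : ℝ) (a : Fin (m+2) → ℝ) (r : ℝ) (i j : Fin (m+2)) :
    MeasurableSet (slab l a r i j) := by
  apply MeasurableSet.univ_pi
  intro κ; split_ifs <;> exact measurableSet_Icc

lemma slab_vol (l : ℝ) (a : Fin (m+2) → ℝ) (r : ℝ) (i j : Fin (m+2)) (hij : i ≠ j) :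
    volume (slab l a r i j) = ENNReal.ofReal l ^ 2 * ENNReal.ofReal (2 * r) ^ m := by
  unfold slab
  rw [volume_pi_pi]
  have : ∀ κ, volume (if κ = i ∨ κ = j then Icc (0:ℝ) l else Icc (a κ - r) (a κ + r)) =
      if κ = i ∨ κ = j then ENNReal.ofReal l else ENNReal.ofReal (2 * r) := by
    intro κ; split_ifs
    · simp
    · rw [Real.volume_Icc]; congr 1; ring
  rw [Finset.prod_congr rfl (fun κ _ => this κ), Finset.prod_ite, Finset.prod_const,
    Finset.prod_const]
  have h1 : (Finset.univ.filter (fun κ : Fin (m+2) => κ = i ∨ κ = j)) = {i, j} := by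
    ext κ; simp
  have h2 : (Finset.univ.filter (fun κ : Fin (m+2) => κ = i ∨ κ = j)).card = 2 := by
    rw [h1, Finset.card_pair hij]
  have h3 := Finset.card_filter_add_card_filter_not (s := (Finset.univ : Finset (Fin (m+2))))
    (fun κ : Fin (m+2) => κ = i ∨ κ = j)
  rw [h2] at h3
  simp only [Finset.card_univ, Fintype.card_fin] at h3
  rw [h2]
  congr 2; omega

lemma touch_slab {l : ℝ} {a β o : Fin (m+2) → ℝ} {r : ℝ} {i j : Fin (m+2)} 
    (ho : o ∈ Icc (0 : Fin (m+2) → ℝ) (fun _ => l)) {p : Fin (m+2) → ℝ}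
    (hp : p ∈ QT.Sq (β + o) i j l) (hpa : p ∈ closedBall a r) :
    o ∈ slab l (a - β) r i j := by
  intro κ _
  change o κ ∈ (if κ = i ∨ κ = j then Icc (0:ℝ) l else Icc ((a - β) κ - r) ((a - β) κ + r))
  split_ifs with h
  · exact ⟨ho.1 κ, ho.2 κ⟩
  · push Not at h
    have h1 := hp.1 κ
    have h2 := hp.2 κ
    have h3 := (dist_le_pi_dist p a κ).trans hpa
    rw [Real.dist_eq, abs_le] at h3
    simp [h.1, h.2] at h1 h2
    simp only [Pi.sub_apply, mem_Icc]
    constructor <;> linarith [h3.1, h3.2]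

open Classical in
theorem avg [Fintype W] (K : W → Set (Fin (m+2) → ℝ)) (y : W → Fin (m+2) → ℝ) (s : W → ℝ)
    (hs : ∀ w, 0 ≤ s w) (hK : ∀ w, K w ⊆ closedBall (y w) (s w)) (l : ℝ) (hl : 0 < l) (L : ℕ)
    (β : Fin (m+2) → ℝ) :
    ∃ o ∈ Icc (0 : Fin (m+2) → ℝ) (fun _ => l), ∀ z : Fin (m+2) → ℕ, (∀ κ, z κ ≤ L) →
      ∀ i j, i ≠ j → ((Finset.univ.filter (fun w =>
        (QT.Sq (β + o + fun κ => l * z κ) i j l ∩ K w).Nonempty)).card : ℝ) ≤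
        ((L+1)^(m+2) * (m+2)^2 : ℕ) * ∑ w, (2 * s w / l) ^ m := by
  obtain ⟨T, hT⟩ : ∃ T : ((Fin (m+2) → Fin (L+1)) × Fin (m+2) × Fin (m+2)) × W →
      Set (Fin (m+2) → ℝ), T = fun q => if q.1.2.1 = q.1.2.2 then ∅ else
        slab l (y q.2 - (β + fun κ => l * (q.1.1 κ : ℕ))) (s q.2) q.1.2.1 q.1.2.2 := ⟨_, rfl⟩
  have hTm : ∀ q, MeasurableSet (T q) := by
    intro q; rw [hT]; dsimp only
    split_ifs
    · exact MeasurableSet.empty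
    · exact slab_meas _ _ _ _ _
  have hTv : ∀ q, volume (T q) ≤ ENNReal.ofReal (l^(m+2) * (2 * s q.2 / l)^m) := by
    intro q; rw [hT]; dsimp only
    split_ifs with h
    · simp
    · rw [slab_vol _ _ _ _ _ h, ← ENNReal.ofReal_pow hl.le,
        ← ENNReal.ofReal_pow (by have := hs q.2; linarith), ← ENNReal.ofReal_mul (by positivity)]
      apply ENNReal.ofReal_le_ofReal
      rw [div_pow, pow_add]; field_simp; exact le_rfl
  obtain ⟨f, hf⟩ : ∃ f : (Fin (m+2) → ℝ) → ℝ≥0∞, f = fun o => ∑ q, (T q).indicator 1 o := ⟨_, rfl⟩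
  have hfm : Measurable f := by
    rw [hf]
    exact Finset.measurable_sum _ (fun q _ => measurable_one.indicator (hTm q))
  have hQ : volume (Icc (0 : Fin (m+2) → ℝ) (fun _ => l)) = ENNReal.ofReal (l^(m+2)) := by
    rw [Real.volume_Icc_pi]; simp [ENNReal.ofReal_pow hl.le]
  have hQ0 : ENNReal.ofReal (l^(m+2)) ≠ 0 := by
    rw [Ne, ENNReal.ofReal_eq_zero, not_le]; positivity
  obtain ⟨o, ho, hoa⟩ := exists_le_setLAverage (μ := volume) (s := Icc (0 : Fin (m+2) → ℝ) (fun _ => l))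
    (f := f) (by rw [hQ]; exact hQ0) (by rw [hQ]; exact ENNReal.ofReal_ne_top) hfm.aemeasurable
  refine ⟨o, ho, ?_⟩
  have hintl : ∫⁻ a in Icc (0 : Fin (m+2) → ℝ) (fun _ => l), f a ≤
      ENNReal.ofReal (l^(m+2)) *
      ENNReal.ofReal (((L+1)^(m+2) * (m+2)^2 : ℕ) * ∑ w, (2 * s w / l) ^ m) := by
    calc _ ≤ ∫⁻ a, f a := setLIntegral_le_lintegral _ _
      _ = ∑ q, volume (T q) := by
        rw [hf, lintegral_finsetSum _ (fun q _ => measurable_one.indicator (hTm q))]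
        apply Finset.sum_congr rfl
        intro q _
        rw [lintegral_indicator_one (hTm q)]
      _ ≤ ∑ q, ENNReal.ofReal (l^(m+2) * (2 * s q.2 / l)^m) := Finset.sum_le_sum (fun q _ => hTv q)
      _ = ENNReal.ofReal (∑ q : ((Fin (m+2) → Fin (L+1)) × Fin (m+2) × Fin (m+2)) × W,
            l^(m+2) * (2 * s q.2 / l)^m) := by
        rw [ENNReal.ofReal_sum_of_nonneg]
        intro q _
        have := hs q.2
        positivity
      _ = _ := by
        rw [← ENNReal.ofReal_mul (by positivity)]
        congr 1
        rw [Fintype.sum_prod_type]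
        simp only
        rw [Finset.sum_const, ← Finset.mul_sum, nsmul_eq_mul]
        simp only [Finset.card_univ, Fintype.card_prod, Fintype.card_fun, Fintype.card_fin]
        push_cast
        ring
  have hfo : f o ≤ ENNReal.ofReal (((L+1)^(m+2) * (m+2)^2 : ℕ) * ∑ w, (2 * s w / l) ^ m) := by
    refine hoa.trans ?_
    rw [setLAverage_eq, hQ]
    apply ENNReal.div_le_of_le_mul
    rw [mul_comm]; exact hintl
  intro z hz i j hij
  have hcard : ((Finset.univ.filter (fun w =>
        (QT.Sq (β + o + fun κ => l * z κ) i j l ∩ K w).Nonempty)).card : ℝ≥0∞) ≤ f o := by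
    rw [hf]; dsimp only
    rw [Finset.card_eq_sum_ones, Nat.cast_sum, Finset.sum_filter]
    obtain ⟨z', hz'⟩ : ∃ z' : Fin (m+2) → Fin (L+1), ∀ κ, (z' κ : ℕ) = z κ :=
      ⟨fun κ => ⟨z κ, Nat.lt_succ_of_le (hz κ)⟩, fun κ => rfl⟩
    rw [Fintype.sum_prod_type]
    refine le_trans ?_ (Finset.single_le_sum
      (f := fun q : (Fin (m+2) → Fin (L+1)) × Fin (m+2) × Fin (m+2) =>
        ∑ w, (T (q, w)).indicator (1 : (Fin (m+2) → ℝ) → ℝ≥0∞) o)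
      (fun _ _ => bot_le) (Finset.mem_univ (z', i, j)))
    apply Finset.sum_le_sum
    intro w _
    split_ifs with hw
    · obtain ⟨p, hp1, hp2⟩ := hw
      have hmem : o ∈ T ((z', i, j), w) := by
        rw [hT]; dsimp only
        rw [if_neg hij]
        apply touch_slab ho (p := p) _ (hK w hp2)
        have : (β + (fun κ => l * (z' κ : ℕ)) + o : Fin (m+2) → ℝ) = β + o + fun κ => l * z κ := by
          funext κ; simp [hz' κ]; ring
        rw [this]; exact hp1
      rw [Set.indicator_of_mem hmem]; simp
    · exact bot_le
  have hfin := hcard.trans hfo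
  rw [← ENNReal.ofReal_natCast] at hfin
  refine (ENNReal.ofReal_le_ofReal_iff ?_).1 hfin
  apply mul_nonneg (by positivity)
  apply Finset.sum_nonneg
  intro w _
  have := hs w
  positivity

theorem packing [Fintype W] (y : W → Fin (m+2) → ℝ) (r : W → ℝ) (hr : ∀ w, 0 < r w)
    (q : Fin (m+2) → ℝ) (R : ℝ) (hR : 0 < R) (hsub : ∀ w, ball (y w) (r w) ⊆ ball q R)
    (hdisj : ∀ w w', w ≠ w' → Disjoint (ball (y w) (r w)) (ball (y w') (r w'))) :
    ∑ w, r w ^ (m+2) ≤ R ^ (m+2) := by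
  have h1 : volume (⋃ w, ball (y w) (r w)) ≤ volume (ball q R) :=
    measure_mono (iUnion_subset hsub)
  rw [measure_iUnion (fun w w' h => hdisj w w' h) (fun w => measurableSet_ball), tsum_fintype,
    Real.volume_pi_ball q hR, Finset.sum_congr rfl (fun w _ => Real.volume_pi_ball (y w) (hr w)),
    ← ENNReal.ofReal_sum_of_nonneg (fun w _ => by have := hr w; positivity),
    ENNReal.ofReal_le_ofReal_iff (by positivity)] at h1
  simp only [Fintype.card_fin, mul_pow] at h1
  rw [← Finset.mul_sum] at h1
  exact le_of_mul_le_mul_left h1 (by positivity)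

lemma young {m : ℕ} (hm : 1 ≤ m) {t τ : ℝ} (ht : 0 ≤ t) (hτ : 0 < τ) (hτ1 : τ ≤ 1) :
    t ^ m ≤ τ + t ^ (m+2) / τ^2 := by
  rcases le_total t τ with h | h
  · have : t ^ m ≤ τ := by
      calc t ^ m ≤ τ ^ m := by gcongr
        _ ≤ τ ^ 1 := pow_le_pow_of_le_one hτ.le hτ1 hm
        _ = τ := pow_one τ
    have : 0 ≤ t ^ (m+2) / τ^2 := by positivity
    linarith
  · have : t ^ m ≤ t ^ (m+2) / τ^2 := by
      rw [le_div_iff₀ (by positivity), pow_add]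
      gcongr
    linarith

/-- the final numeric contradiction -/
lemma numeric (C1 C2 : ℝ) (h1 : 0 < C1) (h2 : 0 ≤ C2) : ∃ k0 : ℕ, ∀ k ≥ k0, 
    ∃ τ : ℝ, 0 < τ ∧ τ ≤ 1 ∧ C1 * (2^k * τ + C2 / τ^2) < 2^k := by
  obtain ⟨τ, hτ⟩ : ∃ τ : ℝ, τ = min 1 (1/(2*C1)) := ⟨_, rfl⟩
  have hτ0 : 0 < τ := by rw [hτ]; positivity
  have hτ1 : τ ≤ 1 := by rw [hτ]; exact min_le_left _ _
  have hτ2 : C1 * τ ≤ 1/2 := by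
    have : τ ≤ 1/(2*C1) := by rw [hτ]; exact min_le_right _ _
    rw [le_div_iff₀ (by positivity)] at this
    linarith
  obtain ⟨k0, hk0⟩ := pow_unbounded_of_one_lt (2 * (C1 * (C2/τ^2))) (one_lt_two (α := ℝ))
  refine ⟨k0, fun k hk => ⟨τ, hτ0, hτ1, ?_⟩⟩
  have h3 : (2:ℝ)^k0 ≤ 2^k := pow_le_pow_right₀ (by norm_num) hk
  have h4 : C1 * (2^k * τ) ≤ 2^k * (1/2) := by
    calc C1 * (2^k * τ) = 2^k * (C1 * τ) := by ring
      _ ≤ _ := by gcongr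
  rw [mul_add]
  linarith

end AV
end
end BD

namespace BD
open Set Metric Filter Topology MeasureTheory
open scoped ENNReal NNReal
noncomputable section
variable {m : ℕ}

/-- parametrization of `X` by the chart at the word `u` -/
def Yw (u : Wd) (p : PP m) : XX m := toX (io (hw u p))

/-- chart -/
def Zw (u : Wd) (x : XX m) : PP m := hwI u (jo (toS x))

lemma Yw_Zw (u : Wd) {x : XX m} (h : toS x ≠ Np m) : Yw u (Zw u x) = x := by
  unfold Yw Zw
  rw [hw_hwI, io_jo h]; rfl

lemma Zw_Yw (u : Wd) (p : PP m) : Zw u (Yw u p) = p := by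
  unfold Yw Zw
  change hwI u (jo (io (hw u p))) = p
  rw [jo_io, hwI_hw]

lemma Yw_append (u v : Wd) (p : PP m) : Yw (u ++ v) p = Yw u (hw v p) := by
  unfold Yw; rw [hw_append]

lemma Zw_append (u v : Wd) (x : XX m) : Zw (u ++ v) x = hwI v (Zw u x) := by
  unfold Zw; rw [hwI_append]

lemma Yw_ne (u : Wd) (p : PP m) : toS (Yw u p) ≠ Np m := io_ne _

lemma Zw_contAt (u : Wd) {x : XX m} (h : toS x ≠ Np m) : ContinuousAt (Zw u) x := by
  unfold Zw
  exact (hwI_cont u).continuousAt.comp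
    (ContinuousAt.comp (f := (toS : XX m → SS m)) (jo_contAt h) toS_cont.continuousAt)

lemma io_sep {K : Set (PP m)} (hK : IsCompact K) {r : ℝ} (hr : 0 < r) :
    ∃ c > 0, ∀ p ∈ K, ∀ p' : PP m, r ≤ dist p p' → c ≤ dist (io p) (io p') := by
  have h := IsCompact.uniformContinuousAt_of_continuousAt (hK.image io_cont) (jo : SS m → PP m)
    (by rintro _ ⟨p, _, rfl⟩; exact jo_contAt (io_ne p)) (Metric.dist_mem_uniformity hr)
  rw [Metric.mem_uniformity_dist] at h
  obtain ⟨c, hc, h⟩ := h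
  refine ⟨c, hc, fun p hp p' hpp => ?_⟩
  by_contra hlt
  have := h (not_le.1 hlt) ⟨p, hp, rfl⟩
  change dist (jo (io p)) (jo (io p')) < r at this
  rw [jo_io, jo_io] at this
  linarith

/-- zero word -/
abbrev zr (k : ℕ) : Wd := List.replicate k 0

lemma zr_succ (k : ℕ) : zr (k+1) = zr k ++ [0] := List.replicate_succ'

lemma aw_Y {u : Wd} (hu : Prs u) {p : PP m} (hp : omg m p = 1) : aw u (toS (Yw u p)) = 1 := by
  by_cases h : u = []
  · subst h; exact aw_nil _
  · rw [aw_eq h hu (Yw_ne u p)]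
    change omg m (Zw u (Yw u p)) = 1
    rw [Zw_Yw, hp]

lemma Yz_eq (k : ℕ) (p : PP m) : Yw (zr (k+1)) p = Yw (zr k) (hm 0 p) := by
  rw [zr_succ, Yw_append]; rfl

lemma ref_aw (k : ℕ) {p : PP m} (hp : ‖p‖ ≤ 8) : aw (zr k) (toS (Yw (zr (k+1)) p)) = 1 := by
  rw [Yz_eq]
  apply aw_Y (replicate_inn k).prs
  apply omg_one
  exact Or.inr ⟨p, by simpa using hp, rfl⟩

lemma ref_child (k : ℕ) {p : PP m} (hp : ‖p‖ ≤ 8) (hU : p ∉ UU m) (i : Fin 3) :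
    aw (zr k ++ [i]) (toS (Yw (zr (k+1)) p)) = 0 := by
  by_contra h
  obtain ⟨-, -, h3⟩ := (aw_ne (snoc_ne _ _)).1 h
  change Zw (zr k ++ [i]) (Yw (zr (k+1)) p) ∈ UU m at h3
  rw [Zw_append, Yz_eq, Zw_Yw] at h3
  change hI i (hm 0 p) ∈ UU m at h3
  by_cases hi : i = 0
  · subst hi; rw [hI_hm] at h3; exact hU h3
  · have h1 := hm_ne_zero_r hi h3.1.le h3.2.1.le
    rw [hm_hI] at h1
    have := hm_zero_r hp
    linarith

/-- R1 -/
lemma ref_le (k : ℕ) {p p' : PP m} (hp : ‖p‖ ≤ 8) (hp' : ‖p'‖ ≤ 8) :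
    dist (Yw (zr (k+1)) p) (Yw (zr (k+1)) p') ≤ 16 * sc (zr k) := by
  rw [dist_X]
  exact E3 (by rw [ref_aw k hp]; exact one_ne_zero) (by rw [ref_aw k hp']; exact one_ne_zero)

lemma hS_Y (u : Wd) (p : PP m) : hS u (toS (Yw u p)) = io p := hS_io u p

lemma hm0_dist (p p' : PP m) : dist (hm 0 p) (hm 0 p') = dist p p' / 100 := by
  have h1 : ∀ q : PP m, hm 0 q = ((5/2, 5/2, 0) : PP m) + (1/100 : ℝ) • q := by
    intro q
    simp only [hm]
    refine Prod.ext ?_ (Prod.ext ?_ ?_)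
    · simp; ring
    · simp; ring
    · funext j; simp; ring
  rw [h1, h1, dist_add_left, dist_smul₀]; norm_num; ring

/-- R2 -/
lemma ref_ge (m : ℕ) {r : ℝ} (hr : 0 < r) : ∃ c > 0, ∀ (k : ℕ) (p p' : PP m), ‖p‖ ≤ 8 → p ∉ UU m →
    r ≤ dist p p' → c * sc (zr k) ≤ dist (Yw (zr (k+1)) p) (Yw (zr (k+1)) p') := by
  obtain ⟨c, hc, h⟩ := io_sep (K := hm 0 '' closedBall (0 : PP m) 8)
    ((isCompact_closedBall 0 8).image (hm_cont 0)) (r := r/100) (by positivity)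
  refine ⟨c/2, by positivity, fun k p p' hp hU hd => ?_⟩
  have hth : th (zr k) (toS (Yw (zr (k+1)) p)) = 1 := by
    rw [th_leaf (ref_child k hp hU), ref_aw k hp]
  have h1 := E1 (w := zr k) (p' := toS (Yw (zr (k+1)) p')) one_pos hth.ge
  rw [← dist_X, Yz_eq k p, Yz_eq k p', hS_Y, hS_Y] at h1
  have h2 := h (hm 0 p) ⟨p, by simpa using hp, rfl⟩ (hm 0 p') (by rw [hm0_dist]; linarith)
  have hs := sc_pos (zr k)
  rw [Yz_eq k p, Yz_eq k p']
  have h3 : c ≤ 2 * (dist (Yw (zr k) (hm 0 p)) (Yw (zr k) (hm 0 p')) / sc (zr k)) := by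
    calc c ≤ _ := h2
      _ ≤ _ := h1
      _ = _ := by norm_num
  have h4 : c/2 ≤ dist (Yw (zr k) (hm 0 p)) (Yw (zr k) (hm 0 p')) / sc (zr k) := by linarith
  rwa [le_div_iff₀ hs] at h4

/-- R3 -/
lemma ref_lip (m : ℕ) : ∃ C > 0, ∀ (k : ℕ) (p p' : PP m), ‖p‖ ≤ 8 → p ∉ UU m → ‖p'‖ ≤ 8 → p' ∉ UU m →
    dist (Yw (zr (k+1)) p) (Yw (zr (k+1)) p') ≤ C * sc (zr k) * dist p p' := by
  obtain ⟨K, hK⟩ := io_lip m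
  refine ⟨50 * CK m * (K + 1), by have := CK_one (m := m); positivity, fun k p p' hp hU hp' hU' => ?_⟩
  have hR : ∀ q : PP m, ‖q‖ ≤ 8 → q ∉ UU m → toS (Yw (zr (k+1)) q) ∈ RR (zr k) := by
    intro q hq hqU
    refine ⟨by rw [ref_aw k hq]; exact one_ne_zero, fun i => by rw [ref_child k hq hqU]; exact one_pos⟩
  have h1 := E2 (hR p hp hU) (hR p' hp' hU')
  rw [← dist_X] at h1
  have e1 : hS (zr k) (toS (Yw (zr (k+1)) p)) = io (hm 0 p) := by rw [Yz_eq, hS_Y]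
  have e2 : hS (zr k) (toS (Yw (zr (k+1)) p')) = io (hm 0 p') := by rw [Yz_eq, hS_Y]
  rw [e1, e2] at h1
  have h2 := hK.dist_le_mul (hm 0 p) (hm 0 p')
  rw [hm0_dist] at h2
  have hs := sc_pos (zr k)
  have hC := CK_one (m := m)
  have hd : 0 ≤ dist p p' := dist_nonneg
  have h3 : dist (io (hm 0 p)) (io (hm 0 p')) ≤ (K + 1) * dist p p' := by
    have := K.coe_nonneg
    have : (K : ℝ) * (dist p p' / 100) ≤ K * dist p p' := by gcongr; linarith
    linarith
  calc _ ≤ _ := h1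
    _ ≤ 50 * CK m * sc (zr k) * ((K + 1) * dist p p') := by gcongr
    _ = _ := by ring

/-- leaf word -/
def lf (k : ℕ) (w : List Bool) : Wd := zr (k+1) ++ w.map bi

lemma lf_length (k : ℕ) {w : List Bool} (hw : w.length = k+1) : (lf k w).length = 2*k+2 := by
  simp [lf, hw]; ring

lemma lf_prs (k : ℕ) {w : List Bool} (hw : w.length = k+1) : Prs (lf k w) := by
  intro v i h
  have hne : w ≠ [] := by intro h; simp [h] at hw
  obtain ⟨w', b, rfl⟩ : ∃ w' b, w = w' ++ [b] := ⟨_, _, (List.dropLast_append_getLast hne).symm⟩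
  unfold lf at h
  rw [List.map_append, ← List.append_assoc] at h
  obtain ⟨h1, -⟩ := List.append_inj' h rfl
  refine ⟨k+1, w'.map bi, h1.symm, ?_, Or.inl ?_⟩
  · intro j hj
    obtain ⟨b, _, rfl⟩ := List.mem_map.1 hj
    exact bi_ne_zero b
  · simp at hw ⊢; omega

lemma lf_not_inn (k : ℕ) {w : List Bool} (hw : w.length = k+1) : ¬ Inn (lf k w) := by
  rintro ⟨j, v, h, hv, hl⟩
  have hvz : ∀ b ∈ w.map bi, b ≠ (0 : Fin 3) := by
    intro j hj
    obtain ⟨b, _, rfl⟩ := List.mem_map.1 hj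
    exact bi_ne_zero b
  have key : ∀ (a b : ℕ) (s t : Wd), (∀ x ∈ s, x ≠ (0 : Fin 3)) → (∀ x ∈ t, x ≠ (0:Fin 3)) →
      List.replicate a 0 ++ s = List.replicate b 0 ++ t → s = t := by
    intro a
    induction a with
    | zero =>
      intro b s t hs ht h
      cases b with
      | zero => simpa using h
      | succ b =>
        exfalso
        simp only [List.replicate_zero, List.nil_append, List.replicate_succ, List.cons_append] at h
        exact hs 0 (by rw [h]; simp) rfl
    | succ a ih =>
      intro b s t hs ht h
      cases b with
      | zero =>
        exfalso
        simp only [List.replicate_zero, List.nil_append, List.replicate_succ, List.cons_append] at h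
        exact ht 0 (by rw [← h]; simp) rfl
      | succ b =>
        apply ih b s t hs ht
        simpa [List.replicate_succ] using h
  have h1 := key _ _ _ _ hvz hv h
  have h2 : v.length = k + 1 := by rw [← h1]; simpa using hw
  have h3 := congrArg List.length h
  simp [lf, hw] at h3
  rcases hl with hl | hl
  · omega
  · rw [hl] at h2; simp at h2

lemma lf_child (k : ℕ) {w : List Bool} (hw : w.length = k+1) (i : Fin 3) (p : SS m) :
    aw (lf k w ++ [i]) p = 0 :=
  aw_absent (snoc_ne _ _) (fun h => lf_not_inn k hw (prs_child.1 h)) p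

lemma lf_ne (k : ℕ) (w : List Bool) : lf k w ≠ [] := by simp [lf]

lemma lf_aw (k : ℕ) {w : List Bool} (hw : w.length = k+1) {x : XX m} (hx : toS x ≠ Np m)
    (hZ : Zw (lf k w) x ∈ UU m) : aw (lf k w) (toS x) ≠ 0 :=
  (aw_ne (lf_ne k w)).2 ⟨lf_prs k hw, hx, hZ⟩

/-- K1 -/
lemma lf_le (k : ℕ) {w : List Bool} (hw : w.length = k+1) {x x' : XX m} (hx : toS x ≠ Np m)
    (hx' : toS x' ≠ Np m) (hZ : Zw (lf k w) x ∈ UU m) (hZ' : Zw (lf k w) x' ∈ UU m) :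
    dist x x' ≤ 16 * sc (lf k w) := by
  rw [dist_X]
  exact E3 (lf_aw k hw hx hZ) (lf_aw k hw hx' hZ')

lemma lf_unique (k : ℕ) {w w' : List Bool} (hw : w.length = k+1) (hw' : w'.length = k+1) {x : XX m}
    (hx : toS x ≠ Np m) (hZ : Zw (lf k w) x ∈ UU m) (hZ' : Zw (lf k w') x ∈ UU m) : w = w' := by
  have := aw_unique (by rw [lf_length k hw, lf_length k hw']) (lf_aw k hw hx hZ) (lf_aw k hw' hx hZ')
  unfold lf at this
  have h2 := List.append_cancel_left this
  exact List.map_injective_iff.2 (by intro a b h; cases a <;> cases b <;> simp_all [bi]) h2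

/-- K2 -/
lemma lf_ge (m : ℕ) {r : ℝ} (hr : 0 < r) : ∃ c > 0, ∀ (k : ℕ) (w : List Bool) (x x' : XX m),
    w.length = k+1 → toS x ≠ Np m → toS x' ≠ Np m → Zw (lf k w) x ∈ NK m →
    r ≤ dist (Zw (lf k w) x) (Zw (lf k w) x') → c * sc (lf k w) ≤ dist x x' := by
  have hcomp : IsCompact (NK m) :=
    isCompact_UB.of_isClosed_subset isClosed_NK (NK_sub.trans UU_sub_UB)
  obtain ⟨c, hc, h⟩ := io_sep hcomp hr
  refine ⟨c/2, by positivity, fun k w x x' hw hx hx' hZ hd => ?_⟩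
  have hth : th (lf k w) (toS x) = 1 := by
    rw [th_leaf (fun i => lf_child k hw i _), aw_eq (lf_ne k w) (lf_prs k hw) hx]
    exact omg_one (Or.inl (Or.inr hZ))
  have h1 := E1 (w := lf k w) (p' := toS x') one_pos hth.ge
  rw [← dist_X, hS_of hx, hS_of hx'] at h1
  have h2 := h _ hZ _ hd
  have hs := sc_pos (lf k w)
  have h3 : c ≤ 2 * (dist x x' / sc (lf k w)) := by
    calc c ≤ _ := h2
      _ ≤ _ := h1
      _ = _ := by norm_num
  have h4 : c/2 ≤ dist x x' / sc (lf k w) := by linarith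
  rwa [le_div_iff₀ hs] at h4

end
end BD

namespace BD
open Set Metric Filter Topology MeasureTheory
open scoped ENNReal NNReal
noncomputable section
variable {m : ℕ} {G : Type} [Group G]

/-- the reference loop -/
def Gam (m : ℕ) (t : ℝ) : PP m :=
  (max (-5) (min 5 (min t (16 - t))), max 0 (min 6 (min (t - 5) (27 - t))), 0)

lemma Gam_cont : Continuous (Gam m) := by
  unfold Gam; fun_prop

lemma Gam_lip (s t : ℝ) : dist (Gam m s) (Gam m t) ≤ |s - t| := by
  have h1 := le_abs_self (s - t)
  have h2 := neg_abs_le (s - t)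
  unfold Gam
  rw [Prod.dist_eq, Prod.dist_eq]
  simp only [dist_self, Real.dist_eq]
  refine max_le ?_ (max_le ?_ (abs_nonneg _))
  · rw [abs_le]; grind
  · rw [abs_le]; grind

lemma Gam_cases {t : ℝ} (ht : t ∈ Icc (-5 : ℝ) 27) :
    (t ≤ 5 ∧ (Gam m t).1 = t ∧ (Gam m t).2.1 = 0) ∨ (3 ≤ t ∧ |(Gam m t).1| = 5 ∧ |(Gam m t).2.1| ≤ 6) ∨
    (3 ≤ t ∧ |(Gam m t).1| ≤ 5 ∧ (Gam m t).2.1 = 6) := by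
  obtain ⟨h1, h2⟩ := ht
  unfold Gam
  simp only [abs_eq (by norm_num : (0:ℝ) ≤ 5), abs_le]
  grind

lemma Gam_v (t : ℝ) : (Gam m t).2.2 = 0 := rfl

lemma Gam_far {t : ℝ} (ht : t ∈ Icc (-5 : ℝ) 27) {p : PP m} (hp : dist p (Gam m t) ≤ 1/2) :
    p ∉ UU m ∧ ‖p‖ ≤ 8 := by
  rw [Prod.dist_eq, Prod.dist_eq, max_le_iff, max_le_iff, Real.dist_eq, Real.dist_eq, Gam_v,
    dist_zero_right, abs_le, abs_le] at hp
  obtain ⟨⟨a1, a2⟩, ⟨b1, b2⟩, c⟩ := hp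
  have hn : ‖p‖ ≤ max |p.1| (max |p.2.1| ‖p.2.2‖) := le_rfl
  obtain ⟨t1, t2⟩ := ht
  rcases Gam_cases (m := m) ⟨t1, t2⟩ with ⟨h0, h1, h2⟩ | ⟨h0, h1, h2⟩ | ⟨h0, h1, h2⟩
  · rw [h1] at a1 a2; rw [h2] at b1 b2
    refine ⟨?_, hn.trans (max_le (abs_le.2 ⟨by linarith, by linarith⟩)
      (max_le (abs_le.2 ⟨by linarith, by linarith⟩) (by linarith)))⟩
    rintro ⟨_, _, _, h | h⟩
    · rcases lt_abs.1 h with h | h <;> linarith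
    · linarith
  · rw [abs_le] at h2
    have h3 : |p.1| ≤ 8 ∧ 3 ≤ |p.1| := by
      rw [abs_le, le_abs]
      rcases (abs_eq (by norm_num)).1 h1 with h | h <;> rw [h] at a1 a2
      · exact ⟨⟨by linarith, by linarith⟩, Or.inl (by linarith)⟩
      · exact ⟨⟨by linarith, by linarith⟩, Or.inr (by linarith)⟩
    refine ⟨fun h => by have := h.1; linarith [h3.2], hn.trans (max_le h3.1
      (max_le (abs_le.2 ⟨by linarith, by linarith⟩) (by linarith)))⟩
  · rw [abs_le] at h1
    rw [h2] at b1 b2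
    refine ⟨fun h => ?_, hn.trans (max_le (abs_le.2 ⟨by linarith, by linarith⟩)
      (max_le (abs_le.2 ⟨by linarith, by linarith⟩) (by linarith)))⟩
    have := (abs_lt.1 h.2.1).2
    linarith

lemma Gam_GB {t : ℝ} (ht : t ∈ Icc (-5 : ℝ) 27) (h : t ≤ -3 ∨ 3 ≤ t) : Gam m t ∉ GB m := by
  rintro ⟨h1, h2, _⟩
  rcases Gam_cases (m := m) ht with ⟨h0, e1, e2⟩ | ⟨h0, e1, e2⟩ | ⟨h0, e1, e2⟩
  · rw [e1, abs_le] at h1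
    rcases h with h | h <;> norm_num at h1 <;> linarith
  · rw [e1] at h1; norm_num at h1
  · rw [e2] at h2; norm_num at h2

lemma Gam_mid {t : ℝ} (ht : t ∈ Icc (-3 : ℝ) 3) : Gam m t = (t, 0, 0) := by
  obtain ⟨h1, h2⟩ := ht
  unfold Gam
  refine Prod.ext ?_ (Prod.ext ?_ rfl) <;> simp only <;> grind

lemma Gam_ends : Gam m 27 = Gam m (-5) := by
  unfold Gam; norm_num

/-- holonomy along the reference loop -/
lemma Gam_hol (k : ℕ) (X : List Bool → G) : ∃ u : ℝ → G,
    Pot (fun s t : ℝ => gt k X (Gam m s) (Gam m t)) (Icc (-5) 27) u ∧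
    (u (-5))⁻¹ * u 27 = iterComm k X := by
  obtain ⟨u, hu⟩ := exists_pot (c := fun s t : ℝ => gt k X (Gam m s) (Gam m t))
    (S := Icc (-5) 27) isCompact_Icc (convex_Icc _ _) (fun t ht =>
      (gt_locCoc X (fun h => (Gam_far ht (by simp)).1 (KK_sub k h))).comp Gam_cont.continuousAt)
  refine ⟨u, hu, ?_⟩
  have e1 : u (-5) = u (-3) := by
    refine (hu.mono (Icc_subset_Icc_right (by norm_num : (-3:ℝ) ≤ 27))).const isPreconnected_Icc ?_
      (by constructor <;> norm_num) (by constructor <;> norm_num)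
    intro s hs t ht
    exact gt_eq_one_left (Gam_GB ⟨hs.1, by linarith [hs.2]⟩ (Or.inl hs.2))
  have e2 : u 3 = u 27 := by
    refine (hu.mono (Icc_subset_Icc_left (by norm_num : (-5:ℝ) ≤ 3))).const isPreconnected_Icc ?_
      (by constructor <;> norm_num) (by constructor <;> norm_num)
    intro s hs t ht
    exact gt_eq_one_left (Gam_GB ⟨by linarith [hs.1], hs.2⟩ (Or.inr hs.1))
  rw [e1, ← e2]
  refine axisHol (m := m) k X u ?_
  obtain ⟨δ, hδ, h⟩ := hu
  refine ⟨δ, hδ, fun x hx y hy hxy => ?_⟩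
  have := h x ⟨by linarith [hx.1], by linarith [hx.2]⟩ y ⟨by linarith [hy.1], by linarith [hy.2]⟩ hxy
  change u y = u x * gt k X (Gam m x) (Gam m y) at this
  rw [Gam_mid hx, Gam_mid hy] at this
  exact this

/-- comparison of holonomies close to the reference loop -/
lemma Gam_local {V : Type*} [NormedAddCommGroup V] [NormedSpace ℝ V] {k : ℕ} {X : List Bool → G}
    {u : ℝ → G} (hu : Pot (fun s t : ℝ => gt k X (Gam m s) (Gam m t)) (Icc (-5) 27) u)
    {a b : ℝ} (ha : -5 ≤ a) (hab : a ≤ b) (hb : b ≤ 27) (h2 : b ≤ a + 1/2) {Z : V → PP m} {S : Set V}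
    (hS : IsCompact S) (hconv : Convex ℝ S) (hZ : ContinuousOn Z S)
    (hm : ∀ s ∈ S, dist (Z s) (Gam m a) ≤ 1/2) {q q' : V} (hq : q ∈ S) (hq' : q' ∈ S)
    (e : Z q = Gam m a) (e' : Z q' = Gam m b) :
    (u a)⁻¹ * u b = hol (fun s t => gt k X (Z s) (Z t)) q q' := by
  obtain ⟨v, hv⟩ := exists_pot (c := gt (m := m) k X) (S := closedBall (Gam m a) (1/2))
    (isCompact_closedBall _ _) (convex_closedBall _ _) (fun p hp =>
      gt_locCoc X (fun h => (Gam_far ⟨ha, hab.trans hb⟩ hp).1 (KK_sub k h)))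
  have p1 : Pot (fun s t : ℝ => gt k X (Gam m s) (Gam m t)) (Icc a b) (v ∘ Gam m) :=
    hv.comp Gam_cont.continuousOn isCompact_Icc (fun t ht => by
      refine (Gam_lip _ _).trans ?_
      rw [abs_le]; constructor <;> linarith [ht.1, ht.2])
  have p2 : Pot (fun s t => gt k X (Z s) (Z t)) S (v ∘ Z) := hv.comp hZ hS hm
  rw [hol_eq p2 (hconv.segment_subset hq hq'),
    (hu.mono (Icc_subset_Icc ha hb)).unique isPreconnected_Icc p1 (left_mem_Icc.2 hab)
      (right_mem_Icc.2 hab)]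
  simp [e, e']
end
end BD

namespace BD
open Set Metric Filter Topology MeasureTheory
open scoped ENNReal NNReal
noncomputable section
variable {m : ℕ} {G : Type} [Group G]

/-- Local quasisymmetric parametrization near the special point. -/
structure QD (ψ : (Fin (m+2) → ℝ) → XX m) (r1 : ℝ) : Prop where
  pos : 0 < r1
  cont : Continuous ψ
  ne : ∀ a ∈ closedBall (0 : Fin (m+2) → ℝ) r1, toS (ψ a) ≠ Np m
  qa : ∀ T > 0, ∃ M ≥ (1:ℝ), ∀ a ∈ closedBall (0 : Fin (m+2) → ℝ) r1,
    ∀ b ∈ closedBall (0 : Fin (m+2) → ℝ) r1, ∀ c ∈ closedBall (0 : Fin (m+2) → ℝ) r1,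
    dist (ψ a) (ψ b) ≤ T * dist (ψ a) (ψ c) → dist a b ≤ M * dist a c
  qb : ∀ ε > 0, ∃ δ > (0:ℝ), ∀ a ∈ closedBall (0 : Fin (m+2) → ℝ) r1,
    ∀ b ∈ closedBall (0 : Fin (m+2) → ℝ) r1, ∀ c ∈ closedBall (0 : Fin (m+2) → ℝ) r1,
    dist (ψ a) (ψ b) ≤ δ * dist (ψ a) (ψ c) → dist a b ≤ ε * dist a c
  cl : ∀ r > 0, ∃ k0 : ℕ, ∀ k ≥ k0, ∀ x : XX m, aw (zr k) (toS x) ≠ 0 →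
    ∃ a ∈ closedBall (0 : Fin (m+2) → ℝ) r, ψ a = x

variable {ψ : (Fin (m+2) → ℝ) → XX m} {r1 : ℝ}

/-- the pulled back thick rims -/
def KS (ψ : (Fin (m+2) → ℝ) → XX m) (r1 : ℝ) (k : ℕ) (w : List.Vector Bool (k+1)) :
    Set (Fin (m+2) → ℝ) :=
  {a | a ∈ closedBall (0 : Fin (m+2) → ℝ) r1 ∧ Zw (lf k w.1) (ψ a) ∈ NK m}

/-- the pulled back chart -/
def ZZ (ψ : (Fin (m+2) → ℝ) → XX m) (k : ℕ) (a : Fin (m+2) → ℝ) : PP m := Zw (zr (k+1)) (ψ a)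

/-- the pulled back cocycle holonomy -/
def HH (ψ : (Fin (m+2) → ℝ) → XX m) (k : ℕ) (X : List Bool → G) :
    (Fin (m+2) → ℝ) → (Fin (m+2) → ℝ) → G :=
  hol (fun a b => gt (k+1) X (ZZ ψ k a) (ZZ ψ k b))

def kap (m : ℕ) (e : ℝ) : PP m := (0, 2 * e, 0)

lemma kap_NK {e : ℝ} (he : |e| = 1) : kap m e ∈ NK m := by
  refine ⟨by simp [kap], ?_, ?_⟩ <;> simp [kap, abs_mul, he] <;> norm_num

lemma KR_NK : KR m ⊆ NK m := by
  rintro p ⟨h1, h2⟩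
  refine ⟨by rw [h1]; norm_num, ?_, ?_⟩ <;> rw [h2] <;> norm_num

lemma coord {p q : PP m} {r : ℝ} (h : dist p q < r) :
    |p.1 - q.1| < r ∧ |max |p.2.1| ‖p.2.2‖ - max |q.2.1| ‖q.2.2‖| < r := by
  rw [Prod.dist_eq] at h
  refine ⟨(le_max_left _ _).trans_lt h, ?_⟩
  have h2 : dist p.2 q.2 < r := (le_max_right _ _).trans_lt h
  have e : ∀ z : PP m, max |z.2.1| ‖z.2.2‖ = ‖z.2‖ := fun z => rfl
  rw [e, e]
  rw [dist_eq_norm] at h2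
  exact (abs_norm_sub_norm_le _ _).trans_lt h2

lemma near_UU {p q : PP m} (hp : p ∈ NK m) (h : dist p q < 1/8) : q ∈ UU m ∧ q ∈ GB m := by
  obtain ⟨h1, h2, h3⟩ := hp
  obtain ⟨c1, c2⟩ := coord h
  rw [abs_lt] at c1 c2
  rw [abs_le] at h1
  have m1 := le_max_left |q.2.1| ‖q.2.2‖
  have m2 := le_max_right |q.2.1| ‖q.2.2‖
  have hx : |q.1| ≤ 2.9 := by rw [abs_le]; constructor <;> norm_num <;> linarith
  refine ⟨⟨hx.trans_lt (by norm_num), by linarith, by linarith, ?_⟩, hx.trans (by norm_num), ?_, ?_⟩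
  · exact lt_max_iff.1 (by linarith)
  · norm_num; linarith
  · norm_num; linarith

/-- one-sidedness of the gate -/
lemma gate_side {O : Set (PP m)} {z : PP m} (hO : ∀ p ∈ O, dist z p < 1/8)
    (hN : ∀ p ∈ O, p ∉ NK m) :
    (∀ a ∈ O, a ∉ gAm m) ∨ (∀ a ∈ O, a ∉ gAp m) ∨ (∀ a ∈ O, a ∈ gAm m ∨ a ∈ gAp m) := by
  by_cases h1 : ∀ a ∈ O, 0 ≤ a.1
  · exact Or.inl fun a ha h => by linarith [h1 a ha, h.2.1]
  by_cases h2 : ∀ a ∈ O, a.1 < 0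
  · exact Or.inr (Or.inl fun a ha h => by linarith [h2 a ha, h.1])
  push Not at h1 h2
  obtain ⟨p, hp, hp1⟩ := h1
  obtain ⟨p', hp', hp1'⟩ := h2
  have pw : ∀ a ∈ O, ∀ b ∈ O, dist a b < 1/4 := by
    intro a ha b hb
    have := dist_triangle_left a b z
    linarith [hO a ha, hO b hb]
  have hx : ∀ a ∈ O, |a.1| ≤ 1/2 := by
    intro a ha
    have e1 := abs_lt.1 (coord (pw a ha p hp)).1
    have e2 := abs_lt.1 (coord (pw a ha p' hp')).1
    rw [abs_le]; constructor <;> linarith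
  have hr : ∀ a ∈ O, max |a.2.1| ‖a.2.2‖ < 3/2 ∨ 5/2 < max |a.2.1| ‖a.2.2‖ := by
    intro a ha
    by_contra h
    push Not at h
    exact hN a ha ⟨hx a ha, h.1, h.2⟩
  rcases hr p hp with h | h
  · refine Or.inr (Or.inr fun a ha => ?_)
    have e1 := abs_lt.1 (coord (pw a ha p hp)).2
    have h3 : max |a.2.1| ‖a.2.2‖ < 2 := by linarith
    obtain ⟨h4, h5⟩ := max_lt_iff.1 h3
    have h6 := abs_le.1 (hx a ha)
    rcases lt_or_ge a.1 0 with h7 | h7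
    · exact Or.inl ⟨by linarith, h7, h4, h5⟩
    · exact Or.inr ⟨h7, by linarith, h4, h5⟩
  · refine Or.inl fun a ha ha' => ?_
    have e1 := abs_lt.1 (coord (pw a ha p hp)).2
    have : max |a.2.1| ‖a.2.2‖ < 2 := max_lt ha'.2.2.1 ha'.2.2.2
    linarith

lemma ZZ_lf (k : ℕ) (w : List Bool) (a : Fin (m+2) → ℝ) :
    ZZ ψ k a = hw (w.map bi) (Zw (lf k w) (ψ a)) := by
  rw [lf, Zw_append, hw_hwI, ZZ]

lemma lf_ZZ (k : ℕ) (w : List Bool) (a : Fin (m+2) → ℝ) :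
    Zw (lf k w) (ψ a) = hwI (w.map bi) (ZZ ψ k a) := by
  rw [lf, Zw_append, ZZ]

lemma ZZ_cont (h : QD ψ r1) (k : ℕ) {a : Fin (m+2) → ℝ} (ha : a ∈ closedBall (0 : Fin (m+2) → ℝ) r1) :
    ContinuousAt (ZZ ψ k) a :=
  ContinuousAt.comp (Zw_contAt _ (h.ne a ha)) h.cont.continuousAt

lemma gate0_cost {cost : G → ℕ} (hc : IsCost cost) {X : G} (hX : cost X ≤ 1) (a b : PP m) :
    cost (gate0 X a b) ≤ 1 := by
  unfold gate0
  split_ifs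
  · exact hX
  · rwa [hc.inv]
  · rw [hc.one]; exact Nat.zero_le _

lemma HH_pot (h : QD ψ r1) (k : ℕ) (X : List Bool → G) {S : Set (Fin (m+2) → ℝ)} (hS : IsCompact S)
    (hconv : Convex ℝ S) (hO : S ⊆ closedBall 0 r1) (hd : ∀ w, Disjoint S (KS ψ r1 k w)) :
    ∃ u : (Fin (m+2) → ℝ) → G, ∀ a ∈ S, ∀ b ∈ S, HH ψ k X a b = (u a)⁻¹ * u b := by
  obtain ⟨u, hu⟩ := exists_pot (c := fun a b => gt (k+1) X (ZZ ψ k a) (ZZ ψ k b)) hS hconv (by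
    intro a ha
    refine (gt_locCoc X ?_).comp (ZZ_cont h k (hO ha))
    rintro ⟨w, hw, hK⟩
    refine Set.disjoint_left.1 (hd ⟨w, hw⟩) ha ⟨hO ha, ?_⟩
    change Zw (lf k w) (ψ a) ∈ NK m
    rw [lf_ZZ]
    exact KR_NK hK)
  exact ⟨u, fun a ha b hb => hol_eq hu (hconv.segment_subset ha hb)⟩

theorem dat (h : QD ψ r1) : ∃ M ≥ (1:ℝ), ∀ (G : Type) (_ : Group G) (k : ℕ)
    (X : List Bool → G) (cost : G → ℕ),
    IsCost cost → (∀ w, cost (X w) ≤ 1) → ∀ (y y' : List.Vector Bool (k+1) → Fin (m+2) → ℝ) (r : ℝ),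
    3 * r ≤ r1 → (∀ w, y w ∈ closedBall (0 : Fin (m+2) → ℝ) r) → (∀ w, y' w ∈ closedBall (0 : Fin (m+2) → ℝ) r) →
    (∀ w, ψ (y w) = Yw (lf k w.1) (kap m 1)) → (∀ w, ψ (y' w) = Yw (lf k w.1) (kap m (-1))) →
    (∀ w, 0 < dist (y w) (y' w)) ∧
    QT.Dat cost (HH ψ k X) (KS ψ r1 k) (fun w => dist (y w) (y' w) / (4*M)) (closedBall 0 r1) y
      (fun w => M * dist (y w) (y' w)) ∧
    ∀ w w', w ≠ w' → Disjoint (ball (y w) (dist (y w) (y' w) / (2*M)))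
      (ball (y w') (dist (y w') (y' w') / (2*M))) := by
  obtain ⟨c, hc, hge⟩ := lf_ge m (r := 1/8) (by norm_num)
  obtain ⟨M, hM1, hM⟩ := h.qa (16/c) (by positivity)
  refine ⟨M, hM1, fun G _ k X cost hcost hX y y' r hr hy hy' ey ey' => ?_⟩
  have hM0 : 0 < M := by linarith
  have hr0 : 0 ≤ r := by
    have := hy ⟨List.replicate (k+1) false, by simp⟩
    exact nonneg_of_mem_closedBall this
  have hsub : ∀ a : Fin (m+2) → ℝ, a ∈ closedBall (0 : Fin (m+2) → ℝ) r →
      a ∈ closedBall (0 : Fin (m+2) → ℝ) r1 := fun a ha => closedBall_subset_closedBall (by linarith) ha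
  have yK : ∀ w, y w ∈ KS ψ r1 k w := fun w => by
    refine ⟨hsub _ (hy w), ?_⟩
    rw [ey, Zw_Yw]; exact kap_NK (by norm_num)
  have yK' : ∀ w, y' w ∈ KS ψ r1 k w := fun w => by
    refine ⟨hsub _ (hy' w), ?_⟩
    rw [ey', Zw_Yw]; exact kap_NK (by norm_num)
  -- basic estimate
  have base : ∀ w, ∀ a ∈ KS ψ r1 k w, ∀ b ∈ closedBall (0 : Fin (m+2) → ℝ) r1,
      1/8 ≤ dist (Zw (lf k w.1) (ψ a)) (Zw (lf k w.1) (ψ b)) → ∀ a' ∈ KS ψ r1 k w,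
      dist a a' ≤ M * dist a b := by
    intro w a ha b hb hab a' ha'
    have h1 := lf_le k w.2 (h.ne a ha.1) (h.ne a' ha'.1) (NK_sub ha.2) (NK_sub ha'.2)
    have h2 := hge k w.1 (ψ a) (ψ b) w.2 (h.ne a ha.1) (h.ne b hb) ha.2 hab
    refine hM a ha.1 a' ha'.1 b hb ?_
    calc dist (ψ a) (ψ a') ≤ 16 * sc (lf k w.1) := h1
      _ = 16 / c * (c * sc (lf k w.1)) := by field_simp
      _ ≤ _ := by gcongr
  have c1 : ∀ w, ∀ a ∈ KS ψ r1 k w, dist (y w) a ≤ M * dist (y w) (y' w) := by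
    intro w a ha
    refine base w _ (yK w) _ (yK' w).1 ?_ a ha
    rw [ey, ey', Zw_Yw, Zw_Yw]
    have : dist (kap m 1) (kap m (-1)) = 4 := by
      simp [kap, Prod.dist_eq, Real.dist_eq]; norm_num
    rw [this]; norm_num
  have c2 : ∀ w, ∀ a ∈ KS ψ r1 k w, ∀ b ∈ closedBall (0 : Fin (m+2) → ℝ) r1,
      dist a b < dist (y w) (y' w) / (2*M) →
      dist (Zw (lf k w.1) (ψ a)) (Zw (lf k w.1) (ψ b)) < 1/8 := by
    intro w a ha b hb hab
    by_contra hcon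
    push Not at hcon
    have h1 := base w a ha b hb hcon _ (yK w)
    have h2 := base w a ha b hb hcon _ (yK' w)
    have h3 := dist_triangle_left (y w) (y' w) a
    rw [lt_div_iff₀ (by positivity)] at hab
    nlinarith
  have rpos : ∀ w, 0 < dist (y w) (y' w) := by
    intro w
    refine dist_pos.2 fun he => ?_
    have h1 := congrArg (Zw (lf k w.1)) ((congrArg ψ he).symm.trans (ey w))
    rw [ey', Zw_Yw, Zw_Yw] at h1
    have := congrArg (fun p : PP m => p.2.1) h1
    simp [kap] at this
    norm_num at this
  have t_lt : ∀ w, dist (y w) (y' w) / (4*M) < dist (y w) (y' w) / (2*M) := by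
    intro w
    exact div_lt_div_of_pos_left (rpos w) (by positivity) (by linarith)
  refine ⟨rpos, ⟨hcost, ?_, ?_, ?_, ?_, ?_, ?_⟩, ?_⟩
  · intro w; have := rpos w; positivity
  · intro w; have := rpos w; positivity
  · intro w a ha
    rw [mem_closedBall, dist_comm]; exact c1 w a ha
  · intro S hS hconv hO hd
    exact HH_pot h k X hS hconv hO hd
  · intro w w' a b ha hb hab
    have h1 := c2 w a ha b hb.1 (hab.trans_lt (t_lt w))
    exact (Subtype.ext (lf_unique k w.2 w'.2 (h.ne b hb.1) (near_UU ha.2 h1).1 (NK_sub hb.2))).symm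
  · intro S w z a b hS hconv hO hd hz hzS ha hb
    have hnear : ∀ p ∈ S, dist (Zw (lf k w.1) (ψ z)) (Zw (lf k w.1) (ψ p)) < 1/8 :=
      fun p hp => c2 w z hz p (hO hp) ((hzS p hp).trans_lt (t_lt w))
    have heq : ∀ p ∈ S, ∀ q, gt (k+1) X (ZZ ψ k p) (ZZ ψ k q) =
        gate0 (X w.1) (Zw (lf k w.1) (ψ p)) (Zw (lf k w.1) (ψ q)) := by
      intro p hp q
      rw [ZZ_lf k w.1 p, ZZ_lf k w.1 q]
      have := gt_word w.1 X (b := Zw (lf k w.1) (ψ q)) (near_UU hz.2 (hnear p hp)).2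
      rwa [show w.1.length = k+1 from w.2] at this
    have hcoc := gate0_coc_of (X := X w.1) (gate_side (O := (fun p => Zw (lf k w.1) (ψ p)) '' S)
      (z := Zw (lf k w.1) (ψ z)) (by rintro _ ⟨p, hp, rfl⟩; exact hnear p hp)
      (by rintro _ ⟨p, hp, rfl⟩ hN; exact Set.disjoint_left.1 (hd w) hp ⟨hO hp, hN⟩))
    have hcoc' : ∀ x ∈ S, ∀ y ∈ S, ∀ z ∈ S, gt (k+1) X (ZZ ψ k x) (ZZ ψ k y) *
        gt (k+1) X (ZZ ψ k y) (ZZ ψ k z) = gt (k+1) X (ZZ ψ k x) (ZZ ψ k z) := by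
      intro x hx y hy z hz
      rw [heq x hx, heq y hy, heq x hx]
      exact hcoc _ ⟨x, hx, rfl⟩ _ ⟨y, hy, rfl⟩ _ ⟨z, hz, rfl⟩
    have hp : Pot (fun a b => gt (k+1) X (ZZ ψ k a) (ZZ ψ k b)) S
        (fun b => gt (k+1) X (ZZ ψ k a) (ZZ ψ k b)) :=
      ⟨1, one_pos, fun x hx y hy _ => (hcoc' a ha x hx y hy).symm⟩
    have h5 : HH ψ k X a b = gt (k+1) X (ZZ ψ k a) (ZZ ψ k b) := by
      rw [HH, hol_eq hp (hconv.segment_subset ha hb)]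
      exact hp.full hconv.isPreconnected hcoc' ha hb
    rw [h5, heq a ha]
    exact gate0_cost hcost (hX _) _ _
  · intro w w' hne
    rw [Set.disjoint_left]
    intro b hb hb'
    refine hne (Subtype.ext ?_)
    have hbO : b ∈ closedBall (0 : Fin (m+2) → ℝ) r1 := by
      have e1 : dist (y w) (y' w) ≤ 2 * r := by
        have := dist_triangle_right (y w) (y' w) 0
        have := hy w; have := hy' w
        simp only [mem_closedBall] at *
        linarith
      have e2 : dist (y w) (y' w) / (2*M) ≤ 2 * r := by
        rw [div_le_iff₀ (by positivity)]; nlinarith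
      have := dist_triangle b (y w) 0
      have := hy w
      simp only [mem_closedBall, mem_ball] at *
      linarith
    rw [mem_ball, dist_comm] at hb hb'
    have h1 := c2 w _ (yK w) b hbO hb
    have h2 := c2 w' _ (yK w') b hbO hb'
    exact lf_unique k w.2 w'.2 (h.ne b hbO) (near_UU (yK w).2 h1).1 (near_UU (yK w').2 h2).1
end
end BD

namespace BD
open Set Metric Filter Topology MeasureTheory
open scoped ENNReal NNReal
noncomputable section
variable {m : ℕ} {G : Type} [Group G]

/-- grid point -/
def gp (β : Fin (m+2) → ℝ) (l : ℝ) (z : Fin (m+2) → ℕ) : Fin (m+2) → ℝ := β + fun κ => l * z κ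

lemma gp_apply (β : Fin (m+2) → ℝ) (l : ℝ) (z : Fin (m+2) → ℕ) (κ) : gp β l z κ = β κ + l * z κ := rfl

lemma gp_single (β : Fin (m+2) → ℝ) (l : ℝ) (z : Fin (m+2) → ℕ) (i) :
    gp β l (z + Pi.single i 1) = gp β l z + Pi.single i l := by
  funext κ
  by_cases h : κ = i
  · subst h; simp [gp]; ring
  · simp [gp, h]

lemma mem_cb {q x : Fin (m+2) → ℝ} {r : ℝ} (hr : 0 ≤ r) :
    x ∈ closedBall q r ↔ ∀ κ, q κ - r ≤ x κ ∧ x κ ≤ q κ + r := by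
  rw [mem_closedBall, dist_pi_le_iff hr]
  refine forall_congr' fun κ => ?_
  rw [Real.dist_eq, abs_le]
  constructor <;> rintro ⟨h1, h2⟩ <;> constructor <;> linarith

theorem lattice {W : Type} [Fintype W] {cost : G → ℕ} {H : (Fin (m+2) → ℝ) → (Fin (m+2) → ℝ) → G}
    {K : W → Set (Fin (m+2) → ℝ)} {tw : W → ℝ} {Om : Set (Fin (m+2) → ℝ)}
    {y : W → Fin (m+2) → ℝ} {s : W → ℝ} (h : QT.Dat cost H K tw Om y s)
    {C : ℝ} (hC : 0 ≤ C) (hst : ∀ w, s w ≤ C * tw w) {N R : ℕ} {q : ℕ → Fin (m+2) → ℝ}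
    {qs : Fin (m+2) → ℝ} {v : ℕ → G} {l : ℝ} (hl : 0 < l) (hqN : q N = q 0)
    (hv : ∀ j < N, (v j)⁻¹ * v (j+1) = H (q j) (q (j+1)))
    (hstep : ∀ j < N, dist (q j) (q (j+1)) ≤ l)
    (hball : ∀ j < N, ∀ w, Disjoint (closedBall (q j) (2*l)) (K w))
    (hqs : ∀ j ≤ N, dist (q j) qs ≤ R * l) (hOm : closedBall qs ((R+2) * l) ⊆ Om) :
    (cost ((v 0)⁻¹ * v N) : ℝ) ≤ (N * (2 * ((m+2 : ℕ) * 1) * ((m+2 : ℕ) * (2*R+2)))) *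
      (64 * (C+1)^2 * (((2*R+2 : ℕ)+1)^(m+2) * (m+2)^2 : ℕ) * ∑ w, (2 * s w / l) ^ m) := by
  classical
  obtain ⟨L, hL⟩ : ∃ L : ℕ, L = 2*R+2 := ⟨_, rfl⟩
  rw [← hL]
  obtain ⟨o, ho, hcnt⟩ := AV.avg K y s h.spos h.ball l hl L (qs - fun _ => (R+2) * l)
  obtain ⟨β, hβ⟩ : ∃ β, β = (qs - fun _ => (R+2) * l) + o := ⟨_, rfl⟩
  have hβ1 : ∀ κ, qs κ - (R+2) * l ≤ β κ ∧ β κ ≤ qs κ - (R+1) * l := by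
    intro κ
    have h1 := ho.1 κ
    have h2 := ho.2 κ
    simp only [Pi.zero_apply] at h1 h2
    rw [hβ]; simp only [Pi.add_apply, Pi.sub_apply]
    constructor <;> linarith
  have hcnt' : ∀ z : Fin (m+2) → ℕ, (∀ κ, z κ ≤ L) →
      ∀ i j, i ≠ j → ((Finset.univ.filter (fun w =>
        (QT.Sq (gp β l z) i j l ∩ K w).Nonempty)).card : ℝ) ≤
        ((L+1)^(m+2) * (m+2)^2 : ℕ) * ∑ w, (2 * s w / l) ^ m := by
    intro z hz i j hij
    have := hcnt z hz i j hij
    rw [← hβ] at this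
    exact this
  clear hcnt
  -- depth
  obtain ⟨D, hD⟩ : ∃ D : ℕ, ∀ w, l / 2^D ≤ tw w := by
    have : ∀ w, ∃ d : ℕ, l / 2^d ≤ tw w := by
      intro w
      obtain ⟨d, hd⟩ := pow_unbounded_of_one_lt (l / tw w) (one_lt_two (α := ℝ))
      refine ⟨d, ?_⟩
      have h0 := h.tpos w
      rw [div_lt_iff₀ h0] at hd
      rw [div_le_iff₀ (by positivity)]; linarith
    choose d hd using this
    refine ⟨Finset.univ.sup d, fun w => le_trans ?_ (hd w)⟩
    gcongr
    · norm_num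
    · exact Finset.le_sup (Finset.mem_univ w)
  obtain ⟨e, he⟩ : ∃ e : (Fin (m+2) → ℕ) → Fin (m+2) → G,
      e = fun z i => QT.hh H K tw D (gp β l z) i l := ⟨_, rfl⟩
  obtain ⟨Y, hY⟩ : ∃ Y : ℝ, Y = 64 * (C+1)^2 * ((L+1)^(m+2) * (m+2)^2 : ℕ) * ∑ w, (2 * s w / l) ^ m :=
    ⟨_, rfl⟩
  have hY0 : 0 ≤ Y := by
    have : 0 ≤ ∑ w, (2 * s w / l) ^ m := Finset.sum_nonneg fun w _ => by
      have := h.spos w; positivity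
    rw [hY]; positivity
  -- squares
  have hsq : ∀ z : Fin (m+2) → ℕ, (∀ κ, z κ ≤ L) → ∀ i j, i ≠ j →
      cost (e z j * e (z + Pi.single j 1) i * (e (z + Pi.single i 1) j)⁻¹ * (e z i)⁻¹) ≤ ⌊Y⌋₊ := by
    intro z hz i j hij
    apply Nat.le_floor
    have hO : QT.Sq (gp β l z) j i l ⊆ Om := by
      refine Subset.trans ?_ hOm
      rintro x ⟨hx1, hx2⟩
      rw [mem_cb (by positivity)]
      intro κ
      have h1 := hx1 κ
      have h2 := hx2 κ
      have h3 := hβ1 κ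
      have hz' : (z κ : ℝ) ≤ 2*R+2 := by have := hz κ; rw [hL] at this; exact_mod_cast this
      have h4 : (0:ℝ) ≤ z κ := by positivity
      have h5 : (Pi.single j l : Fin (m+2) → ℝ) κ + (Pi.single i l : Fin (m+2) → ℝ) κ ≤ l := by
        by_cases h6 : κ = j
        · subst h6; simp [hij.symm]
        · simp only [Pi.single_apply, h6, if_false]; split_ifs <;> linarith
      simp only [Pi.add_apply, gp_apply] at h1 h2
      constructor <;> nlinarith
    have := QT.sq_count h D C hC hst (gp β l z) j i l hij.symm hl.le hO hD
    have h2 := hcnt' z hz j i hij.symm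
    rw [he]
    simp only [gp_single]
    calc _ ≤ _ := this
      _ ≤ 64 * (C+1)^2 * (((L+1)^(m+2) * (m+2)^2 : ℕ) * ∑ w, (2 * s w / l) ^ m) := by
        refine mul_le_mul_of_nonneg_left ?_ (by positivity)
        convert h2
      _ = Y := by rw [hY]; ring
  have hPD := LT.PT_D h.hc e L ⌊Y⌋₊ hsq ((m+2) * L)
  -- lattice points
  obtain ⟨zz, hzz⟩ : ∃ zz : ℕ → Fin (m+2) → ℕ, zz = fun j κ => ⌊(q j κ - β κ) / l⌋₊ := ⟨_, rfl⟩
  have hq1 : ∀ j ≤ N, ∀ κ, qs κ - R * l ≤ q j κ ∧ q j κ ≤ qs κ + R * l := by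
    intro j hj
    exact (mem_cb (by positivity)).1 (hqs j hj)
  have hz1 : ∀ j ≤ N, ∀ κ, gp β l (zz j) κ ≤ q j κ ∧ q j κ < gp β l (zz j) κ + l ∧ zz j κ ≤ L := by
    intro j hj κ
    have h1 := hq1 j hj κ
    have h2 := hβ1 κ
    have h3 : 0 ≤ (q j κ - β κ) / l := div_nonneg (by nlinarith) hl.le
    have h4 := Nat.floor_le h3
    have h5 := Nat.lt_floor_add_one ((q j κ - β κ) / l)
    rw [le_div_iff₀ hl] at h4
    rw [div_lt_iff₀ hl] at h5
    have h6 : zz j κ = ⌊(q j κ - β κ) / l⌋₊ := by rw [hzz]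
    rw [gp_apply, h6]
    refine ⟨by linarith, by linarith, ?_⟩
    rw [← h6] at h4 h5 ⊢
    by_contra hcon
    push Not at hcon
    have h7 : ((2*R+2 : ℕ) : ℝ) + 1 ≤ zz j κ := by rw [hL] at hcon; exact_mod_cast hcon
    push_cast at h7
    nlinarith
  have hstep' : ∀ j < N, ∀ κ, q j κ - l ≤ q (j+1) κ ∧ q (j+1) κ ≤ q j κ + l := by
    intro j hj
    refine (mem_cb hl.le).1 ?_
    rw [mem_closedBall, dist_comm]; exact hstep j hj
  have hz2 : ∀ j < N, ∀ κ, zz j κ ≤ zz (j+1) κ + 1 ∧ zz (j+1) κ ≤ zz j κ + 1 := by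
    intro j hj κ
    obtain ⟨a1, a2, _⟩ := hz1 j hj.le κ
    obtain ⟨b1, b2, _⟩ := hz1 (j+1) hj κ
    obtain ⟨c1, c2⟩ := hstep' j hj κ
    rw [gp_apply] at a1 a2 b1 b2
    constructor
    · by_contra hcon
      push Not at hcon
      have h7 : (zz (j+1) κ : ℝ) + 1 + 1 ≤ zz j κ := by exact_mod_cast hcon
      nlinarith
    · by_contra hcon
      push Not at hcon
      have h7 : (zz j κ : ℝ) + 1 + 1 ≤ zz (j+1) κ := by exact_mod_cast hcon
      nlinarith
  -- box points
  have hbox : ∀ j < N, ∀ z, zz j ⊓ zz (j+1) ≤ z → z ≤ zz j ⊔ zz (j+1) →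
      gp β l z ∈ closedBall (q j) (2*l) := by
    intro j hj z h1 h2
    rw [mem_cb (by positivity)]
    intro κ
    obtain ⟨a1, a2, _⟩ := hz1 j hj.le κ
    obtain ⟨b1, b2, _⟩ := hz1 (j+1) hj κ
    obtain ⟨c1, c2⟩ := hstep' j hj κ
    have d1 := h1 κ
    have d2 := h2 κ
    rw [gp_apply] at a1 a2 b1 b2
    rw [gp_apply]
    rcases inf_le_iff.1 d1 with d1 | d1 <;> rcases le_sup_iff.1 d2 with d2 | d2
    all_goals
      have d1' : l * _ ≤ l * (z κ : ℝ) := mul_le_mul_of_nonneg_left (Nat.cast_le.2 d1) hl.le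
      have d2' : l * (z κ : ℝ) ≤ l * _ := mul_le_mul_of_nonneg_left (Nat.cast_le.2 d2) hl.le
      constructor <;> linarith
  have hSO : ∀ j < N, closedBall (q j) (2*l) ⊆ Om := by
    intro j hj
    refine Subset.trans (closedBall_subset_closedBall' ?_) hOm
    have := hqs j hj.le
    linarith
  have hpot : ∀ j, ∃ u : (Fin (m+2) → ℝ) → G, j < N → ∀ a ∈ closedBall (q j) (2*l),
      ∀ b ∈ closedBall (q j) (2*l), H a b = (u a)⁻¹ * u b := by
    intro j
    by_cases hj : j < N
    · obtain ⟨u, hu⟩ := h.pot _ (isCompact_closedBall (q j) (2*l)) (convex_closedBall _ _) (hSO j hj)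
        (hball j hj)
      exact ⟨u, fun _ => hu⟩
    · exact ⟨fun _ => 1, fun h => absurd h hj⟩
  choose u hu using hpot
  have key := LT.telescope_closed h.hc v (fun j => LT.PT e (zz j)) (fun j => H (q j) (gp β l (zz j)))
    (fun j => (u j (gp β l (zz j)))⁻¹ * u j (gp β l (zz (j+1))))
    (2 * ((m+2) * 1) * ((m+2) * L * ⌊Y⌋₊)) N ?_ ?_ ?_ ?_
  · have h1 : (cost ((v 0)⁻¹ * v N) : ℝ) ≤ ((N * (2 * ((m+2) * 1) * ((m+2) * L * ⌊Y⌋₊)) : ℕ) : ℝ) := by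
      exact_mod_cast key
    refine h1.trans ?_
    rw [← hY]
    have h2 : (⌊Y⌋₊ : ℝ) ≤ Y := Nat.floor_le hY0
    have h3 : (L : ℝ) = 2*R+2 := by rw [hL]; push_cast; ring
    calc ((N * (2 * ((m+2) * 1) * ((m+2) * L * ⌊Y⌋₊)) : ℕ) : ℝ)
        = (N * (2 * ((m+2 : ℕ) * 1) * ((m+2 : ℕ) * (2*R+2)))) * (⌊Y⌋₊ : ℝ) := by
          push_cast; rw [h3]; ring
      _ ≤ _ := by gcongr
  · intro j hj
    have m1 : q j ∈ closedBall (q j) (2*l) := mem_closedBall_self (by linarith)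
    have m2 : q (j+1) ∈ closedBall (q j) (2*l) := by
      rw [mem_closedBall, dist_comm]; linarith [hstep j hj]
    have m3 := hbox j hj (zz j) inf_le_left le_sup_left
    have m4 := hbox j hj (zz (j+1)) inf_le_right le_sup_right
    rw [hv j hj, hu j hj _ m1 _ m2]
    change _ = H (q j) (gp β l (zz j)) * _ * (H (q (j+1)) (gp β l (zz (j+1))))⁻¹
    rw [hu j hj _ m1 _ m3, hu j hj _ m2 _ m4]
    group
  · intro j hj
    refine LT.PT_two h.hc e ((m+2) * L * ⌊Y⌋₊) 1 (fun z => u j (gp β l z)) (zz j) (zz (j+1))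
      (hz2 j hj) ?_ ?_
    · intro z h1 h2 i
      have hzL : ∀ κ, z κ ≤ L := fun κ => (h2 κ).trans
        (sup_le (hz1 j hj.le κ).2.2 (hz1 (j+1) hj κ).2.2)
      refine hPD z ?_ hzL i
      calc ∑ κ, z κ ≤ ∑ κ : Fin (m+2), L := Finset.sum_le_sum fun κ _ => hzL κ
        _ = (m+2) * L := by simp
    · intro z h1 i h2
      have le1 : z ≤ z + Pi.single i 1 := by simp
      have m1 := hbox j hj z h1 (le1.trans h2)
      have m2 := hbox j hj _ (h1.trans le1) h2
      have hIcc : Icc (gp β l z) (gp β l z + Pi.single i l) ⊆ closedBall (q j) (2*l) := by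
        rintro x ⟨hx1, hx2⟩
        rw [gp_single] at m2
        rw [mem_cb (by positivity)] at m1 m2 ⊢
        intro κ
        exact ⟨(m1 κ).1.trans (hx1 κ), (hx2 κ).trans (m2 κ).2⟩
      have : e z i = H (gp β l z) (gp β l (z + Pi.single i 1)) := by
        rw [he, gp_single]
        exact QT.hh_untouched h D _ i l hl.le (hIcc.trans (hSO j hj))
          (fun w => (hball j hj w).mono_left hIcc)
      rw [this]
      exact hu j hj _ m1 _ m2
  · have : zz N = zz 0 := by rw [hzz]; simp only [hqN]
    simp only [this]
  · have : zz N = zz 0 := by rw [hzz]; simp only [hqN]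
    simp only [this, hqN]
end
end BD

namespace BD
open Set Metric Filter Topology MeasureTheory
open scoped ENNReal NNReal
noncomputable section
variable {m : ℕ} {ψ : (Fin (m+2) → ℝ) → XX m} {r1 : ℝ}

def gst (m : ℕ) : PP m := (8, 0, 0)

lemma gst_norm : ‖gst m‖ ≤ 8 := by
  simp [gst, Prod.norm_def]

lemma gst_UU : gst m ∉ UU m := by
  rintro ⟨h, _⟩
  norm_num [gst] at h

lemma gst_dist {t : ℝ} (_ : t ∈ Icc (-5 : ℝ) 27) : 1/4 ≤ dist (gst m) (Gam m t) := by
  have h1 : dist (8:ℝ) (Gam m t).1 ≤ dist (gst m) (Gam m t) := le_max_left _ _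
  have h2 : (Gam m t).1 ≤ 5 := by
    simp only [Gam]; grind
  rw [Real.dist_eq] at h1
  have := le_abs_self (8 - (Gam m t).1)
  linarith

set_option maxHeartbeats 4000000 in
theorem no_QD (hm : 1 ≤ m) (h : QD ψ r1) : False := by
  obtain ⟨M, hM1, hdat⟩ := dat h
  obtain ⟨c0, hc0, hge⟩ := ref_ge m (r := 1/4) (by norm_num)
  obtain ⟨Cl, hCl, hlip⟩ := ref_lip m
  obtain ⟨M1, hM11, hqa⟩ := h.qa (16/c0) (by positivity)
  obtain ⟨δ, hδ, hqb⟩ := h.qb (1/(4*M1^3)) (by positivity)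
  obtain ⟨N, hN⟩ := exists_nat_gt (max 64 (32*Cl/(δ*c0)))
  obtain ⟨R, hR⟩ := exists_nat_gt (4*M1^3)
  have hN64 : (64:ℝ) < N := (le_max_left _ _).trans_lt hN
  have hNδ : 32*Cl/(δ*c0) < N := (le_max_right _ _).trans_lt hN
  have hN0 : (0:ℝ) < N := by linarith
  rw [div_lt_iff₀ (by positivity)] at hNδ
  obtain ⟨C, hC⟩ : ∃ C : ℝ, C = 4*M^2 := ⟨_, rfl⟩
  obtain ⟨C1, hC1⟩ : ∃ C1 : ℝ, C1 = (N * (2 * ((m+2 : ℕ) * 1) * ((m+2 : ℕ) * (2*R+2)))) *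
      (64 * (C+1)^2 * (((2*R+2 : ℕ)+1)^(m+2) * (m+2)^2 : ℕ)) := ⟨_, rfl⟩
  obtain ⟨C2, hC2⟩ : ∃ C2 : ℝ, C2 = (32*M^2*M1^3)^(m+2) := ⟨_, rfl⟩
  have hM0 : 0 < M := by linarith
  have hM10 : 0 < M1 := by linarith
  obtain ⟨k1, hk1⟩ := AV.numeric C1 C2 (by rw [hC1, hC]; positivity) (by rw [hC2]; positivity)
  obtain ⟨r, hr⟩ : ∃ r : ℝ, r = r1/(2*R+5) := ⟨_, rfl⟩
  have hr1 := h.pos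
  have hr0 : 0 < r := by rw [hr]; positivity
  have hrr : (2*R+5) * r = r1 := by rw [hr]; field_simp
  have hR0 : (0:ℝ) ≤ R := by positivity
  have hrΩ : closedBall (0 : Fin (m+2) → ℝ) r ⊆ closedBall 0 r1 :=
    closedBall_subset_closedBall (by nlinarith)
  obtain ⟨k0, hk0⟩ := h.cl r hr0
  obtain ⟨k, hkk⟩ : ∃ k, k = max k0 k1 := ⟨_, rfl⟩
  have hcl := hk0 k (by rw [hkk]; exact le_max_left _ _)
  obtain ⟨τ, hτ0, hτ1, hnum⟩ := hk1 (k+1) (by rw [hkk]; exact (le_max_right _ _).trans (Nat.le_succ _))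
  clear hk0 hk1
  obtain ⟨G, _, cost, X, g1, g2, g3, g4, g5, g6⟩ := exists_cost (k+1)
  have hcost : IsCost cost := ⟨g1, g2, g3, g4⟩
  have hpre : ∀ p : PP m, ∃ a, ‖p‖ ≤ 8 → a ∈ closedBall (0 : Fin (m+2) → ℝ) r ∧
      ψ a = Yw (zr (k+1)) p := by
    intro p
    by_cases hp : ‖p‖ ≤ 8
    · obtain ⟨a, ha, e⟩ := hcl (Yw (zr (k+1)) p) (by rw [ref_aw k hp]; norm_num)
      exact ⟨a, fun _ => ⟨ha, e⟩⟩
    · exact ⟨0, fun h => absurd h hp⟩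
  choose pre hpre using hpre
  have preΩ : ∀ p, ‖p‖ ≤ 8 → pre p ∈ closedBall (0 : Fin (m+2) → ℝ) r1 := fun p hp => hrΩ (hpre p hp).1
  have preZ : ∀ p, ‖p‖ ≤ 8 → ZZ ψ k (pre p) = p := by
    intro p hp; rw [ZZ, (hpre p hp).2, Zw_Yw]
  have hsc := sc_pos (zr k)
  -- comparison estimate
  have cmp : ∀ p p' : PP m, ‖p‖ ≤ 8 → p ∉ UU m → ‖p'‖ ≤ 8 → ∀ b ∈ closedBall (0 : Fin (m+2) → ℝ) r1,
      1/4 ≤ dist p (ZZ ψ k b) → dist (pre p) (pre p') ≤ M1 * dist (pre p) b := by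
    intro p p' hp hpU hp' b hb hpb
    refine hqa _ (preΩ p hp) _ (preΩ p' hp') b hb ?_
    have e1 := ref_le k hp hp'
    have e2 := hge k p (ZZ ψ k b) hp hpU hpb
    rw [ZZ, Yw_Zw _ (h.ne b hb)] at e2
    rw [(hpre p hp).2, (hpre p' hp').2]
    calc _ ≤ 16 * sc (zr k) := e1
      _ = 16 / c0 * (c0 * sc (zr k)) := by field_simp
      _ ≤ _ := by gcongr
  obtain ⟨tt, htt⟩ : ∃ tt : ℕ → ℝ, tt = fun j : ℕ => -5 + 32 * (j:ℝ) / N := ⟨_, rfl⟩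
  have tt0 : tt 0 = -5 := by rw [htt]; simp
  have ttN : tt N = 27 := by rw [htt]; simp only; field_simp; norm_num
  have tts : ∀ j, tt (j+1) = tt j + 32 / N := by
    intro j; rw [htt]; simp only; push_cast; ring
  have ttm : ∀ j ≤ N, tt j ∈ Icc (-5:ℝ) 27 := by
    intro j hj
    have hj' : (j:ℝ) ≤ N := by exact_mod_cast hj
    have h1 : 32 * (j:ℝ) / N ≤ 32 := by rw [div_le_iff₀ hN0]; linarith
    have h2 : 0 ≤ 32 * (j:ℝ) / N := by positivity
    rw [htt]; constructor <;> simp only <;> linarith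
  have h32 : 32 / (N:ℝ) ≤ 1/2 := by rw [div_le_iff₀ hN0]; linarith
  have h320 : 0 < 32 / (N:ℝ) := by positivity
  have gam : ∀ j ≤ N, Gam m (tt j) ∉ UU m ∧ ‖Gam m (tt j)‖ ≤ 8 := fun j hj =>
    Gam_far (ttm j hj) (by simp)
  obtain ⟨q, hq⟩ : ∃ q : ℕ → Fin (m+2) → ℝ, q = fun j => pre (Gam m (tt j)) := ⟨_, rfl⟩
  obtain ⟨qs, hqs⟩ : ∃ qs, qs = pre (gst m) := ⟨_, rfl⟩
  obtain ⟨A, hA⟩ : ∃ A, A = dist qs (q 0) := ⟨_, rfl⟩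
  have qj : ∀ j, q j = pre (Gam m (tt j)) := fun j => by rw [hq]
  have qΩ : ∀ j ≤ N, q j ∈ closedBall (0 : Fin (m+2) → ℝ) r1 := fun j hj => by
    rw [qj]; exact preΩ _ (gam j hj).2
  have qsΩ : qs ∈ closedBall (0 : Fin (m+2) → ℝ) r1 := by rw [hqs]; exact preΩ _ gst_norm
  have qZ : ∀ j ≤ N, ZZ ψ k (q j) = Gam m (tt j) := fun j hj => by
    rw [qj]; exact preZ _ (gam j hj).2
  have qsZ : ZZ ψ k qs = gst m := by rw [hqs]; exact preZ _ gst_norm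
  have up : ∀ p, ‖p‖ ≤ 8 → dist qs (pre p) ≤ M1 * A := by
    intro p hp
    rw [hA, hqs]
    refine cmp _ p gst_norm gst_UU hp _ (qΩ 0 (Nat.zero_le _)) ?_
    rw [qZ 0 (Nat.zero_le _)]
    exact gst_dist (ttm 0 (Nat.zero_le _))
  have low : ∀ j ≤ N, A ≤ M1 * dist qs (q j) := by
    intro j hj
    rw [hA, hqs, qj 0]
    refine cmp _ _ gst_norm gst_UU (gam 0 (Nat.zero_le _)).2 _ (qΩ j hj) ?_
    rw [qZ j hj]
    exact gst_dist (ttm j hj)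
  have hA0 : 0 < A := by
    rw [hA]
    refine dist_pos.2 fun e => ?_
    have e1 := congrArg (ZZ ψ k) e
    rw [qsZ, qZ 0 (Nat.zero_le _)] at e1
    have := gst_dist (m := m) (ttm 0 (Nat.zero_le _))
    rw [e1, dist_self] at this
    norm_num at this
  obtain ⟨l, hl⟩ : ∃ l, l = A/(4*M1^2) := ⟨_, rfl⟩
  have hl0 : 0 < l := by rw [hl]; positivity
  have hlA : A = 4*M1^2*l := by rw [hl]; field_simp
  have near : ∀ j ≤ N, ∀ b ∈ closedBall (0 : Fin (m+2) → ℝ) r1, dist b (q j) ≤ 2*l →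
      dist (ZZ ψ k b) (Gam m (tt j)) ≤ 1/2 := by
    intro j hj b hb hd
    by_contra hcon
    push Not at hcon
    rw [dist_comm] at hcon hd
    have e1 := cmp _ _ (gam j hj).2 (gam j hj).1 gst_norm b hb (by linarith)
    rw [← qj, ← hqs, dist_comm] at e1
    have e2 := low j hj
    have e3 : A ≤ M1 * (M1 * (2*l)) := by
      calc A ≤ _ := e2
        _ ≤ _ := by gcongr; exact e1.trans (by gcongr)
    have e4 : A = 2 * (M1 * (M1 * (2*l))) := by rw [hlA]; ring
    linarith
  have hstep : ∀ j < N, dist (q j) (q (j+1)) ≤ l := by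
    intro j hj
    have e1 := hqb _ (qΩ j hj.le) _ (qΩ (j+1) hj) qs qsΩ (by
      rw [qj, qj, hqs, (hpre _ (gam j hj.le).2).2, (hpre _ (gam (j+1) hj).2).2, (hpre _ gst_norm).2]
      have f1 := hlip k _ _ (gam j hj.le).2 (gam j hj.le).1 (gam (j+1) hj).2 (gam (j+1) hj).1
      have f2 := hge k _ (gst m) (gam j hj.le).2 (gam j hj.le).1
        (by rw [dist_comm]; exact gst_dist (ttm j hj.le))
      have f3 : dist (Gam m (tt j)) (Gam m (tt (j+1))) ≤ 32 / N := by
        refine (Gam_lip _ _).trans ?_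
        rw [tts, abs_le]; constructor <;> linarith
      have f4 : Cl * (32 / N) ≤ δ * c0 := by
        rw [← mul_div_assoc, div_le_iff₀ hN0]; linarith
      calc _ ≤ _ := f1
        _ ≤ Cl * sc (zr k) * (32 / N) := by gcongr
        _ = (Cl * (32 / N)) * sc (zr k) := by ring
        _ ≤ (δ * c0) * sc (zr k) := by gcongr
        _ = δ * (c0 * sc (zr k)) := by ring
        _ ≤ _ := by gcongr)
    have e2 := up _ (gam j hj.le).2
    rw [← qj, dist_comm] at e2
    calc _ ≤ _ := e1
      _ ≤ 1/(4*M1^3) * (M1 * A) := by gcongr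
      _ = l := by rw [hl]; field_simp
  have hqsR : ∀ j ≤ N, dist (q j) qs ≤ R * l := by
    intro j hj
    have e2 := up _ (gam j hj).2
    rw [← qj, dist_comm] at e2
    calc _ ≤ _ := e2
      _ = 4*M1^3 * l := by rw [hlA]; ring
      _ ≤ _ := by gcongr
  have hl2 : l ≤ 2*r := by
    have e1 : A ≤ 2*r := by
      have f1 := (hpre _ (gst_norm (m := m))).1
      have f2 := (hpre _ (gam 0 (Nat.zero_le _)).2).1
      rw [← hqs] at f1
      rw [← qj] at f2
      rw [mem_closedBall] at f1 f2
      have := dist_triangle_right qs (q 0) 0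
      linarith
    have e2 : 1 ≤ 4*M1^2 := by
      have : 1 ≤ M1^2 := one_le_pow₀ hM11
      linarith
    have e3 : 1 * l ≤ 4*M1^2*l := mul_le_mul_of_nonneg_right e2 hl0.le
    linarith
  have hOm : closedBall qs ((R+2) * l) ⊆ closedBall (0 : Fin (m+2) → ℝ) r1 := by
    refine closedBall_subset_closedBall' ?_
    have f1 := (hpre _ (gst_norm (m := m))).1
    rw [← hqs, mem_closedBall] at f1
    have f2 : (R+2) * l ≤ (R+2) * (2*r) := mul_le_mul_of_nonneg_left hl2 (by positivity)
    linarith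
  have hSO : ∀ j ≤ N, closedBall (q j) (2*l) ⊆ closedBall (0 : Fin (m+2) → ℝ) r1 := by
    intro j hj
    refine Subset.trans (closedBall_subset_closedBall' ?_) hOm
    have := hqsR j hj
    linarith
  have hball : ∀ j < N, ∀ w, Disjoint (closedBall (q j) (2*l)) (KS ψ r1 k w) := by
    intro j hj w
    rw [Set.disjoint_left]
    intro b hb hbK
    have e1 := near j hj.le b hbK.1 hb
    refine (Gam_far (ttm j hj.le) e1).1 ?_
    rw [ZZ_lf k w.1]
    exact hw_maps _ (NK_sub hbK.2)
  -- rim points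
  have hkn : ∀ (w : List Bool) (e : ℝ), |e| = 1 → ‖hw (w.map bi) (kap m e)‖ ≤ 8 := by
    intro w e he
    have := UB_norm (UU_sub_UB (hw_maps (w.map bi) (NK_sub (kap_NK (m := m) he))))
    linarith
  have a1 : |(1:ℝ)| = 1 := by norm_num
  have a2 : |(-1:ℝ)| = 1 := by norm_num
  obtain ⟨y, hy⟩ : ∃ y : List.Vector Bool (k+1) → Fin (m+2) → ℝ,
      y = fun w => pre (hw (w.1.map bi) (kap m 1)) := ⟨_, rfl⟩
  obtain ⟨y', hy'⟩ : ∃ y' : List.Vector Bool (k+1) → Fin (m+2) → ℝ,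
      y' = fun w => pre (hw (w.1.map bi) (kap m (-1))) := ⟨_, rfl⟩
  obtain ⟨rpos, hD, hdisj⟩ := hdat G _ k X cost hcost g5 y y' r (by
      have : 0 ≤ R * r := by positivity
      linarith)
    (fun w => by rw [hy]; exact (hpre _ (hkn _ _ a1)).1)
    (fun w => by rw [hy']; exact (hpre _ (hkn _ _ a2)).1)
    (fun w => by rw [hy, lf, Yw_append]; exact (hpre _ (hkn _ _ a1)).2)
    (fun w => by rw [hy', lf, Yw_append]; exact (hpre _ (hkn _ _ a2)).2)
  obtain ⟨u, hu, huI⟩ := Gam_hol (m := m) (k+1) X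
  have hfin := lattice (C := C) (N := N) (R := R) (q := q) (qs := qs) (v := fun j => u (tt j)) (l := l)
    hD (by rw [hC]; positivity) (fun w => by rw [hC]; apply le_of_eq; field_simp) hl0
    (by rw [qj, qj, ttN, tt0, Gam_ends])
    (fun j hj => by
      have e1 := near j hj.le
      refine Gam_local hu (ttm j hj.le).1 (by rw [tts]; linarith) (ttm (j+1) hj).2
        (by rw [tts]; linarith) (S := closedBall (q j) (2*l)) (isCompact_closedBall _ _)
        (convex_closedBall _ _) (fun b hb => (ZZ_cont h k (hSO j hj.le hb)).continuousWithinAt)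
        (fun b hb => e1 b (hSO j hj.le hb) hb) (mem_closedBall_self (by linarith)) ?_
        (qZ j hj.le) (qZ (j+1) hj)
      rw [mem_closedBall, dist_comm]
      linarith [hstep j hj])
    hstep hball hqsR hOm
  rw [tt0, ttN, huI] at hfin
  have g6' : (2:ℝ)^(k+1) ≤ cost (iterComm (k+1) X) := by exact_mod_cast g6
  -- packing
  have hyq : ∀ w, dist qs (y w) ≤ M1 * A := fun w => by rw [hy]; exact up _ (hkn _ _ a1)
  have hyq' : ∀ w, dist qs (y' w) ≤ M1 * A := fun w => by rw [hy']; exact up _ (hkn _ _ a2)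
  have hpack := AV.packing y (fun w => dist (y w) (y' w) / (2*M))
    (fun w => by have := rpos w; positivity) qs (2*M1*A) (by positivity) (fun w => by
      refine ball_subset_ball' ?_
      have e1 := hyq w
      have e2 := hyq' w
      have e3 := dist_triangle_left (y w) (y' w) qs
      have e4 : dist (y w) (y' w) / (2*M) ≤ M1 * A := by
        rw [div_le_iff₀ (by positivity)]
        nlinarith [mul_pos hM10 hA0]
      rw [dist_comm] at e1
      linarith) hdisj
  have hsum : ∑ w, (2 * (M * dist (y w) (y' w)) / l) ^ m ≤ 2^(k+1) * τ + C2 / τ^2 := by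
    have e1 : ∀ w, (2 * (M * dist (y w) (y' w)) / l) ^ m ≤
        τ + ((4*M^2/l)^(m+2)/τ^2) * (dist (y w) (y' w) / (2*M))^(m+2) := by
      intro w
      have h0 := rpos w
      refine (AV.young hm (by positivity) hτ0 hτ1).trans (le_of_eq ?_)
      have : 2 * (M * dist (y w) (y' w)) / l = (4*M^2/l) * (dist (y w) (y' w) / (2*M)) := by
        field_simp; norm_num
      rw [this, mul_pow]; ring
    calc _ ≤ ∑ w, (τ + ((4*M^2/l)^(m+2)/τ^2) * (dist (y w) (y' w) / (2*M))^(m+2)) :=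
          Finset.sum_le_sum fun w _ => e1 w
      _ = 2^(k+1) * τ + ((4*M^2/l)^(m+2)/τ^2) * ∑ w, (dist (y w) (y' w) / (2*M))^(m+2) := by
          rw [Finset.sum_add_distrib, ← Finset.mul_sum, Finset.sum_const, Finset.card_univ,
            card_vector, Fintype.card_bool, nsmul_eq_mul]
          push_cast; rfl
      _ ≤ 2^(k+1) * τ + ((4*M^2/l)^(m+2)/τ^2) * (2*M1*A)^(m+2) := by gcongr
      _ = 2^(k+1) * τ + C2 / τ^2 := by
          have : 32*M^2*M1^3 = (4*M^2/l) * (2*M1*A) := by rw [hlA]; field_simp; norm_num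
          rw [hC2, this, mul_pow (4*M^2/l) (2*M1*A), div_mul_eq_mul_div]
  have hC10 : 0 ≤ C1 := by rw [hC1]; positivity
  have : (2:ℝ)^(k+1) ≤ C1 * (2^(k+1) * τ + C2 / τ^2) := by
    calc _ ≤ _ := g6'
      _ ≤ _ := hfin
      _ = C1 * ∑ w, (2 * (M * dist (y w) (y' w)) / l) ^ m := by rw [hC1]; ring
      _ ≤ _ := by gcongr
  linarith
end
end BD

namespace BD
open Set Metric Filter Topology MeasureTheory
open scoped ENNReal NNReal
noncomputable section
variable {m : ℕ}

theorem eta_zero (η : ℝ≥0 ≃ₜ ℝ≥0) : η 0 = 0 := by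
  rcases η.continuous.strictMono_of_inj η.injective with h | h
  · by_contra h0
    have h1 : η 0 ≤ η (η.symm 0) := h.monotone (zero_le)
    rw [η.apply_symm_apply] at h1
    exact h0 (le_antisymm h1 (zero_le))
  · exfalso
    have h1 : η (η.symm (η 0 + 1)) ≤ η 0 := h.antitone (zero_le)
    rw [η.apply_symm_apply] at h1
    exact absurd h1 (not_le.2 (lt_add_of_pos_right _ one_pos))

theorem eta_mono (η : ℝ≥0 ≃ₜ ℝ≥0) : Monotone η := by
  rcases η.continuous.strictMono_of_inj η.injective with h | h
  · exact h.monotone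
  · exfalso
    have h1 : η 1 < η 0 := h one_pos
    rw [eta_zero] at h1
    exact not_lt_zero h1

theorem eta_use {X Y : Type} [MetricSpace X] [MetricSpace Y] (f : X ≃ₜ Y) (η : ℝ≥0 ≃ₜ ℝ≥0)
    (hη : ∀ x y z : X, x ≠ y → x ≠ z → y ≠ z →
      nndist (f x) (f y) / nndist (f x) (f z) ≤ η (nndist x y / nndist x z))
    (t H : ℝ≥0) (hH : η t ≤ H) {x y z : X} (hyz : y ≠ z) (h : dist x y ≤ t * dist x z) :
    dist (f x) (f y) ≤ H * dist (f x) (f z) := by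
  by_cases hxy : x = y
  · subst hxy; rw [dist_self]; positivity
  by_cases hxz : x = z
  · subst hxz
    rw [dist_self, mul_zero] at h
    exact absurd (dist_le_zero.1 h) hxy
  have h1 : nndist x y / nndist x z ≤ t := by
    rw [div_le_iff₀ (by rw [pos_iff_ne_zero]; simpa using hxz)]
    exact_mod_cast h
  have h2 := (hη x y z hxy hxz hyz).trans ((eta_mono η h1).trans hH)
  rw [div_le_iff₀ (by rw [pos_iff_ne_zero]; simpa using hxz)] at h2
  exact_mod_cast h2

theorem X0_ne : X0 m ≠ Np m := io_ne _

theorem ster_cont {n : ℕ} (v : EucSphere n) : Continuous (ster v) :=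
  (LipschitzWith.of_dist_le_mul (K := 1) (fun a b => by simpa using ster_lip v a b)).continuous

theorem exists_QD (f : XX m ≃ₜ EucSphere (m+2)) (hf : IsQuasisymmetric f) :
    ∃ ψ r1, QD (m := m) ψ r1 := by
  obtain ⟨η, hη⟩ := hf
  obtain ⟨q, hq⟩ : ∃ q, q = f (toX (X0 m)) := ⟨_, rfl⟩
  obtain ⟨e, he⟩ : ∃ e : (Fin (m+2) → ℝ) ≃L[ℝ] En (m+2),
      e = (EuclideanSpace.equiv (Fin (m+2)) ℝ).symm := ⟨_, rfl⟩
  obtain ⟨K, hK1, hK⟩ : ∃ K : ℝ, 1 ≤ K ∧ ∀ a b, dist (e a) (e b) ≤ K * dist a b := by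
    refine ⟨max 1 ‖(e : (Fin (m+2) → ℝ) →L[ℝ] En (m+2))‖, le_max_left _ _, fun a b => ?_⟩
    rw [dist_eq_norm, dist_eq_norm, ← map_sub]
    refine ((e : (Fin (m+2) → ℝ) →L[ℝ] En (m+2)).le_opNorm _).trans ?_
    gcongr
    exact le_max_right _ _
  obtain ⟨L, hL1, hL⟩ : ∃ K : ℝ, 1 ≤ K ∧ ∀ a b, dist (e.symm a) (e.symm b) ≤ K * dist a b := by
    refine ⟨max 1 ‖(e.symm : En (m+2) →L[ℝ] (Fin (m+2) → ℝ))‖, le_max_left _ _, fun a b => ?_⟩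
    rw [dist_eq_norm, dist_eq_norm, ← map_sub]
    refine ((e.symm : En (m+2) →L[ℝ] (Fin (m+2) → ℝ)).le_opNorm _).trans ?_
    gcongr
    exact le_max_right _ _
  obtain ⟨ψ, hψ⟩ : ∃ ψ : (Fin (m+2) → ℝ) → XX m, ∀ a, ψ a = f.symm (ster (-q) (e a)) :=
    ⟨_, fun _ => rfl⟩
  have hfψ : ∀ a, f (ψ a) = ster (-q) (e a) := fun a => by rw [hψ, f.apply_symm_apply]
  have hc : Continuous ψ := by
    rw [show ψ = fun a => f.symm (ster (-q) (e a)) from funext hψ]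
    exact f.symm.continuous.comp ((ster_cont _).comp e.continuous)
  have h0 : ψ 0 = toX (X0 m) := by
    rw [hψ, map_zero, ster_neg_zero, hq, f.symm_apply_apply]
  have hinj : ∀ a b, ψ a = ψ b → a = b := by
    intro a b h
    have h2 := hfψ a
    rw [h, hfψ b] at h2
    have h3 := congrArg (stereographic' (m+2) (-q)) h2
    rw [ster_left, ster_left] at h3
    exact (e.injective h3).symm
  obtain ⟨r, hr, hrb⟩ : ∃ r > 0, ∀ a ∈ ball (0 : Fin (m+2) → ℝ) r, toS (ψ a) ≠ Np m := by
    have h1 : ∀ᶠ a in 𝓝 (0 : Fin (m+2) → ℝ), toS (ψ a) ≠ Np m :=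
      (toS_cont.comp hc).continuousAt.eventually_ne (by
        change toS (ψ 0) ≠ Np m
        rw [h0]; exact X0_ne)
    rw [Metric.eventually_nhds_iff_ball] at h1
    exact h1
  have hAA : ∀ H : ℝ, 0 ≤ H → ∀ a ∈ closedBall (0 : Fin (m+2) → ℝ) (min 1 (r/2)),
      ∀ b ∈ closedBall (0 : Fin (m+2) → ℝ) (min 1 (r/2)), ∀ c,
      dist (f (ψ a)) (f (ψ b)) ≤ H * dist (f (ψ a)) (f (ψ c)) →
      dist a b ≤ (L * ((K ^ 2 + 4) / 4) * K) * H * dist a c := by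
    intro H hH a ha b hb c h
    have hn : ∀ a ∈ closedBall (0 : Fin (m+2) → ℝ) (min 1 (r/2)), ‖e a‖ ≤ K := by
      intro a ha
      have h1 := hK a 0
      have h2 : dist a 0 ≤ 1 := (mem_closedBall.1 ha).trans (min_le_left _ _)
      rw [map_zero, dist_zero_right] at h1
      nlinarith
    have h1 := hL (e a) (e b)
    rw [e.symm_apply_apply, e.symm_apply_apply] at h1
    have h2 := ster_antilip (-q) (hn a ha) (hn b hb)
    rw [← hfψ, ← hfψ] at h2
    have h3 := ster_lip (-q) (e a) (e c)
    rw [← hfψ, ← hfψ] at h3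
    calc dist a b ≤ L * dist (e a) (e b) := h1
      _ ≤ L * ((K ^ 2 + 4) / 4 * (H * (K * dist a c))) := by
        have h4 := h3.trans (hK a c)
        have h5 : H * dist (f (ψ a)) (f (ψ c)) ≤ H * (K * dist a c) := by gcongr
        refine mul_le_mul_of_nonneg_left (h2.trans ?_) (by linarith)
        exact mul_le_mul_of_nonneg_left (h.trans h5) (by positivity)
      _ = _ := by ring
  obtain ⟨A, hA⟩ : ∃ A : ℝ, A = L * ((K ^ 2 + 4) / 4) * K := ⟨_, rfl⟩
  have hA1 : 1 ≤ A := by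
    rw [hA]
    have h1 : 1 ≤ (K ^ 2 + 4) / 4 := by nlinarith
    exact one_le_mul_of_one_le_of_one_le (one_le_mul_of_one_le_of_one_le hL1 h1) hK1
  rw [← hA] at hAA
  refine ⟨ψ, min 1 (r / 2), by positivity, hc, ?_, ?_, ?_, ?_⟩
  · intro a ha
    refine hrb a ?_
    rw [mem_closedBall] at ha
    rw [mem_ball]
    have := min_le_right 1 (r/2)
    linarith
  · intro T hT
    lift T to ℝ≥0 using hT.le
    refine ⟨A * (max 1 (η T) : ℝ≥0), ?_, ?_⟩
    · refine one_le_mul_of_one_le_of_one_le hA1 ?_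
      exact_mod_cast le_max_left _ _
    · intro a ha b hb c _ h
      have h1 : (1:ℝ) ≤ (max 1 (η T) : ℝ≥0) := by exact_mod_cast le_max_left _ _
      by_cases hbc : b = c
      · subst hbc
        exact le_mul_of_one_le_left dist_nonneg (one_le_mul_of_one_le_of_one_le hA1 h1)
      · exact hAA _ (by positivity) a ha b hb c
          (eta_use f η hη T _ (le_max_right _ _) (fun h => hbc (hinj _ _ h)) h)
  · intro ε hε
    have h1 : ∀ᶠ t : ℝ≥0 in 𝓝 0, η t < (ε / A).toNNReal := by
      refine η.continuous.continuousAt.eventually (gt_mem_nhds ?_)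
      rw [eta_zero, Real.toNNReal_pos]
      positivity
    rw [Metric.eventually_nhds_iff_ball] at h1
    obtain ⟨δ, hδ, h1⟩ := h1
    have hd0 : 0 < min (δ/2) (1/2) := by positivity
    obtain ⟨d, hd⟩ : ∃ d : ℝ≥0, (d : ℝ) = min (δ/2) (1/2) := ⟨⟨_, hd0.le⟩, rfl⟩
    refine ⟨d, by rw [hd]; exact hd0, ?_⟩
    intro a ha b hb c _ h
    have h2 : η d ≤ (ε / A).toNNReal := by
      refine (h1 d ?_).le
      rw [mem_ball, NNReal.dist_eq, NNReal.coe_zero, sub_zero, abs_of_nonneg (NNReal.coe_nonneg d)]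
      rw [hd]
      have := min_le_left (δ/2) (1/2)
      linarith
    by_cases hbc : b = c
    · subst hbc
      have h3 : (d : ℝ) ≤ 1/2 := by rw [hd]; exact min_le_right _ _
      have h4 : dist (ψ a) (ψ b) ≤ 0 := by
        nlinarith [dist_nonneg (x := ψ a) (y := ψ b)]
      rw [hinj _ _ (dist_le_zero.1 h4), dist_self, mul_zero]
    · have h3 := hAA _ (NNReal.coe_nonneg _) a ha b hb c
          (eta_use f η hη d _ h2 (fun h => hbc (hinj _ _ h)) h)
      rwa [Real.coe_toNNReal _ (by positivity), mul_div_cancel₀ _ (by positivity)] at h3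
  · intro s hs
    have hqn : q ≠ -q := ne_neg_of_mem_unit_sphere ℝ q
    have hst : stereographic' (m+2) (-q) q = 0 := by
      have := ster_left (-q) (0 : En (m+2))
      rwa [ster_neg_zero] at this
    have hca : ContinuousAt (fun x => e.symm (stereographic' (m+2) (-q) (f x))) (toX (X0 m)) := by
      have h1 : ContinuousAt (stereographic' (m+2) (-q)) (f (toX (X0 m))) := by
        refine (stereographic' (m+2) (-q)).continuousAt ?_
        rw [stereographic'_source, ← hq]
        simpa using hqn
      exact e.symm.continuous.continuousAt.comp (h1.comp f.continuous.continuousAt)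
    have hev : ∀ᶠ x in 𝓝 (toX (X0 m)), f x ≠ -q ∧
        e.symm (stereographic' (m+2) (-q) (f x)) ∈ closedBall (0 : Fin (m+2) → ℝ) s := by
      refine (f.continuous.continuousAt.eventually_ne (by rw [← hq]; exact hqn)).and ?_
      refine hca.eventually (closedBall_mem_nhds_of_mem ?_)
      beta_reduce
      rw [← hq, hst, map_zero]
      exact mem_ball_self hs
    rw [Metric.eventually_nhds_iff_ball] at hev
    obtain ⟨δ, hδ, hev⟩ := hev
    obtain ⟨k0, hk0⟩ := exists_pow_lt_of_lt_one (show (0:ℝ) < δ / 16 by positivity)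
      (show (1/2:ℝ) < 1 by norm_num)
    refine ⟨k0, fun k hk x hx => ?_⟩
    have h1 : x ∈ ball (toX (X0 m)) δ := by
      rw [mem_ball, dist_X]
      have h2 := E3 hx (by unfold zr; rw [aw_X0]; norm_num : aw (zr k) (X0 m) ≠ 0)
      unfold zr at h2
      rw [sc_replicate] at h2
      have h3 : ((1:ℝ)/2) ^ k ≤ (1/2) ^ k0 := pow_le_pow_of_le_one (by norm_num) (by norm_num) hk
      change dF (toS x) (X0 m) < δ
      linarith
    obtain ⟨h2, h3⟩ := hev x h1
    refine ⟨_, h3, ?_⟩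
    rw [hψ, e.apply_symm_apply, ster_right _ h2, f.symm_apply_apply]

end
end BD

/-- **Theorem 6.1 (quasisymmetric form).** For each `n ≥ 3` there is a metric sphere
`(X, d)` homeomorphic to the Euclidean `n`-sphere, Ahlfors `n`-regular, linearly locally
contractible, and almost smooth away from a closed set `E` homeomorphic to the Cantor
space, which admits no quasisymmetric parametrization by the Euclidean sphere. -/
theorem qs_nonparametrizable_almost_smooth_sphere_cantor_set (n : ℕ) (hn : 3 ≤ n) :
    ∃ (X : Type) (_ : MetricSpace X) (_ : X ≃ₜ EucSphere n) (E : Set X),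
      IsClosed E ∧
      Nonempty (E ≃ₜ (ℕ → Bool)) ∧
      AhlforsRegular X n ∧
      LinearlyLocallyContractible X ∧
      (∀ x : X, x ∉ E → AlmostSmoothAt X n x) ∧
      ¬ ∃ f : X ≃ₜ EucSphere n, IsQuasisymmetric f := by
  obtain ⟨m, rfl⟩ : ∃ m, n = m + 2 := ⟨n - 2, by omega⟩
  have hm : 1 ≤ m := by omega
  obtain ⟨E, hE, hC, h1, h2⟩ := BD.cantor_E m
  refine ⟨BD.XX m, inferInstance, (BD.XH m).symm, E, hE, hC, BD.XX_AR m hm, BD.XX_LLC m,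
    fun x hx => BD.XX_AS ?_ ?_, ?_⟩
  · intro h; apply hx; rw [← h] at h1; exact h1
  · intro h; apply hx; rw [← h] at h2; exact h2
  · rintro ⟨f, hf⟩
    obtain ⟨ψ, r1, h⟩ := BD.exists_QD f hf
    exact BD.no_QD hm h
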